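/- Let ψ be a bounded perturbation of a strictly convex potential and let L > 0. Then there exists ρ > 0 depending only on ψ and L (in particular independent of N, m and the sequence (a_i)) such that for every N ∈ ℕ, every m ∈ ℝ and every a ∈ ℝ^N with max_i |a_i| ≤ L, the canonical ensemble μ_{N,a,m} satisfies the logarithmic Sobolev inequality LSI(ρ). -/

import Mathlib

open MeasureTheory ENNReal Real

noncomputable section

/-- The canonical ensemble `μ_{N,a,m}`: the probability measure on the hyperplane
`X_{N,m} = {x : (1/N)∑ xᵢ = m}` with density `Z⁻¹ exp(-∑ (ψ(xᵢ) + aᵢxᵢ))` with respect to the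
`(N-1)`-dimensional Hausdorff measure on that hyperplane. -/
def canonEns (ψ : ℝ → ℝ) (N : ℕ) (a : Fin N → ℝ) (m : ℝ) :
    Measure (EuclideanSpace ℝ (Fin N)) :=
  let ν : Measure (EuclideanSpace ℝ (Fin N)) :=
    ((μH[(N : ℝ) - 1]).restrict {x : EuclideanSpace ℝ (Fin N) | ∑ i, x i = (N : ℝ) * m}).withDensity
      fun x => ENNReal.ofReal (Real.exp (-(∑ i, (ψ (x i) + a i * x i))))
  (ν Set.univ)⁻¹ • ν

/-- Entropy `Ent_μ(f) = ∫ f log f dμ - (∫ f dμ) log (∫ f dμ)`. -/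
def entFor {X : Type*} [MeasurableSpace X] (μ : Measure X) (f : X → ℝ) : ℝ :=
  (∫ x, f x * Real.log (f x) ∂μ) - (∫ x, f x ∂μ) * Real.log (∫ x, f x ∂μ)

/-- `|∇f|²/f` where `∇f` is the projection of the Euclidean gradient onto the mean-zero
subspace `{v : ∑ vᵢ = 0}` (the direction space of the hyperplane `X_{N,m}`), interpreted
as `0` where `f = 0`. -/
def fisherX (N : ℕ) (f : EuclideanSpace ℝ (Fin N) → ℝ) (x : EuclideanSpace ℝ (Fin N)) : ℝ :=
  if f x = 0 then 0
  else (∑ i, (gradient f x i - (∑ j, gradient f x j) / (N : ℝ)) ^ 2) / f x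

/-- The logarithmic Sobolev inequality `LSI(ρ)` for a measure supported on the hyperplane
`X_{N,m} ⊆ ℝ^N`, stated for all smooth nonnegative test functions (for which the relevant
integrals exist). -/
def IsLSI (N : ℕ) (μ : Measure (EuclideanSpace ℝ (Fin N))) (ρ : ℝ) : Prop :=
  ∀ f : EuclideanSpace ℝ (Fin N) → ℝ, ContDiff ℝ (⊤ : ℕ∞) f → (∀ x, 0 ≤ f x) →
    Integrable f μ → Integrable (fun x => f x * Real.log (f x)) μ →
    Integrable (fisherX N f) μ →
    entFor μ f ≤ (1 / ρ) * ∫ x, fisherX N f x ∂μ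

/-- Sum form of the one-dimensional Brunn–Minkowski inequality at the midpoint. -/
lemma volume_add_le_of_midpoint_mem {A B D : Set ℝ} (hA : MeasurableSet A) (hB : MeasurableSet B)
    (hAn : A.Nonempty) (hBn : B.Nonempty)
    (h : ∀ x ∈ A, ∀ y ∈ B, (x + y) / 2 ∈ D) :
    volume A + volume B ≤ 2 * volume D := by
  have key : ∀ K L : Set ℝ, IsCompact K → IsCompact L → K.Nonempty → L.Nonempty → K ⊆ A → L ⊆ B →
      volume K + volume L ≤ 2 * volume D := by
    intro K L hK hL hKn hLn hKA hLB
    obtain ⟨p, hp, hpm⟩ := hK.exists_isGreatest hKn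
    obtain ⟨q, hq, hqm⟩ := hL.exists_isLeast hLn
    set K' := (fun x => x + q) '' K
    set L' := (fun x => x + p) '' L
    have hK' : IsCompact K' := hK.image (by fun_prop)
    have hL' : IsCompact L' := hL.image (by fun_prop)
    have hvK : volume K' = volume K := by
      simp only [K', Set.image_add_right]; exact measure_preimage_add_right _ _ _
    have hvL : volume L' = volume L := by
      simp only [L', Set.image_add_right]; exact measure_preimage_add_right _ _ _
    have hint : K' ∩ L' ⊆ {p + q} := by
      rintro x ⟨⟨a, ha, rfl⟩, ⟨b, hb, hab⟩⟩
      have h1 := hpm ha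
      have h2 := hqm hb
      simp only [Set.mem_singleton_iff] at *
      linarith
    have hun : K' ∪ L' ⊆ (fun x => 2 * x) '' D := by
      rintro x (⟨a, ha, rfl⟩ | ⟨b, hb, rfl⟩)
      · exact ⟨(a + q) / 2, h _ (hKA ha) _ (hLB hq), by ring⟩
      · exact ⟨(p + b) / 2, h _ (hKA hp) _ (hLB hb), by ring⟩
    have h0 : volume (K' ∩ L') = 0 :=
      measure_mono_null hint (by simp)
    have h1 := measure_union_add_inter K' hL'.measurableSet (μ := (volume : Measure ℝ))
    have h2 : volume ((fun x => 2 * x) '' D) = 2 * volume D := by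
      have := Measure.addHaar_smul (volume : Measure ℝ) 2 D
      simpa [Set.image_smul, ← Set.image_smul] using this
    rw [← hvK, ← hvL, ← h1, h0, add_zero, ← h2]
    exact measure_mono hun
  rw [hA.measure_eq_iSup_isCompact, hB.measure_eq_iSup_isCompact]
  obtain ⟨a, ha⟩ := hAn
  obtain ⟨b, hb⟩ := hBn
  have e1 : ∀ K : Set ℝ, IsCompact K → K ⊆ A → ∀ L : Set ℝ, IsCompact L → L ⊆ B →
      volume K + volume L ≤ 2 * volume D := by
    intro K hK hKA L hL hLB
    have := key (insert a K) (insert b L) (hK.insert a) (hL.insert b) ⟨a, by simp⟩ ⟨b, by simp⟩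
      (Set.insert_subset ha hKA) (Set.insert_subset hb hLB)
    refine le_trans (add_le_add (measure_mono (Set.subset_insert _ _))
      (measure_mono (Set.subset_insert _ _))) this
  have swap : ∀ S : Set ℝ, (⨆ K, ⨆ (_ : K ⊆ S), ⨆ (_ : IsCompact K), volume K)
      = ⨆ K, ⨆ (_ : K ⊆ S ∧ IsCompact K), volume K := fun S => by
    simp only [iSup_and]
  rw [swap, swap]
  exact ENNReal.biSup_add_biSup_le' ⟨∅, by simp⟩ ⟨∅, by simp⟩
    fun K hK L hL => e1 K hK.2 hK.1 L hL.2 hL.1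

lemma lintegral_add_le_of_normalized {f g h : ℝ → ℝ} (hf : Measurable f) (hg : Measurable g)
    (hh : Measurable h) (hf0 : ∀ x, 0 ≤ f x) (hg0 : ∀ x, 0 ≤ g x) (hh0 : ∀ x, 0 ≤ h x)
    (hf1 : ∀ x, f x ≤ 1) (hg1 : ∀ x, g x ≤ 1)
    (hfs : ∀ t < 1, ∃ x, t < f x) (hgs : ∀ t < 1, ∃ x, t < g x)
    (H : ∀ x y, f x * g y ≤ h ((x + y) / 2) ^ 2) :
    (∫⁻ x, ENNReal.ofReal (f x)) + ∫⁻ x, ENNReal.ofReal (g x)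
      ≤ 2 * ∫⁻ x, ENNReal.ofReal (h x) := by
  have red : ∀ u : ℝ → ℝ, Measurable u → (∀ x, 0 ≤ u x) → (∀ x, u x ≤ 1) →
      ∫⁻ x, ENNReal.ofReal (u x) = ∫⁻ t in Set.Ioo (0:ℝ) 1, volume {x | t < u x} := by
    intro u hu hu0 hu1
    rw [lintegral_eq_lintegral_meas_lt _ (Filter.Eventually.of_forall hu0) hu.aemeasurable,
      ← Set.Ioo_union_Ici_eq_Ioi (zero_lt_one' ℝ),
      lintegral_union measurableSet_Ici
        (Set.disjoint_left.2 fun x hx hx' => not_lt.2 hx' hx.2)]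
    have : ∫⁻ t in Set.Ici (1:ℝ), volume {x | t < u x} = 0 := by
      rw [← lintegral_zero (μ := volume.restrict (Set.Ici (1:ℝ)))]
      refine setLIntegral_congr_fun measurableSet_Ici fun t ht => ?_
      have : {x | t < u x} = ∅ := by
        ext x; simpa using (hu1 x).trans ht
      simp [this]
    rw [this, add_zero]
  have meas : ∀ u : ℝ → ℝ, Measurable fun t : ℝ => volume {x | t < u x} := fun u =>
    Antitone.measurable fun s t hst => measure_mono fun x (hx : t < u x) => lt_of_le_of_lt hst hx
  rw [red f hf hf0 hf1, red g hg hg0 hg1, ← lintegral_add_left (meas f)]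
  calc _ ≤ ∫⁻ t in Set.Ioo (0:ℝ) 1, 2 * volume {x | t < h x} := by
        refine setLIntegral_mono' measurableSet_Ioo fun t ht => ?_
        refine volume_add_le_of_midpoint_mem (measurableSet_lt measurable_const hf)
          (measurableSet_lt measurable_const hg) (hfs t ht.2) (hgs t ht.2) fun x hx y hy => ?_
        simp only [Set.mem_ofPred_eq] at *
        refine lt_of_pow_lt_pow_left₀ 2 (hh0 _) (lt_of_lt_of_le ?_ (H x y))
        nlinarith [ht.1]
    _ = 2 * ∫⁻ t in Set.Ioo (0:ℝ) 1, volume {x | t < h x} := lintegral_const_mul _ (meas h)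
    _ ≤ 2 * ∫⁻ x, ENNReal.ofReal (h x) := by
        rw [lintegral_eq_lintegral_meas_lt _ (Filter.Eventually.of_forall hh0) hh.aemeasurable]
        exact mul_le_mul_right (lintegral_mono_set Set.Ioo_subset_Ioi_self) _

lemma ENNReal.mul_le_sq_of_add_le {p q r : ℝ≥0∞} (h : p + q ≤ 2 * r) : p * q ≤ r ^ 2 := by
  by_cases hr : r = ⊤
  · simp [hr]
  have h2 : (2 : ℝ≥0∞) * r ≠ ⊤ := ENNReal.mul_ne_top (by simp) hr
  have hp : p ≠ ⊤ := ne_top_of_le_ne_top h2 (le_self_add.trans h)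
  have hq : q ≠ ⊤ := ne_top_of_le_ne_top h2 (le_add_self.trans h)
  lift p to NNReal using hp
  lift q to NNReal using hq
  lift r to NNReal using hr
  norm_cast at *
  have : (p:ℝ) + q ≤ 2 * r := by exact_mod_cast h
  have : (p:ℝ) * q ≤ r ^ 2 := by nlinarith [sq_nonneg ((p:ℝ) - q), p.2, q.2, r.2]
  exact_mod_cast this

lemma prekopa_leindler_real {f g h : ℝ → ℝ} (hf : Measurable f) (hg : Measurable g)
    (hh : Measurable h) (hf0 : ∀ x, 0 ≤ f x) (hg0 : ∀ x, 0 ≤ g x) (hh0 : ∀ x, 0 ≤ h x)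
    (hfb : BddAbove (Set.range f)) (hgb : BddAbove (Set.range g))
    (H : ∀ x y, f x * g y ≤ h ((x + y) / 2) ^ 2) :
    (∫⁻ x, ENNReal.ofReal (f x)) * ∫⁻ x, ENNReal.ofReal (g x)
      ≤ (∫⁻ x, ENNReal.ofReal (h x)) ^ 2 := by
  set a := ⨆ x, f x
  set b := ⨆ x, g x
  have hfa : ∀ x, f x ≤ a := le_ciSup hfb
  have hgb' : ∀ x, g x ≤ b := le_ciSup hgb
  rcases (hf0 0).trans (hfa 0) |>.eq_or_lt with ha | ha
  · have : f = 0 := by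
      ext x; exact le_antisymm (by rw [Pi.zero_apply, ha]; exact hfa x) (hf0 x)
    simp [this]
  rcases (hg0 0).trans (hgb' 0) |>.eq_or_lt with hb | hb
  · have : g = 0 := by
      ext x; exact le_antisymm (by rw [Pi.zero_apply, hb]; exact hgb' x) (hg0 x)
    simp [this]
  set c := √(a * b)
  have hc : 0 < c := Real.sqrt_pos.2 (mul_pos ha hb)
  have hc2 : c ^ 2 = a * b := Real.sq_sqrt (mul_pos ha hb).le
  have key := lintegral_add_le_of_normalized (f := fun x => a⁻¹ * f x) (g := fun x => b⁻¹ * g x)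
    (h := fun x => c⁻¹ * h x) (by fun_prop) (by fun_prop) (by fun_prop)
    (fun x => mul_nonneg (by positivity) (hf0 x)) (fun x => mul_nonneg (by positivity) (hg0 x))
    (fun x => mul_nonneg (by positivity) (hh0 x))
    (fun x => by rw [inv_mul_le_iff₀ ha, mul_one]; exact hfa x)
    (fun x => by rw [inv_mul_le_iff₀ hb, mul_one]; exact hgb' x)
    (fun t ht => by
      obtain ⟨x, hx⟩ := exists_lt_of_lt_ciSup (show t * a < ⨆ x, f x from by
        change t * a < a; nlinarith)
      exact ⟨x, by rw [lt_inv_mul_iff₀ ha]; linarith⟩)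
    (fun t ht => by
      obtain ⟨x, hx⟩ := exists_lt_of_lt_ciSup (show t * b < ⨆ x, g x from by
        change t * b < b; nlinarith)
      exact ⟨x, by rw [lt_inv_mul_iff₀ hb]; linarith⟩)
    (fun x y => by
      have := H x y
      rw [mul_pow, inv_pow, hc2, mul_inv]
      have h3 : 0 ≤ a⁻¹ * b⁻¹ := by positivity
      nlinarith [mul_le_mul_of_nonneg_left this h3])
  have key2 := ENNReal.mul_le_sq_of_add_le key
  have pull : ∀ (u : ℝ → ℝ) (k : ℝ), 0 < k → Measurable u → ∫⁻ x, ENNReal.ofReal (k⁻¹ * u x) =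
      ENNReal.ofReal k⁻¹ * ∫⁻ x, ENNReal.ofReal (u x) := fun u k hk hu => by
    rw [← lintegral_const_mul _ (by fun_prop)]
    exact lintegral_congr fun x => ENNReal.ofReal_mul (by positivity)
  rw [pull f a ha hf, pull g b hb hg, pull h c hc hh] at key2
  have e : ENNReal.ofReal c⁻¹ ^ 2 = ENNReal.ofReal a⁻¹ * ENNReal.ofReal b⁻¹ := by
    rw [← ENNReal.ofReal_mul (by positivity), ← ENNReal.ofReal_pow (by positivity), inv_pow, hc2,
      mul_inv]
  rw [mul_mul_mul_comm, mul_pow, e] at key2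
  refine (ENNReal.mul_le_mul_iff_right ?_ ?_).1 key2
  · rw [← ENNReal.ofReal_mul (by positivity)]; simp; positivity
  · exact ENNReal.mul_ne_top ENNReal.ofReal_ne_top ENNReal.ofReal_ne_top

/-- One-dimensional Prékopa–Leindler inequality at the midpoint. -/
lemma prekopa_leindler_one {f g h : ℝ → ℝ≥0∞} (hf : Measurable f) (hg : Measurable g)
    (hh : Measurable h) (H : ∀ x y, f x * g y ≤ h ((x + y) / 2) ^ 2) :
    (∫⁻ x, f x) * ∫⁻ x, g x ≤ (∫⁻ x, h x) ^ 2 := by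
  have trunc : ∀ n : ℕ, (∫⁻ x, min (f x) n) * ∫⁻ x, min (g x) n ≤ (∫⁻ x, h x) ^ 2 := by
    intro n
    have ne : ∀ p : ℝ≥0∞, min p n ≠ ⊤ := fun p =>
      ne_top_of_le_ne_top (ENNReal.natCast_ne_top n) (min_le_right _ _)
    have le_n : ∀ p : ℝ≥0∞, (min p n).toReal ≤ n := fun p => by
      have := ENNReal.toReal_mono (ENNReal.natCast_ne_top n) (min_le_right p n)
      simpa using this
    have := prekopa_leindler_real (f := fun x => (min (f x) n).toReal)
      (g := fun x => (min (g x) n).toReal) (h := fun x => (min (h x) n).toReal)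
      (by fun_prop) (by fun_prop) (by fun_prop) (fun _ => by positivity) (fun _ => by positivity)
      (fun _ => by positivity) ⟨n, by rintro _ ⟨x, rfl⟩; exact le_n _⟩
      ⟨n, by rintro _ ⟨x, rfl⟩; exact le_n _⟩
      (fun x y => by
        rw [← ENNReal.toReal_mul, ← ENNReal.toReal_pow]
        refine ENNReal.toReal_mono (ENNReal.pow_ne_top (ne _)) ?_
        rcases le_total (h ((x + y) / 2)) n with hn | hn
        · rw [min_eq_left hn]
          exact (mul_le_mul' (min_le_left _ _) (min_le_left _ _)).trans (H x y)
        · rw [min_eq_right hn, sq]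
          exact mul_le_mul' (min_le_right _ _) (min_le_right _ _))
    simp only [ENNReal.ofReal_toReal (ne _)] at this
    exact this.trans (by gcongr; exact min_le_left _ _)
  have lim : ∀ u : ℝ → ℝ≥0∞, Measurable u →
      Filter.Tendsto (fun n : ℕ => ∫⁻ x, min (u x) n) Filter.atTop (nhds (∫⁻ x, u x)) := by
    intro u hu
    refine lintegral_tendsto_of_tendsto_of_monotone (fun n => by fun_prop)
      (Filter.Eventually.of_forall fun x m n hmn => by dsimp only; gcongr)
      (Filter.Eventually.of_forall fun x => ?_)
    have := (tendsto_const_nhds (x := u x)).min ENNReal.tendsto_nat_nhds_top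
    simpa using this
  by_cases hF0 : ∫⁻ x, f x = 0
  · simp [hF0]
  by_cases hG0 : ∫⁻ x, g x = 0
  · simp [hG0]
  exact le_of_tendsto (ENNReal.Tendsto.mul (lim f hf) (Or.inl hF0) (lim g hg) (Or.inl hG0))
    (Filter.Eventually.of_forall trunc)

/-- Prékopa–Leindler inequality at the midpoint on `ℝⁿ`. -/
lemma prekopa_leindler_pi (n : ℕ) {f g h : (Fin n → ℝ) → ℝ≥0∞} (hf : Measurable f)
    (hg : Measurable g) (hh : Measurable h)
    (H : ∀ x y, f x * g y ≤ h (fun i => (x i + y i) / 2) ^ 2) :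
    (∫⁻ x, f x) * ∫⁻ x, g x ≤ (∫⁻ x, h x) ^ 2 := by
  induction n with
  | zero =>
    have e : ∀ u : (Fin 0 → ℝ) → ℝ≥0∞, ∫⁻ x, u x = u default := fun u => by
      rw [lintegral_unique, volume_pi, Measure.pi_of_empty]; simp
      exact congrArg u (Subsingleton.elim _ _)
    rw [e, e, e]
    convert H default default using 3
  | succ n ih =>
    have e : ∀ u : (Fin (n + 1) → ℝ) → ℝ≥0∞, Measurable u →
        ∫⁻ x, u x = ∫⁻ t, ∫⁻ y, u (Fin.cons t y) := fun u hu => by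
      have mp := (volume_preserving_piFinSuccAbove (fun _ : Fin (n + 1) => ℝ) 0).symm
      rw [← mp.lintegral_comp hu, Measure.volume_eq_prod, lintegral_prod _ (by fun_prop)]
      simp [MeasurableEquiv.piFinSuccAbove, Fin.insertNthEquiv, Fin.insertNth_zero']
    have mc : ∀ u : (Fin (n + 1) → ℝ) → ℝ≥0∞, Measurable u →
        Measurable fun p : ℝ × (Fin n → ℝ) => u (Fin.cons p.1 p.2) := fun u hu =>
by
      have := hu.comp (MeasurableEquiv.piFinSuccAbove (fun _ : Fin (n + 1) => ℝ) 0).symm.measurable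
      simpa [MeasurableEquiv.piFinSuccAbove, Fin.insertNthEquiv, Fin.insertNth_zero',
        Function.comp_def] using this
    rw [e f hf, e g hg, e h hh]
    refine prekopa_leindler_one (mc f hf).lintegral_prod_right'
      (mc g hg).lintegral_prod_right' (mc h hh).lintegral_prod_right' fun s t => ?_
    refine ih ((mc f hf).comp measurable_prodMk_left) ((mc g hg).comp measurable_prodMk_left)
      ((mc h hh).comp measurable_prodMk_left) fun x y => ?_
    refine (H _ _).trans (le_of_eq ?_)
    congr 2
    ext i
    refine Fin.cases ?_ (fun j => ?_) i <;> simp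

/-- Gaussian window of precision `k`. -/
def gwin (k u : ℝ) : ℝ := Real.exp (-(k * u ^ 2 / 2))

lemma gwin_nonneg (k u : ℝ) : 0 ≤ gwin k u := (Real.exp_pos _).le

lemma gwin_pos (k u : ℝ) : 0 < gwin k u := Real.exp_pos _

lemma gwin_le_one {k : ℝ} (hk : 0 ≤ k) (u : ℝ) : gwin k u ≤ 1 :=
  Real.exp_le_one_iff.2 (by have := mul_nonneg hk (sq_nonneg u); linarith)

@[fun_prop]
lemma continuous_gwin (k : ℝ) : Continuous (gwin k) := by unfold gwin; fun_prop

@[fun_prop]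
lemma measurable_gwin (k : ℝ) : Measurable (gwin k) := (continuous_gwin k).measurable

lemma integrable_gwin_sub {k : ℝ} (hk : 0 ≤ k) {Ω : Type*} [MeasurableSpace Ω] (μ : Measure Ω)
    [IsFiniteMeasure μ] {X : Ω → ℝ} (hX : Measurable X) (y : ℝ) :
    Integrable (fun ω => gwin k (X ω - y)) μ :=
  Integrable.of_bound (by fun_prop) 1
    (Filter.Eventually.of_forall fun ω => by
      rw [Real.norm_of_nonneg (gwin_nonneg _ _)]; exact gwin_le_one hk _)

lemma exp_le_gwin {k u : ℝ} (h : k * u ^ 2 ≤ 1) : Real.exp (-(1 / 2)) ≤ gwin k u :=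
  Real.exp_le_exp.2 (by linarith)

lemma integrable_gwin {k : ℝ} (hk : 0 < k) : Integrable (gwin k) := by
  have := integrable_exp_neg_mul_sq (half_pos hk)
  refine this.congr (Filter.Eventually.of_forall fun x => ?_)
  simp only [gwin]; ring_nf

lemma integral_gwin {k : ℝ} (hk : 0 < k) : ∫ u, gwin k u = √(2 * π) / √k := by
  have := integral_gaussian (k / 2)
  rw [← Real.sqrt_div (by positivity)]
  convert this using 2
  · ext x; simp only [gwin]; ring_nf
  · field_simp

lemma integral_gwin_eq_charFun (ν : Measure ℝ) [IsProbabilityMeasure ν] {k : ℝ} (hk : 0 < k)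
    (y : ℝ) : ((∫ x, gwin k (x - y) ∂ν : ℝ) : ℂ) =
      ∫ ξ, charFun ν ξ * Complex.exp (-(ξ * y * Complex.I))
        ∂(ProbabilityTheory.gaussianReal 0 k.toNNReal) := by
  set γ := ProbabilityTheory.gaussianReal 0 k.toNNReal
  have : IsProbabilityMeasure γ := ProbabilityTheory.instIsProbabilityMeasureGaussianReal _ _
  have e1 : ∀ x : ℝ, ((gwin k (x - y) : ℝ) : ℂ) =
      ∫ ξ, Complex.exp (ξ * x * Complex.I) * Complex.exp (-(ξ * y * Complex.I)) ∂γ := by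
    intro x
    have := ProbabilityTheory.charFun_gaussianReal (μ := 0) (v := k.toNNReal) (x - y)
    rw [charFun_apply_real] at this
    rw [show ∀ z : ℝ, ((gwin k z : ℝ) : ℂ) = Complex.exp (-(k * z ^ 2 / 2)) from fun z => by
      simp [gwin]]
    rw [show Complex.exp (-(k * ((x - y : ℝ) : ℂ) ^ 2 / 2)) = _ by
      refine Eq.trans ?_ this.symm
      congr 1
      simp only [Complex.ofReal_zero, mul_zero, zero_mul, zero_sub, Real.coe_toNNReal k hk.le]]
    refine integral_congr_ae (Filter.Eventually.of_forall fun ξ => ?_)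
    simp only
    rw [← Complex.exp_add]
    congr 1
    push_cast
    ring
  rw [← integral_complex_ofReal]
  simp_rw [e1]
  rw [integral_integral_swap]
  · refine integral_congr_ae (Filter.Eventually.of_forall fun ξ => ?_)
    simp only
    rw [integral_mul_const, charFun_apply_real]
  · refine Integrable.of_bound ?_ 1 (Filter.Eventually.of_forall fun z => ?_)
    · refine Continuous.aestronglyMeasurable ?_
      simp only [Function.uncurry_def]
      fun_prop
    · simp only [Function.uncurry_def, norm_mul]
      have h1 : ‖Complex.exp ((z.2 : ℂ) * z.1 * Complex.I)‖ = 1 := by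
        have := Complex.norm_exp_ofReal_mul_I (z.2 * z.1); push_cast at this; exact this
      have h2 : ‖Complex.exp (-((z.2 : ℂ) * y * Complex.I))‖ = 1 := by
        have := Complex.norm_exp_ofReal_mul_I (-(z.2 * y)); push_cast at this
        rwa [neg_mul] at this
      rw [h1, h2, one_mul]

lemma gaussianReal_le {k : ℝ} (hk : 0 < k) :
    ProbabilityTheory.gaussianReal 0 k.toNNReal ≤ ENNReal.ofReal (√k)⁻¹ • volume := by
  have hv : k.toNNReal ≠ 0 := by simpa using hk
  rw [ProbabilityTheory.gaussianReal_of_var_ne_zero _ hv, ← withDensity_const]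
  refine withDensity_mono (Filter.Eventually.of_forall fun x => ?_)
  refine ENNReal.ofReal_le_ofReal ?_
  simp only [ProbabilityTheory.gaussianPDFReal, Real.coe_toNNReal k hk.le]
  have h1 : (√(2 * π * k))⁻¹ ≤ (√k)⁻¹ := by
    apply inv_anti₀ (Real.sqrt_pos.2 hk)
    apply Real.sqrt_le_sqrt
    nlinarith [Real.pi_gt_three]
  have h2 : Real.exp (-(x - 0) ^ 2 / (2 * k)) ≤ 1 := Real.exp_le_one_iff.2 (by
    have : 0 ≤ (x - 0) ^ 2 / (2 * k) := by positivity
    rw [neg_div]; linarith)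
  calc _ ≤ (√k)⁻¹ * 1 := mul_le_mul h1 h2 (Real.exp_pos _).le (by positivity)
    _ = _ := mul_one _

/-- Window averages are controlled by the `L¹` norm of the characteristic function. -/
lemma norm_integral_mul_exp_gaussianReal_le {k : ℝ} (hk : 0 < k) (y : ℝ) {g : ℝ → ℝ} {φ : ℝ → ℂ}
    (hg : Integrable g) (hle : ∀ ξ, ‖φ ξ‖ ≤ g ξ) :
    ‖∫ ξ, φ ξ * Complex.exp (-(ξ * y * Complex.I))
        ∂(ProbabilityTheory.gaussianReal 0 k.toNNReal)‖ ≤ (√k)⁻¹ * ∫ ξ, g ξ := by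
  have hg0 : ∀ ξ, 0 ≤ g ξ := fun ξ => (norm_nonneg _).trans (hle ξ)
  have hgc := hg.smul_measure (c := ENNReal.ofReal (√k)⁻¹) ENNReal.ofReal_ne_top
  have h1 := integral_mono_measure (gaussianReal_le hk) (Filter.Eventually.of_forall hg0) hgc
  rw [integral_smul_measure, ENNReal.toReal_ofReal (by positivity), smul_eq_mul] at h1
  refine le_trans ?_ h1
  refine norm_integral_le_of_norm_le (hgc.mono_measure (gaussianReal_le hk))
    (Filter.Eventually.of_forall fun ξ => ?_)
  have h2 : ‖Complex.exp (-((ξ : ℂ) * y * Complex.I))‖ = 1 := by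
    have := Complex.norm_exp_ofReal_mul_I (-(ξ * y)); push_cast at this
    rwa [neg_mul] at this
  rw [norm_mul, h2, mul_one]
  exact hle ξ

lemma integral_gwin_le_of_charFun_le (ν : Measure ℝ) [IsProbabilityMeasure ν] {k : ℝ} (hk : 0 < k)
    (y : ℝ) {g : ℝ → ℝ} (hg : Integrable g) (hle : ∀ ξ, ‖charFun ν ξ‖ ≤ g ξ) :
    ∫ x, gwin k (x - y) ∂ν ≤ (√k)⁻¹ * ∫ ξ, g ξ := by
  refine le_trans ?_ (norm_integral_mul_exp_gaussianReal_le hk y hg hle)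
  rw [← integral_gwin_eq_charFun ν hk y, Complex.norm_real]
  exact le_abs_self _

lemma abs_integral_gwin_sub_le (ν₁ ν₂ : Measure ℝ) [IsProbabilityMeasure ν₁]
    [IsProbabilityMeasure ν₂] {k : ℝ} (hk : 0 < k)
    (y : ℝ) {g : ℝ → ℝ} (hg : Integrable g) (hle : ∀ ξ, ‖charFun ν₁ ξ - charFun ν₂ ξ‖ ≤ g ξ) :
    |∫ x, gwin k (x - y) ∂ν₁ - ∫ x, gwin k (x - y) ∂ν₂| ≤ (√k)⁻¹ * ∫ ξ, g ξ := by
  refine le_trans ?_ (norm_integral_mul_exp_gaussianReal_le hk y hg hle)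
  have hi : ∀ ν : Measure ℝ, IsProbabilityMeasure ν →
      Integrable (fun ξ : ℝ => charFun ν ξ * Complex.exp (-(ξ * y * Complex.I)))
      (ProbabilityTheory.gaussianReal 0 k.toNNReal) := fun ν _ => by
    refine Integrable.of_bound (by
      refine Continuous.aestronglyMeasurable ?_
      have := continuous_charFun (μ := ν)
      fun_prop) 1 (Filter.Eventually.of_forall fun ξ => ?_)
    have h2 : ‖Complex.exp (-((ξ : ℂ) * y * Complex.I))‖ = 1 := by
      have := Complex.norm_exp_ofReal_mul_I (-(ξ * y)); push_cast at this
      rwa [neg_mul] at this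
    rw [norm_mul, h2, mul_one]
    exact norm_charFun_le_one _
  simp_rw [sub_mul]
  rw [integral_sub (hi ν₁ ‹_›) (hi ν₂ ‹_›), ← integral_gwin_eq_charFun ν₁ hk y,
    ← integral_gwin_eq_charFun ν₂ hk y, ← Complex.ofReal_sub, Complex.norm_real]
  exact le_rfl

lemma integral_inv_one_add_mul_sq {b : ℝ} (hb : 0 < b) :
    Integrable (fun ξ : ℝ => (1 + (b * ξ) ^ 2)⁻¹) ∧
      ∫ ξ : ℝ, (1 + (b * ξ) ^ 2)⁻¹ = π / b := by
  refine ⟨integrable_inv_one_add_sq.comp_mul_left' hb.ne', ?_⟩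
  have := Measure.integral_comp_mul_left (fun x : ℝ => (1 + x ^ 2)⁻¹) b
  rw [this, integral_univ_inv_one_add_sq, abs_of_pos (by positivity), smul_eq_mul]
  field_simp

/-- If no summand dominates, a product of `1 / (1 + c i)` decays like a high power. -/
lemma prod_inv_one_add_le {ι : Type*} (A : Finset ι) (c : ι → ℝ) (hc : ∀ i ∈ A, 0 ≤ c i) (R : ℕ)
    (hR : 0 < R) (hdom : ∀ i ∈ A, R * c i ≤ ∑ j ∈ A, c j) :
    ∏ i ∈ A, (1 + c i)⁻¹ ≤ ((1 + (∑ j ∈ A, c j) / R) ^ R)⁻¹ := by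
  set t := ∑ j ∈ A, c j
  have ht : 0 ≤ t := Finset.sum_nonneg hc
  have hR' : (0 : ℝ) < R := by exact_mod_cast hR
  rcases ht.eq_or_lt with h0 | h0
  · rw [← h0]; simp only [zero_div, add_zero, one_pow, inv_one]
    refine Finset.prod_le_one (fun i hi => ?_) fun i hi => ?_
    · have := hc i hi; positivity
    · exact inv_le_one_of_one_le₀ (by linarith [hc i hi])
  rw [Finset.prod_inv_distrib]
  have hpos : (0 : ℝ) < 1 + t / R := by positivity
  refine inv_anti₀ (by positivity) ?_
  calc (1 + t / R) ^ R = (1 + t / R) ^ (∑ i ∈ A, R * c i / t) := by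
        rw [← Finset.sum_div, ← Finset.mul_sum, mul_div_assoc, div_self h0.ne', mul_one,
          Real.rpow_natCast]
    _ = ∏ i ∈ A, (1 + t / R) ^ (R * c i / t) := Real.rpow_sum_of_pos hpos _ _
    _ ≤ ∏ i ∈ A, (1 + c i) := by
        refine Finset.prod_le_prod (fun i _ => by positivity) fun i hi => ?_
        have := rpow_one_add_le_one_add_mul_self (s := t / R)
          (by have : 0 ≤ t / R := by positivity
              linarith) (p := R * c i / t) (by have := hc i hi; positivity)
          (by rw [div_le_one h0]; exact hdom i hi)
        refine this.trans (le_of_eq ?_)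
        field_simp

lemma norm_prod_sub_prod_le_sum {ι : Type*} (A : Finset ι) (a b : ι → ℂ)
    (ha : ∀ i ∈ A, ‖a i‖ ≤ 1) (hb : ∀ i ∈ A, ‖b i‖ ≤ 1) :
    ‖∏ i ∈ A, a i - ∏ i ∈ A, b i‖ ≤ ∑ i ∈ A, ‖a i - b i‖ := by
  classical
  induction A using Finset.induction_on with
  | empty => simp
  | insert i A hi ih =>
    rw [Finset.prod_insert hi, Finset.prod_insert hi, Finset.sum_insert hi]
    have ih' := ih (fun j hj => ha j (by simp [hj])) (fun j hj => hb j (by simp [hj]))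
    have h1 : ‖∏ j ∈ A, a j‖ ≤ 1 := by
      rw [norm_prod]
      exact Finset.prod_le_one (fun _ _ => norm_nonneg _) fun j hj => ha j (by simp [hj])
    have h2 := hb i (by simp)
    calc _ = ‖(a i - b i) * ∏ j ∈ A, a j + b i * (∏ j ∈ A, a j - ∏ j ∈ A, b j)‖ := by
          congr 1; ring
      _ ≤ ‖a i - b i‖ * ‖∏ j ∈ A, a j‖ + ‖b i‖ * ‖∏ j ∈ A, a j - ∏ j ∈ A, b j‖ := by
          refine (norm_add_le _ _).trans ?_; rw [norm_mul, norm_mul]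
      _ ≤ ‖a i - b i‖ * 1 + 1 * ∑ j ∈ A, ‖a j - b j‖ := by gcongr
      _ = _ := by ring

lemma norm_exp_I_sub_taylor_le (x : ℝ) :
    ‖Complex.exp (x * Complex.I) - (1 + x * Complex.I - x ^ 2 / 2)‖ ≤ 4 * |x| ^ 3 := by
  rcases le_total |x| 1 with h | h
  · have hn : ‖(x : ℂ) * Complex.I‖ = |x| := by simp
    have := Complex.exp_bound (x := x * Complex.I) (by rw [hn]; exact h) (n := 3) (by norm_num)
    rw [hn] at this
    have e : ∑ m ∈ Finset.range 3, ((x : ℂ) * Complex.I) ^ m / (m.factorial : ℂ)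
        = 1 + x * Complex.I - x ^ 2 / 2 := by
      simp [Finset.sum_range_succ, Nat.factorial, mul_pow]; ring
    rw [e] at this
    refine this.trans ?_
    have : 0 ≤ |x| ^ 3 := by positivity
    norm_num [Nat.factorial]
    linarith
  · have h1 : ‖Complex.exp (x * Complex.I)‖ = 1 := Complex.norm_exp_ofReal_mul_I x
    calc _ ≤ ‖Complex.exp (x * Complex.I)‖ + ‖(1 + x * Complex.I - x ^ 2 / 2 : ℂ)‖ := norm_sub_le _ _
      _ ≤ 1 + (1 + |x| + |x| ^ 2 / 2) := by
          rw [h1]; gcongr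
          refine (norm_sub_le _ _).trans ?_
          gcongr
          · refine (norm_add_le _ _).trans ?_; simp
          · simp
      _ ≤ 4 * |x| ^ 3 := by nlinarith [sq_nonneg (|x| - 1), pow_le_pow_left₀ zero_le_one h 2]

/-- Third order expansion of the characteristic function of a centred law. -/
lemma norm_charFun_sub_taylor_le (ν : Measure ℝ) [IsProbabilityMeasure ν]
    (h3 : Integrable (fun x => |x| ^ 3) ν) (h0 : ∫ x, x ∂ν = 0) (ξ : ℝ) :
    ‖charFun ν ξ - (1 - ((∫ x, x ^ 2 ∂ν) * ξ ^ 2 / 2 : ℝ))‖ ≤ 4 * |ξ| ^ 3 * ∫ x, |x| ^ 3 ∂ν := by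
  have hle1 : ∀ x : ℝ, |x| ≤ 1 + |x| ^ 3 := fun x => by
    rcases le_total |x| 1 with h | h
    · have : 0 ≤ |x| ^ 3 := by positivity
      linarith
    · nlinarith [pow_le_pow_left₀ zero_le_one h 2]
  have hle2 : ∀ x : ℝ, |x| ^ 2 ≤ 1 + |x| ^ 3 := fun x => by
    rcases le_total |x| 1 with h | h
    · have : 0 ≤ |x| ^ 3 := by positivity
      nlinarith [abs_nonneg x]
    · nlinarith [pow_le_pow_left₀ zero_le_one h 2]
  have i1 : Integrable (fun x : ℝ => x) ν :=
    ((integrable_const 1).add h3).mono' (by fun_prop)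
      (Filter.Eventually.of_forall fun x => by simpa using hle1 x)
  have i2 : Integrable (fun x : ℝ => x ^ 2) ν :=
    ((integrable_const 1).add h3).mono' (by fun_prop)
      (Filter.Eventually.of_forall fun x => by simpa using hle2 x)
  have ie : Integrable (fun x : ℝ => Complex.exp (ξ * x * Complex.I)) ν :=
    Integrable.of_bound (Continuous.aestronglyMeasurable (by fun_prop)) 1
      (Filter.Eventually.of_forall fun x => by
        have := Complex.norm_exp_ofReal_mul_I (ξ * x); push_cast at this; exact this.le)
  have ic : Integrable (fun x : ℝ => 1 + ((ξ * x : ℝ) : ℂ) * Complex.I - ((ξ * x : ℝ) : ℂ) ^ 2 / 2) ν := by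
    refine Integrable.sub (Integrable.add (integrable_const _) ?_) ?_
    · exact (i1.const_mul ξ).ofReal.mul_const _
    · have := ((i2.const_mul (ξ ^ 2)).ofReal (𝕜 := ℂ)).div_const 2
      refine this.congr (Filter.Eventually.of_forall fun x => ?_)
      change ((ξ ^ 2 * x ^ 2 : ℝ) : ℂ) / 2 = _
      push_cast; ring
  have e : (1 - ((∫ x, x ^ 2 ∂ν) * ξ ^ 2 / 2 : ℝ) : ℂ) =
      ∫ x : ℝ, (1 + ((ξ * x : ℝ) : ℂ) * Complex.I - ((ξ * x : ℝ) : ℂ) ^ 2 / 2) ∂ν := by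
    rw [integral_sub, integral_add (integrable_const _), integral_mul_const, integral_complex_ofReal,
      integral_const_mul, h0]
    · have : ∫ x : ℝ, ((ξ * x : ℝ) : ℂ) ^ 2 / 2 ∂ν = (((∫ x, x ^ 2 ∂ν) * ξ ^ 2 / 2 : ℝ) : ℂ) := by
        rw [show ((∫ x, x ^ 2 ∂ν) * ξ ^ 2 / 2) = ∫ x, (ξ * x) ^ 2 / 2 ∂ν by
          rw [mul_div_assoc, ← integral_mul_const]; congr 1; ext x; ring, ← integral_complex_ofReal]
        congr 1; ext x; push_cast; ring
      rw [this]; simp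
    · exact (i1.const_mul ξ).ofReal.mul_const _
    · exact Integrable.add (integrable_const _) ((i1.const_mul ξ).ofReal.mul_const _)
    · have := ((i2.const_mul (ξ ^ 2)).ofReal (𝕜 := ℂ)).div_const 2
      refine this.congr (Filter.Eventually.of_forall fun x => ?_)
      change ((ξ ^ 2 * x ^ 2 : ℝ) : ℂ) / 2 = _
      push_cast; ring
  rw [e, charFun_apply_real, ← integral_sub ie ic, ← integral_const_mul]
  refine norm_integral_le_of_norm_le (h3.const_mul _) (Filter.Eventually.of_forall fun x => ?_)
  have := norm_exp_I_sub_taylor_le (ξ * x)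
  rw [abs_mul, mul_pow] at this
  push_cast at this ⊢
  linarith

lemma abs_exp_neg_sub_taylor_le {u : ℝ} (hu : 0 ≤ u) :
    |Real.exp (-(u ^ 2 / 2)) - (1 - u ^ 2 / 2)| ≤ u ^ 3 := by
  have h1 : 1 - u ^ 2 / 2 ≤ Real.exp (-(u ^ 2 / 2)) := by
    have := Real.add_one_le_exp (-(u ^ 2 / 2)); linarith
  rcases le_total u 1 with hu1 | hu1
  · have := Real.abs_exp_sub_one_sub_id_le (x := -(u ^ 2 / 2)) (by
      rw [abs_neg, abs_of_nonneg (by positivity)]; nlinarith)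
    rw [show Real.exp (-(u ^ 2 / 2)) - (1 - u ^ 2 / 2)
      = Real.exp (-(u ^ 2 / 2)) - 1 - -(u ^ 2 / 2) by ring]
    refine this.trans ?_
    have h2 : u ^ 3 * u ≤ u ^ 3 * 1 := mul_le_mul_of_nonneg_left hu1 (by positivity)
    have h3 : 0 ≤ u ^ 3 := by positivity
    nlinarith
  · rw [abs_of_nonneg (by linarith)]
    have h3 : Real.exp (-(u ^ 2 / 2)) ≤ 1 :=
      Real.exp_le_one_iff.2 (by have : 0 ≤ u ^ 2 := by positivity
                                linarith)
    nlinarith [sq_nonneg u]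

/-- A one-dimensional law with mean `m` and variance `σ²` satisfying scale-invariant density,
third moment and characteristic function bounds and a comparison with a log-concave density, all
with constant `K`. -/
structure GoodLaw (K : ℝ) (ν : Measure ℝ) (m σ : ℝ) : Prop where
  one_le : 1 ≤ K
  pos : 0 < σ
  prob : IsProbabilityMeasure ν
  int_cube : Integrable (fun x => |x| ^ 3) ν
  mean : ∫ x, x ∂ν = m
  var : ∫ x, (x - m) ^ 2 ∂ν = σ ^ 2
  var_le : σ ^ 2 ≤ K
  dens : ν ≤ ENNReal.ofReal (K / σ) • volume
  third : ∫ x, |x - m| ^ 3 ∂ν ≤ K * σ ^ 3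
  char : ∀ ξ, ‖charFun ν ξ‖ ^ 2 ≤ (1 + σ ^ 2 * ξ ^ 2 / K)⁻¹
  logConcave : ∃ p q : ℝ → ℝ, Measurable p ∧ Measurable q ∧ (∀ x, 0 ≤ q x) ∧
    ν = volume.withDensity (fun x => ENNReal.ofReal (p x)) ∧
    (∀ x y, q x * q y ≤ q ((x + y) / 2) ^ 2) ∧ ∀ x, K⁻¹ * q x ≤ p x ∧ p x ≤ K * q x

lemma integrable_abs_sub_cube {ν : Measure ℝ} [IsFiniteMeasure ν]
    (h : Integrable (fun x => |x| ^ 3) ν) (m : ℝ) : Integrable (fun x => |x - m| ^ 3) ν := by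
  refine ((h.const_mul 4).add (integrable_const (4 * |m| ^ 3))).mono' (by fun_prop)
    (Filter.Eventually.of_forall fun x => ?_)
  rw [Real.norm_of_nonneg (by positivity), Pi.add_apply]
  have h1 : |x - m| ≤ |x| + |m| := abs_sub _ _
  have h2 := pow_le_pow_left₀ (abs_nonneg _) h1 3
  nlinarith [mul_nonneg (add_nonneg (abs_nonneg x) (abs_nonneg m)) (sq_nonneg (|x| - |m|))]

lemma integrable_of_integrable_cube {ν : Measure ℝ} [IsFiniteMeasure ν]
    (h : Integrable (fun x => |x| ^ 3) ν) : Integrable (fun x => x) ν := by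
  refine ((integrable_const 1).add h).mono' (by fun_prop)
    (Filter.Eventually.of_forall fun x => ?_)
  rw [Real.norm_eq_abs, Pi.add_apply]
  rcases le_total |x| 1 with h | h
  · have : 0 ≤ |x| ^ 3 := by positivity
    linarith
  · nlinarith [pow_le_pow_left₀ zero_le_one h 2]

lemma integrable_sub_sq_of_integrable_cube {ν : Measure ℝ} [IsFiniteMeasure ν]
    (h : Integrable (fun x => |x| ^ 3) ν) (m : ℝ) : Integrable (fun x => (x - m) ^ 2) ν := by
  refine ((integrable_const 1).add (integrable_abs_sub_cube h m)).mono' (by fun_prop)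
    (Filter.Eventually.of_forall fun x => ?_)
  rw [Real.norm_of_nonneg (by positivity), Pi.add_apply, ← sq_abs]
  rcases le_total |x - m| 1 with h | h
  · have : 0 ≤ |x - m| ^ 3 := by positivity
    nlinarith [abs_nonneg (x - m)]
  · nlinarith [pow_le_pow_left₀ zero_le_one h 2]

lemma norm_charFun_map_sub (ν : Measure ℝ) (m ξ : ℝ) :
    charFun (ν.map (fun x => x - m)) ξ = Complex.exp (-(ξ * m * Complex.I)) * charFun ν ξ := by
  rw [charFun_apply_real, charFun_apply_real, integral_map (by fun_prop)
    (Continuous.aestronglyMeasurable (by fun_prop)), ← integral_const_mul]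
  congr 1; ext x
  rw [← Complex.exp_add]; congr 1; push_cast; ring

/-- Comparison of a good law with the Gaussian law of the same mean and variance. -/
lemma GoodLaw.norm_charFun_sub_gaussian_le {K m σ : ℝ} {ν : Measure ℝ} (h : GoodLaw K ν m σ)
    (ξ : ℝ) : ‖charFun ν ξ - Complex.exp (ξ * m * Complex.I - σ ^ 2 * ξ ^ 2 / 2)‖
      ≤ 5 * K * (σ * |ξ|) ^ 3 := by
  have := h.prob
  set ν' := ν.map (fun x => x - m)
  have : IsProbabilityMeasure ν' := Measure.isProbabilityMeasure_map (by fun_prop)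
  have h3 : Integrable (fun x => |x| ^ 3) ν' := by
    rw [integrable_map_measure (Continuous.aestronglyMeasurable (by fun_prop)) (by fun_prop)]
    exact integrable_abs_sub_cube h.int_cube m
  have hm : ∫ x, x ∂ν' = 0 := by
    rw [integral_map (by fun_prop) (Continuous.aestronglyMeasurable (by fun_prop)),
      integral_sub (integrable_of_integrable_cube h.int_cube) (integrable_const _), h.mean]
    simp
  have hv : ∫ x, x ^ 2 ∂ν' = σ ^ 2 := by
    rw [integral_map (by fun_prop) (Continuous.aestronglyMeasurable (by fun_prop)), h.var]
  have ht : ∫ x, |x| ^ 3 ∂ν' ≤ K * σ ^ 3 := by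
    rw [integral_map (by fun_prop) (Continuous.aestronglyMeasurable (by fun_prop))]
    exact h.third
  have key := norm_charFun_sub_taylor_le ν' h3 hm ξ
  rw [hv] at key
  have e : charFun ν ξ - Complex.exp (ξ * m * Complex.I - σ ^ 2 * ξ ^ 2 / 2) =
      Complex.exp (ξ * m * Complex.I) *
        (charFun ν' ξ - ((Real.exp (-((σ * |ξ|) ^ 2 / 2)) : ℝ) : ℂ)) := by
    rw [norm_charFun_map_sub, mul_sub, ← mul_assoc, ← Complex.exp_add, Complex.ofReal_exp,
      ← Complex.exp_add]
    have : ((|ξ| : ℝ) : ℂ) ^ 2 = (ξ : ℂ) ^ 2 := by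
      rw [← Complex.ofReal_pow, sq_abs, Complex.ofReal_pow]
    congr 1
    · simp
    · congr 1
      push_cast
      rw [mul_pow, this]
      ring
  have hn : ‖Complex.exp (ξ * m * Complex.I)‖ = 1 := by
    have := Complex.norm_exp_ofReal_mul_I (ξ * m); push_cast at this; exact this
  rw [e, norm_mul, hn, one_mul]
  have hg := abs_exp_neg_sub_taylor_le (u := σ * |ξ|) (mul_nonneg h.pos.le (abs_nonneg _))
  have hpos : 0 ≤ (σ * |ξ|) ^ 3 := pow_nonneg (mul_nonneg h.pos.le (abs_nonneg _)) 3
  calc _ = ‖(charFun ν' ξ - ((1 - σ ^ 2 * ξ ^ 2 / 2 : ℝ) : ℂ))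
        - ((Real.exp (-((σ * |ξ|) ^ 2 / 2)) - (1 - (σ * |ξ|) ^ 2 / 2) : ℝ) : ℂ)‖ := by
        congr 1
        rw [mul_pow, sq_abs]
        push_cast; ring
    _ ≤ 4 * |ξ| ^ 3 * (∫ x, |x| ^ 3 ∂ν') + (σ * |ξ|) ^ 3 := by
        refine (norm_sub_le _ _).trans (add_le_add ?_ ?_)
        · exact_mod_cast key
        · rw [Complex.norm_real]; exact hg
    _ ≤ 4 * |ξ| ^ 3 * (K * σ ^ 3) + K * (σ * |ξ|) ^ 3 := by
        gcongr
        nlinarith [h.one_le]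
    _ = _ := by ring

/-- Window averages of a law with bounded density. -/
lemma GoodLaw.integral_gwin_le {K m σ : ℝ} {ν : Measure ℝ} (h : GoodLaw K ν m σ) {k : ℝ}
    (hk : 0 < k) (y : ℝ) : (∫ x, gwin k (x - y) ∂ν) * (√k * σ) ≤ 3 * K := by
  have hK := h.one_le
  have hσ := h.pos
  have hi : Integrable (fun x => gwin k (x - y)) := (integrable_gwin hk).comp_sub_right y
  have h1 := integral_mono_measure h.dens
    (Filter.Eventually.of_forall fun x => gwin_nonneg k (x - y))
    (hi.smul_measure (c := ENNReal.ofReal (K / σ)) ENNReal.ofReal_ne_top)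
  rw [integral_smul_measure, ENNReal.toReal_ofReal (by positivity), smul_eq_mul,
    integral_sub_right_eq_self (μ := volume) (fun x => gwin k x) y, integral_gwin hk] at h1
  have h2 : √(2 * π) ≤ 3 := by
    rw [Real.sqrt_le_left (by norm_num)]; nlinarith [Real.pi_lt_four]
  have hk' : 0 < √k := Real.sqrt_pos.2 hk
  calc _ ≤ K / σ * (√(2 * π) / √k) * (√k * σ) := by gcongr
    _ = √(2 * π) * K := by field_simp
    _ ≤ 3 * K := by gcongr

section Independence

open ProbabilityTheory

variable {Ω : Type*} [MeasurableSpace Ω] {μ : Measure Ω}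

lemma ProbabilityTheory.IndepFun.integral_comp_prodMk [IsProbabilityMeasure μ] {α β : Type*}
    [MeasurableSpace α] [MeasurableSpace β] {U : Ω → α} {V : Ω → β} (hUV : IndepFun U V μ)
    (hU : Measurable U)
    (hV : Measurable V) {g : α → β → ℝ} (hg : Measurable (Function.uncurry g))
    (hi : Integrable (fun ω => g (U ω) (V ω)) μ) :
    ∫ ω, g (U ω) (V ω) ∂μ = ∫ ω', ∫ ω, g (U ω) (V ω') ∂μ ∂μ := by
  have hmap := (indepFun_iff_map_prod_eq_prod_map_map hU.aemeasurable hV.aemeasurable).1 hUV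
  have : IsProbabilityMeasure (μ.map U) := Measure.isProbabilityMeasure_map hU.aemeasurable
  have : IsProbabilityMeasure (μ.map V) := Measure.isProbabilityMeasure_map hV.aemeasurable
  have hi' : Integrable (Function.uncurry g) ((μ.map U).prod (μ.map V)) := by
    rw [← hmap, integrable_map_measure hg.aestronglyMeasurable (by fun_prop)]
    exact hi
  calc _ = ∫ z, Function.uncurry g z ∂(μ.map fun ω => (U ω, V ω)) := by
        rw [integral_map (by fun_prop) hg.aestronglyMeasurable]; rfl
    _ = ∫ v, ∫ u, g u v ∂(μ.map U) ∂(μ.map V) := by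
        rw [hmap, integral_prod_symm _ hi']; rfl
    _ = ∫ ω', ∫ u, g u (V ω') ∂(μ.map U) ∂μ := by
        rw [integral_map hV.aemeasurable]
        exact hi'.integral_prod_right.aestronglyMeasurable
    _ = _ := by
        refine integral_congr_ae (Filter.Eventually.of_forall fun ω' => ?_)
        exact integral_map hU.aemeasurable
          ((hg.comp measurable_prodMk_right).aestronglyMeasurable)

lemma ProbabilityTheory.IndepFun.integral_mul_le [IsProbabilityMeasure μ] {α β : Type*}
    [MeasurableSpace α] [MeasurableSpace β] {U : Ω → α} {V : Ω → β} (hUV : IndepFun U V μ)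
    (hU : Measurable U)
    (hV : Measurable V) {g : α → β → ℝ} (hg : Measurable (Function.uncurry g))
    (hg0 : ∀ u v, 0 ≤ g u v) (hg1 : ∀ u v, g u v ≤ 1) {h : β → ℝ} (hh : Measurable h)
    (hh0 : ∀ v, 0 ≤ h v) (hhi : Integrable (fun ω => h (V ω)) μ) {b : ℝ}
    (hb : ∀ v, ∫ ω, g (U ω) v ∂μ ≤ b) :
    ∫ ω, h (V ω) * g (U ω) (V ω) ∂μ ≤ b * ∫ ω, h (V ω) ∂μ := by
  have hm : Measurable (Function.uncurry fun u v => h v * g u v) := by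
    exact (hh.comp measurable_snd).mul hg
  have hi : Integrable (fun ω => h (V ω) * g (U ω) (V ω)) μ := by
    refine hhi.mono' (hm.comp (hU.prodMk hV)).aestronglyMeasurable
      (Filter.Eventually.of_forall fun ω => ?_)
    rw [Real.norm_of_nonneg (mul_nonneg (hh0 _) (hg0 _ _))]
    exact mul_le_of_le_one_right (hh0 _) (hg1 _ _)
  rw [hUV.integral_comp_prodMk hU hV (g := fun u v => h v * g u v) hm hi, ← integral_const_mul]
  refine integral_mono_of_nonneg (Filter.Eventually.of_forall fun ω => ?_) (hhi.const_mul _)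
    (Filter.Eventually.of_forall fun ω => ?_)
  · exact integral_nonneg fun _ => mul_nonneg (hh0 _) (hg0 _ _)
  · simp only
    rw [integral_const_mul, mul_comm]
    exact mul_le_mul_of_nonneg_right (hb _) (hh0 _)

lemma ProbabilityTheory.IndepFun.le_integral [IsProbabilityMeasure μ] {α β : Type*}
    [MeasurableSpace α] [MeasurableSpace β] {U : Ω → α} {V : Ω → β} (hUV : IndepFun U V μ)
    (hU : Measurable U)
    (hV : Measurable V) {g : α → β → ℝ} (hg : Measurable (Function.uncurry g))
    (hg0 : ∀ u v, 0 ≤ g u v) (hg1 : ∀ u v, g u v ≤ 1) {G : Set β} (hG : MeasurableSet G)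
    {b : ℝ} (hb : ∀ v ∈ G, b ≤ ∫ ω, g (U ω) v ∂μ) :
    b * μ.real (V ⁻¹' G) ≤ ∫ ω, g (U ω) (V ω) ∂μ := by
  have hi : Integrable (fun ω => g (U ω) (V ω)) μ :=
    Integrable.of_bound (hg.comp (hU.prodMk hV)).aestronglyMeasurable 1
      (Filter.Eventually.of_forall fun ω => by
        rw [Real.norm_of_nonneg (hg0 _ _)]; exact hg1 _ _)
  rw [hUV.integral_comp_prodMk hU hV hg hi, mul_comm, ← smul_eq_mul,
    ← integral_indicator_const b (hV hG)]
  refine integral_mono ((integrable_const b).indicator (hV hG)) ?_ fun ω => ?_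
  · have : StronglyMeasurable fun ω' => ∫ ω, g (U ω) (V ω') ∂μ :=
      StronglyMeasurable.integral_prod_right' (f := fun z : Ω × Ω => g (U z.2) (V z.1))
        (hg.comp ((hU.comp measurable_snd).prodMk (hV.comp measurable_fst))).stronglyMeasurable
    refine Integrable.of_bound this.aestronglyMeasurable 1
      (Filter.Eventually.of_forall fun ω => ?_)
    rw [Real.norm_of_nonneg (integral_nonneg fun _ => hg0 _ _)]
    calc _ ≤ ∫ _, (1 : ℝ) ∂μ := integral_mono_of_nonneg
          (Filter.Eventually.of_forall fun _ => hg0 _ _) (integrable_const _)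
          (Filter.Eventually.of_forall fun _ => hg1 _ _)
      _ = 1 := by simp
  · by_cases hω : V ω ∈ G
    · rw [Set.indicator_of_mem (by exact hω)]; exact hb _ hω
    · rw [Set.indicator_of_notMem (by exact hω)]; exact integral_nonneg fun _ => hg0 _ _

end Independence

/-- Independent random variables with good laws. -/
structure GoodFam {Ω ι : Type*} [MeasurableSpace Ω] (K : ℝ) (μ : Measure Ω) (X : ι → Ω → ℝ)
    (m σ : ι → ℝ) : Prop where
  one_le : 1 ≤ K
  meas : ∀ i, Measurable (X i)
  indep : ProbabilityTheory.iIndepFun X μ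
  good : ∀ i, GoodLaw K (μ.map (X i)) (m i) (σ i)

namespace GoodFam

open ProbabilityTheory

variable {Ω ι : Type*} [MeasurableSpace Ω] {K : ℝ} {μ : Measure Ω} [IsProbabilityMeasure μ]
  {X : ι → Ω → ℝ} {m σ : ι → ℝ}

omit [IsProbabilityMeasure μ] in
lemma indepFun_restrict (h : GoodFam K μ X m σ) {A B : Finset ι} (hAB : Disjoint A B) :
    IndepFun (fun ω (i : A) => X i ω) (fun ω (i : B) => X i ω) μ :=
  h.indep.indepFun_finset A B hAB h.meas

omit [IsProbabilityMeasure μ] in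
lemma measurable_sum (h : GoodFam K μ X m σ) (A : Finset ι) :
    Measurable fun ω => ∑ i ∈ A, X i ω := by
  have := h.meas; fun_prop

omit [IsProbabilityMeasure μ] in
lemma measurable_restrict (h : GoodFam K μ X m σ) (A : Finset ι) :
    Measurable fun ω (i : A) => X i ω := by
  have := h.meas; fun_prop

lemma indepFun_sum_restrict (h : GoodFam K μ X m σ) {A B : Finset ι} (hAB : Disjoint A B) :
    IndepFun (fun ω => ∑ i ∈ A, X i ω) (fun ω (i : B) => X i ω) μ := by
  have := (h.indepFun_restrict hAB).comp (φ := fun x : A → ℝ => ∑ i, x i) (ψ := id)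
    (by fun_prop) measurable_id
  have e : (fun ω => ∑ i ∈ A, X i ω) = (fun x : A → ℝ => ∑ i, x i) ∘ fun ω (i : A) => X i ω := by
    ext ω
    exact (Finset.sum_coe_sort A fun i => X i ω).symm
  rw [e]
  exact this

lemma indepFun_sum_sum (h : GoodFam K μ X m σ) {A B : Finset ι} (hAB : Disjoint A B) :
    IndepFun (fun ω => ∑ i ∈ A, X i ω) (fun ω => ∑ i ∈ B, X i ω) μ := by
  have := (h.indepFun_sum_restrict hAB).comp (φ := id) (ψ := fun x : B → ℝ => ∑ i, x i)
    measurable_id (by fun_prop)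
  have e : (fun ω => ∑ i ∈ B, X i ω) = (fun x : B → ℝ => ∑ i, x i) ∘ fun ω (i : B) => X i ω := by
    ext ω
    exact (Finset.sum_coe_sort B fun i => X i ω).symm
  rw [e]
  exact this

lemma integrable_sq (h : GoodFam K μ X m σ) (i : ι) :
    Integrable (fun ω => (X i ω - m i) ^ 2) μ := by
  have := (h.good i).prob
  have h1 := integrable_sub_sq_of_integrable_cube (h.good i).int_cube (m i)
  exact (integrable_map_measure (by fun_prop) (h.meas i).aemeasurable).1 h1

omit [IsProbabilityMeasure μ] in
lemma integral_sq (h : GoodFam K μ X m σ) (i : ι) : ∫ ω, (X i ω - m i) ^ 2 ∂μ = σ i ^ 2 := by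
  rw [← (h.good i).var, integral_map (h.meas i).aemeasurable (by fun_prop)]

lemma integral_sub (h : GoodFam K μ X m σ) (i : ι) : ∫ ω, (X i ω - m i) ∂μ = 0 := by
  have := (h.good i).prob
  have h1 := integrable_of_integrable_cube (h.good i).int_cube
  have h2 : Integrable (X i) μ :=
    (integrable_map_measure (by fun_prop) (h.meas i).aemeasurable).1 h1
  have h3 := (h.good i).mean
  rw [integral_map (h.meas i).aemeasurable (by fun_prop)] at h3
  rw [MeasureTheory.integral_sub h2 (integrable_const _), h3]
  simp

lemma memLp (h : GoodFam K μ X m σ) (i : ι) : MemLp (fun ω => X i ω - m i) 2 μ :=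
  (memLp_two_iff_integrable_sq (by have := h.meas i; fun_prop)).2 (h.integrable_sq i)

lemma memLp_wsum (h : GoodFam K μ X m σ) (A : Finset ι) (u : ι → ℝ) :
    MemLp (fun ω => ∑ i ∈ A, u i * (X i ω - m i)) 2 μ := by
  refine memLp_finsetSum A fun i _ => ?_
  exact (h.memLp i).const_mul (u i)

/-- Second moment of a weighted centred sum. -/
lemma integral_wsum_sq (h : GoodFam K μ X m σ) (A : Finset ι) (u : ι → ℝ) :
    ∫ ω, (∑ i ∈ A, u i * (X i ω - m i)) ^ 2 ∂μ = ∑ i ∈ A, u i ^ 2 * σ i ^ 2 := by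
  have h0 : ∀ i, ∫ ω, u i * (X i ω - m i) ∂μ = 0 := fun i => by
    rw [integral_const_mul, h.integral_sub, mul_zero]
  have hs := IndepFun.variance_sum (μ := μ) (X := fun i ω => u i * (X i ω - m i)) (s := A)
    (fun i _ => (h.memLp i).const_mul (u i)) (fun i _ j _ hij =>
      (h.indep.indepFun hij).comp (φ := fun x => u i * (x - m i)) (ψ := fun x => u j * (x - m j))
        (by fun_prop) (by fun_prop))
  have e0 : ∫ ω, (∑ i ∈ A, fun ω => u i * (X i ω - m i)) ω ∂μ = 0 := by
    simp only [Finset.sum_apply]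
    rw [integral_finsetSum _ fun i _ => ((h.memLp i).const_mul (u i)).integrable one_le_two]
    exact Finset.sum_eq_zero fun i _ => h0 i
  rw [variance_of_integral_eq_zero (Finset.aemeasurable_sum _ fun i _ => by
    have := h.meas i; fun_prop) e0] at hs
  simp only [Finset.sum_apply] at hs
  rw [hs]
  refine Finset.sum_congr rfl fun i _ => ?_
  rw [variance_of_integral_eq_zero (by have := h.meas i; fun_prop) (h0 i), ← h.integral_sq i,
    ← integral_const_mul]
  congr 1; ext ω; ring

lemma integral_sum_sq (h : GoodFam K μ X m σ) (A : Finset ι) :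
    ∫ ω, (∑ i ∈ A, X i ω - ∑ i ∈ A, m i) ^ 2 ∂μ = ∑ i ∈ A, σ i ^ 2 := by
  have := h.integral_wsum_sq A 1
  simpa [Finset.sum_sub_distrib] using this

lemma integrable_sum_sq (h : GoodFam K μ X m σ) (A : Finset ι) :
    Integrable (fun ω => (∑ i ∈ A, X i ω - ∑ i ∈ A, m i) ^ 2) μ := by
  have := (h.memLp_wsum A 1).integrable_sq
  simpa [Finset.sum_sub_distrib] using this

/-- Chebyshev's inequality for sums. -/
lemma chebyshev (h : GoodFam K μ X m σ) (A : Finset ι) {c : ℝ} (hc : 0 < c) :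
    μ.real {ω | c < |∑ i ∈ A, X i ω - ∑ i ∈ A, m i|} ≤ (∑ i ∈ A, σ i ^ 2) / c ^ 2 := by
  rw [le_div_iff₀ (by positivity), mul_comm, ← h.integral_sum_sq A]
  have := mul_meas_ge_le_integral_of_nonneg (μ := μ)
    (Filter.Eventually.of_forall fun ω => sq_nonneg (∑ i ∈ A, X i ω - ∑ i ∈ A, m i))
    (h.integrable_sum_sq A) (c ^ 2)
  refine le_trans ?_ this
  refine mul_le_mul_of_nonneg_left (measureReal_mono ?_) (by positivity)
  · intro ω hω
    simp only [Set.mem_ofPred_eq] at *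
    rw [← sq_abs (∑ i ∈ A, X i ω - ∑ i ∈ A, m i)]
    exact pow_le_pow_left₀ hc.le hω.le 2

omit [IsProbabilityMeasure μ] in
lemma charFun_sum (h : GoodFam K μ X m σ) (A : Finset ι) (ξ : ℝ) :
    charFun (μ.map fun ω => ∑ i ∈ A, X i ω) ξ = ∏ i ∈ A, charFun (μ.map (X i)) ξ := by
  have := iIndepFun.charFun_map_fun_finsetSum_eq_prod (P := μ) (X := X) (s := A)
    (fun i _ => (h.meas i).aemeasurable) (h.indep.restrict _)
  rw [this, Finset.prod_apply]

omit [IsProbabilityMeasure μ] in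
/-- Decay of the characteristic function of a sum without dominating summand. -/
lemma norm_charFun_sum_le (h : GoodFam K μ X m σ) (A : Finset ι) (R : ℕ) (hR : 0 < R)
    (hdom : ∀ i ∈ A, (2 * R) * σ i ^ 2 ≤ ∑ j ∈ A, σ j ^ 2) (ξ : ℝ) :
    ‖charFun (μ.map fun ω => ∑ i ∈ A, X i ω) ξ‖ ≤
      ((1 + (√((∑ j ∈ A, σ j ^ 2) / (2 * R * K)) * ξ) ^ 2) ^ R)⁻¹ := by
  have hK : 0 < K := zero_lt_one.trans_le h.one_le
  have hv : 0 ≤ ∑ j ∈ A, σ j ^ 2 := Finset.sum_nonneg fun _ _ => sq_nonneg _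
  have hR' : (0 : ℝ) < R := by exact_mod_cast hR
  refine (abs_le_of_sq_le_sq' ?_ (by positivity)).2
  rw [h.charFun_sum, norm_prod, ← Finset.prod_pow]
  calc ∏ i ∈ A, ‖charFun (μ.map (X i)) ξ‖ ^ 2 ≤ ∏ i ∈ A, (1 + σ i ^ 2 * ξ ^ 2 / K)⁻¹ :=
        Finset.prod_le_prod (fun _ _ => by positivity) fun i _ => (h.good i).char ξ
    _ ≤ ((1 + (∑ j ∈ A, σ j ^ 2 * ξ ^ 2 / K) / (2 * R : ℕ)) ^ (2 * R))⁻¹ := by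
        refine prod_inv_one_add_le A (fun i => σ i ^ 2 * ξ ^ 2 / K) (fun i _ => by positivity)
          (2 * R) (by positivity) fun i hi => ?_
        rw [← Finset.sum_div, ← Finset.sum_mul]
        have := mul_le_mul_of_nonneg_right (hdom i hi) (show 0 ≤ ξ ^ 2 / K by positivity)
        push_cast
        calc _ = 2 * R * σ i ^ 2 * (ξ ^ 2 / K) := by ring
          _ ≤ _ := this
          _ = _ := by ring
    _ = _ := by
        rw [inv_pow, ← pow_mul, mul_comm R 2]
        congr 3
        rw [mul_pow, Real.sq_sqrt (by positivity), ← Finset.sum_div, ← Finset.sum_mul]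
        push_cast
        field_simp

lemma norm_charFun_sum_le_inv (h : GoodFam K μ X m σ) (A : Finset ι)
    (hdom : ∀ i ∈ A, 2 * σ i ^ 2 ≤ ∑ j ∈ A, σ j ^ 2) (ξ : ℝ) :
    ‖charFun (μ.map fun ω => ∑ i ∈ A, X i ω) ξ‖ ≤
      (1 + (√((∑ j ∈ A, σ j ^ 2) / (2 * K)) * ξ) ^ 2)⁻¹ := by
  have := h.norm_charFun_sum_le A 1 one_pos (by simpa using hdom) ξ
  simpa using this

/-- Upper bound for window averages of sums: the law of the sum has a smoothed density at most of
the order of the inverse standard deviation. -/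
lemma integral_gwin_sum_le (h : GoodFam K μ X m σ) (A : Finset ι) {k : ℝ} (hk : 0 < k) (y : ℝ) :
    (∫ ω, gwin k (∑ i ∈ A, X i ω - y) ∂μ) * (√k * √(∑ i ∈ A, σ i ^ 2)) ≤ 6 * K := by
  classical
  have hK1 := h.one_le
  have hK : 0 < K := zero_lt_one.trans_le h.one_le
  set v := ∑ j ∈ A, σ j ^ 2
  have hv : 0 ≤ v := Finset.sum_nonneg fun _ _ => sq_nonneg _
  rcases hv.eq_or_lt with h0 | h0
  · rw [← h0]; simp; positivity
  have hk' : 0 < √k := Real.sqrt_pos.2 hk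
  have hv' : 0 < √v := Real.sqrt_pos.2 h0
  by_cases hdom : ∀ i ∈ A, 2 * σ i ^ 2 ≤ v
  · have hc := integral_inv_one_add_mul_sq (b := √(v / (2 * K))) (Real.sqrt_pos.2 (by positivity))
    have : IsProbabilityMeasure (μ.map fun ω => ∑ i ∈ A, X i ω) :=
      Measure.isProbabilityMeasure_map (h.measurable_sum A).aemeasurable
    have key := integral_gwin_le_of_charFun_le (μ.map fun ω => ∑ i ∈ A, X i ω) hk y hc.1
      (h.norm_charFun_sum_le_inv A hdom)
    rw [hc.2, integral_map (h.measurable_sum A).aemeasurable (by fun_prop)] at key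
    have h2K : √(2 * K) * π ≤ 6 * K := by
      have e1 : √(2 * K) ≤ 3 / 2 * K := by
        rw [Real.sqrt_le_left (by positivity)]; nlinarith
      have := Real.pi_lt_four
      calc √(2 * K) * π ≤ (3 / 2 * K) * 4 := by gcongr
        _ = 6 * K := by ring
    calc _ ≤ (√k)⁻¹ * (π / √(v / (2 * K))) * (√k * √v) := by gcongr
      _ = √(2 * K) * π := by
        rw [Real.sqrt_div hv]; field_simp
      _ ≤ _ := h2K
  · push Not at hdom
    obtain ⟨i, hi, hiv⟩ := hdom
    have hind : IndepFun (fun ω => ∑ j ∈ {i}, X j ω) (fun ω => ∑ j ∈ A.erase i, X j ω) μ :=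
      h.indepFun_sum_sum (Finset.disjoint_singleton_left.2 (Finset.notMem_erase i A))
    simp only [Finset.sum_singleton] at hind
    have hσ := (h.good i).pos
    have hb : ∀ z, ∫ ω, gwin k (X i ω + z - y) ∂μ ≤ 3 * K / (√k * σ i) := by
      intro z
      have := (h.good i).integral_gwin_le hk (y - z)
      rw [integral_map (h.meas i).aemeasurable (by fun_prop)] at this
      rw [le_div_iff₀ (by positivity)]
      simpa only [sub_sub_eq_add_sub] using this
    have := hind.integral_mul_le (h.meas i) (h.measurable_sum _)
      (g := fun u z => gwin k (u + z - y)) (by simp only [Function.uncurry_def]; fun_prop)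
      (fun _ _ => gwin_nonneg _ _)
      (fun _ _ => gwin_le_one hk.le _) (h := fun _ => 1) (by fun_prop) (fun _ => zero_le_one)
      (integrable_const _) hb
    simp only [one_mul, integral_const, probReal_univ, smul_eq_mul, mul_one] at this
    have e : ∀ ω, X i ω + ∑ j ∈ A.erase i, X j ω = ∑ j ∈ A, X j ω :=
      fun ω => Finset.add_sum_erase A (fun j => X j ω) hi
    simp only [e] at this
    have hs : √v ≤ 2 * σ i := by
      rw [Real.sqrt_le_left (by positivity)]; nlinarith [sq_nonneg (σ i)]
    calc _ ≤ 3 * K / (√k * σ i) * (√k * (2 * σ i)) := by gcongr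
      _ = 6 * K := by field_simp; ring

end GoodFam

/-- Window averages of a Gaussian law are bounded below on the scale of its deviation. -/
lemma gaussianReal_integral_gwin_ge {v k : ℝ} (hv : 0 < v) (hkv : 1 ≤ k * v) {m y M : ℝ}
    (hy : |y - m| ≤ M * √v) :
    2 * Real.exp (-(1 / 2)) * (√(2 * π))⁻¹ * Real.exp (-((M + 1) ^ 2 / 2)) ≤
      √k * √v * ∫ x, gwin k (x - y) ∂(ProbabilityTheory.gaussianReal m v.toNNReal) := by
  have hk : 0 < k := by
    by_contra h
    nlinarith [mul_nonneg (neg_nonneg.2 (not_lt.1 h)) hv.le]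
  have hv0 : v.toNNReal ≠ 0 := by simpa using hv
  have hsv : 0 < √v := Real.sqrt_pos.2 hv
  have hsk : 0 < √k := Real.sqrt_pos.2 hk
  have hsk2 : √k ^ 2 = k := Real.sq_sqrt hk.le
  have hsv2 : √v ^ 2 = v := Real.sq_sqrt hv.le
  have hprod : 1 ≤ √k * √v := by
    rw [← Real.sqrt_mul hk.le]; exact Real.one_le_sqrt.2 hkv
  have hinv : (√k)⁻¹ ≤ √v := by
    rw [inv_le_iff_one_le_mul₀ hsk]; linarith
  rw [ProbabilityTheory.integral_gaussianReal_eq_integral_smul hv0]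
  set c : ℝ := (√(2 * π))⁻¹ * (√v)⁻¹ * Real.exp (-((M + 1) ^ 2 / 2)) * Real.exp (-(1 / 2))
  have hc : 0 < c := by positivity
  set I := Set.Icc (y - (√k)⁻¹) (y + (√k)⁻¹)
  have hint : Integrable fun x =>
      ProbabilityTheory.gaussianPDFReal m v.toNNReal x • gwin k (x - y) := by
    refine (ProbabilityTheory.integrable_gaussianPDFReal m v.toNNReal).mono' 
      (Measurable.aestronglyMeasurable (by fun_prop))
      (Filter.Eventually.of_forall fun x => ?_)
    rw [smul_eq_mul, norm_mul, Real.norm_of_nonneg (gwin_nonneg _ _),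
      Real.norm_of_nonneg (ProbabilityTheory.gaussianPDFReal_nonneg _ _ _)]
    exact mul_le_of_le_one_right (ProbabilityTheory.gaussianPDFReal_nonneg _ _ _)
      (gwin_le_one hk.le _)
  have hle : ∫ x, I.indicator (fun _ => c) x ≤ 
      ∫ x, ProbabilityTheory.gaussianPDFReal m v.toNNReal x • gwin k (x - y) := by
    refine integral_mono ((integrable_indicator_iff measurableSet_Icc).2
      (integrableOn_const (by simp))) hint fun x => ?_
    by_cases hx : x ∈ I
    · rw [Set.indicator_of_mem hx, smul_eq_mul]
      have hxy : |x - y| ≤ (√k)⁻¹ := by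
        rw [abs_le]; constructor <;> linarith [hx.1, hx.2]
      have h1 : k * (x - y) ^ 2 ≤ 1 := by
        rw [← sq_abs, ← hsk2, ← mul_pow]
        have : √k * |x - y| ≤ 1 := by
          calc _ ≤ √k * (√k)⁻¹ := by gcongr
            _ = 1 := mul_inv_cancel₀ hsk.ne'
        exact pow_le_one₀ (by positivity) this
      have h2 : (x - m) ^ 2 ≤ (M + 1) ^ 2 * v := by
        have : |x - m| ≤ (M + 1) * √v := by
          calc |x - m| ≤ |x - y| + |y - m| := abs_sub_le _ _ _
            _ ≤ √v + M * √v := by linarith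
            _ = _ := by ring
        have := pow_le_pow_left₀ (abs_nonneg _) this 2
        rwa [sq_abs, mul_pow, hsv2] at this
      refine mul_le_mul ?_ (exp_le_gwin h1) (Real.exp_pos _).le
        (ProbabilityTheory.gaussianPDFReal_nonneg _ _ _)
      rw [ProbabilityTheory.gaussianPDFReal, Real.coe_toNNReal v hv.le,
        Real.sqrt_mul (by positivity) v, mul_inv]
      gcongr
      rw [neg_div, neg_le_neg_iff, div_le_div_iff₀ (by positivity) two_pos]
      nlinarith
    · rw [Set.indicator_of_notMem hx]
      exact smul_nonneg (ProbabilityTheory.gaussianPDFReal_nonneg _ _ _) (gwin_nonneg _ _)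
  rw [integral_indicator_const c measurableSet_Icc] at hle
  have hvol : volume.real I = 2 * (√k)⁻¹ := by
    rw [Measure.real, Real.volume_Icc, ENNReal.toReal_ofReal (by ring_nf; positivity)]; ring
  rw [hvol, smul_eq_mul] at hle
  calc _ = √k * √v * (2 * (√k)⁻¹ * c) := by simp only [c]; field_simp
    _ ≤ _ := by gcongr

namespace GoodFam

open ProbabilityTheory

variable {Ω ι : Type*} [MeasurableSpace Ω] {K : ℝ} {μ : Measure Ω} [IsProbabilityMeasure μ]
  {X : ι → Ω → ℝ} {m σ : ι → ℝ}

lemma norm_charFun_sum_sub_le (h : GoodFam K μ X m σ) (A : Finset ι) {r : ℕ} (hr : 2 ≤ r)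
    (hv : 0 < ∑ i ∈ A, σ i ^ 2)
    (hdom : ∀ i ∈ A, (r : ℝ) ^ 4 * σ i ^ 2 ≤ ∑ j ∈ A, σ j ^ 2) (ξ : ℝ) :
    ‖charFun (μ.map fun ω => ∑ i ∈ A, X i ω) ξ -
      charFun (gaussianReal (∑ i ∈ A, m i) (∑ i ∈ A, σ i ^ 2).toNNReal) ξ‖ ≤
      26 * K ^ 2 / r * (1 + (√((∑ j ∈ A, σ j ^ 2) / (8 * K)) * ξ) ^ 2)⁻¹ := by
  have hK1 := h.one_le
  have hK : 0 < K := zero_lt_one.trans_le h.one_le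
  have hr' : (2 : ℝ) ≤ r := by exact_mod_cast hr
  set v := ∑ i ∈ A, σ i ^ 2
  have hsv : √v ^ 2 = v := Real.sq_sqrt hv.le
  set u := √v * |ξ|
  have hu : 0 ≤ u := by positivity
  set q := 1 + (√(v / (8 * K)) * ξ) ^ 2
  have hqe : q = 1 + u ^ 2 / (8 * K) := by
    simp only [q, u]
    rw [mul_pow, mul_pow, Real.sq_sqrt (by positivity), hsv, sq_abs]; ring
  have hq : 0 < q := by rw [hqe]; positivity
  have hG : charFun (gaussianReal (∑ i ∈ A, m i) v.toNNReal) ξ =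
      ∏ i ∈ A, Complex.exp (ξ * m i * Complex.I - σ i ^ 2 * ξ ^ 2 / 2) := by
    rw [charFun_gaussianReal, ← Complex.exp_sum, Real.coe_toNNReal v hv.le,
      Finset.sum_sub_distrib]
    simp only [v]
    push_cast
    rw [Finset.mul_sum, Finset.sum_mul, ← Finset.sum_div, Finset.sum_mul]
  set z := ‖charFun (μ.map fun ω => ∑ i ∈ A, X i ω) ξ -
      charFun (gaussianReal (∑ i ∈ A, m i) v.toNNReal) ξ‖
  have hz1 : z ≤ 5 * K * u ^ 3 / r ^ 2 := by
    simp only [z]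
    rw [hG, h.charFun_sum]
    have hn : ∀ i ∈ A, ‖Complex.exp (ξ * m i * Complex.I - σ i ^ 2 * ξ ^ 2 / 2)‖ ≤ 1 := by
      intro i _
      rw [Complex.norm_exp]
      have : (ξ * m i * Complex.I - σ i ^ 2 * ξ ^ 2 / 2 : ℂ).re = -(σ i ^ 2 * ξ ^ 2 / 2) := by
        have e : (σ i ^ 2 * ξ ^ 2 / 2 : ℂ) = ((σ i ^ 2 * ξ ^ 2 / 2 : ℝ) : ℂ) := by push_cast; ring
        rw [e, Complex.sub_re, Complex.ofReal_re]; simp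
      rw [this, Real.exp_le_one_iff]
      have : 0 ≤ σ i ^ 2 * ξ ^ 2 / 2 := by positivity
      linarith
    refine (norm_prod_sub_prod_le_sum A _ _ (fun i _ => ?_) hn).trans ?_
    · have := (h.good i).prob
      exact norm_charFun_le_one _
    calc _ ≤ ∑ i ∈ A, 5 * K * |ξ| ^ 3 * (√v / r ^ 2) * σ i ^ 2 := by
          refine Finset.sum_le_sum fun i hi => ((h.good i).norm_charFun_sub_gaussian_le ξ).trans ?_
          have hσ := (h.good i).pos
          have h1 : σ i ≤ √v / r ^ 2 := by
            rw [le_div_iff₀ (by positivity)]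
            refine Real.le_sqrt_of_sq_le ?_
            have := hdom i hi
            nlinarith
          calc _ = 5 * K * |ξ| ^ 3 * σ i * σ i ^ 2 := by ring
            _ ≤ _ := by gcongr
      _ = 5 * K * |ξ| ^ 3 * (√v / r ^ 2) * √v ^ 2 := by rw [← Finset.mul_sum, hsv]
      _ = _ := by simp only [u]; ring
  have hz2 : z ≤ 2 * (q ^ 4)⁻¹ := by
    have h1 := h.norm_charFun_sum_le A 4 (by norm_num) (fun i hi => by
      have := hdom i hi
      have h16 : (16 : ℝ) ≤ r ^ 4 := by
        calc (16 : ℝ) = 2 ^ 4 := by norm_num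
          _ ≤ _ := by gcongr
      refine le_trans ?_ this
      push_cast
      gcongr
      linarith) ξ
    have h2 : ‖charFun (gaussianReal (∑ i ∈ A, m i) v.toNNReal) ξ‖ ≤ (q ^ 4)⁻¹ := by
      rw [charFun_gaussianReal, Complex.norm_exp, Real.coe_toNNReal v hv.le]
      have : (ξ * (∑ i ∈ A, m i : ℝ) * Complex.I - v * ξ ^ 2 / 2 : ℂ).re = -(u ^ 2 / 2) := by
        have e : (v * ξ ^ 2 / 2 : ℂ) = ((u ^ 2 / 2 : ℝ) : ℂ) := by
          simp only [u]; rw [mul_pow, sq_abs, hsv]; push_cast; ring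
        rw [e, Complex.sub_re, Complex.ofReal_re]; simp
      rw [this, Real.exp_neg]
      gcongr
      have h3 : q ≤ Real.exp (u ^ 2 / 8) := by
        have := Real.add_one_le_exp (u ^ 2 / 8)
        refine le_trans ?_ this
        rw [hqe, add_comm]
        gcongr
        linarith
      calc q ^ 4 ≤ Real.exp (u ^ 2 / 8) ^ 4 := by gcongr
        _ = Real.exp (u ^ 2 / 2) := by rw [← Real.exp_nat_mul]; congr 1; push_cast; ring
    refine (norm_sub_le _ _).trans ?_
    have e : √(v / (2 * (4 : ℕ) * K)) = √(v / (8 * K)) := by congr 2; push_cast; ring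
    rw [e] at h1
    linarith
  have hu3 : u ^ 3 ≤ (8 * K) ^ 2 * q ^ 2 := by
    have h1 : 1 + u ^ 2 ≤ 8 * K * q := by
      rw [hqe, mul_add, mul_div_cancel₀ _ (by positivity : 8 * K ≠ 0)]; linarith
    calc u ^ 3 ≤ (1 + u ^ 2) ^ 2 := by nlinarith [mul_nonneg hu (sq_nonneg (u - 1)), sq_nonneg u, pow_nonneg hu 4, sq_nonneg (u^2-u)]
      _ ≤ (8 * K * q) ^ 2 := by gcongr
      _ = _ := by ring
  have hz0 : 0 ≤ z := norm_nonneg _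
  refine (abs_le_of_sq_le_sq' ?_ (by positivity)).2
  calc z ^ 2 = z * z := sq z
    _ ≤ (5 * K * u ^ 3 / r ^ 2) * (2 * (q ^ 4)⁻¹) := by gcongr
    _ ≤ (5 * K * ((8 * K) ^ 2 * q ^ 2) / r ^ 2) * (2 * (q ^ 4)⁻¹) := by gcongr
    _ = 640 * K ^ 3 * 1 / r ^ 2 * (q⁻¹) ^ 2 := by field_simp; ring
    _ ≤ 676 * K ^ 3 * K / r ^ 2 * (q⁻¹) ^ 2 := by gcongr; norm_num
    _ = _ := by ring

/-- Local central limit lower bound: for a sum of uniformly negligible summands the window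
averages around points at distance `O(√v)` from the mean are of order at least `1 / √(k v)`. -/
lemma exists_integral_gwin_sum_ge (hK : 1 ≤ K) (M : ℝ) : ∃ r : ℕ, 2 ≤ r ∧ ∃ c : ℝ, 0 < c ∧
    ∀ {Ω ι : Type*} [MeasurableSpace Ω] {μ : Measure Ω} [IsProbabilityMeasure μ]
      {X : ι → Ω → ℝ} {m σ : ι → ℝ} (_ : GoodFam K μ X m σ) (A : Finset ι) (k y : ℝ),
      0 < ∑ i ∈ A, σ i ^ 2 → (∀ i ∈ A, (r : ℝ) ^ 4 * σ i ^ 2 ≤ ∑ j ∈ A, σ j ^ 2) →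
      1 ≤ k * ∑ i ∈ A, σ i ^ 2 → |y - ∑ i ∈ A, m i| ≤ M * √(∑ i ∈ A, σ i ^ 2) →
      c ≤ √k * √(∑ i ∈ A, σ i ^ 2) * ∫ ω, gwin k (∑ i ∈ A, X i ω - y) ∂μ := by
  set c0 := 2 * Real.exp (-(1 / 2)) * (√(2 * π))⁻¹ * Real.exp (-((M + 1) ^ 2 / 2))
  have hc0 : 0 < c0 := by positivity
  obtain ⟨r0, hr0⟩ := exists_nat_ge (624 * K ^ 3 / c0)
  set r := max r0 2
  have hr : 624 * K ^ 3 / c0 ≤ r := hr0.trans (by simp [r])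
  refine ⟨r, le_max_right _ _, c0 / 2, by positivity, ?_⟩
  intro Ω ι _ μ _ X m σ h A k y hv hdom hkv hy
  set v := ∑ i ∈ A, σ i ^ 2
  have hk : 0 < k := by
    by_contra h
    nlinarith [mul_nonneg (neg_nonneg.2 (not_lt.1 h)) hv.le]
  have hrpos : (0 : ℝ) < r := by
    have : 2 ≤ r := le_max_right _ _
    exact_mod_cast two_pos.trans_le this
  have hsk : 0 < √k := Real.sqrt_pos.2 hk
  have hsv : 0 < √v := Real.sqrt_pos.2 hv
  have hKp : 0 < K := by linarith
  have h1 := gaussianReal_integral_gwin_ge hv hkv hy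
  have : IsProbabilityMeasure (μ.map fun ω => ∑ i ∈ A, X i ω) :=
    Measure.isProbabilityMeasure_map (h.measurable_sum A).aemeasurable
  have hb := integral_inv_one_add_mul_sq (b := √(v / (8 * K))) (Real.sqrt_pos.2 (by positivity))
  have h2 := abs_integral_gwin_sub_le (μ.map fun ω => ∑ i ∈ A, X i ω)
    (gaussianReal (∑ i ∈ A, m i) v.toNNReal) hk y (hb.1.const_mul (26 * K ^ 2 / r))
    (h.norm_charFun_sum_sub_le A (le_max_right _ _) hv hdom)
  rw [integral_const_mul, hb.2, integral_map (h.measurable_sum A).aemeasurable (by fun_prop)] at h2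
  have h3 : √k * √v * ((√k)⁻¹ * (26 * K ^ 2 / r * (π / √(v / (8 * K))))) ≤ c0 / 2 := by
    have e1 : √(8 * K) ≤ 3 * K := by
      rw [Real.sqrt_le_left (by positivity)]; nlinarith
    calc _ = 26 * K ^ 2 * √(8 * K) * π / r := by rw [Real.sqrt_div hv.le]; field_simp
      _ ≤ 26 * K ^ 2 * (3 * K) * 4 / r := by
        gcongr
        exact Real.pi_lt_four.le
      _ = 312 * K ^ 3 / r := by ring
      _ ≤ _ := by
        rw [div_le_iff₀ hc0] at hr
        rw [div_le_iff₀ hrpos]; linarith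
  have h4 := (abs_le.1 h2).1
  have h5 := mul_le_mul_of_nonneg_left h4 (mul_pos hsk hsv).le
  rw [mul_sub, mul_neg] at h5
  linarith

end GoodFam

/-- A positive continuous midpoint log-concave function is quasi-concave. -/
lemma min_le_of_midpoint_logConcave {f : ℝ → ℝ} (hf : Continuous f) (hpos : ∀ x, 0 < f x)
    (hmid : ∀ x y, f x * f y ≤ f ((x + y) / 2) ^ 2) {a b y : ℝ} (hy : y ∈ Set.Icc a b) :
    min (f a) (f b) ≤ f y := by
  by_contra! hlt
  obtain ⟨z, hz, hmin⟩ := isCompact_Icc.exists_isMinOn ⟨y, hy⟩ hf.continuousOn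
  have hcl : IsClosed {x | x ∈ Set.Icc a b ∧ f x = f z} :=
    isClosed_Icc.inter (isClosed_singleton.preimage hf)
  have hcomp : IsCompact {x | x ∈ Set.Icc a b ∧ f x = f z} :=
    isCompact_Icc.of_isClosed_subset hcl fun x hx => hx.1
  obtain ⟨w, ⟨hw, hwz⟩, hleast⟩ := hcomp.exists_isLeast ⟨z, hz, rfl⟩
  have hwmin : ∀ x ∈ Set.Icc a b, f w ≤ f x := fun x hx => hwz ▸ hmin hx
  have hwy : f w < min (f a) (f b) := (hwmin y hy).trans_lt hlt
  have haw : a < w := lt_of_le_of_ne hw.1 fun e => by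
    rw [← e] at hwy; exact (lt_min_iff.1 hwy).1.false
  have hwb : w < b := lt_of_le_of_ne hw.2 fun e => by
    rw [e] at hwy; exact (lt_min_iff.1 hwy).2.false
  set h := min (w - a) (b - w)
  have hh : 0 < h := lt_min (by linarith) (by linarith)
  have h1 : h ≤ w - a := min_le_left _ _
  have h2 : h ≤ b - w := min_le_right _ _
  have hl : w - h ∈ Set.Icc a b := ⟨by linarith, by linarith⟩
  have hr : w + h ∈ Set.Icc a b := ⟨by linarith, by linarith⟩
  have hlt' : f w < f (w - h) := lt_of_le_of_ne (hwmin _ hl) fun e => by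
    have := hleast ⟨hl, e ▸ hwz⟩
    linarith
  have := hmid (w - h) (w + h)
  rw [show (w - h + (w + h)) / 2 = w by ring] at this
  nlinarith [hwmin _ hr, hpos w]

namespace GoodFam

open ProbabilityTheory

variable {Ω ι : Type*} [MeasurableSpace Ω] {K : ℝ} {μ : Measure Ω} [IsProbabilityMeasure μ]
  {X : ι → Ω → ℝ} {m σ : ι → ℝ}

lemma integral_gwin_sum_pos (h : GoodFam K μ X m σ) (A : Finset ι) {k : ℝ} (hk : 0 ≤ k) (y : ℝ) :
    0 < ∫ ω, gwin k (∑ i ∈ A, X i ω - y) ∂μ := by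
  rw [integral_pos_iff_support_of_nonneg (fun _ => gwin_nonneg _ _)
    (integrable_gwin_sub hk μ (h.measurable_sum A) y)]
  have : (Function.support fun ω => gwin k (∑ i ∈ A, X i ω - y)) = Set.univ :=
    Set.eq_univ_of_forall fun ω => (gwin_pos _ _).ne'
  rw [this]; simp

lemma integral_gwin_sum_le_one (h : GoodFam K μ X m σ) (A : Finset ι) {k : ℝ} (hk : 0 ≤ k)
    (y : ℝ) : ∫ ω, gwin k (∑ i ∈ A, X i ω - y) ∂μ ≤ 1 := by
  calc _ ≤ ∫ _, (1 : ℝ) ∂μ := integral_mono (integrable_gwin_sub hk μ (h.measurable_sum A) y)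
        (integrable_const _) fun _ => gwin_le_one hk _
    _ = 1 := by simp

lemma continuous_integral_gwin_sum (h : GoodFam K μ X m σ) (A : Finset ι) {k : ℝ} (hk : 0 ≤ k) :
    Continuous fun y => ∫ ω, gwin k (∑ i ∈ A, X i ω - y) ∂μ := by
  refine continuous_of_dominated (bound := fun _ => 1) (fun y => ?_) (fun y => ?_)
    (integrable_const _) ?_
  · exact (integrable_gwin_sub hk μ (h.measurable_sum A) y).aestronglyMeasurable
  · refine Filter.Eventually.of_forall fun ω => ?_
    rw [Real.norm_of_nonneg (gwin_nonneg _ _)]; exact gwin_le_one hk _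
  · exact Filter.Eventually.of_forall fun ω => by fun_prop

/-- Window averages of a sum of boundedly many terms are comparable with a log-concave function. -/
lemma exists_logConcave_comparison (h : GoodFam K μ X m σ) {k : ℝ} (hk : 0 ≤ k) (A : Finset ι) :
    ∃ Q : ℝ → ℝ, Continuous Q ∧ (∀ y, 0 < Q y) ∧ (∀ x y, Q x * Q y ≤ Q ((x + y) / 2) ^ 2) ∧
      ∀ y, Q y ≤ K ^ A.card * ∫ ω, gwin k (∑ i ∈ A, X i ω - y) ∂μ ∧
        ∫ ω, gwin k (∑ i ∈ A, X i ω - y) ∂μ ≤ K ^ A.card * Q y := by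
  classical
  have hK : 0 < K := zero_lt_one.trans_le h.one_le
  induction A using Finset.induction_on with
  | empty =>
    refine ⟨fun y => gwin k (0 - y), by fun_prop, fun y => gwin_pos _ _, fun x y => ?_,
      fun y => by simp⟩
    change Real.exp _ * Real.exp _ ≤ Real.exp _ ^ 2
    rw [← Real.exp_add, ← Real.exp_nat_mul]
    refine Real.exp_le_exp.2 ?_
    push_cast
    nlinarith [mul_nonneg hk (sq_nonneg (x - y))]
  | insert i A hi ih =>
    obtain ⟨Q, hQc, hQpos, hQmid, hQ⟩ := ih
    obtain ⟨p, q, hpm, hqm, hq0, hpν, hqmid, hqp⟩ := (h.good i).logConcave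
    have hprob := (h.good i).prob
    have hp0 : ∀ x, 0 ≤ p x := fun x =>
      (mul_nonneg (inv_nonneg.2 hK.le) (hq0 x)).trans (hqp x).1
    have hqp' : ∀ x, q x ≤ K * p x := fun x => by
      have := mul_le_mul_of_nonneg_left (hqp x).1 hK.le
      rwa [mul_inv_cancel_left₀ hK.ne'] at this
    have hpi : Integrable p := by
      refine ⟨hpm.aestronglyMeasurable, ?_⟩
      rw [hasFiniteIntegral_iff_ofReal (Filter.Eventually.of_forall hp0)]
      have : (μ.map (X i)) Set.univ = 1 := measure_univ
      rw [hpν, withDensity_apply _ MeasurableSet.univ, Measure.restrict_univ] at this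
      rw [this]; exact one_lt_top
    have hqi : Integrable q := (hpi.const_mul K).mono' hqm.aestronglyMeasurable
      (Filter.Eventually.of_forall fun x => by
        rw [Real.norm_of_nonneg (hq0 x)]; exact hqp' x)
    set Φ := fun y => ∫ ω, gwin k (∑ i ∈ A, X i ω - y) ∂μ
    have hΦc : Continuous Φ := h.continuous_integral_gwin_sum A hk
    have hΦ1 : ∀ y, Φ y ≤ 1 := fun y => h.integral_gwin_sum_le_one A hk y
    have hΦ0 : ∀ y, 0 < Φ y := fun y => h.integral_gwin_sum_pos A hk y
    have hQ1 : ∀ y, Q y ≤ K ^ A.card := fun y =>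
      (hQ y).1.trans (mul_le_of_le_one_right (by positivity) (hΦ1 y))
    have hΦi : ∀ y, Integrable fun x => p x * Φ (y - x) := fun y =>
      hpi.mono' (by fun_prop) (Filter.Eventually.of_forall fun x => by
        rw [Real.norm_of_nonneg (mul_nonneg (hp0 _) (hΦ0 _).le)]
        exact mul_le_of_le_one_right (hp0 _) (hΦ1 _))
    have hQi : ∀ y, Integrable fun x => q x * Q (y - x) := fun y =>
      (hqi.mul_const (K ^ A.card)).mono' (by fun_prop) (Filter.Eventually.of_forall fun x => by
        rw [Real.norm_of_nonneg (mul_nonneg (hq0 _) (hQpos _).le)]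
        exact mul_le_mul_of_nonneg_left (hQ1 _) (hq0 _))
    have hstep : ∀ y, ∫ ω, gwin k (∑ j ∈ insert i A, X j ω - y) ∂μ = ∫ x, p x * Φ (y - x) := by
      intro y
      have hind : IndepFun (fun ω => ∑ j ∈ A, X j ω) (fun ω => ∑ j ∈ {i}, X j ω) μ :=
        h.indepFun_sum_sum (Finset.disjoint_singleton_right.2 hi)
      simp only [Finset.sum_singleton] at hind
      have e1 := hind.integral_comp_prodMk (h.measurable_sum A) (h.meas i)
        (g := fun u x => gwin k (u - (y - x))) (by simp only [Function.uncurry_def]; fun_prop)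
        (Integrable.of_bound (Measurable.aestronglyMeasurable (by
          have := h.meas i; have := h.measurable_sum A; fun_prop)) 1
          (Filter.Eventually.of_forall fun ω => by
            rw [Real.norm_of_nonneg (gwin_nonneg _ _)]; exact gwin_le_one hk _))
      calc _ = ∫ ω, gwin k (∑ j ∈ A, X j ω - (y - X i ω)) ∂μ := by
            congr 1; ext ω; rw [Finset.sum_insert hi]; ring_nf
        _ = ∫ ω, Φ (y - X i ω) ∂μ := e1
        _ = ∫ x, Φ (y - x) ∂(μ.map (X i)) := by
            rw [integral_map (h.meas i).aemeasurable
              (Continuous.aestronglyMeasurable (by fun_prop))]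
        _ = _ := by
            rw [hpν, integral_withDensity_eq_integral_toReal_smul₀ (by fun_prop)
              (Filter.Eventually.of_forall fun _ => ofReal_lt_top)]
            simp only [ENNReal.toReal_ofReal (hp0 _), smul_eq_mul]
    set Q' := fun y => ∫ x, q x * Q (y - x)
    have hcomp : ∀ y, Q' y ≤ K ^ (A.card + 1) * ∫ x, p x * Φ (y - x) ∧
        ∫ x, p x * Φ (y - x) ≤ K ^ (A.card + 1) * Q' y := by
      intro y
      simp only [Q']
      rw [← integral_const_mul, ← integral_const_mul]
      constructor
      · refine integral_mono (hQi y) ((hΦi y).const_mul _) fun x => ?_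
        calc q x * Q (y - x) ≤ (K * p x) * (K ^ A.card * Φ (y - x)) :=
              mul_le_mul (hqp' x) (hQ _).1 (hQpos _).le (mul_nonneg hK.le (hp0 x))
          _ = _ := by ring
      · refine integral_mono (hΦi y) ((hQi y).const_mul _) fun x => ?_
        calc p x * Φ (y - x) ≤ (K * q x) * (K ^ A.card * Q (y - x)) :=
              mul_le_mul (hqp x).2 (hQ _).2 (hΦ0 _).le (mul_nonneg hK.le (hq0 x))
          _ = _ := by ring
    refine ⟨Q', ?_, fun y => ?_, fun a b => ?_, fun y => ?_⟩
    · refine continuous_of_dominated (bound := fun x => q x * K ^ A.card) (fun y => by fun_prop)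
        (fun y => ?_) (hqi.mul_const _) ?_
      · refine Filter.Eventually.of_forall fun x => ?_
        rw [Real.norm_of_nonneg (mul_nonneg (hq0 _) (hQpos _).le)]
        exact mul_le_mul_of_nonneg_left (hQ1 _) (hq0 _)
      · exact Filter.Eventually.of_forall fun x => by fun_prop
    · have h1 := h.integral_gwin_sum_pos (insert i A) hk y
      rw [hstep y] at h1
      have := h1.trans_le (hcomp y).2
      exact pos_of_mul_pos_right this (by positivity)
    · have hQ'0 : ∀ y, 0 ≤ Q' y := fun y => integral_nonneg fun x =>
        mul_nonneg (hq0 x) (hQpos _).le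
      have hof : ∀ y, ENNReal.ofReal (Q' y) = ∫⁻ x, ENNReal.ofReal (q x * Q (y - x)) := fun y =>
        ofReal_integral_eq_lintegral_ofReal (hQi y)
          (Filter.Eventually.of_forall fun x => mul_nonneg (hq0 x) (hQpos _).le)
      have hpl := prekopa_leindler_one (f := fun x => ENNReal.ofReal (q x * Q (a - x)))
        (g := fun x => ENNReal.ofReal (q x * Q (b - x)))
        (h := fun x => ENNReal.ofReal (q x * Q ((a + b) / 2 - x)))
        (by fun_prop) (by fun_prop) (by fun_prop) (fun x y => by
          have hn := fun c x => mul_nonneg (hq0 x) (hQpos (c - x)).le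
          rw [← ENNReal.ofReal_mul (hn _ _), ← ENNReal.ofReal_pow (hn _ _)]
          refine ENNReal.ofReal_le_ofReal ?_
          have e : (a - x + (b - y)) / 2 = (a + b) / 2 - (x + y) / 2 := by ring
          have h2 := hQmid (a - x) (b - y)
          rw [e] at h2
          calc _ = (q x * q y) * (Q (a - x) * Q (b - y)) := by ring
            _ ≤ q ((x + y) / 2) ^ 2 * Q ((a + b) / 2 - (x + y) / 2) ^ 2 :=
              mul_le_mul (hqmid x y) h2 (mul_nonneg (hQpos _).le (hQpos _).le) (sq_nonneg _)
            _ = _ := by ring)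
      rw [← hof, ← hof, ← hof, ← ENNReal.ofReal_mul (hQ'0 _), ← ENNReal.ofReal_pow (hQ'0 _)] at hpl
      exact (ENNReal.ofReal_le_ofReal_iff (sq_nonneg _)).1 hpl
    · rw [Finset.card_insert_of_notMem hi, hstep y]
      exact hcomp y

/-- Quasi-concavity up to constants of window averages of sums of boundedly many terms. -/
lemma min_le_integral_gwin_sum (h : GoodFam K μ X m σ) {k : ℝ} (hk : 0 ≤ k) (A : Finset ι)
    {a b y t : ℝ} (hy : y ∈ Set.Icc a b) (ha : t ≤ ∫ ω, gwin k (∑ i ∈ A, X i ω - a) ∂μ)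
    (hb : t ≤ ∫ ω, gwin k (∑ i ∈ A, X i ω - b) ∂μ) :
    t ≤ K ^ A.card * (K ^ A.card * ∫ ω, gwin k (∑ i ∈ A, X i ω - y) ∂μ) := by
  obtain ⟨Q, hc, hpos, hmid, hQ⟩ := h.exists_logConcave_comparison hk A
  have hK : 0 < K := zero_lt_one.trans_le h.one_le
  have h1 := min_le_of_midpoint_logConcave hc hpos hmid hy
  have h2 : t ≤ K ^ A.card * Q y := by
    rcases min_le_iff.1 h1 with h3 | h3
    · exact ha.trans ((hQ a).2.trans (by gcongr))
    · exact hb.trans ((hQ b).2.trans (by gcongr))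
  exact h2.trans (mul_le_mul_of_nonneg_left (hQ y).1 (by positivity))

end GoodFam

/-- A centred variable that is not concentrated near zero has a positive tail of definite mass. -/
lemma measureReal_tail_ge {Ω : Type*} [MeasurableSpace Ω] {μ : Measure Ω} [IsProbabilityMeasure μ]
    {Y : Ω → ℝ} (hY : Measurable Y) (hi : Integrable Y μ) (hi2 : Integrable (fun ω => Y ω ^ 2) μ)
    (h0 : ∫ ω, Y ω ∂μ = 0) {w c : ℝ} (hw : 0 < w) (hc : 0 < c) (hvar : ∫ ω, Y ω ^ 2 ∂μ = w ^ 2)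
    (hconc : μ.real {ω | |Y ω| ≤ 8 * c * w} ≤ 1 / 2) : c ^ 2 ≤ μ.real {ω | c * w ≤ Y ω} := by
  have hm1 : MeasurableSet {ω | |Y ω| ≤ 8 * c * w} := measurableSet_le hY.abs measurable_const
  have hm2 : MeasurableSet {ω | c * w ≤ Y ω} := measurableSet_le measurable_const hY
  have h1 : 8 * c * w * (1 / 2) ≤ ∫ ω, |Y ω| ∂μ := by
    have := integral_mono (μ := μ)
      (f := fun ω => 8 * c * w - {ω | |Y ω| ≤ 8 * c * w}.indicator (fun _ => 8 * c * w) ω)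
      ((integrable_const _).sub ((integrable_const _).indicator hm1)) hi.abs (fun ω => by
        by_cases h : |Y ω| ≤ 8 * c * w
        · simp [Set.indicator, h]
        · simp only [Set.indicator, Set.mem_ofPred_eq, h, if_false, sub_zero]
          exact (not_le.1 h).le)
    rw [integral_sub (integrable_const _) ((integrable_const _).indicator hm1),
      integral_indicator_const _ hm1, integral_const, probReal_univ, smul_eq_mul, smul_eq_mul] at this
    have h2 := mul_le_mul_of_nonneg_right hconc (show 0 ≤ 8 * c * w by positivity)
    linarith
  have h2 := integral_mono (μ := μ) (f := fun ω => (|Y ω| + Y ω) / 2)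
      (g := fun ω => c * w + c / 2 / w * Y ω ^ 2 +
        {ω | c * w ≤ Y ω}.indicator (fun _ => w / (2 * c)) ω)
      ((hi.abs.add hi).div_const 2)
      (((integrable_const _).add (hi2.const_mul _)).add ((integrable_const _).indicator hm2))
      (fun ω => by
        by_cases h : c * w ≤ Y ω
        · have hY0 : 0 ≤ Y ω := le_trans (by positivity) h
          simp only [Set.indicator, Set.mem_ofPred_eq, h, if_true, abs_of_nonneg hY0]
          have e : c / 2 / w * Y ω ^ 2 + w / (2 * c) - Y ω = (c * Y ω - w) ^ 2 / (2 * c * w) := by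
            field_simp; ring
          have : 0 ≤ (c * Y ω - w) ^ 2 / (2 * c * w) := by positivity
          have : 0 < c * w := by positivity
          linarith
        · simp only [Set.indicator, Set.mem_ofPred_eq, h, if_false, add_zero]
          have h3 : 0 ≤ c / 2 / w * Y ω ^ 2 := by positivity
          have h4 : 0 < c * w := by positivity
          rcases le_total 0 (Y ω) with h5 | h5
          · rw [abs_of_nonneg h5]; push Not at h; linarith
          · rw [abs_of_nonpos h5]; linarith)
  have e1 : ∫ ω, (|Y ω| + Y ω) / 2 ∂μ = (∫ ω, |Y ω| ∂μ) / 2 := by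
    rw [integral_div, integral_add hi.abs hi, h0, add_zero]
  have e2 : ∫ ω, (c * w + c / 2 / w * Y ω ^ 2 +
        {ω | c * w ≤ Y ω}.indicator (fun _ => w / (2 * c)) ω) ∂μ =
      c * w + c / 2 / w * w ^ 2 + μ.real {ω | c * w ≤ Y ω} * (w / (2 * c)) := by
    rw [integral_add (f := fun ω => c * w + c / 2 / w * Y ω ^ 2)
      ((integrable_const _).add (hi2.const_mul _)) ((integrable_const _).indicator hm2),
      integral_add (integrable_const _) (hi2.const_mul _), integral_const_mul (c / 2 / w), hvar, integral_indicator_const _ hm2]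
    simp
  rw [e1, e2] at h2
  have h3 : c * w / 2 ≤ μ.real {ω | c * w ≤ Y ω} * (w / (2 * c)) := by
    have : c / 2 / w * w ^ 2 = c * w / 2 := by field_simp
    rw [this] at h2
    linarith
  rw [mul_div_assoc', div_le_div_iff₀ two_pos (by positivity)] at h3
  have h4 : c ^ 2 * (2 * w) ≤ μ.real {ω | c * w ≤ Y ω} * (2 * w) := by linarith
  exact le_of_mul_le_mul_right h4 (by positivity)

/-- If `Y ∈ [a, b]` with probability `P`, some window average near `[a, b]` is bounded below. -/
lemma exists_le_integral_gwin {Ω : Type*} [MeasurableSpace Ω] {μ : Measure Ω}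
    [IsProbabilityMeasure μ] {Y : Ω → ℝ} (hY : Measurable Y) {k : ℝ} (hk : 0 < k) {a b : ℝ}
    (hab : a ≤ b) : ∃ y ∈ Set.Icc (a - (√k)⁻¹) (b + (√k)⁻¹),
      μ.real {ω | Y ω ∈ Set.Icc a b} * (2 * (√k)⁻¹ * Real.exp (-(1 / 2))) ≤
        (b - a + 2 * (√k)⁻¹) * ∫ ω, gwin k (Y ω - y) ∂μ := by
  have hsk : 0 < √k := Real.sqrt_pos.2 hk
  have hd : 0 < (√k)⁻¹ := inv_pos.2 hsk
  set d := (√k)⁻¹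
  have hkd : k * d ^ 2 = 1 := by
    simp only [d]; rw [inv_pow, Real.sq_sqrt hk.le, mul_inv_cancel₀ hk.ne']
  set I := Set.Icc (a - d) (b + d)
  have hvol : volume.real I = b - a + 2 * d := by
    rw [Measure.real, Real.volume_Icc, ENNReal.toReal_ofReal (by linarith)]; ring
  have hint : Integrable (Function.uncurry fun (y : ℝ) (ω : Ω) => gwin k (Y ω - y))
      ((volume.restrict I).prod μ) :=
    Integrable.of_bound (Measurable.aestronglyMeasurable (by
      simp only [Function.uncurry_def]; fun_prop)) 1
      (Filter.Eventually.of_forall fun z => by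
        rw [Function.uncurry_def, Real.norm_of_nonneg (gwin_nonneg _ _)]
        exact gwin_le_one hk.le _)
  obtain ⟨y, hy, hle⟩ := exists_setAverage_le (μ := volume) (s := I)
    (f := fun y => ∫ ω, gwin k (Y ω - y) ∂μ)
    (by simp only [I, Real.volume_Icc, ne_eq, ENNReal.ofReal_eq_zero, not_le]; linarith)
    (by simp [I]) hint.integral_prod_left
  refine ⟨y, hy, ?_⟩
  rw [setAverage_eq, smul_eq_mul, hvol, inv_mul_le_iff₀ (by linarith)] at hle
  refine le_trans ?_ hle
  rw [integral_integral_swap hint]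
  have hm : MeasurableSet {ω | Y ω ∈ Set.Icc a b} := measurableSet_Icc.preimage hY
  rw [← smul_eq_mul, ← integral_indicator_const _ hm]
  refine integral_mono ((integrable_const _).indicator hm) hint.integral_prod_right fun ω => ?_
  by_cases hω : Y ω ∈ Set.Icc a b
  · simp only [Set.indicator, Set.mem_ofPred_eq, hω, if_true]
    have hi : IntegrableOn (fun y => gwin k (Y ω - y)) I :=
      Continuous.integrableOn_Icc (by fun_prop)
    have hsub : Set.Icc (Y ω - d) (Y ω + d) ⊆ I :=
      Set.Icc_subset_Icc (by linarith [hω.1]) (by linarith [hω.2])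
    calc 2 * d * Real.exp (-(1 / 2))
        = ∫ _ in Set.Icc (Y ω - d) (Y ω + d), Real.exp (-(1 / 2)) := by
          rw [setIntegral_const, Measure.real, Real.volume_Icc,
            ENNReal.toReal_ofReal (by linarith), smul_eq_mul]
          ring
      _ ≤ ∫ y in Set.Icc (Y ω - d) (Y ω + d), gwin k (Y ω - y) := by
          refine setIntegral_mono_on (integrableOn_const (by simp)) (hi.mono_set hsub)
            measurableSet_Icc fun y hy => exp_le_gwin ?_
          rw [← hkd]
          refine mul_le_mul_of_nonneg_left (sq_le_sq' ?_ ?_) hk.le <;> linarith [hy.1, hy.2]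
      _ ≤ _ := setIntegral_mono_set hi
          (Filter.Eventually.of_forall fun y => gwin_nonneg _ _) hsub.eventuallyLE
  · simp only [Set.indicator, Set.mem_ofPred_eq, hω, if_false]
    exact integral_nonneg fun y => gwin_nonneg _ _

namespace GoodFam

open ProbabilityTheory

variable {Ω ι : Type*} [MeasurableSpace Ω] {K : ℝ} {μ : Measure Ω} [IsProbabilityMeasure μ]
  {X : ι → Ω → ℝ} {m σ : ι → ℝ}

/-- Both tails of a sum have definite mass at the scale of the standard deviation. -/
lemma measureReal_sum_tail_ge (h : GoodFam K μ X m σ) (A : Finset ι)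
    (hv : 0 < ∑ i ∈ A, σ i ^ 2) :
    ((192 * K)⁻¹) ^ 2 ≤ μ.real {ω | (192 * K)⁻¹ * √(∑ i ∈ A, σ i ^ 2) ≤
        ∑ i ∈ A, X i ω - ∑ i ∈ A, m i} ∧
      ((192 * K)⁻¹) ^ 2 ≤ μ.real {ω | (192 * K)⁻¹ * √(∑ i ∈ A, σ i ^ 2) ≤
        -(∑ i ∈ A, X i ω - ∑ i ∈ A, m i)} := by
  have hK : 0 < K := zero_lt_one.trans_le h.one_le
  have hmeas := h.measurable_sum A
  set v := ∑ i ∈ A, σ i ^ 2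
  set c := (192 * K)⁻¹
  have hc : 0 < c := by positivity
  have hw : 0 < √v := Real.sqrt_pos.2 hv
  have hv2 : √v ^ 2 = v := Real.sq_sqrt hv.le
  set Y := fun ω => ∑ i ∈ A, X i ω - ∑ i ∈ A, m i
  have hY : Measurable Y := hmeas.sub_const _
  have hi2 : Integrable (fun ω => Y ω ^ 2) μ := h.integrable_sum_sq A
  have hi : Integrable Y μ :=
    ((memLp_two_iff_integrable_sq hY.aestronglyMeasurable).2 hi2).integrable one_le_two
  have h0 : ∫ ω, Y ω ∂μ = 0 := by
    simp only [Y, ← Finset.sum_sub_distrib]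
    rw [integral_finsetSum _ fun i _ => (h.memLp i).integrable one_le_two]
    exact Finset.sum_eq_zero fun i _ => h.integral_sub i
  have hvar : ∫ ω, Y ω ^ 2 ∂μ = √v ^ 2 := by rw [hv2]; exact h.integral_sum_sq A
  have hconc : μ.real {ω | |Y ω| ≤ 8 * c * √v} ≤ 1 / 2 := by
    set k := ((8 * c * √v) ^ 2)⁻¹
    have hk : 0 < k := by positivity
    have hsk : √k = (8 * c * √v)⁻¹ := by
      simp only [k]; rw [Real.sqrt_inv, Real.sqrt_sq (by positivity)]
    have h1 := h.integral_gwin_sum_le A hk (∑ i ∈ A, m i)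
    have hm1 : MeasurableSet {ω | |Y ω| ≤ 8 * c * √v} :=
      measurableSet_le hY.abs measurable_const
    have h2 : μ.real {ω | |Y ω| ≤ 8 * c * √v} * Real.exp (-(1 / 2)) ≤
        ∫ ω, gwin k (∑ i ∈ A, X i ω - ∑ i ∈ A, m i) ∂μ := by
      rw [← smul_eq_mul, ← integral_indicator_const _ hm1]
      refine integral_mono ((integrable_const _).indicator hm1)
        (integrable_gwin_sub hk.le μ hmeas _) fun ω => ?_
      by_cases hω : |Y ω| ≤ 8 * c * √v
      · simp only [Set.indicator, Set.mem_ofPred_eq, hω, if_true]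
        refine exp_le_gwin ?_
        rw [inv_mul_le_iff₀ (by positivity), mul_one, ← sq_abs]
        exact pow_le_pow_left₀ (abs_nonneg _) hω 2
      · simp only [Set.indicator, Set.mem_ofPred_eq, hω, if_false]
        exact gwin_nonneg _ _
    have h3 : (2 : ℝ)⁻¹ ≤ Real.exp (-(1 / 2)) := by
      have := Real.add_one_le_exp (-(1 / 2) : ℝ); norm_num at this ⊢; linarith
    change (∫ ω, gwin k (∑ i ∈ A, X i ω - ∑ i ∈ A, m i) ∂μ) * (√k * √v) ≤ 6 * K at h1
    have e : √k * √v = 24 * K := by rw [hsk]; simp only [c]; field_simp; norm_num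
    rw [e] at h1
    have h4 : ∫ ω, gwin k (∑ i ∈ A, X i ω - ∑ i ∈ A, m i) ∂μ ≤ 1 / 4 := by
      by_contra! h5
      nlinarith
    have h6 := mul_le_mul_of_nonneg_left h3
      (measureReal_nonneg (μ := μ) (s := {ω | |Y ω| ≤ 8 * c * √v}))
    linarith
  refine ⟨measureReal_tail_ge hY hi hi2 h0 hw hc hvar hconc, ?_⟩
  refine measureReal_tail_ge (Y := fun ω => -Y ω) hY.neg hi.neg (by simpa using hi2) ?_ hw hc
    (by simpa using hvar) (by simpa using hconc)
  rw [integral_neg, h0, neg_zero]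

/-- For a sum of finitely many terms, window averages near the mean are bounded below, with a
constant that depends on the number of terms. -/
lemma le_integral_gwin_sum_of_card (h : GoodFam K μ X m σ) (A : Finset ι)
    (hv : 0 < ∑ i ∈ A, σ i ^ 2) {k c : ℝ} (hcK : c = (192 * K)⁻¹)
    (hk : 4 ≤ c ^ 2 * (k * ∑ i ∈ A, σ i ^ 2)) {y : ℝ}
    (hy : |y - ∑ i ∈ A, m i| ≤ c / 2 * √(∑ i ∈ A, σ i ^ 2)) :
    c ^ 3 * Real.exp (-(1 / 2)) / 2 ≤ √k * √(∑ i ∈ A, σ i ^ 2) *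
      (K ^ A.card * (K ^ A.card * ∫ ω, gwin k (∑ i ∈ A, X i ω - y) ∂μ)) := by
  have hK1 := h.one_le
  have hK : 0 < K := zero_lt_one.trans_le h.one_le
  have hc : 0 < c := by rw [hcK]; positivity
  have hc1 : c ≤ 1 := by rw [hcK]; exact inv_le_one_of_one_le₀ (by linarith)
  have htail := h.measureReal_sum_tail_ge A hv
  rw [← hcK] at htail
  set v := ∑ i ∈ A, σ i ^ 2
  set w := √v
  set s := ∑ i ∈ A, m i
  have hw : 0 < w := Real.sqrt_pos.2 hv
  have hw2 : w ^ 2 = v := Real.sq_sqrt hv.le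
  have hkpos : 0 < k := by
    by_contra h'
    have : k * v ≤ 0 := mul_nonpos_of_nonpos_of_nonneg (not_lt.1 h') hv.le
    nlinarith [mul_nonneg (sq_nonneg c) (neg_nonneg.2 this)]
  have hsk : 0 < √k := Real.sqrt_pos.2 hkpos
  have hd : (√k)⁻¹ ≤ c / 2 * w := by
    rw [inv_le_iff_one_le_mul₀ hsk]
    have h1 : (2 : ℝ) ^ 2 ≤ (c * w * √k) ^ 2 := by
      rw [mul_pow, mul_pow, hw2, Real.sq_sqrt hkpos.le]; linarith
    have := (abs_le_of_sq_le_sq' h1 (by positivity)).2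
    linarith
  set H := 2 / c
  have hcH : c * H = 2 := by simp only [H]; field_simp
  have hHc : c ≤ H := by simp only [H]; rw [le_div_iff₀ hc]; nlinarith
  have hH : 0 < H := by positivity
  have hcheb := h.chebyshev A (c := H * w) (by positivity)
  have hcheb' : μ.real {ω | H * w < |∑ i ∈ A, X i ω - s|} ≤ c ^ 2 / 4 := by
    refine hcheb.trans (le_of_eq ?_)
    change v / (H * w) ^ 2 = _
    rw [mul_pow, hw2]; simp only [H]; field_simp; norm_num
  set t := c ^ 3 * Real.exp (-(1 / 2)) / 2 / (√k * w)
  -- the argument for each of the two tails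
  have hone : ∀ a b : ℝ, b - a = (H - c) * w →
      c ^ 2 - c ^ 2 / 4 ≤ μ.real {ω | ∑ i ∈ A, X i ω ∈ Set.Icc a b} →
      ∃ y ∈ Set.Icc (a - (√k)⁻¹) (b + (√k)⁻¹), t ≤ ∫ ω, gwin k (∑ i ∈ A, X i ω - y) ∂μ := by
    intro a b hab hP
    obtain ⟨y, hy, hle⟩ := exists_le_integral_gwin (μ := μ) (h.measurable_sum A) hkpos
      (a := a) (b := b) (by nlinarith)
    refine ⟨y, hy, ?_⟩
    have hI := (h.integral_gwin_sum_pos A hkpos.le y).le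
    set Φ := ∫ ω, gwin k (∑ i ∈ A, X i ω - y) ∂μ
    have h1 : (b - a + 2 * (√k)⁻¹) * Φ ≤ H * w * Φ := by
      refine mul_le_mul_of_nonneg_right ?_ hI
      rw [hab]; linarith
    have h2 : c ^ 2 / 2 * (2 * (√k)⁻¹ * Real.exp (-(1 / 2))) ≤ H * w * Φ := by
      refine le_trans (mul_le_mul_of_nonneg_right ?_ (by positivity)) (hle.trans h1)
      nlinarith [sq_nonneg c]
    have e : t = c ^ 2 / 2 * (2 * (√k)⁻¹ * Real.exp (-(1 / 2))) / (H * w) := by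
      simp only [t, H]; field_simp
    rw [e, div_le_iff₀ (by positivity)]
    linarith
  have hup : c ^ 2 - c ^ 2 / 4 ≤
      μ.real {ω | ∑ i ∈ A, X i ω ∈ Set.Icc (s + c * w) (s + H * w)} := by
    have h1 : {ω | c * w ≤ ∑ i ∈ A, X i ω - s} ⊆
        {ω | ∑ i ∈ A, X i ω ∈ Set.Icc (s + c * w) (s + H * w)} ∪
          {ω | H * w < |∑ i ∈ A, X i ω - s|} := by
      intro ω hω
      simp only [Set.mem_union, Set.mem_ofPred_eq, Set.mem_Icc] at *
      by_cases h2 : H * w < |∑ i ∈ A, X i ω - s|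
      · exact Or.inr h2
      · exact Or.inl ⟨by linarith, by linarith [(abs_le.1 (not_lt.1 h2)).2]⟩
    have h2 := (measureReal_mono h1).trans (measureReal_union_le (μ := μ) _ _)
    linarith [htail.1]
  have hdown : c ^ 2 - c ^ 2 / 4 ≤
      μ.real {ω | ∑ i ∈ A, X i ω ∈ Set.Icc (s - H * w) (s - c * w)} := by
    have h1 : {ω | c * w ≤ -(∑ i ∈ A, X i ω - s)} ⊆
        {ω | ∑ i ∈ A, X i ω ∈ Set.Icc (s - H * w) (s - c * w)} ∪
          {ω | H * w < |∑ i ∈ A, X i ω - s|} := by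
      intro ω hω
      simp only [Set.mem_union, Set.mem_ofPred_eq, Set.mem_Icc] at *
      by_cases h2 : H * w < |∑ i ∈ A, X i ω - s|
      · exact Or.inr h2
      · exact Or.inl ⟨by linarith [(abs_le.1 (not_lt.1 h2)).1], by linarith⟩
    have h2 := (measureReal_mono h1).trans (measureReal_union_le (μ := μ) _ _)
    linarith [htail.2]
  obtain ⟨y1, hy1, ht1⟩ := hone _ _ (by ring) hup
  obtain ⟨y2, hy2, ht2⟩ := hone _ _ (by ring) hdown
  have hy' := abs_le.1 hy
  have := h.min_le_integral_gwin_sum hkpos.le A (a := y2) (b := y1) (y := y)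
    ⟨by linarith [hy2.2, hy'.1], by linarith [hy1.1, hy'.2]⟩ ht2 ht1
  have e : c ^ 3 * Real.exp (-(1 / 2)) / 2 = √k * w * t := by simp only [t]; field_simp
  rw [e]
  gcongr

/-- Lower bound for window averages of sums at their mean. -/
theorem exists_le_integral_gwin_sum (hK : 1 ≤ K) : ∃ c : ℝ, 0 < c ∧ ∃ k₁ : ℝ, 0 < k₁ ∧
    ∀ {Ω ι : Type*} [MeasurableSpace Ω] {μ : Measure Ω} [IsProbabilityMeasure μ]
      {X : ι → Ω → ℝ} {m σ : ι → ℝ} (_ : GoodFam K μ X m σ) (A : Finset ι) (k : ℝ),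
      0 < ∑ i ∈ A, σ i ^ 2 → k₁ ≤ k * ∑ i ∈ A, σ i ^ 2 →
      c ≤ √k * √(∑ i ∈ A, σ i ^ 2) * ∫ ω, gwin k (∑ i ∈ A, X i ω - ∑ i ∈ A, m i) ∂μ := by
  have hK0 : 0 < K := by linarith
  obtain ⟨c, hcK⟩ : ∃ c, c = (192 * K)⁻¹ := ⟨_, rfl⟩
  have hc : 0 < c := by rw [hcK]; positivity
  have hc1 : c ≤ 1 := by rw [hcK]; exact inv_le_one_of_one_le₀ (by linarith)
  obtain ⟨η, hη⟩ : ∃ η, η = c ^ 2 / 16 := ⟨_, rfl⟩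
  have hη0 : 0 < η := by rw [hη]; positivity
  have hη1 : η ≤ 1 / 16 := by rw [hη]; nlinarith
  obtain ⟨r, hr, cr, hcr, hLoR⟩ := exists_integral_gwin_sum_ge hK (2 / √η)
  have hr0 : (0 : ℝ) < r := by exact_mod_cast two_pos.trans_le hr
  set K' := (r : ℝ) ^ 4 / η
  have hK' : 0 < K' := by positivity
  set n₀ := ⌈K'⌉₊
  set c' := c ^ 3 * Real.exp (-(1 / 2)) / 2 / (K ^ n₀ * K ^ n₀)
  have hc' : 0 < c' := by positivity
  refine ⟨min (cr * (3 / 4)) (c' * (1 / 2)), by positivity, max η⁻¹ (8 / c ^ 2), by positivity, ?_⟩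
  intro Ω ι _ μ _ X m σ h A k hv hk
  classical
  set D := A.filter fun i => ∑ j ∈ A, σ j ^ 2 < K' * σ i ^ 2
  set R := A.filter fun i => ¬ ∑ j ∈ A, σ j ^ 2 < K' * σ i ^ 2
  have hDR : Disjoint D R := Finset.disjoint_filter_filter_not A A _
  have hsplit : ∀ f : ι → ℝ, ∑ i ∈ D, f i + ∑ i ∈ R, f i = ∑ i ∈ A, f i := fun f =>
    Finset.sum_filter_add_sum_filter_not A _ f
  set v := ∑ i ∈ A, σ i ^ 2
  set vD := ∑ i ∈ D, σ i ^ 2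
  set vR := ∑ i ∈ R, σ i ^ 2
  have hvv : vD + vR = v := hsplit _
  have hvD0 : 0 ≤ vD := Finset.sum_nonneg fun _ _ => sq_nonneg _
  have hvR0 : 0 ≤ vR := Finset.sum_nonneg fun _ _ => sq_nonneg _
  have hk1 : η⁻¹ ≤ k * v := (le_max_left _ _).trans hk
  have hk2 : 8 / c ^ 2 ≤ k * v := (le_max_right _ _).trans hk
  have hkpos : 0 < k := by
    by_contra h'
    have h1 : k * v ≤ 0 := mul_nonpos_of_nonpos_of_nonneg (not_lt.1 h') hv.le
    have h2 : 0 < η⁻¹ := by positivity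
    linarith
  have hsk : 0 < √k := Real.sqrt_pos.2 hkpos
  have hsv : 0 < √v := Real.sqrt_pos.2 hv
  by_cases hcase : η * v ≤ vR
  · refine (min_le_left _ _).trans ?_
    have hvRpos : 0 < vR := lt_of_lt_of_le (by positivity) hcase
    have hsvR : 0 < √vR := Real.sqrt_pos.2 hvRpos
    have hind := h.indepFun_sum_sum hDR.symm
    set G : Set ℝ := {x | |x - ∑ i ∈ D, m i| ≤ 2 * √v}
    have hG : MeasurableSet G := measurableSet_le (by fun_prop) (by fun_prop)
    have hb : ∀ x ∈ G, cr / (√k * √v) ≤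
        ∫ ω, gwin k (∑ i ∈ R, X i ω + x - ∑ i ∈ A, m i) ∂μ := by
      intro x hx
      have h1 := hLoR h R k (∑ i ∈ A, m i - x) hvRpos (fun i hi => by
        have h2 := (Finset.mem_filter.1 hi).2
        rw [not_lt] at h2
        have h3 : K' * η = (r : ℝ) ^ 4 := by simp only [K']; field_simp
        rw [← h3]
        calc K' * η * σ i ^ 2 = η * (K' * σ i ^ 2) := by ring
          _ ≤ η * v := by gcongr
          _ ≤ _ := hcase) (by
        calc 1 = η⁻¹ * η := (inv_mul_cancel₀ hη0.ne').symm
          _ ≤ k * v * η := by gcongr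
          _ = k * (η * v) := by ring
          _ ≤ _ := by gcongr) (by
        have e : ∑ i ∈ A, m i - x - ∑ i ∈ R, m i = -(x - ∑ i ∈ D, m i) := by
          rw [← hsplit m]; ring
        rw [e, abs_neg]
        refine (show |x - ∑ i ∈ D, m i| ≤ 2 * √v from hx).trans ?_
        rw [div_mul_eq_mul_div, le_div_iff₀ (Real.sqrt_pos.2 hη0), mul_assoc,
          ← Real.sqrt_mul hv.le]
        refine mul_le_mul_of_nonneg_left (Real.sqrt_le_sqrt ?_) two_pos.le
        rw [mul_comm]; exact hcase)
      have hI : 0 ≤ ∫ ω, gwin k (∑ i ∈ R, X i ω - (∑ i ∈ A, m i - x)) ∂μ :=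
        integral_nonneg fun _ => gwin_nonneg _ _
      simp only [sub_sub_eq_add_sub] at h1 hI ⊢
      rw [div_le_iff₀ (by positivity)]
      refine h1.trans ?_
      rw [mul_comm]
      gcongr
      linarith
    have hle := hind.le_integral (h.measurable_sum R) (h.measurable_sum D)
      (g := fun u x => gwin k (u + x - ∑ i ∈ A, m i))
      (by simp only [Function.uncurry_def]; fun_prop) (fun _ _ => gwin_nonneg _ _)
      (fun _ _ => gwin_le_one hkpos.le _) hG hb
    have e : ∀ ω, ∑ i ∈ R, X i ω + ∑ i ∈ D, X i ω = ∑ i ∈ A, X i ω := fun ω => by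
      rw [add_comm]; exact hsplit fun i => X i ω
    simp only [e] at hle
    have hP : 3 / 4 ≤ μ.real ((fun ω => ∑ i ∈ D, X i ω) ⁻¹' G) := by
      have h1 := h.chebyshev D (c := 2 * √v) (by positivity)
      have h2 : vD / (2 * √v) ^ 2 ≤ 1 / 4 := by
        rw [mul_pow, Real.sq_sqrt hv.le, div_le_div_iff₀ (by positivity) (by norm_num)]; linarith
      have h3 := probReal_compl_eq_one_sub (μ := μ) (h.measurable_sum D hG)
      have e2 : ((fun ω => ∑ i ∈ D, X i ω) ⁻¹' G)ᶜ =
          {ω | 2 * √v < |∑ i ∈ D, X i ω - ∑ i ∈ D, m i|} := by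
        ext ω; simp [G]
      rw [e2] at h3
      linarith
    calc cr * (3 / 4) = √k * √v * (cr / (√k * √v) * (3 / 4)) := by field_simp
      _ ≤ √k * √v * (cr / (√k * √v) * μ.real ((fun ω => ∑ i ∈ D, X i ω) ⁻¹' G)) := by gcongr
      _ ≤ _ := by gcongr
  · refine (min_le_right _ _).trans ?_
    push Not at hcase
    have hvDge : v / 2 ≤ vD := by nlinarith
    have hvDpos : 0 < vD := by linarith
    have hsvD : 0 < √vD := Real.sqrt_pos.2 hvDpos
    have hcard : D.card ≤ n₀ := by
      have h1 : (D.card : ℝ) * v ≤ K' * vD := by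
        rw [← nsmul_eq_mul, Finset.mul_sum]
        exact Finset.card_nsmul_le_sum D _ _ fun i hi => (Finset.mem_filter.1 hi).2.le
      have h2 : (D.card : ℝ) ≤ K' := by
        refine le_of_mul_le_mul_right (h1.trans ?_) hv
        gcongr; linarith
      exact_mod_cast h2.trans (Nat.le_ceil K')
    have hkD : 4 ≤ c ^ 2 * (k * vD) := by
      rw [div_le_iff₀ (by positivity)] at hk2
      have := mul_le_mul_of_nonneg_left hvDge (show 0 ≤ c ^ 2 * k by positivity)
      linarith
    have hind := h.indepFun_sum_sum hDR
    set G : Set ℝ := {x | |x - ∑ i ∈ R, m i| ≤ c / 2 * √vD}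
    have hG : MeasurableSet G := measurableSet_le (by fun_prop) (by fun_prop)
    have hb : ∀ x ∈ G, c' / (√k * √v) ≤
        ∫ ω, gwin k (∑ i ∈ D, X i ω + x - ∑ i ∈ A, m i) ∂μ := by
      intro x hx
      have h1 := h.le_integral_gwin_sum_of_card D hvDpos hcK hkD (y := ∑ i ∈ A, m i - x) (by
        have e : ∑ i ∈ A, m i - x - ∑ i ∈ D, m i = -(x - ∑ i ∈ R, m i) := by
          rw [← hsplit m]; ring
        rw [e, abs_neg]
        exact hx)
      have hI : 0 ≤ ∫ ω, gwin k (∑ i ∈ D, X i ω - (∑ i ∈ A, m i - x)) ∂μ :=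
        integral_nonneg fun _ => gwin_nonneg _ _
      simp only [sub_sub_eq_add_sub] at h1 hI ⊢
      set Φ := ∫ ω, gwin k (∑ i ∈ D, X i ω + x - ∑ i ∈ A, m i) ∂μ
      rw [div_le_iff₀ (by positivity)]
      simp only [c']
      rw [div_le_iff₀ (by positivity)]
      calc _ ≤ √k * √vD * (K ^ D.card * (K ^ D.card * Φ)) := h1
        _ ≤ √k * √v * (K ^ n₀ * (K ^ n₀ * Φ)) := by
          gcongr
          linarith
        _ = _ := by ring
    have hle := hind.le_integral (h.measurable_sum D) (h.measurable_sum R)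
      (g := fun u x => gwin k (u + x - ∑ i ∈ A, m i))
      (by simp only [Function.uncurry_def]; fun_prop) (fun _ _ => gwin_nonneg _ _)
      (fun _ _ => gwin_le_one hkpos.le _) hG hb
    have e : ∀ ω, ∑ i ∈ D, X i ω + ∑ i ∈ R, X i ω = ∑ i ∈ A, X i ω := fun ω =>
      hsplit fun i => X i ω
    simp only [e] at hle
    have hP : 1 / 2 ≤ μ.real ((fun ω => ∑ i ∈ R, X i ω) ⁻¹' G) := by
      have h1 := h.chebyshev R (c := c / 2 * √vD) (by positivity)
      have h2 : vR / (c / 2 * √vD) ^ 2 ≤ 1 / 2 := by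
        rw [mul_pow, Real.sq_sqrt hvDpos.le, div_le_div_iff₀ (by positivity) (by norm_num)]
        rw [hη] at hcase
        nlinarith [mul_le_mul_of_nonneg_left hvDge (sq_nonneg c)]
      have h3 := probReal_compl_eq_one_sub (μ := μ) (h.measurable_sum R hG)
      have e2 : ((fun ω => ∑ i ∈ R, X i ω) ⁻¹' G)ᶜ =
          {ω | c / 2 * √vD < |∑ i ∈ R, X i ω - ∑ i ∈ R, m i|} := by
        ext ω; simp [G]
      rw [e2] at h3
      linarith
    calc c' * (1 / 2) = √k * √v * (c' / (√k * √v) * (1 / 2)) := by field_simp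
      _ ≤ √k * √v * (c' / (√k * √v) * μ.real ((fun ω => ∑ i ∈ R, X i ω) ⁻¹' G)) := by gcongr
      _ ≤ _ := by gcongr

end GoodFam

lemma integral_abs_pow_mul_exp (n : ℕ) {r : ℝ} (hr : 0 < r) (x₀ : ℝ) :
    Integrable (fun x => |x - x₀| ^ n * Real.exp (-(r * |x - x₀|))) ∧
    ∫ x, |x - x₀| ^ n * Real.exp (-(r * |x - x₀|)) = 2 * n.factorial * (1 / r) ^ (n + 1) := by
  have h : ∫ x, |x - x₀| ^ n * Real.exp (-(r * |x - x₀|))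
      = 2 * n.factorial * (1 / r) ^ (n + 1) := by
    rw [integral_sub_right_eq_self (fun x => |x| ^ n * Real.exp (-(r * |x|))) x₀,
      integral_comp_abs (f := fun x => x ^ n * Real.exp (-(r * x)))]
    have h1 := Real.integral_rpow_mul_exp_neg_mul_Ioi (a := n + 1) (by positivity) hr
    rw [add_sub_cancel_right, Real.Gamma_nat_eq_factorial] at h1
    simp_rw [Real.rpow_natCast] at h1
    rw [h1, ← Nat.cast_add_one, Real.rpow_natCast]
    ring
  refine ⟨by_contra fun hn => ?_, h⟩
  rw [integral_undef hn] at h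
  exact absurd h (ne_of_lt (by positivity))

lemma abs_sin_le_mul {u : ℝ} (hu : 0 < u) : |Real.sin u| ≤ u * (1 - min (u ^ 2) 1 / 40) := by
  have key : ∀ v : ℝ, 0 < v → v ≤ 1 → Real.sin v ≤ v * (1 - v ^ 2 * (3 / 20)) := fun v h0 h1 => by
    have h := (abs_le.1 (Real.sin_bound (abs_le.2 ⟨by linarith, h1⟩))).2
    rw [abs_of_pos h0] at h
    nlinarith [pow_pos h0 3, pow_le_pow_left₀ h0.le h1 2]
  rcases le_or_gt u 2 with h2 | h2
  · rw [abs_of_nonneg (Real.sin_nonneg_of_nonneg_of_le_pi hu.le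
      (h2.trans (by linarith [Real.pi_gt_three])))]
    rcases le_or_gt u 1 with h1 | h1
    · refine (key u hu h1).trans ?_
      gcongr
      have := min_le_left (u ^ 2) 1
      nlinarith [sq_nonneg u]
    · have e : Real.sin u ≤ 2 * Real.sin (u / 2) := by
        have h := Real.sin_two_mul (u / 2)
        rw [mul_div_cancel₀ _ (two_ne_zero)] at h
        rw [h]
        have := Real.cos_le_one (u / 2)
        have := Real.sin_nonneg_of_nonneg_of_le_pi (x := u / 2) (by linarith)
          (by linarith [Real.pi_gt_three])
        nlinarith
      have k := key (u / 2) (by linarith) (by linarith)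
      have : u * (1 / 40) ≤ u * ((u / 2) ^ 2 * (3 / 20)) := by
        gcongr
        nlinarith
      rw [min_eq_right (by nlinarith)]
      linarith
  · refine (Real.abs_sin_le_one u).trans ?_
    rw [min_eq_right (by nlinarith)]
    linarith

lemma cube_div_le_integral_sub_sq (α m : ℝ) {L : ℝ} (hL : 0 ≤ L) :
    L ^ 3 / 12 ≤ ∫ x in α..α + L, (x - m) ^ 2 := by
  rw [intervalIntegral.integral_comp_sub_right (fun x => x ^ 2), integral_pow]
  norm_num
  nlinarith [mul_nonneg hL (sq_nonneg (α - m + L / 2))]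

lemma integral_one_sub_cos_ge (α θ : ℝ) {L ξ : ℝ} (hL : 0 < L) (hξ : ξ ≠ 0) :
    L * (min ((|ξ| * L / 2) ^ 2) 1 / 40) ≤ ∫ x in α..α + L, (1 - Real.cos (ξ * x - θ)) := by
  rw [intervalIntegral.integral_sub (by simp)
    (Continuous.intervalIntegrable (by fun_prop) _ _),
    intervalIntegral.integral_comp_mul_sub (fun x => Real.cos x) hξ, integral_cos,
    Real.sin_sub_sin]
  have e1 : (ξ * (α + L) - θ - (ξ * α - θ)) / 2 = ξ * L / 2 := by ring
  rw [e1]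
  have h1 := abs_sin_le_mul (u := |ξ| * L / 2) (by positivity)
  have e2 : |Real.sin (|ξ| * L / 2)| = |Real.sin (ξ * L / 2)| := by
    rcases abs_choice ξ with h | h <;> rw [h]
    rw [neg_mul, neg_div, Real.sin_neg, abs_neg]
  rw [e2] at h1
  set c := Real.cos ((ξ * (α + L) - θ + (ξ * α - θ)) / 2)
  set s := Real.sin (ξ * L / 2)
  have h2 : ξ⁻¹ * (2 * s * c) ≤ |ξ|⁻¹ * (2 * |s|) := by
    refine (le_abs_self _).trans ?_
    rw [abs_mul, abs_inv, abs_mul, abs_mul, abs_two]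
    have := Real.abs_cos_le_one ((ξ * (α + L) - θ + (ξ * α - θ)) / 2)
    refine mul_le_mul_of_nonneg_left ?_ (by positivity)
    exact mul_le_of_le_one_right (by positivity) this
  have h3 : |ξ|⁻¹ * (2 * |s|) ≤ L * (1 - min ((|ξ| * L / 2) ^ 2) 1 / 40) := by
    rw [inv_mul_le_iff₀ (by positivity)]
    linarith
  simp only [intervalIntegral.integral_const, smul_eq_mul, mul_one]
  linarith

lemma norm_charFun_le_one_sub {ν : Measure ℝ} [IsProbabilityMeasure ν] {p : ℝ → ℝ}
    (hp : Measurable p) (hp0 : ∀ x, 0 ≤ p x)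
    (hν : ν = volume.withDensity (fun x => ENNReal.ofReal (p x))) {α L A : ℝ} (hA : 0 < A)
    (hL : 0 < L) (hlow : ∀ x ∈ Set.Ioc α (α + L), 1 / (2 * A * L) ≤ p x) {ξ : ℝ} (hξ : ξ ≠ 0) :
    ‖charFun ν ξ‖ ≤ 1 - min ((|ξ| * L / 2) ^ 2) 1 / (80 * A) := by
  set z := charFun ν ξ
  set θ := Complex.arg z
  have h1 : ‖z‖ = ∫ x, Real.cos (ξ * x - θ) ∂ν := by
    have e1 : (‖z‖ : ℂ) = Complex.exp (-(θ * Complex.I)) * z := by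
      conv_rhs => rw [← Complex.norm_mul_exp_arg_mul_I z]
      rw [mul_left_comm, ← Complex.exp_add]
      simp [θ]
    have e2 : Complex.exp (-(θ * Complex.I)) * z
        = ∫ x, Complex.exp (((ξ * x - θ : ℝ) : ℂ) * Complex.I) ∂ν := by
      simp only [z, charFun_apply_real]
      rw [← integral_const_mul]
      congr 1; ext x
      rw [← Complex.exp_add]; congr 1; push_cast; ring
    have hint : Integrable (fun x : ℝ => Complex.exp (((ξ * x - θ : ℝ) : ℂ) * Complex.I)) ν :=
      (integrable_const (1 : ℝ)).mono' (Continuous.aestronglyMeasurable (by fun_prop))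
        (Filter.Eventually.of_forall fun x => (Complex.norm_exp_ofReal_mul_I _).le)
    have e3 := congrArg Complex.re (e1.trans e2)
    rw [Complex.ofReal_re] at e3
    rw [e3, ← Complex.reCLM_apply, ← ContinuousLinearMap.integral_comp_comm _ hint]
    simp only [Complex.reCLM_apply, Complex.exp_ofReal_mul_I_re]
  have hcos : Integrable (fun x => Real.cos (ξ * x - θ)) ν :=
    (integrable_const (1 : ℝ)).mono' (Continuous.aestronglyMeasurable (by fun_prop))
      (Filter.Eventually.of_forall fun x => Real.abs_cos_le_one _)
  have h2 : 1 - ‖z‖ = ∫ x, (1 - Real.cos (ξ * x - θ)) ∂ν := by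
    rw [integral_sub (integrable_const _) hcos, h1]; simp
  have h3 : ∫ x, (1 - Real.cos (ξ * x - θ)) ∂ν = ∫ x, p x * (1 - Real.cos (ξ * x - θ)) := by
    rw [hν, integral_withDensity_eq_integral_toReal_smul (by fun_prop) (by simp)]
    simp [ENNReal.toReal_ofReal (hp0 _)]
  have hi : Integrable (fun x => p x * (1 - Real.cos (ξ * x - θ))) := by
    have := (integrable_const (1 : ℝ)).sub hcos
    rw [hν, integrable_withDensity_iff_integrable_smul' (by fun_prop) (by simp)] at this
    simpa [ENNReal.toReal_ofReal (hp0 _)] using this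
  have h4 : ∫ x in α..α + L, (1 / (2 * A * L)) * (1 - Real.cos (ξ * x - θ))
      ≤ ∫ x, p x * (1 - Real.cos (ξ * x - θ)) := by
    rw [intervalIntegral.integral_of_le (by linarith)]
    refine le_trans (setIntegral_mono_on (Continuous.integrableOn_Ioc (by fun_prop))
      hi.integrableOn measurableSet_Ioc fun x hx => ?_)
      (setIntegral_le_integral hi (Filter.Eventually.of_forall fun x => mul_nonneg (hp0 x)
        (by linarith [Real.cos_le_one (ξ * x - θ)])))
    exact mul_le_mul_of_nonneg_right (hlow x hx) (by linarith [Real.cos_le_one (ξ * x - θ)])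
  rw [intervalIntegral.integral_const_mul] at h4
  have h5 := mul_le_mul_of_nonneg_left (integral_one_sub_cos_ge α θ hL hξ)
    (show 0 ≤ 1 / (2 * A * L) by positivity)
  have e : 1 / (2 * A * L) * (L * (min ((|ξ| * L / 2) ^ 2) 1 / 40))
      = min ((|ξ| * L / 2) ^ 2) 1 / (80 * A) := by field_simp; norm_num
  linarith

lemma sq_mul_one_add_le_one {r u A C K₁ : ℝ} (hA : 0 < A) (hr : 0 ≤ r) (hu : 0 ≤ u)
    (hA₁ : 80 * A ≤ K₁) (hC₁ : 20 * A * C ^ 2 ≤ K₁) (c1 : r ≤ 1 - min (u ^ 2) 1 / (80 * A))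
    (c2 : 2 * u * r ≤ C) : r ^ 2 * (1 + u ^ 2 / K₁) ≤ 1 := by
  have hK₁ : 0 < K₁ := by linarith
  have hr1 : r ≤ 1 := c1.trans (by
    have : 0 ≤ min (u ^ 2) 1 / (80 * A) := by positivity
    linarith)
  have c3 : r ^ 2 ≤ 1 - min (u ^ 2) 1 / (80 * A) := (pow_le_of_le_one hr hr1 two_ne_zero).trans c1
  rcases le_or_gt u 1 with h1 | h1
  · rw [min_eq_left (pow_le_one₀ hu h1)] at c3
    have h2 : u ^ 2 / K₁ ≤ u ^ 2 / (80 * A) := by gcongr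
    set a := u ^ 2 / (80 * A)
    have ha : 0 ≤ a := by positivity
    have hb : 0 ≤ u ^ 2 / K₁ := by positivity
    calc r ^ 2 * (1 + u ^ 2 / K₁) ≤ (1 - a) * (1 + a) :=
          mul_le_mul c3 (by linarith) (by linarith) ((sq_nonneg r).trans c3)
      _ ≤ 1 := by nlinarith [sq_nonneg a]
  · rw [min_eq_right (one_le_pow₀ h1.le)] at c3
    have c4 := pow_le_pow_left₀ (by positivity) c2 2
    have c5 : r ^ 2 * (u ^ 2 / K₁) ≤ 1 / (80 * A) := by
      rw [mul_div_assoc', div_le_div_iff₀ hK₁ (by positivity)]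
      have := mul_le_mul_of_nonneg_left c4 (show 0 ≤ 20 * A by positivity)
      linarith
    linarith

/-- Scale-invariant bounds on a density, in terms of the length scale `L` at which it lives. -/
structure DensityBounds (A C L x₀ α : ℝ) (p : ℝ → ℝ) (ν : Measure ℝ) : Prop where
  one_le : 1 ≤ A
  L_pos : 0 < L
  meas : Measurable p
  nonneg : ∀ x, 0 ≤ p x
  prob : IsProbabilityMeasure ν
  eq : ν = volume.withDensity (fun x => ENNReal.ofReal (p x))
  upper : ∀ x, p x ≤ A / L * Real.exp (-(1 / L * |x - x₀|))
  lower : ∀ x ∈ Set.Ioc α (α + L), 1 / (2 * A * L) ≤ p x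
  char : ∀ ξ, |ξ| * ‖charFun ν ξ‖ ≤ C / L

namespace DensityBounds

variable {A C L x₀ α : ℝ} {p : ℝ → ℝ} {ν : Measure ℝ}

lemma moment (h : DensityBounds A C L x₀ α p ν) (n : ℕ) :
    Integrable (fun x => |x - x₀| ^ n) ν ∧
      ∫ x, |x - x₀| ^ n ∂ν ≤ 2 * A * n.factorial * L ^ n := by
  have hL := h.L_pos
  have hA := h.one_le
  have hp := h.meas
  obtain ⟨h1, h2⟩ := integral_abs_pow_mul_exp n (r := 1 / L) (by positivity) x₀
  have hle : ∀ x, p x * |x - x₀| ^ n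
      ≤ A / L * (|x - x₀| ^ n * Real.exp (-(1 / L * |x - x₀|))) := fun x => by
    have := mul_le_mul_of_nonneg_right (h.upper x) (show 0 ≤ |x - x₀| ^ n by positivity)
    linarith
  have hi : Integrable (fun x => p x * |x - x₀| ^ n) :=
    (h1.const_mul (A / L)).mono' (by fun_prop) (Filter.Eventually.of_forall fun x => by
      rw [Real.norm_of_nonneg (mul_nonneg (h.nonneg x) (by positivity))]
      exact hle x)
  constructor
  · rw [h.eq, integrable_withDensity_iff_integrable_smul' (by fun_prop) (by simp)]
    simpa [ENNReal.toReal_ofReal (h.nonneg _)] using hi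
  · rw [h.eq, integral_withDensity_eq_integral_toReal_smul (by fun_prop) (by simp)]
    simp only [ENNReal.toReal_ofReal (h.nonneg _), smul_eq_mul]
    refine (integral_mono hi (h1.const_mul _) hle).trans (le_of_eq ?_)
    rw [integral_const_mul, h2, one_div_one_div, pow_succ]
    field_simp

lemma abs_mean_sub_le (h : DensityBounds A C L x₀ α p ν) : |∫ x, x ∂ν - x₀| ≤ 2 * A * L := by
  have := h.prob
  have h1 := h.moment 1
  simp only [pow_one, Nat.factorial_one, Nat.cast_one, mul_one] at h1
  have hi : Integrable (fun x => x - x₀) ν := (integrable_norm_iff (by fun_prop)).1 h1.1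
  have e : ∫ x, x ∂ν - x₀ = ∫ x, (x - x₀) ∂ν := by
    have hx : Integrable (fun x : ℝ => x) ν := by
      simpa [Pi.add_def] using (hi.add (integrable_const x₀) : Integrable (fun x => x - x₀ + x₀) ν)
    rw [integral_sub hx (integrable_const _)]; simp
  rw [e]
  exact (abs_integral_le_integral_abs).trans h1.2

lemma variance_bounds (h : DensityBounds A C L x₀ α p ν) (m : ℝ) (hm : |m - x₀| ≤ 2 * A * L) :
    L ^ 2 / (24 * A) ≤ ∫ x, (x - m) ^ 2 ∂ν ∧ ∫ x, (x - m) ^ 2 ∂ν ≤ 16 * A ^ 2 * L ^ 2 := by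
  have := h.prob
  have hL := h.L_pos
  have hA := h.one_le
  have hp := h.meas
  obtain ⟨h1, h2⟩ := h.moment 2
  simp only [sq_abs] at h1 h2
  have hb : ∀ x, (x - m) ^ 2 ≤ 2 * (x - x₀) ^ 2 + 8 * A ^ 2 * L ^ 2 := fun x => by
    have := sq_le_sq' (abs_le.1 hm).1 (abs_le.1 hm).2
    nlinarith [sq_nonneg ((x - x₀) + (m - x₀))]
  have hbi : Integrable (fun x => 2 * (x - x₀) ^ 2 + 8 * A ^ 2 * L ^ 2) ν :=
    (h1.const_mul 2).add (integrable_const _)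
  have hi : Integrable (fun x => (x - m) ^ 2) ν := hbi.mono' (by fun_prop)
    (Filter.Eventually.of_forall fun x => by
      rw [Real.norm_of_nonneg (sq_nonneg _)]; exact hb x)
  constructor
  · have hi' : Integrable (fun x => p x * (x - m) ^ 2) := by
      rw [h.eq, integrable_withDensity_iff_integrable_smul' (by fun_prop) (by simp)] at hi
      simpa [ENNReal.toReal_ofReal (h.nonneg _)] using hi
    rw [h.eq, integral_withDensity_eq_integral_toReal_smul (by fun_prop) (by simp)]
    simp only [ENNReal.toReal_ofReal (h.nonneg _), smul_eq_mul]
    have h4 : ∫ x in α..α + L, (1 / (2 * A * L)) * (x - m) ^ 2 ≤ ∫ x, p x * (x - m) ^ 2 := by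
      rw [intervalIntegral.integral_of_le (by linarith)]
      refine le_trans (setIntegral_mono_on (Continuous.integrableOn_Ioc (by fun_prop))
        hi'.integrableOn measurableSet_Ioc fun x hx => ?_)
        (setIntegral_le_integral hi' (Filter.Eventually.of_forall fun x => mul_nonneg (h.nonneg x)
          (sq_nonneg _)))
      exact mul_le_mul_of_nonneg_right (h.lower x hx) (sq_nonneg _)
    rw [intervalIntegral.integral_const_mul] at h4
    have h5 := mul_le_mul_of_nonneg_left (cube_div_le_integral_sub_sq α m hL.le)
      (show 0 ≤ 1 / (2 * A * L) by positivity)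
    have e : 1 / (2 * A * L) * (L ^ 3 / 12) = L ^ 2 / (24 * A) := by field_simp; norm_num
    linarith
  · have := integral_mono hi hbi hb
    rw [integral_add (f := fun x => 2 * (x - x₀) ^ 2) (h1.const_mul 2) (integrable_const _),
      integral_const_mul] at this
    simp only [integral_const, probReal_univ, smul_eq_mul, one_mul, Nat.factorial_two,
      Nat.cast_ofNat] at this h2
    nlinarith [mul_nonneg (mul_nonneg (sub_nonneg.2 hA) (by linarith : 0 ≤ A)) (sq_nonneg L)]

lemma goodLaw (h : DensityBounds A C L x₀ α p ν) {M B' K₁ K : ℝ} (hLM : L ^ 2 ≤ M)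
    (hA₁ : 80 * A ≤ K₁) (hC₁ : 20 * A * C ^ 2 ≤ K₁) (hB' : 1 ≤ B')
    (hK : 64 * A ^ 2 * K₁ + 16 * A ^ 2 * M + 10000 * A ^ 6 + B' ≤ K)
    (hq : ∃ q : ℝ → ℝ, Measurable q ∧ (∀ x, 0 ≤ q x) ∧
      (∀ x y, q x * q y ≤ q ((x + y) / 2) ^ 2) ∧ ∀ x, B'⁻¹ * q x ≤ p x ∧ p x ≤ B' * q x) :
    ∃ m σ, GoodLaw K ν m σ ∧ |m - x₀| ≤ 2 * A * L := by
  have := h.prob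
  have hL := h.L_pos
  have hA := h.one_le
  have hA0 : 0 < A := by linarith
  have hK₁ : 0 < K₁ := by linarith
  have hp := h.meas
  have hm := h.abs_mean_sub_le
  set m := ∫ x, x ∂ν with hmdef
  obtain ⟨v1, v2⟩ := h.variance_bounds m hm
  set v := ∫ x, (x - m) ^ 2 ∂ν with hv
  have hv0 : 0 < v := lt_of_lt_of_le (by positivity) v1
  have hσ : 0 < √v := Real.sqrt_pos.2 hv0
  have hσ2 : √v ^ 2 = v := Real.sq_sqrt hv0.le
  have hM : 0 ≤ M := (sq_nonneg L).trans hLM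
  have hσu : √v ≤ 4 * A * L := by
    refine Real.sqrt_le_iff.2 ⟨by positivity, ?_⟩
    linarith [v2]
  have hσl : L ≤ 5 * A * √v := by
    refine abs_le_of_sq_le_sq' ?_ (by positivity) |>.2
    rw [div_le_iff₀ (by positivity)] at v1
    rw [mul_pow, hσ2]
    nlinarith
  have hA2 : 1 ≤ A ^ 2 := one_le_pow₀ hA
  have hA6 : A ^ 2 ≤ A ^ 6 := pow_le_pow_right₀ hA (by norm_num)
  have h1 : 0 ≤ 64 * A ^ 2 * K₁ := by positivity
  have h2 : 0 ≤ 16 * A ^ 2 * M := by positivity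
  obtain ⟨m3, m3'⟩ := h.moment 3
  have hK1 : 1 ≤ K := by linarith
  refine ⟨m, √v, ⟨hK1, hσ, this, ?_, rfl, by rw [hσ2], ?_, ?_, ?_, ?_, ?_⟩, hm⟩
  · have hi : Integrable (fun x => 4 * |x - x₀| ^ 3 + 4 * |x₀| ^ 3) ν :=
      (m3.const_mul 4).add (integrable_const _)
    refine hi.mono' (by fun_prop) (Filter.Eventually.of_forall fun x => ?_)
    rw [Real.norm_of_nonneg (by positivity)]
    have h1 : |x| ≤ |x - x₀| + |x₀| := by simpa using abs_add_le (x - x₀) x₀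
    have h2 := pow_le_pow_left₀ (abs_nonneg _) h1 3
    nlinarith [mul_nonneg (add_nonneg (abs_nonneg (x - x₀)) (abs_nonneg x₀))
      (sq_nonneg (|x - x₀| - |x₀|))]
  · rw [hσ2]
    have := mul_le_mul_of_nonneg_left hLM (show 0 ≤ 16 * A ^ 2 by positivity)
    nlinarith
  · rw [← withDensity_const, h.eq]
    refine withDensity_mono (Filter.Eventually.of_forall fun x => ENNReal.ofReal_le_ofReal ?_)
    refine (h.upper x).trans ((mul_le_of_le_one_right (by positivity)
      (Real.exp_le_one_iff.2 (by simp; positivity))).trans ?_)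
    rw [div_le_div_iff₀ hL hσ]
    calc A * √v ≤ A * (4 * A * L) := by gcongr
      _ = 4 * A ^ 2 * L := by ring
      _ ≤ K * L := by gcongr; linarith
  · have hb : ∀ x, |x - m| ^ 3 ≤ 4 * |x - x₀| ^ 3 + 4 * (2 * A * L) ^ 3 := fun x => by
      have h1 : |x - m| ≤ |x - x₀| + |m - x₀| := by
        have := abs_sub (x - x₀) (m - x₀); simpa using this
      have h1' : |x - m| ≤ |x - x₀| + 2 * A * L := by linarith
      have h2 := pow_le_pow_left₀ (abs_nonneg _) h1' 3
      have h0 : 0 ≤ 2 * A * L := by positivity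
      nlinarith [mul_nonneg (add_nonneg (abs_nonneg (x - x₀)) h0)
        (sq_nonneg (|x - x₀| - 2 * A * L))]
    have hi : Integrable (fun x => 4 * |x - x₀| ^ 3 + 4 * (2 * A * L) ^ 3) ν :=
      (m3.const_mul 4).add (integrable_const _)
    have hle := integral_mono (hi.mono' (by fun_prop) (Filter.Eventually.of_forall fun x => by
      rw [Real.norm_of_nonneg (by positivity)]; exact hb x)) hi hb
    refine hle.trans ?_
    rw [integral_add (f := fun x => 4 * |x - x₀| ^ 3) (m3.const_mul 4) (integrable_const _),
      integral_const_mul]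
    simp only [integral_const, probReal_univ, smul_eq_mul, one_mul]
    have e3 : ((3 : ℕ).factorial : ℝ) = 6 := by norm_num [Nat.factorial]
    rw [e3] at m3'
    have e1 : A * L ^ 3 ≤ A ^ 3 * L ^ 3 := by
      gcongr; exact le_self_pow₀ hA (by norm_num)
    calc _ ≤ 80 * A ^ 3 * L ^ 3 := by nlinarith
      _ ≤ 80 * A ^ 3 * (5 * A * √v) ^ 3 := by gcongr
      _ = 10000 * A ^ 6 * √v ^ 3 := by ring
      _ ≤ K * √v ^ 3 := by gcongr; linarith
  · intro ξ
    rcases eq_or_ne ξ 0 with rfl | hξ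
    · simp
    set u := |ξ| * L / 2 with hu
    have hu0 : 0 < u := by positivity
    set r := ‖charFun ν ξ‖
    have hr0 : 0 ≤ r := norm_nonneg _
    have c1 : r ≤ 1 - min (u ^ 2) 1 / (80 * A) :=
      norm_charFun_le_one_sub hp h.nonneg h.eq hA0 hL h.lower hξ
    have c2 : 2 * u * r ≤ C := by
      have := h.char ξ
      rw [le_div_iff₀ hL] at this
      rw [hu]; linarith
    have main := sq_mul_one_add_le_one hA0 hr0 hu0.le hA₁ hC₁ c1 c2
    have hle : √v ^ 2 * ξ ^ 2 / K ≤ u ^ 2 / K₁ := by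
      rw [hσ2, div_le_div_iff₀ (by linarith) hK₁]
      have e : u ^ 2 = ξ ^ 2 * L ^ 2 / 4 := by rw [hu, div_pow, mul_pow, sq_abs]; norm_num
      calc v * ξ ^ 2 * K₁ ≤ 16 * A ^ 2 * L ^ 2 * ξ ^ 2 * K₁ := by gcongr
        _ = u ^ 2 * (64 * A ^ 2 * K₁) := by rw [e]; ring
        _ ≤ u ^ 2 * K := by gcongr; linarith
    have hpos : 0 < 1 + √v ^ 2 * ξ ^ 2 / K := by positivity
    rw [← one_div, le_div_iff₀ hpos]
    refine le_trans ?_ main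
    gcongr
  · obtain ⟨q, hqm, hq0, hqq, hqp⟩ := hq
    have hBK : B' ≤ K := by linarith
    refine ⟨p, q, hp, hqm, hq0, h.eq, hqq, fun x => ⟨le_trans ?_ (hqp x).1,
      (hqp x).2.trans (mul_le_mul_of_nonneg_right hBK (hq0 x))⟩⟩
    exact mul_le_mul_of_nonneg_right (inv_anti₀ (by linarith) hBK) (hq0 x)

end DensityBounds

/-- The probability law on `ℝ` with density proportional to `exp (-W)`. -/
def siteLaw (W : ℝ → ℝ) : Measure ℝ :=
  volume.withDensity fun x => ENNReal.ofReal (Real.exp (-W x) / ∫ y, Real.exp (-W y))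

/-- A strongly convex function `f` with minimum `0` at `x₀`. -/
structure StrongConvexAt (lam : ℝ) (f : ℝ → ℝ) (x₀ : ℝ) : Prop where
  lam_pos : 0 < lam
  diff : Differentiable ℝ f
  mono : ∀ x y, x ≤ y → lam * (y - x) ≤ deriv f y - deriv f x
  crit : deriv f x₀ = 0
  zero : f x₀ = 0

namespace StrongConvexAt

variable {lam : ℝ} {f : ℝ → ℝ} {x₀ : ℝ}

lemma convexOn (h : StrongConvexAt lam f x₀) : ConvexOn ℝ Set.univ f := by
  refine Monotone.convexOn_univ_of_deriv h.diff fun x y hxy => ?_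
  nlinarith [h.mono x y hxy, h.lam_pos]

lemma quad_le (h : StrongConvexAt lam f x₀) (x : ℝ) : lam / 2 * (x - x₀) ^ 2 ≤ f x := by
  set g : ℝ → ℝ := fun x => f x - lam / 2 * (x - x₀) ^ 2 with hg
  have hd : ∀ x, HasDerivAt g (deriv f x - lam * (x - x₀)) x := fun x => by
    have := (h.diff x).hasDerivAt.sub ((((hasDerivAt_id x).sub_const x₀).pow 2).const_mul (lam / 2))
    convert! this using 1
    simp; ring
  have hgd : Differentiable ℝ g := fun x => (hd x).differentiableAt
  have h0 : g x₀ = 0 := by simp [hg, h.zero]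
  suffices 0 ≤ g x by simpa [hg] using this
  rw [← h0]
  rcases le_total x₀ x with hx | hx
  · refine monotoneOn_of_deriv_nonneg (convex_Ici x₀) hgd.continuous.continuousOn
      hgd.differentiableOn (fun y hy => ?_) Set.self_mem_Ici hx hx
    rw [interior_Ici, Set.mem_Ioi] at hy
    rw [(hd y).deriv]
    have := h.mono x₀ y hy.le
    rw [h.crit] at this; linarith
  · refine antitoneOn_of_deriv_nonpos (convex_Iic x₀) hgd.continuous.continuousOn
      hgd.differentiableOn (fun y hy => ?_) hx Set.self_mem_Iic hx
    rw [interior_Iic, Set.mem_Iio] at hy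
    rw [(hd y).deriv]
    have := h.mono y x₀ hy.le
    rw [h.crit] at this; linarith

lemma nonneg (h : StrongConvexAt lam f x₀) (x : ℝ) : 0 ≤ f x :=
  le_trans (by have := h.lam_pos; positivity) (h.quad_le x)

lemma reflect (h : StrongConvexAt lam f x₀) :
    StrongConvexAt lam (fun x => f (2 * x₀ - x)) x₀ := by
  have hd : ∀ x, HasDerivAt (fun x => f (2 * x₀ - x)) (-deriv f (2 * x₀ - x)) x := fun x => by
    have := (h.diff (2 * x₀ - x)).hasDerivAt.comp x ((hasDerivAt_id x).const_sub (2 * x₀))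
    simpa using! this
  refine ⟨h.lam_pos, fun x => (hd x).differentiableAt, fun x y hxy => ?_, ?_, ?_⟩
  · rw [(hd x).deriv, (hd y).deriv]
    have := h.mono (2 * x₀ - y) (2 * x₀ - x) (by linarith)
    linarith
  · rw [(hd x₀).deriv, two_mul, add_sub_cancel_right, h.crit, neg_zero]
  · rw [two_mul, add_sub_cancel_right, h.zero]

lemma exists_right (h : StrongConvexAt lam f x₀) :
    ∃ a, 0 < a ∧ a ≤ √(2 / lam) ∧ f (x₀ + a) = 1 ∧ (∀ x ∈ Set.Icc x₀ (x₀ + a), f x ≤ 1) ∧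
      ∀ x, x₀ + a ≤ x → (x - x₀) / a ≤ f x := by
  have hl := h.lam_pos
  set r := √(2 / lam) with hr
  have hr0 : 0 < r := Real.sqrt_pos.2 (by positivity)
  have h1 : 1 ≤ f (x₀ + r) := by
    refine le_trans (le_of_eq ?_) (h.quad_le _)
    rw [add_sub_cancel_left, hr, Real.sq_sqrt (by positivity)]
    field_simp
  obtain ⟨y, hy, hy1⟩ := intermediate_value_Icc (by linarith : x₀ ≤ x₀ + r)
    h.diff.continuous.continuousOn (show (1 : ℝ) ∈ Set.Icc (f x₀) (f (x₀ + r)) from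
      ⟨by rw [h.zero]; norm_num, h1⟩)
  have hne : y ≠ x₀ := by rintro rfl; rw [h.zero] at hy1; norm_num at hy1
  have ha : 0 < y - x₀ := sub_pos.2 (lt_of_le_of_ne hy.1 hne.symm)
  refine ⟨y - x₀, ha, by linarith [hy.2], by rw [add_sub_cancel]; exact hy1, fun x hx => ?_,
    fun x hx => ?_⟩
  · rw [add_sub_cancel] at hx
    have hseg : x ∈ segment ℝ x₀ y := by rw [segment_eq_Icc hy.1]; exact hx
    refine (h.convexOn.le_on_segment trivial trivial hseg).trans ?_
    rw [h.zero, hy1]; norm_num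
  · rw [add_sub_cancel] at hx
    have hxp : 0 < x - x₀ := by linarith
    obtain ⟨-, hc⟩ := h.convexOn
    have := @hc x₀ (Set.mem_univ x₀) x (Set.mem_univ x)
      (1 - (y - x₀) / (x - x₀)) ((y - x₀) / (x - x₀))
      (by rw [sub_nonneg, div_le_one hxp]; linarith) (by positivity) (by ring)
    rw [h.zero, smul_zero, zero_add, smul_eq_mul, smul_eq_mul, smul_eq_mul] at this
    have e : (1 - (y - x₀) / (x - x₀)) * x₀ + (y - x₀) / (x - x₀) * x = y := by
      field_simp; ring
    rw [e, hy1] at this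
    rw [div_le_iff₀ ha]
    rw [div_mul_eq_mul_div, le_div_iff₀ hxp] at this
    linarith

/-- The length scale of `exp (-f)`. -/
lemma exists_scale (h : StrongConvexAt lam f x₀) :
    ∃ α L, 0 < L ∧ L ≤ 2 * √(2 / lam) ∧ (∀ x ∈ Set.Ioc α (α + L), f x ≤ 1) ∧
      ∀ x, 1 / L * |x - x₀| - 1 ≤ f x := by
  obtain ⟨a, ha0, ha1, -, ha3, ha4⟩ := h.exists_right
  obtain ⟨b, hb0, hb1, -, hb3, hb4⟩ := h.reflect.exists_right
  have hnn := h.nonneg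
  refine ⟨x₀ - b, a + b, by linarith, by linarith, fun x hx => ?_, fun x => ?_⟩
  · rcases le_total x₀ x with h1 | h1
    · exact ha3 x ⟨h1, by linarith [hx.2]⟩
    · have := hb3 (2 * x₀ - x) ⟨by linarith, by linarith [hx.1]⟩
      rwa [_root_.sub_sub_cancel] at this
  · rw [one_div_mul_eq_div]
    rcases le_total x₀ x with h1 | h1
    · rw [abs_of_nonneg (sub_nonneg.2 h1)]
      rcases le_total (x₀ + a) x with h2 | h2
      · have h3 : (x - x₀) / (a + b) ≤ (x - x₀) / a := by
          gcongr
          linarith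
        linarith [ha4 x h2]
      · have h3 : (x - x₀) / (a + b) ≤ 1 := (div_le_one (by linarith)).2 (by linarith)
        linarith [hnn x]
    · rw [abs_of_nonpos (sub_nonpos.2 h1)]
      rcases le_total (x₀ + b) (2 * x₀ - x) with h2 | h2
      · have h3 : -(x - x₀) / (a + b) ≤ (2 * x₀ - x - x₀) / b := by
          gcongr
          · linarith
          · linarith
          · linarith
        have := hb4 _ h2
        rw [_root_.sub_sub_cancel] at this
        linarith
      · have h3 : -(x - x₀) / (a + b) ≤ 1 := (div_le_one (by linarith)).2 (by linarith)
        linarith [hnn x]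

lemma tendsto_exp_neg (h : StrongConvexAt lam f x₀) :
    Filter.Tendsto (fun x => Real.exp (-f x)) Filter.atTop (nhds 0) := by
  refine Real.tendsto_exp_neg_atTop_nhds_zero.comp ?_
  refine Filter.tendsto_atTop_mono h.quad_le ?_
  refine Filter.Tendsto.const_mul_atTop (by have := h.lam_pos; positivity) ?_
  exact (Filter.tendsto_pow_atTop two_ne_zero).comp (Filter.tendsto_atTop_add_const_right _ (-x₀)
    Filter.tendsto_id)

lemma integral_Ioi_deriv (h : StrongConvexAt lam f x₀) :
    IntegrableOn (fun x => |deriv f x| * Real.exp (-f x)) (Set.Ioi x₀) ∧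
      ∫ x in Set.Ioi x₀, |deriv f x| * Real.exp (-f x) = 1 := by
  have hd : ∀ x ∈ Set.Ici x₀, HasDerivAt (fun x => -Real.exp (-f x))
      (|deriv f x| * Real.exp (-f x)) x := fun x hx => by
    have h0 : 0 ≤ deriv f x := by
      have := h.mono x₀ x hx
      rw [h.crit] at this
      have := mul_nonneg h.lam_pos.le (sub_nonneg.2 (Set.mem_Ici.1 hx)); linarith
    rw [abs_of_nonneg h0]
    convert! (h.diff x).hasDerivAt.neg.exp.neg using 1
    simp [mul_comm]
  have hn : ∀ x ∈ Set.Ioi x₀, 0 ≤ |deriv f x| * Real.exp (-f x) := fun x _ => by positivity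
  have ht : Filter.Tendsto (fun x => -Real.exp (-f x)) Filter.atTop (nhds 0) := by
    simpa using h.tendsto_exp_neg.neg
  refine ⟨integrableOn_Ioi_deriv_of_nonneg' hd hn ht, ?_⟩
  rw [integral_Ioi_of_hasDerivAt_of_nonneg' hd hn ht, h.zero]
  simp

lemma integral_deriv (h : StrongConvexAt lam f x₀) :
    Integrable (fun x => |deriv f x| * Real.exp (-f x)) ∧
      ∫ x, |deriv f x| * Real.exp (-f x) = 2 := by
  obtain ⟨h1, h2⟩ := h.integral_Ioi_deriv
  obtain ⟨h3, h4⟩ := h.reflect.integral_Ioi_deriv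
  set F : ℝ → ℝ := fun x => |deriv f x| * Real.exp (-f x) with hF
  have hcomp : (fun x => |deriv (fun x => f (2 * x₀ - x)) x| * Real.exp (-f (2 * x₀ - x)))
      = F ∘ fun x => 2 * x₀ - x := by
    ext x
    have := (h.diff (2 * x₀ - x)).hasDerivAt.comp x ((hasDerivAt_id x).const_sub (2 * x₀))
    have e : deriv (fun x => f (2 * x₀ - x)) x = deriv f (2 * x₀ - x) * (-1) := this.deriv
    simp [hF, e]
  have hT : MeasurePreserving (fun x : ℝ => 2 * x₀ - x) volume volume :=
    Measure.measurePreserving_sub_left volume (2 * x₀)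
  have hTe : MeasurableEmbedding (fun x : ℝ => 2 * x₀ - x) :=
    (MeasurableEquiv.subLeft (2 * x₀)).measurableEmbedding
  have hpre : (fun x : ℝ => 2 * x₀ - x) ⁻¹' Set.Iio x₀ = Set.Ioi x₀ := by
    ext x; simp only [Set.mem_preimage, Set.mem_Iio, Set.mem_Ioi]
    constructor <;> intro h <;> linarith
  have h5 : IntegrableOn F (Set.Iio x₀) := by
    rw [← hT.integrableOn_comp_preimage hTe, hpre]
    rw [hcomp] at h3; exact h3
  have h6 : ∫ x in Set.Iio x₀, F x = 1 := by
    rw [← hT.setIntegral_preimage_emb hTe, hpre, ← h4]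
    exact congrArg (fun G : ℝ → ℝ => ∫ x in Set.Ioi x₀, G x) hcomp.symm
  have h7 : IntegrableOn F (Set.Iic x₀) := (integrableOn_Iic_iff_integrableOn_Iio (by simp)).2 h5
  have h8 : IntegrableOn F (Set.Iic x₀ ∪ Set.Ioi x₀) := h7.union h1
  rw [Set.Iic_union_Ioi, integrableOn_univ] at h8
  refine ⟨h8, ?_⟩
  rw [← intervalIntegral.integral_Iic_add_Ioi h7 h1, integral_Iic_eq_integral_Iio, h6, h2]
  norm_num

end StrongConvexAt

/-- A single-site potential: a strongly convex function plus a perturbation bounded in `C¹`. -/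
structure SitePotential (lam B : ℝ) (f δ : ℝ → ℝ) (x₀ : ℝ) : Prop
    extends StrongConvexAt lam f x₀ where
  B_nonneg : 0 ≤ B
  pert_diff : Differentiable ℝ δ
  pert_le : ∀ x, |δ x| ≤ B
  deriv_pert_le : ∀ x, |deriv δ x| ≤ B

namespace SitePotential

variable {lam B : ℝ} {f δ : ℝ → ℝ} {x₀ : ℝ}

lemma exp_bounds (h : SitePotential lam B f δ x₀) (x : ℝ) :
    Real.exp (-B) * Real.exp (-f x) ≤ Real.exp (-(f x + δ x)) ∧
      Real.exp (-(f x + δ x)) ≤ Real.exp B * Real.exp (-f x) := by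
  have := abs_le.1 (h.pert_le x)
  rw [← Real.exp_add, ← Real.exp_add]
  exact ⟨Real.exp_le_exp.2 (by linarith), Real.exp_le_exp.2 (by linarith)⟩

lemma partition_bounds (h : SitePotential lam B f δ x₀) {α L : ℝ} (hL : 0 < L)
    (h1 : ∀ x ∈ Set.Ioc α (α + L), f x ≤ 1) (h2 : ∀ x, 1 / L * |x - x₀| - 1 ≤ f x) :
    Integrable (fun x => Real.exp (-(f x + δ x))) ∧
      L * Real.exp (-(1 + B)) ≤ ∫ x, Real.exp (-(f x + δ x)) ∧
      ∫ x, Real.exp (-(f x + δ x)) ≤ 2 * L * Real.exp (1 + B) := by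
  obtain ⟨e1, e2⟩ := integral_abs_pow_mul_exp 0 (r := 1 / L) (by positivity) x₀
  simp only [pow_zero, one_mul, Nat.factorial_zero, Nat.cast_one, mul_one, zero_add, pow_one,
    one_div_one_div] at e1 e2
  have hc : Continuous fun x => Real.exp (-(f x + δ x)) :=
    (h.diff.continuous.add h.pert_diff.continuous).neg.rexp
  have hle : ∀ x, Real.exp (-(f x + δ x))
      ≤ Real.exp (1 + B) * Real.exp (-(1 / L * |x - x₀|)) := fun x => by
    have := abs_le.1 (h.pert_le x)
    rw [← Real.exp_add]
    exact Real.exp_le_exp.2 (by linarith [h2 x])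
  have hi : Integrable (fun x => Real.exp (-(f x + δ x))) :=
    (e1.const_mul _).mono' hc.aestronglyMeasurable (Filter.Eventually.of_forall fun x => by
      rw [Real.norm_of_nonneg (Real.exp_pos _).le]; exact hle x)
  refine ⟨hi, ?_, ?_⟩
  · have : ∫ x in Set.Ioc α (α + L), Real.exp (-(1 + B)) ≤ ∫ x, Real.exp (-(f x + δ x)) := by
      refine le_trans (setIntegral_mono_on (by simp)
        hi.integrableOn measurableSet_Ioc fun x hx => ?_)
        (setIntegral_le_integral hi (Filter.Eventually.of_forall fun x => (Real.exp_pos _).le))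
      have := abs_le.1 (h.pert_le x)
      exact Real.exp_le_exp.2 (by linarith [h1 x hx])
    simpa [hL.le] using this
  · refine (integral_mono hi (e1.const_mul _) hle).trans (le_of_eq ?_)
    rw [integral_const_mul, e2]; ring

lemma abs_mul_charFun_le (h : SitePotential lam B f δ x₀) {α L : ℝ} (hL : 0 < L)
    (h1 : ∀ x ∈ Set.Ioc α (α + L), f x ≤ 1) (h2 : ∀ x, 1 / L * |x - x₀| - 1 ≤ f x)
    (hLM : L ≤ 2 * √(2 / lam)) (ξ : ℝ) :
    |ξ| * ‖charFun (siteLaw fun x => f x + δ x) ξ‖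
      ≤ (2 * Real.exp (1 + 2 * B) + 2 * B * √(2 / lam)) / L := by
  obtain ⟨hi, hZ1, hZ2⟩ := h.partition_bounds hL h1 h2
  set Z := ∫ x, Real.exp (-(f x + δ x)) with hZ
  have hZ0 : 0 < Z := lt_of_lt_of_le (by positivity) hZ1
  set p : ℝ → ℝ := fun x => Real.exp (-(f x + δ x)) / Z with hp
  have hpc : Continuous p :=
    (h.diff.continuous.add h.pert_diff.continuous).neg.rexp.div_const _
  have hp0 : ∀ x, 0 ≤ p x := fun x => by positivity
  have hpi : Integrable p := hi.div_const _
  have hp1 : ∫ x, p x = 1 := by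
    simp only [hp]; rw [integral_div, ← hZ, div_self hZ0.ne']
  set p' : ℝ → ℝ := fun x => -(deriv f x + deriv δ x) * p x with hp'
  have hd : ∀ x, HasDerivAt p (p' x) x := fun x => by
    convert! (((h.diff x).hasDerivAt.add (h.pert_diff x).hasDerivAt).neg.exp.div_const Z) using 1
    simp only [hp', hp, Pi.add_apply, Pi.neg_apply]; ring
  obtain ⟨hfi, hf2⟩ := h.integral_deriv
  have hb : ∀ x, |p' x| ≤ Real.exp B / Z * (|deriv f x| * Real.exp (-f x)) + B * p x := fun x => by
    rw [hp', abs_mul, abs_neg, abs_of_nonneg (hp0 x)]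
    refine (mul_le_mul_of_nonneg_right (abs_add_le _ _) (hp0 x)).trans ?_
    rw [add_mul]
    refine add_le_add ?_ (mul_le_mul_of_nonneg_right (h.deriv_pert_le x) (hp0 x))
    have := mul_le_mul_of_nonneg_left (h.exp_bounds x).2 (abs_nonneg (deriv f x))
    simp only [hp]
    rw [mul_div_assoc', div_mul_eq_mul_div]
    refine div_le_div_of_nonneg_right ?_ hZ0.le
    linarith
  have hbi : Integrable fun x =>
      Real.exp B / Z * (|deriv f x| * Real.exp (-f x)) + B * p x :=
    (hfi.const_mul _).add (hpi.const_mul _)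
  have hp'm : Measurable p' := ((measurable_deriv f).add (measurable_deriv δ)).neg.mul
    hpc.measurable
  have hp'i : Integrable p' := hbi.mono' hp'm.aestronglyMeasurable (Filter.Eventually.of_forall hb)
  have hp'le : ∫ x, |p' x| ≤ Real.exp B / Z * 2 + B := by
    refine (integral_mono hp'i.abs hbi hb).trans (le_of_eq ?_)
    rw [integral_add (f := fun x => Real.exp B / Z * (|deriv f x| * Real.exp (-f x)))
      (hfi.const_mul _) (hpi.const_mul _), integral_const_mul, integral_const_mul, hf2, hp1,
      mul_one]
  have hφ : charFun (siteLaw fun x => f x + δ x) ξ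
      = ∫ x : ℝ, Complex.exp (ξ * x * Complex.I) * (p x : ℂ) := by
    rw [charFun_apply_real, siteLaw,
      integral_withDensity_eq_integral_toReal_smul hpc.measurable.ennreal_ofReal (by simp)]
    congr 1; ext x
    rw [ENNReal.toReal_ofReal (hp0 x), Complex.real_smul, mul_comm]
  have hn : ∀ x : ℝ, ‖Complex.exp (ξ * x * Complex.I)‖ = 1 := fun x => by
    have := Complex.norm_exp_ofReal_mul_I (ξ * x)
    push_cast at this; exact this
  have hm : Continuous fun x : ℝ => Complex.exp (ξ * x * Complex.I) := by fun_prop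
  have hprod : ∀ g : ℝ → ℝ, Integrable g →
      Integrable (fun x : ℝ => Complex.exp (ξ * x * Complex.I) * (g x : ℂ)) := fun g hg => by
    refine (hg.ofReal (𝕜 := ℂ)).bdd_mul (c := 1) hm.aestronglyMeasurable
      (Filter.Eventually.of_forall fun x => (hn x).le)
  have ibp := integral_mul_deriv_eq_deriv_mul_of_integrable
    (u := fun x : ℝ => Complex.exp (ξ * x * Complex.I)) (v := fun x => (p x : ℂ))
    (u' := fun x : ℝ => ξ * Complex.I * Complex.exp (ξ * x * Complex.I)) (v' := fun x => (p' x : ℂ))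
    (fun x _ => by
      have h1 : HasDerivAt (fun x : ℝ => (ξ : ℂ) * x * Complex.I) (ξ * Complex.I) x := by
        simpa using ((Complex.ofRealCLM.hasDerivAt (x := x)).const_mul (ξ : ℂ)).mul_const Complex.I
      convert! h1.cexp using 1
      ring)
    (fun x _ => (hd x).ofReal_comp) (hprod p' hp'i)
    (by
      have := (hprod p hpi).const_mul (ξ * Complex.I)
      refine this.congr (Filter.Eventually.of_forall fun x => ?_)
      simp [mul_assoc])
    (hprod p hpi)
  have e1 : |ξ| * ‖charFun (siteLaw fun x => f x + δ x) ξ‖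
      = ‖∫ x : ℝ, Complex.exp (ξ * x * Complex.I) * (p' x : ℂ)‖ := by
    rw [ibp, norm_neg, hφ]
    simp_rw [mul_assoc]
    rw [integral_const_mul, norm_mul, integral_const_mul, norm_mul]
    simp
  rw [e1]
  refine (norm_integral_le_integral_norm _).trans ?_
  simp only [norm_mul, hn, one_mul, Complex.norm_real, Real.norm_eq_abs]
  refine hp'le.trans ?_
  rw [add_div]
  refine add_le_add ?_ ?_
  · rw [div_mul_eq_mul_div, div_le_div_iff₀ hZ0 hL]
    calc Real.exp B * 2 * L = 2 * Real.exp (1 + 2 * B) * (L * Real.exp (-(1 + B))) := by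
          have : Real.exp B = Real.exp (1 + 2 * B) * Real.exp (-(1 + B)) := by
            rw [← Real.exp_add]; congr 1; ring
          rw [this]; ring
      _ ≤ _ := by gcongr
  · rw [le_div_iff₀ hL]
    have := mul_le_mul_of_nonneg_left hLM h.B_nonneg
    linarith

end SitePotential

/-- The law of a single-site potential satisfies uniform bounds depending only on the convexity
constant and the size of the perturbation. -/
theorem exists_goodLaw_siteLaw {lam B : ℝ} : ∃ K, 1 ≤ K ∧ ∃ C, ∀ {f δ : ℝ → ℝ} {x₀ : ℝ},
    SitePotential lam B f δ x₀ →
    ∃ m σ, GoodLaw K (siteLaw fun x => f x + δ x) m σ ∧ |m - x₀| ≤ C := by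
  set A := Real.exp (2 + 2 * B)
  set C' := 2 * Real.exp (1 + 2 * B) + 2 * B * √(2 / lam)
  set M := (2 * √(2 / lam)) ^ 2
  set K₁ := 80 * A + 20 * A * C' ^ 2
  have hA0 : 0 < A := Real.exp_pos _
  refine ⟨64 * A ^ 2 * K₁ + 16 * A ^ 2 * M + 10000 * A ^ 6 + Real.exp |B| , ?_,
    2 * A * (2 * √(2 / lam)), fun {f δ x₀} h => ?_⟩
  · have h1 : 1 ≤ Real.exp |B| := Real.one_le_exp (abs_nonneg _)
    have h2 : 0 ≤ K₁ := by positivity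
    have h3 : 0 ≤ M := by positivity
    have h4 : 0 ≤ 64 * A ^ 2 * K₁ + 16 * A ^ 2 * M + 10000 * A ^ 6 := by positivity
    linarith
  rw [abs_of_nonneg h.B_nonneg]
  obtain ⟨α, L, hL, hLM, h1, h2⟩ := h.exists_scale
  obtain ⟨hi, hZ1, hZ2⟩ := h.partition_bounds hL h1 h2
  have hchar := h.abs_mul_charFun_le hL h1 h2 hLM
  set Z := ∫ x, Real.exp (-(f x + δ x)) with hZ
  have hZ0 : 0 < Z := lt_of_lt_of_le (by positivity) hZ1
  have hA : 1 ≤ A := Real.one_le_exp (by linarith [h.B_nonneg])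
  set p : ℝ → ℝ := fun x => Real.exp (-(f x + δ x)) / Z with hp
  have hpc : Continuous p :=
    (h.diff.continuous.add h.pert_diff.continuous).neg.rexp.div_const _
  have hp0 : ∀ x, 0 ≤ p x := fun x => by positivity
  have hp1 : ∫ x, p x = 1 := by
    simp only [hp]; rw [integral_div, ← hZ, div_self hZ0.ne']
  have hprob : IsProbabilityMeasure (siteLaw fun x => f x + δ x) := ⟨by
    rw [siteLaw, withDensity_apply _ MeasurableSet.univ, Measure.restrict_univ,
      ← ofReal_integral_eq_lintegral_ofReal (hi.div_const _)
      (Filter.Eventually.of_forall hp0), hp1, ENNReal.ofReal_one]⟩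
  have hDB : DensityBounds A C' L x₀ α p (siteLaw fun x => f x + δ x) := by
    refine ⟨hA, hL, hpc.measurable, hp0, hprob, rfl, fun x => ?_, fun x hx => ?_, hchar⟩
    · rw [div_mul_eq_mul_div]
      simp only [hp]
      rw [div_le_div_iff₀ hZ0 hL]
      have e1 : Real.exp (-(f x + δ x))
          ≤ Real.exp (1 + B) * Real.exp (-(1 / L * |x - x₀|)) := by
        have := abs_le.1 (h.pert_le x)
        rw [← Real.exp_add]
        exact Real.exp_le_exp.2 (by linarith [h2 x])
      calc _ ≤ Real.exp (1 + B) * Real.exp (-(1 / L * |x - x₀|)) * L := by gcongr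
        _ = A * Real.exp (-(1 / L * |x - x₀|)) * (L * Real.exp (-(1 + B))) := by
          have : Real.exp (1 + B) = A * Real.exp (-(1 + B)) := by
            simp only [A]
            rw [← Real.exp_add]; congr 1; ring
          rw [this]; ring
        _ ≤ _ := by gcongr
    · simp only [hp]
      rw [div_le_div_iff₀ (by positivity) hZ0]
      have e1 : Real.exp (-(1 + B)) ≤ Real.exp (-(f x + δ x)) := by
        have := abs_le.1 (h.pert_le x)
        exact Real.exp_le_exp.2 (by linarith [h1 x hx])
      calc 1 * Z ≤ 2 * L * Real.exp (1 + B) := by linarith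
        _ = Real.exp (-(1 + B)) * (2 * A * L) := by
          have : Real.exp (1 + B) = A * Real.exp (-(1 + B)) := by
            simp only [A]
            rw [← Real.exp_add]; congr 1; ring
          rw [this]; ring
        _ ≤ _ := by gcongr
  have hK₁ : 80 * A ≤ K₁ := le_add_of_nonneg_right (by positivity)
  have hq : ∃ q : ℝ → ℝ, Measurable q ∧ (∀ x, 0 ≤ q x) ∧
      (∀ x y, q x * q y ≤ q ((x + y) / 2) ^ 2) ∧
      ∀ x, (Real.exp B)⁻¹ * q x ≤ p x ∧ p x ≤ Real.exp B * q x := by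
    refine ⟨fun x => Real.exp (-f x) / Z, (h.diff.continuous.neg.rexp.div_const _).measurable,
      fun x => by positivity, fun x y => ?_, fun x => ?_⟩
    · obtain ⟨-, hc⟩ := h.convexOn
      have := @hc x trivial y trivial (1 / 2) (1 / 2) (by norm_num) (by norm_num) (by norm_num)
      simp only [smul_eq_mul] at this
      rw [show 1 / 2 * x + 1 / 2 * y = (x + y) / 2 by ring] at this
      rw [div_mul_div_comm, div_pow, ← sq, ← Real.exp_add, ← Real.exp_nat_mul]
      gcongr
      push_cast; linarith
    · obtain ⟨e1, e2⟩ := h.exp_bounds x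
      rw [← Real.exp_neg]
      simp only [hp, mul_div_assoc']
      exact ⟨by gcongr, by gcongr⟩
  obtain ⟨m, σ, hg, hm⟩ := hDB.goodLaw (M := M) (B' := Real.exp B) (K₁ := K₁)
    (pow_le_pow_left₀ hL.le hLM 2) hK₁ (by simp only [K₁]; linarith) (Real.one_le_exp h.B_nonneg)
    le_rfl hq
  exact ⟨m, σ, hg, hm.trans (by gcongr)⟩

/-- `F + D` with `F` strongly convex and `D` bounded in `C¹`. -/
structure ConvexPert (lam B : ℝ) (F D : ℝ → ℝ) : Prop where
  lam_pos : 0 < lam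
  diff : Differentiable ℝ F
  cont_deriv : Continuous (deriv F)
  mono : ∀ x y, x ≤ y → lam * (y - x) ≤ deriv F y - deriv F x
  B_nonneg : 0 ≤ B
  pert_diff : Differentiable ℝ D
  pert_le : ∀ x, |D x| ≤ B
  deriv_pert_le : ∀ x, |deriv D x| ≤ B

lemma siteLaw_add_const (W : ℝ → ℝ) (c : ℝ) : siteLaw (fun x => W x + c) = siteLaw W := by
  unfold siteLaw
  simp_rw [neg_add, Real.exp_add, integral_mul_const]
  congr 1; ext x
  rw [mul_div_mul_right _ _ (Real.exp_pos _).ne']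

lemma siteLaw_eq_tilted (W : ℝ → ℝ) : siteLaw W = volume.tilted (fun x => -W x) := rfl

namespace ConvexPert

variable {lam B : ℝ} {F D : ℝ → ℝ}

lemma tilt (h : ConvexPert lam B F D) (θ : ℝ) :
    ConvexPert lam B (fun x => F x + θ * x) D := by
  have hd : ∀ x, HasDerivAt (fun x => F x + θ * x) (deriv F x + θ) x := fun x => by
    simpa using! (h.diff x).hasDerivAt.add ((hasDerivAt_id x).const_mul θ)
  have hd' : deriv (fun x => F x + θ * x) = fun x => deriv F x + θ := by
    ext x; exact (hd x).deriv
  refine ⟨h.lam_pos, fun x => (hd x).differentiableAt, ?_, fun x y hxy => ?_, h.B_nonneg,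
    h.pert_diff, h.pert_le, h.deriv_pert_le⟩
  · rw [hd']; exact h.cont_deriv.add continuous_const
  · rw [hd']; simpa using h.mono x y hxy

lemma exists_crit (h : ConvexPert lam B F D) : ∃ x, deriv F x = 0 := by
  set r := |deriv F 0| / lam with hr
  have hr0 : 0 ≤ r := by have := h.lam_pos; positivity
  have e : lam * r = |deriv F 0| := mul_div_cancel₀ _ h.lam_pos.ne'
  refine mem_range_of_exists_le_of_exists_ge h.cont_deriv ⟨-r, ?_⟩ ⟨r, ?_⟩
  · have := h.mono (-r) 0 (by linarith)
    linarith [le_abs_self (deriv F 0)]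
  · have := h.mono 0 r hr0
    linarith [neg_abs_le (deriv F 0)]

lemma sitePotential (h : ConvexPert lam B F D) {x₀ : ℝ} (hx : deriv F x₀ = 0) :
    SitePotential lam B (fun x => F x - F x₀) D x₀ := by
  refine ⟨⟨h.lam_pos, h.diff.sub_const _, fun x y hxy => ?_, ?_, ?_⟩, h.B_nonneg, h.pert_diff,
    h.pert_le, h.deriv_pert_le⟩
  · simpa using h.mono x y hxy
  · simpa using hx
  · simp

lemma le_crit (h : ConvexPert lam B F D) {x₀ T : ℝ} (hx : deriv F x₀ = 0) (hT : deriv F T ≤ 0) :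
    T ≤ x₀ := by
  by_contra! hlt
  have := h.mono x₀ T hlt.le
  nlinarith [mul_pos h.lam_pos (sub_pos.2 hlt)]

lemma crit_le (h : ConvexPert lam B F D) {x₀ T : ℝ} (hx : deriv F x₀ = 0) (hT : 0 ≤ deriv F T) :
    x₀ ≤ T := by
  by_contra! hlt
  have := h.mono T x₀ hlt.le
  nlinarith [mul_pos h.lam_pos (sub_pos.2 hlt)]

lemma integrable_exp (h : ConvexPert lam B F D) :
    Integrable (fun x => Real.exp (-(F x + D x))) := by
  obtain ⟨x₀, hx₀⟩ := h.exists_crit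
  have hs := h.sitePotential hx₀
  obtain ⟨α, L, hL, -, h1, h2⟩ := hs.exists_scale
  have := (hs.partition_bounds hL h1 h2).1
  refine (this.mul_const (Real.exp (-F x₀))).congr (Filter.Eventually.of_forall fun x => ?_)
  simp only [← Real.exp_add]; congr 1; ring

lemma siteLaw_tilt (h : ConvexPert lam B F D) (θ : ℝ) :
    siteLaw (fun x => F x + θ * x + D x)
      = (siteLaw fun x => F x + D x).tilted (fun x => -θ * x) := by
  rw [siteLaw_eq_tilted, siteLaw_eq_tilted, tilted_tilted h.integrable_exp]
  congr 1; ext x; simp only [Pi.add_apply]; ring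

lemma continuous_mean (h : ConvexPert lam B F D) :
    Continuous fun θ => ∫ x, x ∂(siteLaw fun x => F x + θ * x + D x) := by
  set ν := siteLaw fun x => F x + D x with hν
  have hset : ProbabilityTheory.integrableExpSet (fun x : ℝ => x) ν = Set.univ := by
    refine Set.eq_univ_of_forall fun t => ?_
    change Integrable (fun x => Real.exp (t * x)) ν
    rw [hν, siteLaw_eq_tilted, integrable_tilted_iff h.integrable_exp]
    refine (h.tilt (-t)).integrable_exp.congr (Filter.Eventually.of_forall fun x => ?_)
    simp only [smul_eq_mul, ← Real.exp_add]; congr 1; ring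
  have hint : ∀ t, t ∈ interior (ProbabilityTheory.integrableExpSet (fun x : ℝ => x) ν) :=
    fun t => by rw [hset]; simp
  have e : (fun θ => ∫ x, x ∂(siteLaw fun x => F x + θ * x + D x))
      = fun θ => deriv (ProbabilityTheory.cgf (fun x : ℝ => x) ν) (-θ) := by
    ext θ
    rw [h.siteLaw_tilt, ← ProbabilityTheory.integral_tilted_mul_self (hint (-θ))]
  rw [e, continuous_iff_continuousAt]
  exact fun θ => ContinuousAt.comp (f := fun θ : ℝ => -θ)
    (ProbabilityTheory.analyticAt_cgf (hint (-θ))).deriv.continuousAt continuousAt_neg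

end ConvexPert

/-- Any family of perturbed strongly convex potentials can be tilted by a common linear field so
that its laws have a prescribed total mean, with uniform bounds on the tilted laws. -/
theorem exists_tilt_goodLaw (lam B : ℝ) : ∃ K, 1 ≤ K ∧ ∀ {ι : Type} [Fintype ι] [Nonempty ι]
    {F D : ι → ℝ → ℝ}, (∀ i, ConvexPert lam B (F i) (D i)) → ∀ s : ℝ, ∃ (θ : ℝ) (m σ : ι → ℝ),
    (∀ i, GoodLaw K (siteLaw fun x => F i x + θ * x + D i x) (m i) (σ i)) ∧ ∑ i, m i = s := by
  obtain ⟨K, hK, C, hC⟩ := exists_goodLaw_siteLaw (lam := lam) (B := B)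
  refine ⟨K, hK, fun {ι _ _ F D} h s => ?_⟩
  have key : ∀ θ i, ∃ x₀ m σ, deriv (fun x => F i x + θ * x) x₀ = 0 ∧ |m - x₀| ≤ C ∧
      GoodLaw K (siteLaw fun x => F i x + θ * x + D i x) m σ := fun θ i => by
    obtain ⟨x₀, hx₀⟩ := ((h i).tilt θ).exists_crit
    obtain ⟨m, σ, hg, hm⟩ := hC (((h i).tilt θ).sitePotential hx₀)
    refine ⟨x₀, m, σ, hx₀, hm, ?_⟩
    rw [← siteLaw_add_const _ (F i x₀ + θ * x₀)] at hg
    convert hg using 3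
    ring
  choose x₀ m σ hx₀ hm hg using key
  have hderiv : ∀ θ i T, deriv (fun x => F i x + θ * x) T = deriv (F i) T + θ := fun θ i T => by
    have := ((h i).diff T).hasDerivAt.add ((hasDerivAt_id T).const_mul θ)
    simpa using! this.deriv
  have hcont : Continuous fun θ => ∑ i, m θ i := by
    have e : (fun θ => ∑ i, m θ i)
        = fun θ => ∑ i, ∫ x, x ∂(siteLaw fun x => F i x + θ * x + D i x) := by
      ext θ; exact Finset.sum_congr rfl fun i _ => (hg θ i).mean.symm
    rw [e]
    exact continuous_finsetSum _ fun i _ => (h i).continuous_mean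
  have hcard : (0 : ℝ) < Fintype.card ι := by exact_mod_cast Fintype.card_pos
  obtain ⟨θ, hθ⟩ := mem_range_of_exists_le_of_exists_ge (c := s) hcont (by
    set T := s / Fintype.card ι - C with hT
    obtain ⟨j, -, hj⟩ := Finset.exists_min_image Finset.univ (fun i => deriv (F i) T)
      Finset.univ_nonempty
    refine ⟨-deriv (F j) T, ?_⟩
    have : ∀ i, m (-deriv (F j) T) i ≤ s / Fintype.card ι := fun i => by
      have h1 := ((h i).tilt (-deriv (F j) T)).crit_le (hx₀ _ i) (T := T) (by
        rw [hderiv]; linarith [hj i (Finset.mem_univ i)])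
      linarith [(abs_le.1 (hm (-deriv (F j) T) i)).2]
    refine (Finset.sum_le_sum fun i _ => this i).trans (le_of_eq ?_)
    rw [Finset.sum_const, Finset.card_univ, nsmul_eq_mul, mul_div_cancel₀ _ hcard.ne']) (by
    set T := s / Fintype.card ι + C with hT
    obtain ⟨j, -, hj⟩ := Finset.exists_max_image Finset.univ (fun i => deriv (F i) T)
      Finset.univ_nonempty
    refine ⟨-deriv (F j) T, ?_⟩
    have : ∀ i, s / Fintype.card ι ≤ m (-deriv (F j) T) i := fun i => by
      have h1 := ((h i).tilt (-deriv (F j) T)).le_crit (hx₀ _ i) (T := T) (by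
        rw [hderiv]; linarith [hj i (Finset.mem_univ i)])
      linarith [(abs_le.1 (hm (-deriv (F j) T) i)).1]
    refine le_trans (le_of_eq ?_) (Finset.sum_le_sum fun i _ => this i)
    rw [Finset.sum_const, Finset.card_univ, nsmul_eq_mul, mul_div_cancel₀ _ hcard.ne'])
  exact ⟨θ, m θ, σ θ, hg θ, hθ⟩

namespace GoodFam

open ProbabilityTheory

variable {Ω ι : Type*} [MeasurableSpace Ω] {K : ℝ} {μ : Measure Ω} [IsProbabilityMeasure μ]
  {X : ι → Ω → ℝ} {m σ : ι → ℝ}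

lemma integrable_wsum_sq_mul_gwin (h : GoodFam K μ X m σ) (A B : Finset ι) (u : ι → ℝ) {k : ℝ}
    (hk : 0 < k) (y : ℝ) :
    Integrable (fun ω => (∑ i ∈ B, u i * (X i ω - m i)) ^ 2 * gwin k (∑ i ∈ A, X i ω - y)) μ := by
  have hm := h.measurable_sum A
  have h2 := (h.memLp_wsum B u).integrable_sq
  refine h2.mono' (h2.aestronglyMeasurable.mul
    ((measurable_gwin k).comp (hm.sub_const y)).aestronglyMeasurable)
    (Filter.Eventually.of_forall fun ω => ?_)
  rw [Real.norm_of_nonneg (mul_nonneg (sq_nonneg _) (gwin_nonneg _ _))]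
  exact mul_le_of_le_one_right (sq_nonneg _) (gwin_le_one hk.le _)

/-- Smoothing by one block bounds the windowed second moment of the complementary block. -/
lemma wsum_sq_mul_gwin_le (h : GoodFam K μ X m σ) {A B : Finset ι} (hAB : Disjoint A B)
    (hA : 0 < ∑ i ∈ A, σ i ^ 2) (u : ι → ℝ) {k : ℝ} (hk : 0 < k) (y : ℝ) :
    ∫ ω, (∑ i ∈ B, u i * (X i ω - m i)) ^ 2 * gwin k (∑ i ∈ A, X i ω + ∑ i ∈ B, X i ω - y) ∂μ ≤
      6 * K / (√k * √(∑ i ∈ A, σ i ^ 2)) * ∑ i ∈ B, u i ^ 2 * σ i ^ 2 := by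
  rw [← h.integral_wsum_sq B u]
  have e1 : ∀ ω, ∑ i ∈ B, u i * (X i ω - m i) = ∑ i : B, u i * (X i ω - m i) := fun ω =>
    (Finset.sum_coe_sort B fun i => u i * (X i ω - m i)).symm
  have e2 : ∀ ω, ∑ i ∈ B, X i ω = ∑ i : B, X i ω := fun ω =>
    (Finset.sum_coe_sort B fun i => X i ω).symm
  have hi := (h.memLp_wsum B u).integrable_sq
  simp only [e1] at hi
  simp only [e1, e2]
  have hg := measurable_gwin k
  refine (h.indepFun_sum_restrict hAB).integral_mul_le (h.measurable_sum A)
    (h.measurable_restrict B) (g := fun s (x : B → ℝ) => gwin k (s + ∑ i : B, x i - y))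
    (hg.comp (by fun_prop)) (fun _ _ => gwin_nonneg _ _)
    (fun _ _ => gwin_le_one hk.le _)
    (h := fun x : B → ℝ => (∑ i : B, u i * (x i - m i)) ^ 2) (by fun_prop) (fun _ => sq_nonneg _)
    hi fun x => ?_
  rw [le_div_iff₀ (by positivity)]
  have := h.integral_gwin_sum_le A hk (y - ∑ i : B, x i)
  have e : ∀ ω, ∑ i ∈ A, X i ω + ∑ i : B, x i - y = ∑ i ∈ A, X i ω - (y - ∑ i : B, x i) :=
    fun ω => by ring
  simpa only [e] using this

end GoodFam

namespace GoodFam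

open ProbabilityTheory

/-- The upper half of the windowed variance bound. -/
lemma exists_integral_sq_mul_gwin_le {Ω ι : Type*} [MeasurableSpace Ω] {K : ℝ} {μ : Measure Ω}
    [IsProbabilityMeasure μ] {X : ι → Ω → ℝ} {m σ : ι → ℝ} [Fintype ι] [Nonempty ι]
    (h : GoodFam K μ X m σ) (v : ι → ℝ) : ∃ c : ℝ, ∀ k, 0 < k → ∀ y,
      ∫ ω, (∑ i, (v i - c) * (X i ω - m i)) ^ 2 * gwin k (∑ i, X i ω - y) ∂μ ≤
        624 * K ^ 2 / (√k * √(∑ i, σ i ^ 2)) * ∑ i, v i ^ 2 := by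
  classical
  have hK1 := h.one_le
  have hK : 0 < K := zero_lt_one.trans_le h.one_le
  obtain ⟨V, hV⟩ : ∃ V, V = ∑ i, σ i ^ 2 := ⟨_, rfl⟩
  have hσ : ∀ i, 0 < σ i := fun i => (h.good i).pos
  have hV0 : 0 < V := by
    rw [hV]; exact Finset.sum_pos (fun i _ => pow_pos (hσ i) 2) Finset.univ_nonempty
  have hsV : 0 < √V := Real.sqrt_pos.2 hV0
  have hS : 0 ≤ ∑ i, v i ^ 2 := Finset.sum_nonneg fun i _ => sq_nonneg _
  rw [← hV]
  by_cases hdom : ∃ i, V < 12 * σ i ^ 2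
  · obtain ⟨i, hi⟩ := hdom
    refine ⟨v i, fun k hk y => ?_⟩
    have hk' : 0 < √k := Real.sqrt_pos.2 hk
    have hd : Disjoint {i} (Finset.univ.erase i) := by simp
    have key := h.wsum_sq_mul_gwin_le hd (by simpa using pow_pos (hσ i) 2) (fun j => v j - v i)
      hk y
    have e1 : ∀ ω, ∑ j, (v j - v i) * (X j ω - m j) =
        ∑ j ∈ Finset.univ.erase i, (v j - v i) * (X j ω - m j) := fun ω => by
      rw [← Finset.add_sum_erase _ _ (Finset.mem_univ i)]; simp
    have e2 : ∀ ω, ∑ j, X j ω = ∑ j ∈ {i}, X j ω + ∑ j ∈ Finset.univ.erase i, X j ω := fun ω => by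
      rw [← Finset.add_sum_erase _ _ (Finset.mem_univ i)]; simp
    simp only [e1, e2]
    refine key.trans ?_
    rw [Finset.sum_singleton, Real.sqrt_sq (hσ i).le]
    have hvi : v i ^ 2 ≤ ∑ j, v j ^ 2 :=
      Finset.single_le_sum (f := fun j => v j ^ 2) (fun j _ => sq_nonneg _) (Finset.mem_univ i)
    have hsum : ∑ j ∈ Finset.univ.erase i, (v j - v i) ^ 2 * σ j ^ 2 ≤ 26 * K * ∑ j, v j ^ 2 := by
      calc ∑ j ∈ Finset.univ.erase i, (v j - v i) ^ 2 * σ j ^ 2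
          ≤ ∑ j, (v j - v i) ^ 2 * σ j ^ 2 :=
            Finset.sum_le_sum_of_subset_of_nonneg (Finset.subset_univ _)
              fun j _ _ => by positivity
        _ ≤ ∑ j, (2 * K * v j ^ 2 + 2 * v i ^ 2 * σ j ^ 2) := by
            refine Finset.sum_le_sum fun j _ => ?_
            have h1 := (h.good j).var_le
            have h2 : (v j - v i) ^ 2 ≤ 2 * v j ^ 2 + 2 * v i ^ 2 := by
              nlinarith [sq_nonneg (v j + v i)]
            nlinarith [mul_le_mul_of_nonneg_right h2 (sq_nonneg (σ j)),
              mul_le_mul_of_nonneg_left h1 (sq_nonneg (v j))]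
        _ = 2 * K * ∑ j, v j ^ 2 + 2 * v i ^ 2 * V := by
            rw [Finset.sum_add_distrib, ← Finset.mul_sum, ← Finset.mul_sum, hV]
        _ ≤ 26 * K * ∑ j, v j ^ 2 := by
            have h1 := (h.good i).var_le
            have h2 : V ≤ 12 * K := by linarith
            nlinarith [mul_le_mul_of_nonneg_left h2 (sq_nonneg (v i)),
              mul_le_mul_of_nonneg_right hvi hK.le]
    have hsq : √V ≤ 4 * σ i := by
      rw [Real.sqrt_le_left (by have := hσ i; positivity)]
      nlinarith [sq_nonneg (σ i)]
    calc 6 * K / (√k * σ i) * ∑ j ∈ Finset.univ.erase i, (v j - v i) ^ 2 * σ j ^ 2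
        ≤ 6 * K / (√k * (√V / 4)) * (26 * K * ∑ j, v j ^ 2) := by
          gcongr
          linarith
      _ = _ := by field_simp; ring
  · push Not at hdom
    refine ⟨0, fun k hk y => ?_⟩
    have hk' : 0 < √k := Real.sqrt_pos.2 hk
    obtain ⟨A, hA1, hA2⟩ : ∃ A : Finset ι, V / 3 ≤ ∑ i ∈ A, σ i ^ 2 ∧
        ∑ i ∈ A, σ i ^ 2 ≤ 2 * V / 3 := by
      obtain ⟨A, hA, hmax⟩ := (Finset.univ.filter fun A : Finset ι =>
        ∑ i ∈ A, σ i ^ 2 ≤ 2 * V / 3).exists_max_image (fun A => ∑ i ∈ A, σ i ^ 2)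
        ⟨∅, by simp; positivity⟩
      simp only [Finset.mem_filter, Finset.mem_univ, true_and] at hA hmax
      refine ⟨A, ?_, hA⟩
      obtain ⟨j, hj⟩ : ∃ j, j ∉ A := by
        by_contra hcon
        push Not at hcon
        have : A = Finset.univ := Finset.eq_univ_iff_forall.2 hcon
        rw [this, ← hV] at hA
        linarith
      by_contra hcon
      push Not at hcon
      have hj1 : ∑ i ∈ insert j A, σ i ^ 2 = σ j ^ 2 + ∑ i ∈ A, σ i ^ 2 := Finset.sum_insert hj
      have := hdom j
      have h1 := hmax (insert j A) (by rw [hj1]; linarith)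
      rw [hj1] at h1
      have := pow_pos (hσ j) 2
      linarith
    have hA3 : V / 3 ≤ ∑ i ∈ Aᶜ, σ i ^ 2 := by
      have := Finset.sum_add_sum_compl A fun i => σ i ^ 2
      rw [← hV] at this
      linarith
    have hblock : ∀ A B : Finset ι, Disjoint A B → V / 3 ≤ ∑ i ∈ A, σ i ^ 2 →
        (∀ ω, ∑ i ∈ A, X i ω + ∑ i ∈ B, X i ω = ∑ i, X i ω) →
        ∫ ω, (∑ i ∈ B, v i * (X i ω - m i)) ^ 2 * gwin k (∑ i, X i ω - y) ∂μ ≤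
          12 * K ^ 2 / (√k * √V) * ∑ i, v i ^ 2 := by
      intro A B hAB hA he
      have key := h.wsum_sq_mul_gwin_le hAB (by linarith) v hk y
      simp only [he] at key
      refine key.trans ?_
      have h1 : ∑ i ∈ B, v i ^ 2 * σ i ^ 2 ≤ K * ∑ i, v i ^ 2 := by
        rw [Finset.mul_sum]
        refine (Finset.sum_le_sum_of_subset_of_nonneg (Finset.subset_univ _)
          fun j _ _ => by positivity).trans (Finset.sum_le_sum fun j _ => ?_)
        rw [mul_comm]
        exact mul_le_mul_of_nonneg_right (h.good j).var_le (sq_nonneg _)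
      have h2 : √V / 2 ≤ √(∑ i ∈ A, σ i ^ 2) := by
        refine Real.le_sqrt_of_sq_le ?_
        rw [div_pow, Real.sq_sqrt hV0.le]
        linarith
      calc _ ≤ 6 * K / (√k * (√V / 2)) * (K * ∑ i, v i ^ 2) := by gcongr
        _ = _ := by field_simp; ring
    have b1 := hblock A Aᶜ disjoint_compl_right hA1 fun ω => Finset.sum_add_sum_compl A _
    have b2 := hblock Aᶜ A disjoint_compl_left hA3 fun ω => by
      rw [add_comm]; exact Finset.sum_add_sum_compl A _
    have i1 := h.integrable_wsum_sq_mul_gwin Finset.univ A v hk y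
    have i2 := h.integrable_wsum_sq_mul_gwin Finset.univ Aᶜ v hk y
    calc ∫ ω, (∑ i, (v i - 0) * (X i ω - m i)) ^ 2 * gwin k (∑ i, X i ω - y) ∂μ
        ≤ ∫ ω, (2 * ((∑ i ∈ A, v i * (X i ω - m i)) ^ 2 * gwin k (∑ i, X i ω - y)) +
          2 * ((∑ i ∈ Aᶜ, v i * (X i ω - m i)) ^ 2 * gwin k (∑ i, X i ω - y))) ∂μ := by
          refine integral_mono (h.integrable_wsum_sq_mul_gwin Finset.univ Finset.univ _ hk y)
            ((i1.const_mul 2).add (i2.const_mul 2)) fun ω => ?_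
          dsimp only
          rw [← Finset.sum_add_sum_compl A fun i => (v i - 0) * (X i ω - m i)]
          simp only [sub_zero]
          have := gwin_nonneg k (∑ i, X i ω - y)
          nlinarith [mul_nonneg (sq_nonneg (∑ i ∈ A, v i * (X i ω - m i) -
            ∑ i ∈ Aᶜ, v i * (X i ω - m i))) this]
      _ ≤ 2 * (12 * K ^ 2 / (√k * √V) * ∑ i, v i ^ 2) +
          2 * (12 * K ^ 2 / (√k * √V) * ∑ i, v i ^ 2) := by
          rw [integral_add (f := fun ω => 2 * ((∑ i ∈ A, v i * (X i ω - m i)) ^ 2 *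
            gwin k (∑ i, X i ω - y))) (i1.const_mul 2) (i2.const_mul 2), integral_const_mul,
            integral_const_mul]
          linarith
      _ = 48 * (K ^ 2 / (√k * √V) * ∑ i, v i ^ 2) := by ring
      _ ≤ 624 * (K ^ 2 / (√k * √V) * ∑ i, v i ^ 2) := by
          refine mul_le_mul_of_nonneg_right (by norm_num) (by positivity)
      _ = _ := by ring

/-- Variance bound for linear statistics conditioned on a thin window around the mean of the
sum. -/
theorem exists_window_variance_le {K : ℝ} (hK : 1 ≤ K) : ∃ C : ℝ, 0 < C ∧ ∃ k₁ : ℝ, 0 < k₁ ∧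
    ∀ {Ω ι : Type} [MeasurableSpace Ω] {μ : Measure Ω} [IsProbabilityMeasure μ]
      {X : ι → Ω → ℝ} {m σ : ι → ℝ} [Fintype ι] [Nonempty ι] (_ : GoodFam K μ X m σ)
      (v : ι → ℝ), ∃ c : ℝ, ∀ k, k₁ ≤ k * ∑ i, σ i ^ 2 →
      ∫ ω, (∑ i, (v i - c) * (X i ω - m i)) ^ 2 * gwin k (∑ i, X i ω - ∑ i, m i) ∂μ ≤
        C * (∑ i, v i ^ 2) * ∫ ω, gwin k (∑ i, X i ω - ∑ i, m i) ∂μ := by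
  obtain ⟨c, hc, k₁, hk₁, H⟩ := exists_le_integral_gwin_sum hK
  refine ⟨624 * K ^ 2 / c, by positivity, k₁, hk₁, ?_⟩
  intro Ω ι _ μ _ X m σ _ _ h v
  obtain ⟨d, hd⟩ := h.exists_integral_sq_mul_gwin_le v
  refine ⟨d, fun k hk => ?_⟩
  have hV0 : 0 < ∑ i, σ i ^ 2 :=
    Finset.sum_pos (fun i _ => pow_pos (h.good i).pos 2) Finset.univ_nonempty
  have hk0 : 0 < k := by
    by_contra hcon
    push Not at hcon
    nlinarith
  have h1 := hd k hk0 (∑ i, m i)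
  have h2 := H h Finset.univ k hV0 hk
  have hS : 0 ≤ ∑ i, v i ^ 2 := Finset.sum_nonneg fun i _ => sq_nonneg _
  have hq : 0 < √k * √(∑ i, σ i ^ 2) := by positivity
  refine h1.trans ?_
  rw [div_mul_eq_mul_div, div_le_iff₀ hq]
  have : 624 * K ^ 2 * (∑ i, v i ^ 2) * c ≤ 624 * K ^ 2 * (∑ i, v i ^ 2) *
      (√k * √(∑ i, σ i ^ 2) * ∫ ω, gwin k (∑ i, X i ω - ∑ i, m i) ∂μ) := by
    gcongr
  calc _ = 624 * K ^ 2 * (∑ i, v i ^ 2) * c / c := by field_simp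
    _ ≤ 624 * K ^ 2 * (∑ i, v i ^ 2) *
      (√k * √(∑ i, σ i ^ 2) * ∫ ω, gwin k (∑ i, X i ω - ∑ i, m i) ∂μ) / c := by gcongr
    _ = _ := by ring

end GoodFam

lemma pi_withDensity_ofReal {ι : Type*} [Fintype ι] {p : ι → ℝ → ℝ} (hp : ∀ i x, 0 ≤ p i x)
    (hi : ∀ i, Integrable (p i)) :
    Measure.pi (fun i => volume.withDensity fun x => ENNReal.ofReal (p i x)) =
      volume.withDensity fun x : ι → ℝ => ENNReal.ofReal (∏ i, p i (x i)) := by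
  have : ∀ i, IsFiniteMeasure (volume.withDensity fun x => ENNReal.ofReal (p i x)) := fun i =>
    isFiniteMeasure_withDensity_ofReal (hi i).2
  refine Measure.pi_eq fun s hs => ?_
  have h0 : ∀ i x, 0 ≤ (s i).indicator (p i) x := fun i => Set.indicator_nonneg fun x _ => hp i x
  have h1 : ∀ i, Integrable ((s i).indicator (p i)) := fun i => (hi i).indicator (hs i)
  have e1 : ∀ i, (volume.withDensity fun x => ENNReal.ofReal (p i x)) (s i) =
      ENNReal.ofReal (∫ x, (s i).indicator (p i) x) := fun i => by
    rw [withDensity_apply _ (hs i), ← lintegral_indicator (hs i),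
      ofReal_integral_eq_lintegral_ofReal (h1 i) (Filter.Eventually.of_forall (h0 i))]
    congr 1; ext x
    by_cases hx : x ∈ s i <;> simp [hx]
  have hS : MeasurableSet (Set.univ.pi s) := MeasurableSet.univ_pi hs
  rw [withDensity_apply _ hS, ← lintegral_indicator hS]
  simp_rw [e1]
  rw [← ENNReal.ofReal_prod_of_nonneg fun i _ => integral_nonneg (h0 i),
    ← integral_fintype_prod_volume_eq_prod, ofReal_integral_eq_lintegral_ofReal (μ := volume)
      (f := fun x : ι → ℝ => ∏ i, (s i).indicator (p i) (x i)) (Integrable.fintype_prod h1)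
      (Filter.Eventually.of_forall fun x => Finset.prod_nonneg fun i _ => h0 i _)]
  congr 1; ext x
  by_cases hx : x ∈ Set.univ.pi s
  · rw [Set.indicator_of_mem hx]
    congr 1
    refine Finset.prod_congr rfl fun i _ => ?_
    rw [Set.indicator_of_mem (hx i trivial)]
  · rw [Set.indicator_of_notMem hx]
    obtain ⟨i, hi⟩ : ∃ i, x i ∉ s i := by simpa [Set.mem_pi] using hx
    rw [Finset.prod_eq_zero (Finset.mem_univ i) (Set.indicator_of_notMem hi _), ENNReal.ofReal_zero]

/-- The point of `ℝ^(n+1)` with coordinate sum `s` and last `n` coordinates `y`. -/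
def slice {n : ℕ} (s : ℝ) (y : Fin n → ℝ) : Fin (n + 1) → ℝ :=
  Fin.cons (s - ∑ i, y i) y

lemma slice_zero {n : ℕ} (s : ℝ) (y : Fin n → ℝ) : slice s y 0 = s - ∑ i, y i := rfl

lemma slice_succ {n : ℕ} (s : ℝ) (y : Fin n → ℝ) (i : Fin n) : slice s y i.succ = y i := rfl

lemma sum_slice {n : ℕ} (s : ℝ) (y : Fin n → ℝ) : ∑ i, slice s y i = s := by
  rw [Fin.sum_univ_succ]; simp [slice_zero, slice_succ]

lemma continuous_uncurry_slice {n : ℕ} :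
    Continuous fun q : ℝ × (Fin n → ℝ) => slice q.1 q.2 := by
  refine continuous_pi fun i => ?_
  refine Fin.cases ?_ (fun i => ?_) i
  · simp only [slice_zero]; fun_prop
  · simp only [slice_succ]; fun_prop

lemma continuous_slice {n : ℕ} (s : ℝ) : Continuous fun y : Fin n → ℝ => slice s y :=
  continuous_uncurry_slice.comp (by fun_prop : Continuous fun y : Fin n → ℝ => (s, y))

lemma lintegral_eq_lintegral_slice {n : ℕ} {f : (Fin (n + 1) → ℝ) → ℝ≥0∞} (hf : Measurable f) :
    ∫⁻ x, f x = ∫⁻ u, ∫⁻ y : Fin n → ℝ, f (slice u y) := by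
  have hm : Measurable fun q : ℝ × (Fin n → ℝ) => f (slice q.1 q.2) :=
    hf.comp continuous_uncurry_slice.measurable
  have hm2 : Measurable fun q : ℝ × (Fin n → ℝ) => f (Fin.cons q.1 q.2) := by
    have : (fun q : ℝ × (Fin n → ℝ) => f (Fin.cons q.1 q.2)) =
        fun q : ℝ × (Fin n → ℝ) => f (slice (q.1 + ∑ i, q.2 i) q.2) := by
      ext q; simp [slice]
    rw [this]
    exact hm.comp (by fun_prop : Measurable fun q : ℝ × (Fin n → ℝ) => (q.1 + ∑ i, q.2 i, q.2))
  rw [lintegral_lintegral_swap hm.aemeasurable]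
  have h1 := ((volume_preserving_piFinSuccAbove (fun _ : Fin (n + 1) => ℝ) 0).symm).lintegral_map_equiv f
  rw [h1]
  have e : ∀ q : ℝ × (Fin n → ℝ),
      (MeasurableEquiv.piFinSuccAbove (fun _ : Fin (n + 1) => ℝ) 0).symm q = Fin.cons q.1 q.2 := by
    intro q
    simp [MeasurableEquiv.piFinSuccAbove, Fin.insertNthEquiv]
  simp_rw [e]
  rw [Measure.volume_eq_prod, lintegral_prod_symm' _ hm2]
  refine lintegral_congr fun y => ?_
  exact (lintegral_sub_right_eq_self (fun u => f (Fin.cons u y)) (∑ i, y i)).symm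

lemma lintegral_gwin_rescale {J : ℝ → ℝ≥0∞} (hJ : Measurable J) (s : ℝ) {a : ℝ} (ha : 0 < a) :
    ∫⁻ u, ENNReal.ofReal (gwin (a ^ 2) (u - s)) * J u =
      ENNReal.ofReal a⁻¹ * ∫⁻ z, ENNReal.ofReal (gwin 1 z) * J (s + z / a) := by
  have hg : ∀ k, Measurable (gwin k) := measurable_gwin
  rw [← lintegral_add_right_eq_self _ s]
  conv_lhs => rw [← Real.smul_map_volume_mul_left (inv_ne_zero ha.ne')]
  have h0 : Measurable fun x => ENNReal.ofReal (gwin (a ^ 2) (x + s - s)) * J (x + s) :=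
    ((hg _).comp (by fun_prop)).ennreal_ofReal.mul (hJ.comp (by fun_prop))
  rw [lintegral_smul_measure, lintegral_map h0 (by fun_prop), abs_of_pos (inv_pos.2 ha), smul_eq_mul]
  congr 1
  refine lintegral_congr fun z => ?_
  have e1 : gwin (a ^ 2) (a⁻¹ * z + s - s) = gwin 1 z := by
    unfold gwin; congr 1; field_simp; ring
  have e2 : a⁻¹ * z + s = s + z / a := by field_simp; ring
  rw [e1, e2]

/-- Passing to the limit of a vanishing Gaussian window. -/
lemma le_mul_of_lintegral_gwin_le {J G : ℝ → ℝ≥0∞} (hJ : Measurable J) (hG : Measurable G)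
    {s k₁ : ℝ} {C M : ℝ≥0∞} (hM : M ≠ ∞)
    (H : ∀ k, k₁ ≤ k → ∫⁻ u, ENNReal.ofReal (gwin k (u - s)) * J u ≤
      C * ∫⁻ u, ENNReal.ofReal (gwin k (u - s)) * G u)
    (hJs : ∀ u : ℕ → ℝ, Filter.Tendsto u Filter.atTop (nhds s) →
      J s ≤ Filter.liminf (fun n => J (u n)) Filter.atTop)
    (hC : C ≠ ∞) (hGs : ContinuousAt G s) (hGM : ∀ u, G u ≤ M) : J s ≤ C * G s := by
  have hg : ∀ k, Measurable (gwin k) := measurable_gwin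
  have hg1 : ∫⁻ z, ENNReal.ofReal (gwin 1 z) = ENNReal.ofReal (√(2 * π)) := by
    rw [← ofReal_integral_eq_lintegral_ofReal (integrable_gwin one_pos)
      (Filter.Eventually.of_forall fun _ => gwin_nonneg _ _), integral_gwin one_pos]
    simp
  have hu : ∀ z : ℝ, Filter.Tendsto (fun n : ℕ => s + z / ((n : ℝ) + 1)) Filter.atTop (nhds s) := by
    intro z
    have := (tendsto_const_nhds (x := s)).add ((tendsto_one_div_add_atTop_nhds_zero_nat (𝕜 := ℝ)).const_mul z)
    simpa only [mul_one_div, mul_zero, add_zero] using this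
  have hmJ : ∀ n : ℕ, Measurable fun z => ENNReal.ofReal (gwin 1 z) * J (s + z / ((n : ℝ) + 1)) :=
    fun n => (hg 1).ennreal_ofReal.mul (hJ.comp (by fun_prop))
  have hmG : ∀ n : ℕ, Measurable fun z => ENNReal.ofReal (gwin 1 z) * G (s + z / ((n : ℝ) + 1)) :=
    fun n => (hg 1).ennreal_ofReal.mul (hG.comp (by fun_prop))
  have hlow : ENNReal.ofReal (√(2 * π)) * J s ≤ Filter.liminf (fun n : ℕ =>
      ∫⁻ z, ENNReal.ofReal (gwin 1 z) * J (s + z / ((n : ℝ) + 1))) Filter.atTop := by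
    refine le_trans ?_ (lintegral_liminf_le hmJ)
    rw [← hg1, ← lintegral_mul_const _ (hg 1).ennreal_ofReal]
    refine lintegral_mono fun z => ?_
    rw [ENNReal.liminf_const_mul_of_ne_zero_of_ne_top]
    · gcongr
      exact hJs _ (hu z)
    · simpa using gwin_pos 1 z
    · exact ENNReal.ofReal_ne_top
  have hup : Filter.Tendsto (fun n : ℕ =>
      C * ∫⁻ z, ENNReal.ofReal (gwin 1 z) * G (s + z / ((n : ℝ) + 1))) Filter.atTop
      (nhds (C * (ENNReal.ofReal (√(2 * π)) * G s))) := by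
    refine ENNReal.Tendsto.const_mul ?_ (Or.inr hC)
    rw [← hg1, ← lintegral_mul_const _ (hg 1).ennreal_ofReal]
    refine tendsto_lintegral_of_dominated_convergence (fun z => ENNReal.ofReal (gwin 1 z) * M) hmG
      (fun n => Filter.Eventually.of_forall fun z => by dsimp only; gcongr; exact hGM _) ?_
      (Filter.Eventually.of_forall fun z => ?_)
    · rw [lintegral_mul_const _ (hg 1).ennreal_ofReal, hg1]
      exact ENNReal.mul_ne_top ENNReal.ofReal_ne_top hM
    · exact ENNReal.Tendsto.const_mul (hGs.tendsto.comp (hu z)) (Or.inr ENNReal.ofReal_ne_top)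
  have hle : Filter.liminf (fun n : ℕ =>
      ∫⁻ z, ENNReal.ofReal (gwin 1 z) * J (s + z / ((n : ℝ) + 1))) Filter.atTop ≤
      C * (ENNReal.ofReal (√(2 * π)) * G s) := by
    rw [← hup.liminf_eq]
    refine Filter.liminf_le_liminf ?_
    obtain ⟨n₀, hn₀⟩ := exists_nat_ge k₁
    filter_upwards [Filter.eventually_ge_atTop n₀] with n hn
    have hn1 : (0 : ℝ) < (n : ℝ) + 1 := by positivity
    have hnn : (n₀ : ℝ) ≤ n := by exact_mod_cast hn
    have := H (((n : ℝ) + 1) ^ 2) (by nlinarith)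
    rw [lintegral_gwin_rescale hJ s hn1, lintegral_gwin_rescale hG s hn1, mul_left_comm] at this
    refine (ENNReal.mul_le_mul_iff_right ?_ ENNReal.ofReal_ne_top).1 this
    simpa using hn1
  have hfin := hlow.trans hle
  rw [mul_left_comm] at hfin
  refine (ENNReal.mul_le_mul_iff_right ?_ ENNReal.ofReal_ne_top).1 hfin
  have : 0 < √(2 * π) := by positivity
  exact (ENNReal.ofReal_pos.2 this).ne'

/-- A bound on windowed integrals of a product density passes to the hyperplane. -/
lemma lintegral_slice_le {n : ℕ} {p : Fin (n + 1) → ℝ → ℝ} (hp : ∀ i x, 0 ≤ p i x)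
    (hc : ∀ i, Continuous (p i)) (hi : ∀ i, Integrable (p i)) {M : ℝ} (hM : ∀ x, p 0 x ≤ M)
    {Q : (Fin (n + 1) → ℝ) → ℝ} (hQ : Continuous Q) (hQ0 : ∀ x, 0 ≤ Q x) {s k₁ C : ℝ}
    (H : ∀ k, k₁ ≤ k → ∫⁻ x, ENNReal.ofReal (Q x * gwin k (∑ i, x i - s))
        ∂(Measure.pi fun i => volume.withDensity fun x => ENNReal.ofReal (p i x)) ≤
      ENNReal.ofReal C * ∫⁻ x, ENNReal.ofReal (gwin k (∑ i, x i - s))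
        ∂(Measure.pi fun i => volume.withDensity fun x => ENNReal.ofReal (p i x))) :
    ∫⁻ y : Fin n → ℝ, ENNReal.ofReal (Q (slice s y) * ∏ i, p i (slice s y i)) ≤
      ENNReal.ofReal C * ∫⁻ y : Fin n → ℝ, ENNReal.ofReal (∏ i, p i (slice s y i)) := by
  have hP : Continuous fun x : Fin (n + 1) → ℝ => ∏ i, p i (x i) := by fun_prop
  have hP0 : ∀ x : Fin (n + 1) → ℝ, 0 ≤ ∏ i, p i (x i) := fun x =>
    Finset.prod_nonneg fun i _ => hp i _
  have hs : ∀ {R : (Fin (n + 1) → ℝ) → ℝ}, Continuous R → Measurable fun u =>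
      ∫⁻ y : Fin n → ℝ, ENNReal.ofReal (R (slice u y)) := fun {R} hR =>
    Measurable.lintegral_prod_right' (f := fun q : ℝ × (Fin n → ℝ) =>
      ENNReal.ofReal (R (slice q.1 q.2)))
      (hR.comp continuous_uncurry_slice).measurable.ennreal_ofReal
  have key : ∀ {R : (Fin (n + 1) → ℝ) → ℝ}, Continuous R → (∀ x, 0 ≤ R x) → ∀ k,
      ∫⁻ x, ENNReal.ofReal (R x * gwin k (∑ i, x i - s))
        ∂(Measure.pi fun i => volume.withDensity fun x => ENNReal.ofReal (p i x)) =
      ∫⁻ u, ENNReal.ofReal (gwin k (u - s)) *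
        ∫⁻ y : Fin n → ℝ, ENNReal.ofReal (R (slice u y) * ∏ i, p i (slice u y i)) := by
    intro R hR hR0 k
    have hg := continuous_gwin k
    have hRP : Continuous fun x => R x * ∏ i, p i (x i) := hR.mul hP
    have hm : Measurable fun x : Fin (n + 1) → ℝ =>
        ENNReal.ofReal (R x * gwin k (∑ i, x i - s)) :=
      (hR.mul (hg.comp (by fun_prop :
        Continuous fun x : Fin (n + 1) → ℝ => ∑ i, x i - s))).measurable.ennreal_ofReal
    rw [pi_withDensity_ofReal hp hi, lintegral_withDensity_eq_lintegral_mul _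
      hP.measurable.ennreal_ofReal
      hm, lintegral_eq_lintegral_slice (hP.measurable.ennreal_ofReal.mul hm)]
    refine lintegral_congr fun u => ?_
    have hm2 : Measurable fun y : Fin n → ℝ =>
        ENNReal.ofReal (R (slice u y) * ∏ i, p i (slice u y i)) :=
      (hRP.comp (continuous_slice u)).measurable.ennreal_ofReal
    rw [← lintegral_const_mul _ hm2]
    refine lintegral_congr fun y => ?_
    rw [Pi.mul_apply, ← ENNReal.ofReal_mul (hP0 _), ← ENNReal.ofReal_mul (gwin_nonneg _ _),
      sum_slice]
    congr 1; ring
  have hMnn : 0 ≤ M := (hp 0 0).trans (hM 0)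
  have hbd : ∀ u (y : Fin n → ℝ), ENNReal.ofReal (∏ i, p i (slice u y i)) ≤
      ENNReal.ofReal (M * ∏ i : Fin n, p i.succ (y i)) := fun u y => by
    refine ENNReal.ofReal_le_ofReal ?_
    rw [Fin.prod_univ_succ]
    simp only [slice_succ]
    exact mul_le_mul_of_nonneg_right (hM _) (Finset.prod_nonneg fun i _ => hp _ _)
  have hfin : ∫⁻ y : Fin n → ℝ, ENNReal.ofReal (M * ∏ i : Fin n, p i.succ (y i)) ≠ ∞ := by
    have h1 : Integrable fun y : Fin n → ℝ => ∏ i : Fin n, p i.succ (y i) :=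
      Integrable.fintype_prod (f := fun i : Fin n => p i.succ) fun i => hi _
    exact (h1.const_mul M).lintegral_lt_top.ne
  have hcont : ∀ {R : (Fin (n + 1) → ℝ) → ℝ}, Continuous R → ∀ u : ℕ → ℝ,
      Filter.Tendsto u Filter.atTop (nhds s) → ∀ y, Filter.Tendsto
      (fun j => ENNReal.ofReal (R (slice (u j) y))) Filter.atTop
      (nhds (ENNReal.ofReal (R (slice s y)))) := fun {R} hR u hu y => by
    have h1 : Continuous fun t => R (slice t y) :=
      hR.comp (continuous_uncurry_slice.comp (by fun_prop : Continuous fun t : ℝ => (t, y)))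
    exact ENNReal.tendsto_ofReal ((h1.tendsto s).comp hu)
  refine le_mul_of_lintegral_gwin_le (s := s) (k₁ := k₁) (hs (hQ.mul hP)) (hs hP) hfin (fun k hk => ?_)
    (fun u hu => ?_) ENNReal.ofReal_ne_top ?_ fun u => lintegral_mono (hbd u)
  · have h1 := key (R := fun _ => 1) continuous_const (fun _ => zero_le_one) k
    simp only [one_mul] at h1
    rw [← h1]
    refine le_trans (le_of_eq ?_) (H k hk)
    exact (key hQ hQ0 k).symm
  · refine le_trans (le_of_eq ?_) (lintegral_liminf_le fun j =>
      ((hQ.mul hP).comp (continuous_slice (u j))).measurable.ennreal_ofReal)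
    refine lintegral_congr fun y => ?_
    exact (hcont (hQ.mul hP) u hu y).liminf_eq.symm
  · rw [ContinuousAt]
    refine Filter.tendsto_of_seq_tendsto fun u hu => ?_
    exact tendsto_lintegral_of_dominated_convergence _
      (fun j => (hP.comp (continuous_slice (u j))).measurable.ennreal_ofReal)
      (fun j => Filter.Eventually.of_forall fun y => hbd _ y) hfin
      (Filter.Eventually.of_forall fun y => hcont hP u hu y)


/-- Uniform spectral bound for linear statistics of the canonical ensemble, in slice
coordinates. -/
theorem exists_lintegral_slice_sq_le (lam B : ℝ) : ∃ C, 0 < C ∧ ∀ {n : ℕ}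
    {F D : Fin (n + 1) → ℝ → ℝ}, (∀ i, ConvexPert lam B (F i) (D i)) → ∀ (s : ℝ)
    (v : Fin (n + 1) → ℝ), ∃ c : ℝ,
    ∫⁻ y : Fin n → ℝ, ENNReal.ofReal ((∑ i, v i * slice s y i - c) ^ 2 *
        Real.exp (-∑ i, (F i (slice s y i) + D i (slice s y i)))) ≤
      ENNReal.ofReal (C * ∑ i, v i ^ 2) * ∫⁻ y : Fin n → ℝ,
        ENNReal.ofReal (Real.exp (-∑ i, (F i (slice s y i) + D i (slice s y i)))) := by
  obtain ⟨K, hK, hT⟩ := exists_tilt_goodLaw lam B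
  obtain ⟨C, hC, k₁, hk₁, hW⟩ := GoodFam.exists_window_variance_le hK
  refine ⟨C, hC, fun {n F D} h s v => ?_⟩
  obtain ⟨θ, m, σ, hgood, hsum⟩ := hT h s
  obtain ⟨Z, hZdef⟩ : ∃ Z : Fin (n + 1) → ℝ, ∀ i,
      Z i = ∫ x, Real.exp (-(F i x + θ * x + D i x)) := ⟨_, fun i => rfl⟩
  have hZ : ∀ i, 0 < Z i := fun i => by
    rw [hZdef]; exact integral_exp_pos ((h i).tilt θ).integrable_exp
  obtain ⟨p, hp⟩ : ∃ p : Fin (n + 1) → ℝ → ℝ, ∀ i x,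
      p i x = Real.exp (-(F i x + θ * x + D i x)) / Z i := ⟨_, fun i x => rfl⟩
  have hlaw : ∀ i, (siteLaw fun x => F i x + θ * x + D i x) =
      volume.withDensity fun x => ENNReal.ofReal (p i x) := fun i => by
    simp only [hp, hZdef]; rfl
  have hp0 : ∀ i x, 0 ≤ p i x := fun i x => by rw [hp]; have := hZ i; positivity
  have hpc : ∀ i, Continuous (p i) := fun i => by
    have h1 := (h i).diff.continuous
    have h2 := (h i).pert_diff.continuous
    have : p i = fun x => Real.exp (-(F i x + θ * x + D i x)) / Z i := funext (hp i)
    rw [this]; fun_prop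
  have hpi : ∀ i, Integrable (p i) := fun i => by
    have : p i = fun x => Real.exp (-(F i x + θ * x + D i x)) / Z i := funext (hp i)
    rw [this]; exact ((h i).tilt θ).integrable_exp.div_const _
  obtain ⟨M, hM⟩ : ∃ M, ∀ x, p 0 x ≤ M := by
    obtain ⟨x₀, hx₀⟩ := ((h 0).tilt θ).exists_crit
    have hs := ((h 0).tilt θ).sitePotential hx₀
    refine ⟨Real.exp (B - (F 0 x₀ + θ * x₀)) / Z 0, fun x => ?_⟩
    rw [hp]
    have h1 := hs.toStrongConvexAt.nonneg x
    have h2 := abs_le.1 ((h 0).pert_le x)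
    have := hZ 0
    gcongr
    linarith
  have hprob : ∀ i, IsProbabilityMeasure (volume.withDensity fun x => ENNReal.ofReal (p i x)) :=
    fun i => by rw [← hlaw]; exact (hgood i).prob
  have hfam : GoodFam K (Measure.pi fun i => volume.withDensity fun x => ENNReal.ofReal (p i x))
      (fun i x => x i) m σ := by
    refine ⟨hK, fun i => measurable_pi_apply i, ?_, fun i => ?_⟩
    · exact ProbabilityTheory.iIndepFun_pi (X := fun _ x => x) fun i => aemeasurable_id
    · have := (measurePreserving_eval
        (fun i => volume.withDensity fun x => ENNReal.ofReal (p i x)) i).map_eq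
      have e : (fun x : Fin (n + 1) → ℝ => x i) = Function.eval i := rfl
      rw [e, this, ← hlaw]
      exact hgood i
  obtain ⟨d, hd⟩ := hW hfam v
  have hV0 : 0 < ∑ i, σ i ^ 2 :=
    Finset.sum_pos (fun i _ => pow_pos (hgood i).pos 2) Finset.univ_nonempty
  have hS : 0 ≤ ∑ i, v i ^ 2 := Finset.sum_nonneg fun i _ => sq_nonneg _
  have key := lintegral_slice_le hp0 hpc hpi hM
    (Q := fun x => (∑ i, (v i - d) * (x i - m i)) ^ 2) (by fun_prop) (fun _ => sq_nonneg _)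
    (s := s) (k₁ := k₁ / ∑ i, σ i ^ 2) (C := C * ∑ i, v i ^ 2) fun k hk => by
      have hk' : k₁ ≤ k * ∑ i, σ i ^ 2 := (div_le_iff₀ hV0).1 hk
      have hk0 : 0 < k := (div_pos hk₁ hV0).trans_le hk
      have h1 := hd k hk'
      rw [hsum] at h1
      have i1 := hfam.integrable_wsum_sq_mul_gwin Finset.univ Finset.univ (fun i => v i - d) hk0 s
      have i2 := integrable_gwin_sub hk0.le
        (Measure.pi fun i => volume.withDensity fun x => ENNReal.ofReal (p i x))
        (hfam.measurable_sum Finset.univ) s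
      rw [← ofReal_integral_eq_lintegral_ofReal i1 (Filter.Eventually.of_forall fun x =>
        mul_nonneg (sq_nonneg _) (gwin_nonneg _ _)), ← ofReal_integral_eq_lintegral_ofReal i2
        (Filter.Eventually.of_forall fun x => gwin_nonneg _ _), ← ENNReal.ofReal_mul (by positivity)]
      exact ENNReal.ofReal_le_ofReal h1
  refine ⟨∑ i, v i * m i, ?_⟩
  obtain ⟨κ, hκdef⟩ : ∃ κ, κ = Real.exp (-(θ * s)) / ∏ i, Z i := ⟨_, rfl⟩
  have hκ : 0 < κ := by rw [hκdef]; exact div_pos (Real.exp_pos _) (Finset.prod_pos fun i _ => hZ i)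
  have eP : ∀ y : Fin n → ℝ, ∏ i, p i (slice s y i) =
      κ * Real.exp (-∑ i, (F i (slice s y i) + D i (slice s y i))) := fun y => by
    simp only [hp, Finset.prod_div_distrib, ← Real.exp_sum]
    rw [hκdef, div_mul_eq_mul_div, ← Real.exp_add]
    congr 2
    have := sum_slice s y
    rw [← this, Finset.mul_sum, ← Finset.sum_neg_distrib, ← Finset.sum_neg_distrib,
      ← Finset.sum_add_distrib]
    exact Finset.sum_congr rfl fun i _ => by rw [this]; ring
  have eQ : ∀ y : Fin n → ℝ, ∑ i, (v i - d) * (slice s y i - m i) =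
      ∑ i, v i * slice s y i - ∑ i, v i * m i := fun y => by
    have h1 : ∑ i, (v i - d) * (slice s y i - m i) = ∑ i, v i * slice s y i - ∑ i, v i * m i -
        d * (∑ i, slice s y i - ∑ i, m i) := by
      simp only [Finset.mul_sum, ← Finset.sum_sub_distrib]
      exact Finset.sum_congr rfl fun i _ => by ring
    rw [h1, sum_slice, hsum]; ring
  have hFc : ∀ i, Continuous (F i) := fun i => (h i).diff.continuous
  have hDc : ∀ i, Continuous (D i) := fun i => (h i).pert_diff.continuous
  have hsl := continuous_slice (n := n) s
  have hEc : Continuous fun y : Fin n → ℝ =>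
      Real.exp (-∑ i, (F i (slice s y i) + D i (slice s y i))) := by fun_prop
  simp only [eP, eQ, mul_left_comm _ κ] at key
  simp only [ENNReal.ofReal_mul hκ.le] at key
  rw [lintegral_const_mul _ hEc.measurable.ennreal_ofReal, lintegral_const_mul _
    (by exact (by fun_prop : Continuous fun y : Fin n → ℝ =>
      (∑ i, v i * slice s y i - ∑ i, v i * m i) ^ 2 *
        Real.exp (-∑ i, (F i (slice s y i) + D i (slice s y i)))).measurable.ennreal_ofReal),
    mul_left_comm] at key
  exact (ENNReal.mul_le_mul_iff_right (ENNReal.ofReal_pos.2 hκ).ne' ENNReal.ofReal_ne_top).1 key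

open ProbabilityTheory in
/-- A variance bound along an exponential tilt controls the log-Laplace transform. -/
lemma log_integral_mul_exp_bounds {Ω : Type*} [MeasurableSpace Ω] {μ : Measure Ω} [NeZero μ]
    {q X : Ω → ℝ} {V : ℝ} (hq : Measurable q) (hq0 : ∀ x, 0 < q x) (hX : Measurable X)
    (hi : ∀ t : ℝ, Integrable (fun x => q x * Real.exp (t * X x)) μ)
    (hV : ∀ t : ℝ, ∃ c : ℝ, ∫ x, (X x - c) ^ 2 * (q x * Real.exp (t * X x)) ∂μ ≤
      V * ∫ x, q x * Real.exp (t * X x) ∂μ) :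
    (∫ x, X x * q x ∂μ) / ∫ x, q x ∂μ ≤
        Real.log (∫ x, q x * Real.exp (X x) ∂μ) - Real.log (∫ x, q x ∂μ) ∧
      Real.log (∫ x, q x * Real.exp (X x) ∂μ) - Real.log (∫ x, q x ∂μ) ≤
        (∫ x, X x * q x ∂μ) / (∫ x, q x ∂μ) + V / 2 := by
  have hqi : Integrable q μ := by simpa using hi 0
  obtain ⟨a, ha⟩ : ∃ a, a = ∫ x, q x ∂μ := ⟨_, rfl⟩
  have hpos : ∀ t : ℝ, 0 < ∫ x, q x * Real.exp (t * X x) ∂μ := fun t => by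
    refine (integral_pos_iff_support_of_nonneg (fun x => (mul_pos (hq0 x) (Real.exp_pos _)).le)
      (hi t)).2 ?_
    have : Function.support (fun x => q x * Real.exp (t * X x)) = Set.univ :=
      Set.eq_univ_of_forall fun x => (mul_pos (hq0 x) (Real.exp_pos _)).ne'
    rw [this]
    exact (Measure.measure_univ_pos).2 (NeZero.ne μ)
  have ha0 : 0 < a := by have := hpos 0; simp only [zero_mul, Real.exp_zero, mul_one] at this; rwa [ha]
  obtain ⟨b, hb⟩ : ∃ b, b = (∫ x, X x * q x ∂μ) / a := ⟨_, rfl⟩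
  have hqa : Measurable fun x => ENNReal.ofReal (q x / a) := (hq.div_const a).ennreal_ofReal
  obtain ⟨ν, hν⟩ : ∃ ν : Measure Ω, ν = μ.withDensity fun x => ENNReal.ofReal (q x / a) := ⟨_, rfl⟩
  have hint : ∀ g : Ω → ℝ, ∫ x, g x ∂ν = (∫ x, g x * q x ∂μ) / a := fun g => by
    rw [hν, integral_withDensity_eq_integral_toReal_smul hqa
      (Filter.Eventually.of_forall fun x => ENNReal.ofReal_lt_top), ← integral_div]
    refine integral_congr_ae (Filter.Eventually.of_forall fun x => ?_)
    dsimp only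
    rw [ENNReal.toReal_ofReal (div_pos (hq0 x) ha0).le, smul_eq_mul]
    ring
  have hintble : ∀ g : Ω → ℝ, Integrable (fun x => g x * q x) μ → Integrable g ν := fun g hg => by
    rw [hν, integrable_withDensity_iff_integrable_smul' hqa
      (Filter.Eventually.of_forall fun x => ENNReal.ofReal_lt_top)]
    refine (hg.div_const a).congr (Filter.Eventually.of_forall fun x => ?_)
    dsimp only
    rw [ENNReal.toReal_ofReal (div_pos (hq0 x) ha0).le, smul_eq_mul]
    ring
  have hprob : IsProbabilityMeasure ν := by
    refine ⟨?_⟩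
    rw [hν, withDensity_apply _ MeasurableSet.univ, Measure.restrict_univ,
      ← ofReal_integral_eq_lintegral_ofReal (hqi.div_const a)
      (Filter.Eventually.of_forall fun x => (div_pos (hq0 x) ha0).le), integral_div, ← ha,
      div_self ha0.ne', ENNReal.ofReal_one]
  have hexp : ∀ t : ℝ, Integrable (fun x => Real.exp (t * X x)) ν := fun t =>
    hintble _ ((hi t).congr (Filter.Eventually.of_forall fun x => mul_comm _ _))
  have hset : integrableExpSet (fun x => X x - b) ν = Set.univ := by
    refine Set.eq_univ_of_forall fun t => ?_
    change Integrable (fun x => Real.exp (t * (X x - b))) ν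
    refine ((hexp t).mul_const (Real.exp (-(t * b)))).congr
      (Filter.Eventually.of_forall fun x => ?_)
    simp only [← Real.exp_add]; congr 1; ring
  have hXi : Integrable X ν := by
    have : integrableExpSet X ν = Set.univ := Set.eq_univ_of_forall fun t => hexp t
    exact integrable_of_mem_interior_integrableExpSet (by rw [this]; simp)
  have hmean : ∫ x, (X x - b) ∂ν = 0 := by
    rw [integral_sub hXi (integrable_const _), hint, ← hb]; simp
  obtain ⟨u, -, hu⟩ := exists_cgf_eq_iteratedDeriv_two_cgf_mul (X := fun x => X x - b) (μ := ν)
    one_pos hmean (by rw [hset]; simp)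
  have hu' : u ∈ interior (integrableExpSet (fun x => X x - b) ν) := by rw [hset]; simp
  rw [← variance_tilted_mul hu', one_pow, mul_one] at hu
  have hvar : Var[fun x => X x - b; ν.tilted fun x => u * (X x - b)] ≤ V := by
    obtain ⟨c, hc⟩ := hV u
    have hexpu : Integrable (fun x => Real.exp (u * (X x - b))) ν := by
      have : u ∈ integrableExpSet (fun x => X x - b) ν := by rw [hset]; trivial
      exact this
    have hp2 : IsProbabilityMeasure (ν.tilted fun x => u * (X x - b)) :=
      isProbabilityMeasure_tilted hexpu
    have h1 := variance_le_expectation_sq (μ := ν.tilted fun x => u * (X x - b))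
      (X := fun x => X x - c) (by fun_prop)
    have h2 : Var[fun x => X x - c; ν.tilted fun x => u * (X x - b)] =
        Var[fun x => X x - b; ν.tilted fun x => u * (X x - b)] := by
      rw [variance_sub_const (by fun_prop), variance_sub_const (by fun_prop)]
    rw [← h2]
    refine h1.trans ?_
    rw [integral_tilted]
    have e1 : ∀ x, Real.exp (u * (X x - b)) = Real.exp (u * X x) * Real.exp (-(u * b)) := fun x => by
      rw [← Real.exp_add]; congr 1; ring
    simp only [e1, integral_mul_const, smul_eq_mul, Pi.pow_apply]
    have hE := Real.exp_pos (-(u * b))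
    have hden : 0 < ∫ x, Real.exp (u * X x) ∂ν := by
      rw [hint]; refine div_pos ?_ ha0
      simpa only [mul_comm] using hpos u
    have e2 : ∀ x, Real.exp (u * X x) * Real.exp (-(u * b)) /
        ((∫ x, Real.exp (u * X x) ∂ν) * Real.exp (-(u * b))) * (X x - c) ^ 2 =
        (X x - c) ^ 2 * Real.exp (u * X x) / ∫ x, Real.exp (u * X x) ∂ν := fun x => by
      field_simp
    simp only [e2]
    rw [integral_div, div_le_iff₀ hden, hint, hint, mul_div_assoc']
    refine div_le_div_of_nonneg_right ?_ ha0.le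
    have e3 : ∫ x, Real.exp (u * X x) * q x ∂μ = ∫ x, q x * Real.exp (u * X x) ∂μ := by
      congr 1; ext x; ring
    have e4 : ∫ x, (X x - c) ^ 2 * Real.exp (u * X x) * q x ∂μ =
        ∫ x, (X x - c) ^ 2 * (q x * Real.exp (u * X x)) ∂μ := by
      congr 1; ext x; ring
    rw [e3, e4]
    exact hc
  have hvar0 : 0 ≤ Var[fun x => X x - b; ν.tilted fun x => u * (X x - b)] := variance_nonneg _ _
  have hcgf : cgf (fun x => X x - b) ν 1 =
      Real.log (∫ x, q x * Real.exp (X x) ∂μ) - Real.log a - b := by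
    have h1 := hpos 1
    simp only [one_mul] at h1
    have e1 : ∀ x, Real.exp (1 * (X x - b)) = Real.exp (X x) * Real.exp (-b) := fun x => by
      rw [← Real.exp_add]; congr 1; ring
    rw [cgf, mgf]
    simp only [e1]
    rw [integral_mul_const, hint]
    have e2 : ∫ x, Real.exp (X x) * q x ∂μ = ∫ x, q x * Real.exp (X x) ∂μ := by
      congr 1; ext x; ring
    rw [e2, Real.log_mul (div_pos h1 ha0).ne' (Real.exp_pos _).ne', Real.log_exp,
      Real.log_div h1.ne' ha0.ne']
    ring
  rw [hcgf] at hu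
  rw [← ha, ← hb]
  constructor <;> linarith

section Heat

open ProbabilityTheory
open scoped RealInnerProductSpace

variable {E : Type*} [NormedAddCommGroup E] [InnerProductSpace ℝ E] [FiniteDimensional ℝ E]
  [MeasurableSpace E] [BorelSpace E]

lemma integrable_exp_neg_half_sq_norm :
    Integrable (fun z : E => Real.exp (-(1 / 2) * ‖z‖ ^ 2)) := by
  by_contra h
  have h1 := integral_undef h
  rw [GaussianFourier.integral_rexp_neg_mul_sq_norm (by norm_num)] at h1
  exact absurd h1 (Real.rpow_pos_of_pos (by positivity) _).ne'

/-- The standard Gaussian measure has the usual density. -/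
lemma exists_stdGaussian_eq_withDensity : ∃ c : ℝ, 0 < c ∧
    stdGaussian E = (volume : Measure E).withDensity
      fun z => ENNReal.ofReal (c * Real.exp (-(1 / 2) * ‖z‖ ^ 2)) := by
  obtain ⟨J, hJ⟩ : ∃ J : ℝ, J = ∫ z : E, Real.exp (-(1 / 2) * ‖z‖ ^ 2) := ⟨_, rfl⟩
  have hJ0 : 0 < J := by
    rw [hJ, GaussianFourier.integral_rexp_neg_mul_sq_norm (by norm_num)]
    positivity
  have hm : Measurable fun z : E => ENNReal.ofReal (J⁻¹ * Real.exp (-(1 / 2) * ‖z‖ ^ 2)) := by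
    fun_prop
  refine ⟨J⁻¹, inv_pos.2 hJ0, ?_⟩
  have hfin : IsFiniteMeasure ((volume : Measure E).withDensity
      fun z => ENNReal.ofReal (J⁻¹ * Real.exp (-(1 / 2) * ‖z‖ ^ 2))) :=
    isFiniteMeasure_withDensity_ofReal (integrable_exp_neg_half_sq_norm.const_mul _).2
  refine Measure.ext_of_charFun (funext fun t => ?_)
  rw [charFun_stdGaussian, charFun_apply, integral_withDensity_eq_integral_toReal_smul hm
    (Filter.Eventually.of_forall fun x => ENNReal.ofReal_lt_top)]
  have e1 : ∀ z : E, (ENNReal.ofReal (J⁻¹ * Real.exp (-(1 / 2) * ‖z‖ ^ 2))).toReal •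
      Complex.exp (⟪z, t⟫ * Complex.I) =
      (J⁻¹ : ℂ) * Complex.exp (-(1 / 2 : ℂ) * ‖z‖ ^ 2 + Complex.I * ⟪t, z⟫) := fun z => by
    rw [ENNReal.toReal_ofReal (by positivity), Complex.real_smul, Complex.exp_add,
      real_inner_comm]
    push_cast
    ring_nf
  simp only [e1]
  have hb : 0 < ((1 / 2 : ℂ)).re := by norm_num
  have hJc : (J : ℂ) = ((π : ℂ) / (1 / 2)) ^ (Module.finrank ℝ E / 2 : ℂ) := by
    rw [← GaussianFourier.integral_cexp_neg_mul_sq_norm hb (V := E), hJ, ← integral_complex_ofReal]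
    refine integral_congr_ae (Filter.Eventually.of_forall fun z => ?_)
    push_cast
    rfl
  rw [integral_const_mul, GaussianFourier.integral_cexp_neg_mul_sq_norm_add hb, ← hJc, ← mul_assoc,
    inv_mul_cancel₀ (by exact_mod_cast hJ0.ne'), one_mul, Complex.I_sq]
  congr 1
  ring

/-- Cameron–Martin formula for the standard Gaussian measure. -/
lemma map_add_stdGaussian (x : E) :
    (stdGaussian E).map (fun z => x + z) = (stdGaussian E).withDensity
      fun z => ENNReal.ofReal (Real.exp (⟪z, x⟫ - ‖x‖ ^ 2 / 2)) := by
  obtain ⟨c, hc, hg⟩ := exists_stdGaussian_eq_withDensity (E := E)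
  have hm : Measurable fun z : E => ENNReal.ofReal (c * Real.exp (-(1 / 2) * ‖z‖ ^ 2)) := by
    fun_prop
  have hm2 : Measurable fun z : E => ENNReal.ofReal (Real.exp (⟪z, x⟫ - ‖x‖ ^ 2 / 2)) := by
    fun_prop
  refine Measure.ext_of_lintegral _ fun g hgm => ?_
  rw [lintegral_map hgm (by fun_prop), lintegral_withDensity_eq_lintegral_mul _ hm2 hgm, hg,
    lintegral_withDensity_eq_lintegral_mul _ hm (by fun_prop),
    lintegral_withDensity_eq_lintegral_mul _ hm (by fun_prop)]
  conv_rhs => rw [← lintegral_add_left_eq_self (μ := (volume : Measure E)) _ x]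
  refine lintegral_congr fun z => ?_
  simp only [Pi.mul_apply]
  rw [← mul_assoc, ← ENNReal.ofReal_mul (by positivity), mul_assoc c, ← Real.exp_add]
  congr 4
  rw [norm_add_sq_real, inner_add_left, real_inner_self_eq_norm_sq, real_inner_comm]
  ring

/-- The law of `√s Z` for a standard Gaussian vector `Z`. -/
def heat (E : Type*) [NormedAddCommGroup E] [InnerProductSpace ℝ E] [FiniteDimensional ℝ E]
    [MeasurableSpace E] [BorelSpace E] (s : ℝ) : Measure E :=
  (stdGaussian E).map fun z => √s • z

instance (s : ℝ) : IsProbabilityMeasure (heat E s) :=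
  Measure.isProbabilityMeasure_map (by fun_prop)

lemma integral_heat {F : Type*} [NormedAddCommGroup F] [NormedSpace ℝ F] (s : ℝ) (g : E → F)
    (hg : StronglyMeasurable g) : ∫ z, g z ∂heat E s = ∫ z, g (√s • z) ∂stdGaussian E := by
  rw [heat, integral_map (by fun_prop) hg.aestronglyMeasurable]

lemma heat_conv_heat {s t : ℝ} (hs : 0 ≤ s) (ht : 0 ≤ t) :
    (heat E s).conv (heat E t) = heat E (s + t) := by
  refine Measure.ext_of_charFun (funext fun u => ?_)
  rw [charFun_conv]
  simp only [heat, charFun_map_smul, charFun_stdGaussian, ← Complex.exp_add, norm_smul,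
    Real.norm_eq_abs, abs_of_nonneg (Real.sqrt_nonneg _)]
  congr 1
  push_cast
  have h : ∀ r : ℝ, 0 ≤ r → ((√r : ℝ) : ℂ) ^ 2 = r := fun r hr => by
    exact_mod_cast Real.sq_sqrt hr
  simp only [mul_pow, h s hs, h t ht, h _ (add_nonneg hs ht)]
  push_cast
  ring

/-- The density of the law of `x + √s Z` with respect to the law of `√s Z`. -/
def heatKernel (s : ℝ) (x y : E) : ℝ := Real.exp (⟪y, x⟫ / s - ‖x‖ ^ 2 / (2 * s))

omit [FiniteDimensional ℝ E] [MeasurableSpace E] [BorelSpace E] in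
lemma heatKernel_pos (s : ℝ) (x y : E) : 0 < heatKernel s x y := Real.exp_pos _

omit [FiniteDimensional ℝ E] [MeasurableSpace E] [BorelSpace E] in
lemma continuous_heatKernel (s : ℝ) :
    Continuous fun p : E × E => heatKernel s p.1 p.2 := by
  unfold heatKernel
  fun_prop

omit [FiniteDimensional ℝ E] [MeasurableSpace E] [BorelSpace E] in
lemma heatKernel_le {s : ℝ} (hs : 0 < s) (x y : E) :
    heatKernel s x y ≤ Real.exp (‖y‖ ^ 2 / (2 * s)) := by
  refine Real.exp_le_exp.2 ?_
  have h : ‖y‖ ^ 2 / (2 * s) - (⟪y, x⟫ / s - ‖x‖ ^ 2 / (2 * s)) = ‖y - x‖ ^ 2 / (2 * s) := by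
    rw [norm_sub_sq_real]; field_simp; ring
  have : 0 ≤ ‖y - x‖ ^ 2 / (2 * s) := by positivity
  linarith

omit [FiniteDimensional ℝ E] [MeasurableSpace E] [BorelSpace E] in
lemma heatKernel_add {s : ℝ} (x y v : E) :
    heatKernel s x (y + v) = heatKernel s x y * Real.exp (⟪v, x⟫ / s) := by
  rw [heatKernel, heatKernel, ← Real.exp_add, inner_add_left]
  congr 1
  ring

lemma map_add_heat {s : ℝ} (hs : 0 < s) (x : E) :
    (heat E s).map (fun z => x + z) =
      (heat E s).withDensity fun y => ENNReal.ofReal (heatKernel s x y) := by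
  have hs' : √s ≠ 0 := (Real.sqrt_pos.2 hs).ne'
  have hm : Measurable fun y => ENNReal.ofReal (heatKernel s x y) := by
    unfold heatKernel; fun_prop
  have hm2 : Measurable fun z : E =>
      ENNReal.ofReal (Real.exp (⟪z, (√s)⁻¹ • x⟫ - ‖(√s)⁻¹ • x‖ ^ 2 / 2)) := by fun_prop
  refine Measure.ext_of_lintegral _ fun g hg => ?_
  rw [lintegral_map hg (by fun_prop), lintegral_withDensity_eq_lintegral_mul _ hm hg, heat,
    lintegral_map (by fun_prop) (by fun_prop), lintegral_map (hm.mul hg) (by fun_prop)]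
  have h1 : ∫⁻ z, g (x + √s • z) ∂stdGaussian E =
      ∫⁻ z, g (√s • z) ∂(stdGaussian E).map fun z => (√s)⁻¹ • x + z := by
    rw [lintegral_map (by fun_prop) (by fun_prop)]
    refine lintegral_congr fun z => ?_
    rw [smul_add, smul_smul, mul_inv_cancel₀ hs', one_smul]
  rw [h1, map_add_stdGaussian, lintegral_withDensity_eq_lintegral_mul _ hm2 (by fun_prop)]
  refine lintegral_congr fun z => ?_
  simp only [Pi.mul_apply]
  congr 2
  rw [heatKernel, inner_smul_left, inner_smul_right, norm_smul, mul_pow, norm_inv,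
    Real.norm_eq_abs, abs_of_nonneg (Real.sqrt_nonneg _), inv_pow, Real.sq_sqrt hs.le]
  congr 1
  simp only [conj_trivial]
  have : (√s)⁻¹ = √s / s := by
    rw [eq_div_iff hs.ne', inv_mul_eq_div, div_eq_iff hs', Real.mul_self_sqrt hs.le]
  rw [this]
  field_simp

/-- Integration against the law of `x + √s Z`. -/
lemma integral_add_heat {s : ℝ} (hs : 0 < s) (x : E) {g : E → ℝ} (hg : Measurable g) :
    ∫ z, g (x + z) ∂heat E s = ∫ y, heatKernel s x y * g y ∂heat E s := by
  have hm : Measurable fun y => ENNReal.ofReal (heatKernel s x y) := by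
    unfold heatKernel; fun_prop
  rw [← integral_map (φ := fun z => x + z) (by fun_prop) hg.aestronglyMeasurable,
    map_add_heat hs x, integral_withDensity_eq_integral_toReal_smul hm
      (Filter.Eventually.of_forall fun x => ENNReal.ofReal_lt_top)]
  refine integral_congr_ae (Filter.Eventually.of_forall fun y => ?_)
  dsimp only
  rw [ENNReal.toReal_ofReal (heatKernel_pos s x y).le, smul_eq_mul]

lemma integrable_norm_pow_stdGaussian (k : ℕ) :
    Integrable (fun z => ‖z‖ ^ k) (stdGaussian E) :=
  (IsGaussian.memLp_id (stdGaussian E) k (by simp)).integrable_norm_pow'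

lemma integral_inner_sq_stdGaussian (w : E) :
    ∫ z, ⟪z, w⟫ ^ 2 ∂stdGaussian E = ‖w‖ ^ 2 := by
  have h := variance_dual_stdGaussian (E := E) (innerSL ℝ w)
  rw [variance_eq_integral (by fun_prop), integral_strongDual_stdGaussian] at h
  simpa [real_inner_comm] using h

end Heat

section Heat

open ProbabilityTheory
open scoped RealInnerProductSpace

variable {E : Type*} [NormedAddCommGroup E] [InnerProductSpace ℝ E] [FiniteDimensional ℝ E]
  [MeasurableSpace E] [BorelSpace E]

omit [FiniteDimensional ℝ E] in
lemma measurable_heatKernel_left (s : ℝ) (y : E) : Measurable fun x => heatKernel s x y :=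
  ((continuous_heatKernel s).comp (Continuous.prodMk_left y)).measurable

lemma measurable_heatKernel (s : ℝ) : Measurable fun p : E × E => heatKernel s p.1 p.2 :=
  (continuous_heatKernel s).measurable

/-- The integral of `q` against the Gaussian tilt of `μ` seen from `y`. -/
def tiltInt (μ : Measure E) (s : ℝ) (q : E → ℝ) (y : E) : ℝ := ∫ x, q x * heatKernel s x y ∂μ

/-- The conditional expectation of `q X` given `X + √s Z = y`, for `X` of law `μ`. -/
def post (μ : Measure E) (s : ℝ) (q : E → ℝ) (y : E) : ℝ :=
  tiltInt μ s q y / tiltInt μ s (fun _ => 1) y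

variable {μ : Measure E} [IsProbabilityMeasure μ] {s : ℝ} {q : E → ℝ} {M : ℝ}

lemma integrable_mul_heatKernel (hs : 0 < s) (hq : Measurable q) (hM : ∀ x, |q x| ≤ M) (y : E) :
    Integrable (fun x => q x * heatKernel s x y) μ := by
  refine Integrable.of_bound ((hq.mul (measurable_heatKernel_left s y)).aestronglyMeasurable)
    (M * Real.exp (‖y‖ ^ 2 / (2 * s))) (Filter.Eventually.of_forall fun x => ?_)
  rw [Real.norm_eq_abs, abs_mul, abs_of_pos (heatKernel_pos s x y)]
  exact mul_le_mul (hM x) (heatKernel_le hs x y) (heatKernel_pos s x y).le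
    ((abs_nonneg _).trans (hM x))

lemma measurable_tiltInt (hq : Measurable q) : Measurable (tiltInt μ s q) := by
  refine StronglyMeasurable.measurable ?_
  refine StronglyMeasurable.integral_prod_left (f := fun x y => q x * heatKernel s x y) ?_
  exact ((hq.comp measurable_fst).mul (measurable_heatKernel s)).stronglyMeasurable

lemma measurable_post (hq : Measurable q) : Measurable (post μ s q) :=
  (measurable_tiltInt hq).div (measurable_tiltInt measurable_const)

lemma tiltInt_one_pos (hs : 0 < s) (y : E) : 0 < tiltInt μ s (fun _ => 1) y := by
  have hi := integrable_mul_heatKernel (μ := μ) (q := fun _ => 1) (M := 1) hs measurable_const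
    (by simp) y
  refine (integral_pos_iff_support_of_nonneg (fun x => by
    have := (heatKernel_pos s x y).le; simpa using this) hi).2 ?_
  have : Function.support (fun x => (1 : ℝ) * heatKernel s x y) = Set.univ :=
    Set.eq_univ_of_forall fun x => by
      have := (heatKernel_pos s x y).ne'
      simpa using this
  rw [this]
  simp

lemma tiltInt_mono (hs : 0 < s) {q r : E → ℝ} (hq : Measurable q) (hM : ∀ x, |q x| ≤ M)
    (hr : Measurable r) (hM' : ∀ x, |r x| ≤ M) (h : ∀ x, q x ≤ r x) (y : E) :
    tiltInt μ s q y ≤ tiltInt μ s r y :=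
  integral_mono (integrable_mul_heatKernel hs hq hM y) (integrable_mul_heatKernel hs hr hM' y)
    fun x => mul_le_mul_of_nonneg_right (h x) (heatKernel_pos s x y).le

omit [FiniteDimensional ℝ E] [BorelSpace E] [IsProbabilityMeasure μ] in
lemma tiltInt_const (c : ℝ) (y : E) :
    tiltInt μ s (fun _ => c) y = c * tiltInt μ s (fun _ => 1) y := by
  simp only [tiltInt, one_mul, integral_const_mul]

lemma le_post (hs : 0 < s) (hq : Measurable q) (hM : ∀ x, |q x| ≤ M) {c : ℝ} (hc : ∀ x, c ≤ q x)
    (y : E) : c ≤ post μ s q y := by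
  rw [post, le_div_iff₀ (tiltInt_one_pos hs y), ← tiltInt_const]
  exact tiltInt_mono (M := max M |c|) hs measurable_const (fun x => le_max_right _ _) hq
    (fun x => (hM x).trans (le_max_left _ _)) hc y

lemma post_le (hs : 0 < s) (hq : Measurable q) (hM : ∀ x, |q x| ≤ M) {c : ℝ} (hc : ∀ x, q x ≤ c)
    (y : E) : post μ s q y ≤ c := by
  rw [post, div_le_iff₀ (tiltInt_one_pos hs y), ← tiltInt_const]
  exact tiltInt_mono (M := max M |c|) hs hq (fun x => (hM x).trans (le_max_left _ _))
    measurable_const (fun x => le_max_right _ _) hc y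

lemma abs_post_le (hs : 0 < s) (hq : Measurable q) (hM : ∀ x, |q x| ≤ M) (y : E) :
    |post μ s q y| ≤ M :=
  abs_le.2 ⟨le_post hs hq hM (fun x => (abs_le.1 (hM x)).1) y,
    post_le hs hq hM (fun x => (abs_le.1 (hM x)).2) y⟩

lemma integrable_heatKernel_prod (hs : 0 < s) :
    Integrable (fun p : E × E => heatKernel s p.1 p.2) (μ.prod (heat E s)) := by
  have h1 : ∀ x : E, ∫ y, heatKernel s x y ∂heat E s = 1 := fun x => by
    have := integral_add_heat hs x (g := fun _ => 1) measurable_const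
    simpa using this.symm
  rw [integrable_prod_iff (measurable_heatKernel s).aestronglyMeasurable]
  refine ⟨Filter.Eventually.of_forall fun x => ?_, ?_⟩
  · by_contra h
    have := integral_undef h
    rw [h1] at this
    exact one_ne_zero this
  · have : ∀ x y : E, ‖heatKernel s x y‖ = heatKernel s x y := fun x y =>
      Real.norm_of_nonneg (heatKernel_pos s x y).le
    simp only [this, h1]
    exact integrable_const _

lemma integrable_of_abs_le {X : Type*} [MeasurableSpace X] {ν : Measure X} [IsFiniteMeasure ν]
    {g : X → ℝ} (hg : Measurable g) {C : ℝ} (hC : ∀ x, |g x| ≤ C) : Integrable g ν :=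
  Integrable.of_bound hg.aestronglyMeasurable C (Filter.Eventually.of_forall hC)

/-- `post μ s q` is the conditional expectation of `q X` given `X + √s Z`. -/
lemma integral_post_mul (hs : 0 < s) (hq : Measurable q) (hM : ∀ x, |q x| ≤ M)
    {g : E → ℝ} (hg : Measurable g) {M' : ℝ} (hM' : ∀ x, |g x| ≤ M') :
    ∫ y, post μ s q y * g y ∂(μ.conv (heat E s)) =
      ∫ x, q x * ∫ z, g (x + z) ∂heat E s ∂μ := by
  have hpm := measurable_post (μ := μ) (s := s) hq
  have hb : ∀ y, |post μ s q y * g y| ≤ M * M' := fun y => by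
    rw [abs_mul]
    exact mul_le_mul (abs_post_le hs hq hM y) (hM' y) (abs_nonneg _)
      ((abs_nonneg _).trans (abs_post_le (μ := μ) hs hq hM y))
  rw [integral_conv (f := fun y => post μ s q y * g y) (integrable_of_abs_le (hpm.mul hg) hb)]
  have e1 : ∀ x, ∫ z, post μ s q (x + z) * g (x + z) ∂heat E s =
      ∫ y, heatKernel s x y * (post μ s q y * g y) ∂heat E s := fun x =>
    integral_add_heat hs x (g := fun y => post μ s q y * g y) (hpm.mul hg)
  have e2 : ∀ x, q x * ∫ z, g (x + z) ∂heat E s =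
      ∫ y, heatKernel s x y * (q x * g y) ∂heat E s := fun x => by
    rw [integral_add_heat hs x hg, ← integral_const_mul]
    congr 1; ext y; ring
  simp only [e1, e2]
  have hk := integrable_heatKernel_prod (μ := μ) hs
  have i1 : Integrable (Function.uncurry fun x y => heatKernel s x y * (post μ s q y * g y))
      (μ.prod (heat E s)) :=
    hk.mul_bdd (c := M * M') (g := fun p : E × E => post μ s q p.2 * g p.2)
      ((hpm.comp measurable_snd).mul (hg.comp measurable_snd)).aestronglyMeasurable
      (Filter.Eventually.of_forall fun p => hb p.2)
  have i2 : Integrable (Function.uncurry fun x y => heatKernel s x y * (q x * g y))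
      (μ.prod (heat E s)) := by
    refine hk.mul_bdd (c := M * M') (g := fun p : E × E => q p.1 * g p.2)
      ((hq.comp measurable_fst).mul (hg.comp measurable_snd)).aestronglyMeasurable
      (Filter.Eventually.of_forall fun p => ?_)
    rw [Real.norm_eq_abs, abs_mul]
    exact mul_le_mul (hM _) (hM' _) (abs_nonneg _) ((abs_nonneg _).trans (hM p.1))
  rw [integral_integral_swap i1, integral_integral_swap i2]
  refine integral_congr_ae (Filter.Eventually.of_forall fun y => ?_)
  have e3 : ∀ x, heatKernel s x y * (post μ s q y * g y) =
      (1 * heatKernel s x y) * (post μ s q y * g y) := fun x => by ring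
  have e4 : ∀ x, heatKernel s x y * (q x * g y) = (q x * heatKernel s x y) * g y :=
    fun x => by ring
  simp only [e3, e4]
  rw [integral_mul_const, integral_mul_const]
  change tiltInt μ s (fun _ => 1) y * (tiltInt μ s q y / tiltInt μ s (fun _ => 1) y * g y) =
    tiltInt μ s q y * g y
  have := (tiltInt_one_pos (μ := μ) hs y).ne'
  field_simp

lemma integral_post (hs : 0 < s) (hq : Measurable q) (hM : ∀ x, |q x| ≤ M) :
    ∫ y, post μ s q y ∂(μ.conv (heat E s)) = ∫ x, q x ∂μ := by
  simpa using integral_post_mul (μ := μ) hs hq hM (g := fun _ => 1) measurable_const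
    (M' := 1) (by simp)

end Heat

section EntropyStep

variable {E : Type*} [AddCommGroup E] [MeasurableSpace E] [MeasurableAdd₂ E]

omit [AddCommGroup E] [MeasurableAdd₂ E] in
lemma abs_log_le_of_mem {e M a : ℝ} (he : 0 < e) (h1 : e ≤ a) (h2 : a ≤ M) :
    |Real.log a| ≤ max |Real.log e| |Real.log M| :=
  abs_le_max_abs_abs (Real.log_le_log he h1) (Real.log_le_log (he.trans_le h1) h2)

/-- The loss of entropy of a density `A` under a convolution with `η`. -/
lemma entropy_conv_step {ν η : Measure E} [IsProbabilityMeasure ν] [IsProbabilityMeasure η]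
    {A A' : E → ℝ} (hA : Measurable A) (hA' : Measurable A') {e M : ℝ} (he : 0 < e)
    (h1 : ∀ x, e ≤ A x) (h2 : ∀ x, A x ≤ M) (h1' : ∀ x, e ≤ A' x) (h2' : ∀ x, A' x ≤ M)
    (h : ∀ g : E → ℝ, Measurable g → ∀ C, (∀ x, |g x| ≤ C) →
      ∫ y, A' y * g y ∂(ν.conv η) = ∫ x, A x * ∫ z, g (x + z) ∂η ∂ν) :
    ∫ x, A x * Real.log (A x) ∂ν - ∫ y, A' y * Real.log (A' y) ∂(ν.conv η) ≤
      ∫ x, ∫ z, (A x * Real.log (A x) - A x * Real.log (A (x + z)) - A x + A (x + z)) ∂η ∂ν := by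
  obtain ⟨R, hR⟩ : ∃ R, R = max |Real.log e| |Real.log M| := ⟨_, rfl⟩
  have hl : ∀ x, |Real.log (A x)| ≤ R := fun x => hR ▸ abs_log_le_of_mem he (h1 x) (h2 x)
  have hl' : ∀ x, |Real.log (A' x)| ≤ R := fun x => hR ▸ abs_log_le_of_mem he (h1' x) (h2' x)
  have hab : ∀ x, |A x| ≤ M := fun x => by rw [abs_of_pos (he.trans_le (h1 x))]; exact h2 x
  have hab' : ∀ x, |A' x| ≤ M := fun x => by rw [abs_of_pos (he.trans_le (h1' x))]; exact h2' x
  have hbd : ∀ {u v U V : ℝ}, |u| ≤ U → |v| ≤ V → |u * v| ≤ U * V := fun hu hv => by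
    rw [abs_mul]; exact mul_le_mul hu hv (abs_nonneg _) ((abs_nonneg _).trans hu)
  have hlA := hA.log
  have hlA' := hA'.log
  have hadd : Measurable fun p : E × E => p.1 + p.2 := measurable_add
  have hadd' : ∀ x : E, Measurable fun z : E => x + z := fun x => measurable_const_add x
  have hint : ∀ x, ∫ z, (A x * Real.log (A x) - A x * Real.log (A (x + z)) - A x + A (x + z)) ∂η =
      A x * Real.log (A x) - A x * ∫ z, Real.log (A (x + z)) ∂η - A x + ∫ z, A (x + z) ∂η := by
    intro x
    have i1 : Integrable (fun z => A x * Real.log (A (x + z))) η :=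
      (integrable_of_abs_le (hlA.comp (hadd' x)) fun z => hl _).const_mul _
    have i2 : Integrable (fun z => A (x + z)) η :=
      integrable_of_abs_le (hA.comp (hadd' x)) fun z => hab _
    rw [integral_add (f := fun z => A x * Real.log (A x) - A x * Real.log (A (x + z)) - A x)
      (((integrable_const _).sub i1).sub (integrable_const _)) i2,
      integral_sub (f := fun z => A x * Real.log (A x) - A x * Real.log (A (x + z)))
      ((integrable_const _).sub i1) (integrable_const _), integral_sub (integrable_const _) i1,
      integral_const_mul (A x) fun z => Real.log (A (x + z))]
    simp
  have mavg : ∀ {g : E → ℝ}, Measurable g → Measurable fun x => ∫ z, g (x + z) ∂η := fun {g} hg =>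
    (StronglyMeasurable.integral_prod_right (ν := η) (f := fun x z => g (x + z))
      (hg.comp hadd).stronglyMeasurable).measurable
  have bavg : ∀ {g : E → ℝ} {C : ℝ}, (∀ x, |g x| ≤ C) → ∀ x, |∫ z, g (x + z) ∂η| ≤ C :=
    fun {g C} hC x => by
      have := norm_integral_le_of_norm_le_const (μ := η) (f := fun z => g (x + z)) (C := C)
        (Filter.Eventually.of_forall fun z => hC _)
      simpa using this
  have k1 : Integrable (fun x => A x * Real.log (A x)) ν :=
    integrable_of_abs_le (hA.mul hlA) fun x => hbd (hab x) (hl x)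
  have k2 : Integrable (fun x => A x * ∫ z, Real.log (A (x + z)) ∂η) ν :=
    integrable_of_abs_le (hA.mul (mavg hlA)) fun x => hbd (hab x) (bavg hl x)
  have k3 : Integrable A ν := integrable_of_abs_le hA hab
  have k4 : Integrable (fun x => ∫ z, A (x + z) ∂η) ν :=
    integrable_of_abs_le (mavg hA) (bavg hab)
  simp only [hint]
  rw [integral_add (f := fun x => A x * Real.log (A x) - A x * ∫ z, Real.log (A (x + z)) ∂η - A x)
      ((k1.sub k2).sub k3) k4,
    integral_sub (f := fun x => A x * Real.log (A x) - A x * ∫ z, Real.log (A (x + z)) ∂η)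
      (k1.sub k2) k3, integral_sub k1 k2, ← h _ hlA R hl]
  have e1 : ∫ x, A x ∂ν = ∫ y, A' y ∂(ν.conv η) := by
    have := h (fun _ => 1) measurable_const 1 (by simp)
    simpa using this.symm
  have e2 : ∫ x, ∫ z, A (x + z) ∂η ∂ν = ∫ y, A y ∂(ν.conv η) :=
    (integral_conv (integrable_of_abs_le hA hab)).symm
  have j1 : Integrable (fun y => A' y * Real.log (A y)) (ν.conv η) :=
    integrable_of_abs_le (hA'.mul hlA) fun x => hbd (hab' x) (hl x)
  have j2 : Integrable (fun y => A' y * Real.log (A' y)) (ν.conv η) :=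
    integrable_of_abs_le (hA'.mul hlA') fun x => hbd (hab' x) (hl' x)
  have j3 : Integrable A' (ν.conv η) := integrable_of_abs_le hA' hab'
  have j4 : Integrable A (ν.conv η) := integrable_of_abs_le hA hab
  have key : ∫ y, (A' y * Real.log (A y) + A' y) ∂(ν.conv η) ≤
      ∫ y, (A' y * Real.log (A' y) + A y) ∂(ν.conv η) := by
    refine integral_mono (j1.add j3) (j2.add j4) fun y => ?_
    have p1 := he.trans_le (h1 y)
    have p2 := he.trans_le (h1' y)
    have := Real.log_le_sub_one_of_pos (div_pos p1 p2)
    rw [Real.log_div p1.ne' p2.ne'] at this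
    have h3 := mul_le_mul_of_nonneg_left this p2.le
    have h4 : A' y * (A y / A' y - 1) = A y - A' y := by field_simp
    dsimp only
    linarith
  rw [integral_add j1 j3, integral_add j2 j4] at key
  rw [e1, e2]
  linarith

end EntropyStep

section HeatEntropy

open ProbabilityTheory
open scoped RealInnerProductSpace

variable {E : Type*} [NormedAddCommGroup E] [InnerProductSpace ℝ E] [FiniteDimensional ℝ E]
  [MeasurableSpace E] [BorelSpace E]

lemma abs_exp_sub_quadratic_le {x R : ℝ} (hR : |x| ≤ R) :
    Real.exp x - 1 - x ≤ x ^ 2 / 2 + |x| ^ 3 * Real.exp R := by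
  have h := Complex.norm_exp_sub_sum_le_norm_mul_exp (x : ℂ) 3
  have e : Complex.exp (x : ℂ) - ∑ m ∈ Finset.range 3, (x : ℂ) ^ m / (m.factorial : ℂ) =
      ((Real.exp x - (1 + x + x ^ 2 / 2) : ℝ) : ℂ) := by
    simp [Finset.sum_range_succ]
  rw [e, Complex.norm_real, Complex.norm_real, Real.norm_eq_abs, Real.norm_eq_abs] at h
  have h1 := mul_le_mul_of_nonneg_left (Real.exp_le_exp.2 hR) (pow_nonneg (abs_nonneg x) 3)
  have h2 := (abs_le.1 (h.trans h1)).2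
  linarith

/-- The entropy loss at a point in one small heat step, to leading order. -/
lemma exists_integral_entropy_loss_le {e M : ℝ} (he : 0 < e) (heM : e ≤ M) {K W : ℝ}
    (hK : 0 ≤ K) (hW : 0 ≤ W) : ∃ C : ℝ, 0 ≤ C ∧ ∀ {A : E → ℝ}, Measurable A → (∀ x, e ≤ A x) →
      (∀ x, A x ≤ M) → ∀ y w : E, ‖w‖ ≤ W →
      (∀ v, |Real.log (A (y + v)) - Real.log (A y) - ⟪v, w⟫| ≤ K * ‖v‖ ^ 2) →
      ∀ δ : ℝ, 0 ≤ δ → δ ≤ 1 →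
      ∫ z, (A y * Real.log (A y) - A y * Real.log (A (y + z)) - A y + A (y + z)) ∂heat E δ ≤
        A y * ‖w‖ ^ 2 * (δ / 2) + C * (√δ) ^ 3 := by
  obtain ⟨R, hR⟩ : ∃ R, R = Real.log (M / e) := ⟨_, rfl⟩
  have hM : 0 < M := he.trans_le heM
  obtain ⟨Q, hQ⟩ : ∃ Q : ℝ → ℝ, Q = fun r => M * ((2 * W * K * r ^ 3 + K ^ 2 * r ^ 4) / 2 +
      (W * r + K * r ^ 2) ^ 3 * Real.exp R) := ⟨_, rfl⟩
  have hQi : Integrable (fun z : E => Q ‖z‖) (stdGaussian E) := by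
    have h3 := integrable_norm_pow_stdGaussian (E := E) 3
    have h4 := integrable_norm_pow_stdGaussian (E := E) 4
    have h5 := integrable_norm_pow_stdGaussian (E := E) 5
    have h6 := integrable_norm_pow_stdGaussian (E := E) 6
    have := ((h3.const_mul (M * (W * K + W ^ 3 * Real.exp R))).add
      (h4.const_mul (M * (K ^ 2 / 2 + 3 * W ^ 2 * K * Real.exp R)))).add
      ((h5.const_mul (M * (3 * W * K ^ 2 * Real.exp R))).add
      (h6.const_mul (M * (K ^ 3 * Real.exp R))))
    refine this.congr (Filter.Eventually.of_forall fun z => ?_)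
    simp only [hQ, Pi.add_apply]
    ring
  have hQ0 : ∀ r, 0 ≤ r → 0 ≤ Q r := fun r hr => by rw [hQ]; dsimp only; positivity
  refine ⟨∫ z : E, Q ‖z‖ ∂stdGaussian E, integral_nonneg fun z => hQ0 _ (norm_nonneg _), ?_⟩
  intro A hA h1 h2 y w hw hlog δ hδ hδ1
  obtain ⟨a, ha⟩ : ∃ a, a = √δ := ⟨_, rfl⟩
  have ha0 : 0 ≤ a := ha ▸ Real.sqrt_nonneg _
  have ha1 : a ≤ 1 := by rw [ha]; exact Real.sqrt_le_one.2 hδ1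
  have haδ : a ^ 2 = δ := by rw [ha, Real.sq_sqrt hδ]
  have hpos : ∀ x, 0 < A x := fun x => he.trans_le (h1 x)
  have hlb : ∀ x x', Real.log (A x) - Real.log (A x') ≤ R := fun x x' => by
    rw [hR, Real.log_div hM.ne' he.ne']
    have := Real.log_le_log (hpos x) (h2 x)
    have := Real.log_le_log he (h1 x')
    linarith
  have hm : Measurable fun z =>
      A y * Real.log (A y) - A y * Real.log (A (y + z)) - A y + A (y + z) := by fun_prop
  rw [integral_heat _ _ hm.stronglyMeasurable, ← ha]
  have hpt : ∀ z : E, A y * Real.log (A y) - A y * Real.log (A (y + a • z)) - A y + A (y + a • z) ≤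
      A y * (δ / 2) * ⟪z, w⟫ ^ 2 + a ^ 3 * Q ‖z‖ := by
    intro z
    obtain ⟨L, hL⟩ : ∃ L, L = Real.log (A (y + a • z)) - Real.log (A y) := ⟨_, rfl⟩
    obtain ⟨r, hr⟩ : ∃ r, r = ‖z‖ := ⟨_, rfl⟩
    obtain ⟨u, hu⟩ : ∃ u, u = ⟪z, w⟫ := ⟨_, rfl⟩
    have hr0 : 0 ≤ r := hr ▸ norm_nonneg _
    have hLR : |L| ≤ R := abs_le.2 ⟨by have := hlb y (y + a • z); linarith,
      by have := hlb (y + a • z) y; linarith⟩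
    have hAe : A (y + a • z) = A y * Real.exp L := by
      rw [hL, Real.exp_sub, Real.exp_log (hpos _), Real.exp_log (hpos _)]
      field_simp [(hpos y).ne']
    have hue : |u| ≤ W * r := by
      rw [hu, hr, mul_comm]
      exact (abs_real_inner_le_norm z w).trans
        (mul_le_mul_of_nonneg_left hw (norm_nonneg _))
    have hLu : |L - a * u| ≤ K * (a ^ 2 * r ^ 2) := by
      have := hlog (a • z)
      rw [inner_smul_left, norm_smul, Real.norm_eq_abs, abs_of_nonneg ha0, mul_pow, ← hu, ← hr,
        ← hL] at this
      simpa using this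
    obtain ⟨d, hd⟩ : ∃ d, d = L - a * u := ⟨_, rfl⟩
    rw [← hd] at hLu
    have hLd : L = a * u + d := by rw [hd]; ring
    have haa : a ^ 2 ≤ a := by nlinarith
    have hd1 : |d| ≤ K * (a * r ^ 2) := hLu.trans (by gcongr)
    have hLabs : |L| ≤ a * (W * r + K * r ^ 2) := by
      rw [hLd]
      refine (abs_add_le _ _).trans ?_
      rw [abs_mul, abs_of_nonneg ha0]
      have := mul_le_mul_of_nonneg_left hue ha0
      linarith
    have hL3 : |L| ^ 3 ≤ a ^ 3 * (W * r + K * r ^ 2) ^ 3 := by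
      rw [← mul_pow]
      exact pow_le_pow_left₀ (abs_nonneg _) hLabs 3
    have hL2 : L ^ 2 ≤ a ^ 2 * u ^ 2 + a ^ 3 * (2 * W * K * r ^ 3 + K ^ 2 * r ^ 4) := by
      have t1 : u * d ≤ (W * r) * (K * (a ^ 2 * r ^ 2)) :=
        (le_abs_self _).trans (by
          rw [abs_mul]
          exact mul_le_mul hue hLu (abs_nonneg _) (by positivity))
      have t2 : d ^ 2 ≤ (K * (a ^ 2 * r ^ 2)) * (K * (a * r ^ 2)) := by
        rw [← sq_abs, sq]
        exact mul_le_mul hLu hd1 (abs_nonneg _) (by positivity)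
      have t3 := mul_le_mul_of_nonneg_left t1 ha0
      rw [hLd]
      nlinarith
    have hexp := abs_exp_sub_quadratic_le hLR
    have hER := Real.exp_pos R
    have h3 : Real.exp L - 1 - L ≤ a ^ 2 * u ^ 2 / 2 + a ^ 3 * ((2 * W * K * r ^ 3 +
        K ^ 2 * r ^ 4) / 2 + (W * r + K * r ^ 2) ^ 3 * Real.exp R) := by
      have := mul_le_mul_of_nonneg_right hL3 hER.le
      linarith
    have h4 : A y * Real.log (A y) - A y * Real.log (A (y + a • z)) - A y + A (y + a • z) =
        A y * (Real.exp L - 1 - L) := by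
      have hl : Real.log (A (y + a • z)) = L + Real.log (A y) := by rw [hL]; ring
      rw [hl, hAe]
      ring
    rw [h4]
    have h5 := mul_le_mul_of_nonneg_left h3 (hpos y).le
    refine h5.trans ?_
    rw [mul_add, hQ]
    dsimp only
    rw [← hr, ← hu, haδ]
    have h6 : A y * (a ^ 3 * ((2 * W * K * r ^ 3 + K ^ 2 * r ^ 4) / 2 +
        (W * r + K * r ^ 2) ^ 3 * Real.exp R)) ≤ M * (a ^ 3 * ((2 * W * K * r ^ 3 +
        K ^ 2 * r ^ 4) / 2 + (W * r + K * r ^ 2) ^ 3 * Real.exp R)) :=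
      mul_le_mul_of_nonneg_right (h2 y) (by positivity)
    linarith
  have hi1 : Integrable (fun z : E => ⟪z, w⟫ ^ 2) (stdGaussian E) := by
    refine ((integrable_norm_pow_stdGaussian (E := E) 2).mul_const (‖w‖ ^ 2)).mono'
      (by fun_prop) (Filter.Eventually.of_forall fun z => ?_)
    rw [Real.norm_eq_abs, abs_pow, ← mul_pow]
    exact pow_le_pow_left₀ (abs_nonneg _) (abs_real_inner_le_norm z w) 2
  have hRHS : ∫ z : E, (A y * (δ / 2) * ⟪z, w⟫ ^ 2 + a ^ 3 * Q ‖z‖) ∂stdGaussian E =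
      A y * ‖w‖ ^ 2 * (δ / 2) + (∫ z : E, Q ‖z‖ ∂stdGaussian E) * a ^ 3 := by
    rw [integral_add (hi1.const_mul _) (hQi.const_mul _), integral_const_mul, integral_const_mul,
      integral_inner_sq_stdGaussian]
    ring
  rw [← hRHS]
  refine integral_mono ?_ ((hi1.const_mul _).add (hQi.const_mul _)) hpt
  have hsm : Measurable fun z : E => a • z := by fun_prop
  have hlA := hA.log
  have hb1 : ∀ x, |Real.log (A x)| ≤ max |Real.log e| |Real.log M| := fun x =>
    abs_log_le_of_mem he (h1 x) (h2 x)
  have hb2 : ∀ x, |A x| ≤ M := fun x => by rw [abs_of_pos (hpos x)]; exact h2 x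
  have j1 : Integrable (fun z : E => Real.log (A (y + a • z))) (stdGaussian E) :=
    integrable_of_abs_le (hlA.comp (hsm.const_add y)) fun z => hb1 _
  have j2 : Integrable (fun z : E => A (y + a • z)) (stdGaussian E) :=
    integrable_of_abs_le (hA.comp (hsm.const_add y)) fun z => hb2 _
  exact (((integrable_const _).sub (j1.const_mul _)).sub (integrable_const _)).add j2

variable {μ : Measure E} [IsProbabilityMeasure μ] {f : E → ℝ} {e M : ℝ}

/-- `E[φ(E[f X | X + √s Z])]` with `φ a = a log a`. -/
def heatEnt (μ : Measure E) (s : ℝ) (f : E → ℝ) : ℝ :=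
  ∫ y, post μ s f y * Real.log (post μ s f y) ∂(μ.conv (heat E s))

lemma integral_add_heat_add {s t : ℝ} (hs : 0 ≤ s) (ht : 0 ≤ t) {g : E → ℝ} (hg : Measurable g)
    {C : ℝ} (hC : ∀ x, |g x| ≤ C) (x : E) :
    ∫ z, g (x + z) ∂heat E (s + t) = ∫ z, ∫ z', g (x + z + z') ∂heat E t ∂heat E s := by
  have hm : Measurable fun z => g (x + z) := by fun_prop
  rw [← heat_conv_heat hs ht,
    integral_conv (f := fun z => g (x + z)) (integrable_of_abs_le hm fun z => hC _)]
  simp only [add_assoc]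

omit [NormedAddCommGroup E] [InnerProductSpace ℝ E] [FiniteDimensional ℝ E] [MeasurableSpace E]
  [BorelSpace E] in
lemma abs_le_of_pos_mem (he : 0 < e) (h1 : ∀ x, e ≤ f x) (h2 : ∀ x, f x ≤ M) (x : E) :
    |f x| ≤ M := by
  rw [abs_of_pos (he.trans_le (h1 x))]; exact h2 x

lemma heatEnt_sub_le {s δ : ℝ} (hs : 0 < s) (hδ : 0 < δ) (hf : Measurable f) (he : 0 < e)
    (h1 : ∀ x, e ≤ f x) (h2 : ∀ x, f x ≤ M) :
    heatEnt μ s f - heatEnt μ (s + δ) f ≤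
      ∫ y, ∫ z, (post μ s f y * Real.log (post μ s f y) -
        post μ s f y * Real.log (post μ s f (y + z)) - post μ s f y + post μ s f (y + z)) ∂heat E δ
        ∂(μ.conv (heat E s)) := by
  have hM := abs_le_of_pos_mem he h1 h2
  have hsd : 0 < s + δ := by linarith
  have hc : (μ.conv (heat E s)).conv (heat E δ) = μ.conv (heat E (s + δ)) := by
    rw [Measure.conv_assoc, heat_conv_heat hs.le hδ.le]
  have := entropy_conv_step (ν := μ.conv (heat E s)) (η := heat E δ) (measurable_post (s := s) hf)
    (measurable_post (μ := μ) (s := s + δ) hf) he (le_post hs hf hM h1) (post_le hs hf hM h2)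
    (le_post hsd hf hM h1) (post_le hsd hf hM h2) (fun g hg C hC => by
      have hadd : Measurable fun p : E × E => p.1 + p.2 := measurable_add
      rw [hc, integral_post_mul hsd hf hM hg hC, integral_post_mul hs hf hM (M' := C)
        (g := fun x => ∫ z, g (x + z) ∂heat E δ)]
      · simp only [integral_add_heat_add hs.le hδ.le hg hC]
      · exact (StronglyMeasurable.integral_prod_right (ν := heat E δ) (f := fun x z => g (x + z))
          (hg.comp hadd).stronglyMeasurable).measurable
      · intro x
        have := norm_integral_le_of_norm_le_const (μ := heat E δ) (f := fun z => g (x + z))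
          (C := C) (Filter.Eventually.of_forall fun z => hC _)
        simpa using this)
  rw [hc] at this
  exact this

lemma integral_mul_log_sub_heatEnt_le {δ : ℝ} (hδ : 0 < δ) (hf : Measurable f) (he : 0 < e)
    (h1 : ∀ x, e ≤ f x) (h2 : ∀ x, f x ≤ M) :
    ∫ x, f x * Real.log (f x) ∂μ - heatEnt μ δ f ≤
      ∫ x, ∫ z, (f x * Real.log (f x) - f x * Real.log (f (x + z)) - f x + f (x + z)) ∂heat E δ
        ∂μ :=
  entropy_conv_step (ν := μ) (η := heat E δ) hf (measurable_post (μ := μ) (s := δ) hf) he h1 h2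
    (le_post hδ hf (abs_le_of_pos_mem he h1 h2) h1) (post_le hδ hf (abs_le_of_pos_mem he h1 h2) h2)
    fun _ hg _ hC => integral_post_mul hδ hf (abs_le_of_pos_mem he h1 h2) hg hC

end HeatEntropy

section TiltVariance

open ProbabilityTheory
open scoped RealInnerProductSpace

variable {E : Type*} [NormedAddCommGroup E] [InnerProductSpace ℝ E] [FiniteDimensional ℝ E]
  [MeasurableSpace E] [BorelSpace E]

/-- All Gaussian tilts of `μ` at scale `s` have covariance at most `χ`. -/
def TiltVariance (μ : Measure E) (s χ : ℝ) : Prop :=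
  ∀ y w : E, ∃ c : ℝ, ∫ x, (⟪w, x⟫ - c) ^ 2 * heatKernel s x y ∂μ ≤
    χ * ‖w‖ ^ 2 * ∫ x, heatKernel s x y ∂μ

omit [FiniteDimensional ℝ E] [MeasurableSpace E] [BorelSpace E] in
lemma sq_norm_mul_heatKernel_le {s : ℝ} (hs : 0 < s) (x y : E) :
    ‖x‖ ^ 2 * heatKernel s x y ≤ 4 * s * Real.exp (‖y‖ ^ 2 / s) := by
  have h1 : ‖x‖ ^ 2 ≤ 4 * s * Real.exp (‖x‖ ^ 2 / (4 * s)) := by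
    have := Real.add_one_le_exp (‖x‖ ^ 2 / (4 * s))
    have h2 : ‖x‖ ^ 2 = 4 * s * (‖x‖ ^ 2 / (4 * s)) := by field_simp
    have h3 := mul_le_mul_of_nonneg_left this (by positivity : 0 ≤ 4 * s)
    linarith
  refine (mul_le_mul_of_nonneg_right h1 (heatKernel_pos s x y).le).trans ?_
  rw [heatKernel, mul_assoc, ← Real.exp_add]
  refine mul_le_mul_of_nonneg_left (Real.exp_le_exp.2 ?_) (by positivity)
  have h : ‖y‖ ^ 2 / s - (‖x‖ ^ 2 / (4 * s) + (⟪y, x⟫ / s - ‖x‖ ^ 2 / (2 * s))) =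
      ‖y - (1 / 2 : ℝ) • x‖ ^ 2 / s := by
    rw [norm_sub_sq_real, inner_smul_right, norm_smul]
    norm_num
    field_simp
    ring
  have : 0 ≤ ‖y - (1 / 2 : ℝ) • x‖ ^ 2 / s := by positivity
  linarith

variable {μ : Measure E} [IsProbabilityMeasure μ] {s : ℝ} {q : E → ℝ} {e M : ℝ}

lemma integrable_sq_norm_mul_heatKernel (hs : 0 < s) (y : E) :
    Integrable (fun x => ‖x‖ ^ 2 * heatKernel s x y) μ := by
  have hk := measurable_heatKernel_left s y
  have hm : Measurable fun x : E => ‖x‖ ^ 2 * heatKernel s x y := by fun_prop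
  refine integrable_of_abs_le hm (C := 4 * s * Real.exp (‖y‖ ^ 2 / s)) fun x => ?_
  rw [abs_of_nonneg (mul_nonneg (sq_nonneg _) (heatKernel_pos s x y).le)]
  exact sq_norm_mul_heatKernel_le hs x y

lemma integrable_heatKernel (hs : 0 < s) (y : E) : Integrable (fun x => heatKernel s x y) μ := by
  simpa using integrable_mul_heatKernel (μ := μ) (q := fun _ => 1) (M := 1) hs measurable_const
    (by simp) y

lemma integrable_norm_mul_heatKernel (hs : 0 < s) (y : E) :
    Integrable (fun x => ‖x‖ * heatKernel s x y) μ := by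
  have hk := measurable_heatKernel_left s y
  have hm : Measurable fun x : E => ‖x‖ * heatKernel s x y := by fun_prop
  refine ((integrable_sq_norm_mul_heatKernel hs y).add (integrable_heatKernel hs y)).mono'
    hm.aestronglyMeasurable (Filter.Eventually.of_forall fun x => ?_)
  rw [Real.norm_eq_abs, abs_of_nonneg (mul_nonneg (norm_nonneg _) (heatKernel_pos s x y).le)]
  have : ‖x‖ ≤ ‖x‖ ^ 2 + 1 := by nlinarith [sq_nonneg (‖x‖ - 1), norm_nonneg x]
  have := mul_le_mul_of_nonneg_right this (heatKernel_pos s x y).le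
  simp only [Pi.add_apply]
  linarith

lemma integrable_inner_sub_sq_mul_heatKernel (hs : 0 < s) (y w : E) (c : ℝ) :
    Integrable (fun x => (⟪w, x⟫ - c) ^ 2 * heatKernel s x y) μ := by
  have hk := measurable_heatKernel_left s y
  have hm : Measurable fun x : E => (⟪w, x⟫ - c) ^ 2 * heatKernel s x y := by fun_prop
  refine (((integrable_sq_norm_mul_heatKernel hs y).const_mul (2 * ‖w‖ ^ 2)).add
    ((integrable_heatKernel hs y).const_mul (2 * c ^ 2))).mono'
    hm.aestronglyMeasurable (Filter.Eventually.of_forall fun x => ?_)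
  rw [Real.norm_eq_abs, abs_of_nonneg (mul_nonneg (sq_nonneg _) (heatKernel_pos s x y).le)]
  have h1 : ⟪w, x⟫ ^ 2 ≤ ‖w‖ ^ 2 * ‖x‖ ^ 2 := by
    rw [← mul_pow, ← sq_abs]
    exact pow_le_pow_left₀ (abs_nonneg _) (abs_real_inner_le_norm w x) 2
  have h2 : (⟪w, x⟫ - c) ^ 2 ≤ 2 * ‖w‖ ^ 2 * ‖x‖ ^ 2 + 2 * c ^ 2 := by
    nlinarith [sq_nonneg (⟪w, x⟫ + c)]
  have := mul_le_mul_of_nonneg_right h2 (heatKernel_pos s x y).le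
  simp only [Pi.add_apply]
  linarith

/-- The mean of the Gaussian tilt of `q μ` seen from `y`. -/
def tiltMean (μ : Measure E) (s : ℝ) (q : E → ℝ) (y : E) : E :=
  (tiltInt μ s q y)⁻¹ • ∫ x, (q x * heatKernel s x y) • x ∂μ

lemma integrable_smul_id (hs : 0 < s) (hq : Measurable q) (hM : ∀ x, |q x| ≤ M) (y : E) :
    Integrable (fun x => (q x * heatKernel s x y) • x) μ := by
  have hk := measurable_heatKernel_left s y
  have hm : Measurable fun x : E => (q x * heatKernel s x y) • x := by fun_prop
  refine ((integrable_norm_mul_heatKernel hs y).const_mul M).mono' hm.aestronglyMeasurable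
    (Filter.Eventually.of_forall fun x => ?_)
  rw [norm_smul, Real.norm_eq_abs, abs_mul, abs_of_pos (heatKernel_pos s x y), mul_assoc,
    mul_comm _ ‖x‖]
  exact mul_le_mul_of_nonneg_right (hM x) (mul_nonneg (norm_nonneg _) (heatKernel_pos s x y).le)

lemma inner_tiltMean (hs : 0 < s) (hq : Measurable q) (hM : ∀ x, |q x| ≤ M) (y v : E) :
    ⟪v, tiltMean μ s q y⟫ = (∫ x, ⟪v, x⟫ * (q x * heatKernel s x y) ∂μ) / tiltInt μ s q y := by
  rw [tiltMean, inner_smul_right, ← integral_inner (integrable_smul_id hs hq hM y), inv_mul_eq_div]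
  congr 2
  ext x
  rw [inner_smul_right, mul_comm]

lemma tiltInt_pos (hs : 0 < s) (hq : Measurable q) (he : 0 < e) (h1 : ∀ x, e ≤ q x)
    (h2 : ∀ x, q x ≤ M) (y : E) : 0 < tiltInt μ s q y := by
  have hM := abs_le_of_pos_mem he h1 h2
  have hp := he.trans_le (le_post (μ := μ) hs hq hM h1 y)
  have h := tiltInt_one_pos (μ := μ) hs y
  rw [post] at hp
  exact (div_pos_iff_of_pos_right h).1 hp

/-- Second-order expansion of `log ∫ q k_s(x, y) dμ(x)` in `y`. -/
lemma log_tiltInt_add_bounds {χ : ℝ} (hs : 0 < s) (hv : TiltVariance μ s χ) (hq : Measurable q)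
    (he : 0 < e) (h1 : ∀ x, e ≤ q x) (h2 : ∀ x, q x ≤ M) (y v : E) :
    ⟪v, tiltMean μ s q y⟫ / s ≤
        Real.log (tiltInt μ s q (y + v)) - Real.log (tiltInt μ s q y) ∧
      Real.log (tiltInt μ s q (y + v)) - Real.log (tiltInt μ s q y) ≤
        ⟪v, tiltMean μ s q y⟫ / s + (M / e * χ / s ^ 2) * ‖v‖ ^ 2 / 2 := by
  have hM := abs_le_of_pos_mem he h1 h2
  have hk := measurable_heatKernel_left (E := E) s y
  have hM0 : 0 < M := he.trans_le ((h1 0).trans (h2 0))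
  have hrw : ∀ (t : ℝ) (x : E), q x * heatKernel s x y * Real.exp (t * (⟪v, x⟫ / s)) =
      q x * heatKernel s x (y + t • v) := fun t x => by
    rw [heatKernel_add, inner_smul_left, mul_assoc]
    simp only [conj_trivial]
    congr 3
    ring
  have h := log_integral_mul_exp_bounds (μ := μ) (q := fun x => q x * heatKernel s x y)
    (X := fun x => ⟪v, x⟫ / s) (V := (M / e * χ / s ^ 2) * ‖v‖ ^ 2) (hq.mul hk)
    (fun x => mul_pos (he.trans_le (h1 x)) (heatKernel_pos s x y)) (by fun_prop)
    (fun t => by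
      simp only [hrw]
      exact integrable_mul_heatKernel hs hq hM _)
    (fun t => by
      obtain ⟨c, hc⟩ := hv (y + t • v) v
      refine ⟨c / s, ?_⟩
      simp only [hrw]
      obtain ⟨z, hz⟩ : ∃ z, z = y + t • v := ⟨_, rfl⟩
      rw [← hz] at hc ⊢
      have i1 := integrable_inner_sub_sq_mul_heatKernel (μ := μ) hs z v c
      have i2 := integrable_heatKernel (μ := μ) hs z
      have i3 := integrable_mul_heatKernel (μ := μ) hs hq hM z
      have hkz := measurable_heatKernel_left (E := E) s z
      have hm : Measurable fun x => (⟪v, x⟫ / s - c / s) ^ 2 * (q x * heatKernel s x z) := by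
        fun_prop
      have a1 : ∫ x, (⟪v, x⟫ / s - c / s) ^ 2 * (q x * heatKernel s x z) ∂μ ≤
          ∫ x, M / s ^ 2 * ((⟪v, x⟫ - c) ^ 2 * heatKernel s x z) ∂μ := by
        have hpt : ∀ x, (⟪v, x⟫ / s - c / s) ^ 2 * (q x * heatKernel s x z) ≤
            M / s ^ 2 * ((⟪v, x⟫ - c) ^ 2 * heatKernel s x z) := fun x => by
          have e1 : (⟪v, x⟫ / s - c / s) ^ 2 * (q x * heatKernel s x z) =
              q x / s ^ 2 * ((⟪v, x⟫ - c) ^ 2 * heatKernel s x z) := by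
            field_simp
          rw [e1]
          exact mul_le_mul_of_nonneg_right (by gcongr; exact h2 x)
            (mul_nonneg (sq_nonneg _) (heatKernel_pos s x z).le)
        refine integral_mono ((i1.const_mul (M / s ^ 2)).mono' hm.aestronglyMeasurable
          (Filter.Eventually.of_forall fun x => ?_)) (i1.const_mul _) hpt
        rw [Real.norm_of_nonneg (mul_nonneg (sq_nonneg _)
          (mul_nonneg (he.trans_le (h1 x)).le (heatKernel_pos s x z).le))]
        exact hpt x
      have a2 : e * ∫ x, heatKernel s x z ∂μ ≤ ∫ x, q x * heatKernel s x z ∂μ := by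
        rw [← integral_const_mul]
        exact integral_mono (i2.const_mul _) i3 fun x =>
          mul_le_mul_of_nonneg_right (h1 x) (heatKernel_pos s x z).le
      have a3 : 0 < ∫ x, heatKernel s x z ∂μ := by
        simpa [tiltInt] using tiltInt_one_pos (μ := μ) hs z
      have a0 : 0 ≤ χ * ‖v‖ ^ 2 := by
        have : 0 ≤ ∫ x, (⟪v, x⟫ - c) ^ 2 * heatKernel s x z ∂μ := integral_nonneg fun x =>
          mul_nonneg (sq_nonneg _) (heatKernel_pos s x z).le
        exact nonneg_of_mul_nonneg_left (this.trans hc) a3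
      rw [integral_const_mul] at a1
      refine a1.trans ((mul_le_mul_of_nonneg_left hc (by positivity)).trans ?_)
      have a4 := mul_le_mul_of_nonneg_left a2
        (by positivity : 0 ≤ M / e / s ^ 2 * (χ * ‖v‖ ^ 2))
      refine le_trans (le_of_eq ?_) (a4.trans (le_of_eq ?_))
      · field_simp
      · ring)
  have e1 : (∫ x, ⟪v, x⟫ / s * (q x * heatKernel s x y) ∂μ) / ∫ x, q x * heatKernel s x y ∂μ =
      ⟪v, tiltMean μ s q y⟫ / s := by
    rw [inner_tiltMean hs hq hM, tiltInt]
    have : ∀ x, ⟪v, x⟫ / s * (q x * heatKernel s x y) =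
        ⟪v, x⟫ * (q x * heatKernel s x y) / s := fun x => by ring
    simp only [this]
    rw [integral_div]
    ring
  have e2 : ∫ x, q x * heatKernel s x y * Real.exp (⟪v, x⟫ / s) ∂μ = tiltInt μ s q (y + v) := by
    rw [tiltInt]
    congr 1
    ext x
    have := hrw 1 x
    rwa [one_mul, one_smul] at this
  rw [e1, e2] at h
  exact h

end TiltVariance

section EntropicStability

open ProbabilityTheory
open scoped RealInnerProductSpace

variable {E : Type*} [NormedAddCommGroup E] [InnerProductSpace ℝ E] [FiniteDimensional ℝ E]
  [MeasurableSpace E] [BorelSpace E] {μ : Measure E} [IsProbabilityMeasure μ] {s χ : ℝ}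
  {f : E → ℝ} {e M : ℝ}

/-- The gradient of `log E[f X | X + √s Z = y]` in `y`. -/
def drift (μ : Measure E) (s : ℝ) (f : E → ℝ) (y : E) : E :=
  s⁻¹ • (tiltMean μ s f y - tiltMean μ s (fun _ => 1) y)

lemma abs_log_post_sub_le (hs : 0 < s) (hχ : 0 ≤ χ) (hv : TiltVariance μ s χ) (hf : Measurable f)
    (he : 0 < e) (h1 : ∀ x, e ≤ f x) (h2 : ∀ x, f x ≤ M) (y v : E) :
    |Real.log (post μ s f (y + v)) - Real.log (post μ s f y) - ⟪v, drift μ s f y⟫| ≤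
      M / e * (χ / s ^ 2) / 2 * ‖v‖ ^ 2 := by
  have heM : e ≤ M := (h1 0).trans (h2 0)
  have hp := fun y => (tiltInt_pos (μ := μ) hs hf he h1 h2 y).ne'
  have hp1 := fun y => (tiltInt_one_pos (μ := μ) hs y).ne'
  obtain ⟨a1, a2⟩ := log_tiltInt_add_bounds hs hv hf he h1 h2 y v
  obtain ⟨b1, b2⟩ := log_tiltInt_add_bounds (q := fun _ => 1) (e := 1) (M := 1) hs hv
    measurable_const one_pos (by simp) (by simp) y v
  have hM1 : 1 ≤ M / e := (one_le_div he).2 heM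
  have hc : 1 / 1 * χ / s ^ 2 * ‖v‖ ^ 2 / 2 ≤ M / e * (χ / s ^ 2) / 2 * ‖v‖ ^ 2 := by
    have := mul_le_mul_of_nonneg_right hM1 (by positivity : 0 ≤ χ / s ^ 2 * ‖v‖ ^ 2 / 2)
    exact le_trans (le_of_eq (by ring)) (this.trans (le_of_eq (by ring)))
  have hd : M / e * χ / s ^ 2 * ‖v‖ ^ 2 / 2 = M / e * (χ / s ^ 2) / 2 * ‖v‖ ^ 2 := by ring
  rw [hd] at a2
  rw [post, post, Real.log_div (hp _) (hp1 _), Real.log_div (hp _) (hp1 _), drift,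
    inner_smul_right, inner_sub_right, abs_le, inv_mul_eq_div, sub_div]
  constructor <;> linarith

/-- The entropy of `f` under the conditional law of `X` given `X + √s Z = y`. -/
def condEnt (μ : Measure E) (s : ℝ) (f : E → ℝ) (y : E) : ℝ :=
  post μ s (fun x => f x * Real.log (f x)) y - post μ s f y * Real.log (post μ s f y)

omit [NormedAddCommGroup E] [InnerProductSpace ℝ E] [FiniteDimensional ℝ E] [MeasurableSpace E]
  [BorelSpace E] in
lemma abs_mul_log_le (he : 0 < e) (h1 : ∀ x, e ≤ f x) (h2 : ∀ x, f x ≤ M) (x : E) :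
    |f x * Real.log (f x)| ≤ M * max |Real.log e| |Real.log M| := by
  have hM := abs_le_of_pos_mem he h1 h2
  rw [abs_mul]
  exact mul_le_mul (hM x) (abs_log_le_of_mem he (h1 x) (h2 x)) (abs_nonneg _)
    ((abs_nonneg _).trans (hM x))

lemma post_mul_norm_drift_sq_le (hs : 0 < s) (hχ : 0 < χ) (hv : TiltVariance μ s χ)
    (hf : Measurable f) (he : 0 < e) (h1 : ∀ x, e ≤ f x) (h2 : ∀ x, f x ≤ M) (y : E) :
    post μ s f y * ‖drift μ s f y‖ ^ 2 ≤ 2 * (χ / s ^ 2) * condEnt μ s f y := by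
  have hM := abs_le_of_pos_mem he h1 h2
  obtain ⟨F, hF⟩ : ∃ F, F = post μ s f y := ⟨_, rfl⟩
  obtain ⟨D, hD⟩ : ∃ D, D = tiltInt μ s (fun _ => 1) y := ⟨_, rfl⟩
  have hF0 : 0 < F := hF ▸ he.trans_le (le_post hs hf hM h1 y)
  have hD0 : 0 < D := hD ▸ tiltInt_one_pos hs y
  have hFD : tiltInt μ s f y = F * D := by rw [hF, hD, post, div_mul_cancel₀ _ (hD ▸ hD0.ne')]
  have hk := measurable_heatKernel_left (E := E) s y
  have hlf := hf.log
  have i1 := integrable_mul_heatKernel (μ := μ) hs hf hM y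
  have i2 : Integrable (fun x => f x * Real.log (f x) * heatKernel s x y) μ :=
    integrable_mul_heatKernel hs (hf.mul hlf) (abs_mul_log_le he h1 h2) y
  have key : ∀ v : E, F * ⟪v, tiltMean μ s f y - tiltMean μ s (fun _ => 1) y⟫ ≤
      condEnt μ s f y + F * (χ * ‖v‖ ^ 2 / 2) := by
    intro v
    obtain ⟨L, hL⟩ : ∃ L, L = Real.log (tiltInt μ s (fun _ => 1) (y + s • v)) - Real.log D :=
      ⟨_, rfl⟩
    have hLle : L ≤ ⟪v, tiltMean μ s (fun _ => 1) y⟫ + χ * ‖v‖ ^ 2 / 2 := by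
      have := (log_tiltInt_add_bounds (q := fun _ => 1) (e := 1) (M := 1) hs hv
        measurable_const one_pos (by simp) (by simp) y (s • v)).2
      rw [inner_smul_left, norm_smul, Real.norm_eq_abs, abs_of_pos hs, ← hD, ← hL] at this
      refine this.trans (le_of_eq ?_)
      simp only [conj_trivial]
      field_simp
    have hexpL : Real.exp (-L) * tiltInt μ s (fun _ => 1) (y + s • v) = D := by
      rw [hL, neg_sub, Real.exp_sub, Real.exp_log hD0, Real.exp_log (tiltInt_one_pos hs _),
        div_mul_cancel₀ _ (tiltInt_one_pos hs _).ne']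
    have i3 : Integrable (fun x => ⟪v, x⟫ * (f x * heatKernel s x y)) μ := by
      have := (integrable_smul_id (μ := μ) hs hf hM y).const_inner (𝕜 := ℝ) v
      refine this.congr (Filter.Eventually.of_forall fun x => ?_)
      dsimp only
      rw [inner_smul_right, mul_comm]
    have i4 := integrable_heatKernel (μ := μ) hs (y + s • v)
    have hpt : ∀ x, ⟪v, x⟫ * (f x * heatKernel s x y) ≤ f x * Real.log (f x) * heatKernel s x y +
        (L - Real.log F - 1) * (f x * heatKernel s x y) +
        Real.exp (-L) * F * heatKernel s x (y + s • v) := fun x => by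
      have hx := he.trans_le (h1 x)
      have hkk : heatKernel s x (y + s • v) = heatKernel s x y * Real.exp ⟪v, x⟫ := by
        rw [heatKernel_add, inner_smul_left]
        simp only [conj_trivial]
        rw [mul_div_cancel_left₀ _ hs.ne']
      obtain ⟨a, ha⟩ : ∃ a, a = ⟪v, x⟫ - L + Real.log F - Real.log (f x) := ⟨_, rfl⟩
      have hexp : Real.exp (-L) * F * Real.exp ⟪v, x⟫ = f x * Real.exp a := by
        rw [ha, Real.exp_sub, Real.exp_add, Real.exp_sub, Real.exp_log hF0, Real.exp_log hx,
          Real.exp_neg]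
        field_simp
      have h3 := mul_le_mul_of_nonneg_left (Real.add_one_le_exp a) hx.le
      have h4 : ⟪v, x⟫ * f x ≤ f x * Real.log (f x) + (L - Real.log F - 1) * f x +
          Real.exp (-L) * F * Real.exp ⟪v, x⟫ := by
        rw [hexp]
        refine le_trans (le_of_eq ?_) (add_le_add_right h3 _)
        rw [ha]; ring
      have h5 := mul_le_mul_of_nonneg_right h4 (heatKernel_pos s x y).le
      rw [hkk]
      linarith
    have hint := integral_mono i3 ((i2.add (i1.const_mul (L - Real.log F - 1))).add
      (i4.const_mul (Real.exp (-L) * F))) hpt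
    simp only [Pi.add_apply] at hint
    rw [integral_add (f := fun x => f x * Real.log (f x) * heatKernel s x y +
      (L - Real.log F - 1) * (f x * heatKernel s x y)) (i2.add (i1.const_mul _)) (i4.const_mul _),
      integral_add i2 (i1.const_mul _), integral_const_mul, integral_const_mul] at hint
    have e1 : ∫ x, heatKernel s x (y + s • v) ∂μ = tiltInt μ s (fun _ => 1) (y + s • v) := by
      simp [tiltInt]
    have e2 : ∫ x, f x * heatKernel s x y ∂μ = F * D := hFD
    have e3 : ∫ x, ⟪v, x⟫ * (f x * heatKernel s x y) ∂μ = ⟪v, tiltMean μ s f y⟫ * (F * D) := by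
      rw [inner_tiltMean hs hf hM, hFD, div_mul_cancel₀ _ (mul_pos hF0 hD0).ne']
    have e4 : ∫ x, f x * Real.log (f x) * heatKernel s x y ∂μ =
        post μ s (fun x => f x * Real.log (f x)) y * D := by
      rw [post, ← hD, div_mul_cancel₀ _ hD0.ne', tiltInt]
    rw [e1, e2, e3, e4] at hint
    have h6 : Real.exp (-L) * F * tiltInt μ s (fun _ => 1) (y + s • v) = F * D := by
      rw [mul_right_comm, hexpL, mul_comm]
    rw [h6] at hint
    have h7 : F * ⟪v, tiltMean μ s f y⟫ ≤ condEnt μ s f y + F * L := by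
      rw [condEnt, ← hF]
      refine le_of_mul_le_mul_right ?_ hD0
      linarith
    rw [inner_sub_right]
    have h8 := mul_le_mul_of_nonneg_left hLle hF0.le
    linarith
  have hw : tiltMean μ s f y - tiltMean μ s (fun _ => 1) y = s • drift μ s f y := by
    rw [drift, smul_smul, mul_inv_cancel₀ hs.ne', one_smul]
  have h := key ((s / χ) • drift μ s f y)
  rw [hw, inner_smul_left, inner_smul_right, real_inner_self_eq_norm_sq, norm_smul, mul_pow,
    Real.norm_eq_abs, sq_abs, ← hF] at *
  simp only [conj_trivial] at h
  have h9 : F * ‖drift μ s f y‖ ^ 2 * (s ^ 2 / (2 * χ)) ≤ condEnt μ s f y := by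
    have e : F * (s / χ * (s * ‖drift μ s f y‖ ^ 2)) -
        F * (χ * ((s / χ) ^ 2 * ‖drift μ s f y‖ ^ 2) / 2) =
        F * ‖drift μ s f y‖ ^ 2 * (s ^ 2 / (2 * χ)) := by
      field_simp; ring
    linarith
  have h10 := mul_le_mul_of_nonneg_left h9 (by positivity : 0 ≤ 2 * (χ / s ^ 2))
  refine le_trans (le_of_eq ?_) h10
  field_simp

lemma measurable_condEnt (hf : Measurable f) : Measurable (condEnt μ s f) := by
  have h := measurable_post (μ := μ) (s := s) hf
  exact (measurable_post (hf.mul hf.log)).sub (h.mul h.log)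

lemma abs_condEnt_le (hs : 0 < s) (hf : Measurable f) (he : 0 < e) (h1 : ∀ x, e ≤ f x)
    (h2 : ∀ x, f x ≤ M) (y : E) :
    |condEnt μ s f y| ≤ 2 * (M * max |Real.log e| |Real.log M|) := by
  have hM := abs_le_of_pos_mem he h1 h2
  have a1 := abs_post_le (μ := μ) hs (hf.mul hf.log) (abs_mul_log_le he h1 h2) y
  have a2 := abs_mul_log_le (f := post μ s f) he (le_post hs hf hM h1) (post_le hs hf hM h2) y
  have := abs_sub (post μ s (fun x => f x * Real.log (f x)) y)
    (post μ s f y * Real.log (post μ s f y))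
  rw [condEnt]
  exact this.trans (by
    have a1' : |post μ s (fun x => f x * Real.log (f x)) y| ≤ _ := a1
    linarith)

lemma integral_condEnt (hs : 0 < s) (hf : Measurable f) (he : 0 < e) (h1 : ∀ x, e ≤ f x)
    (h2 : ∀ x, f x ≤ M) :
    ∫ y, condEnt μ s f y ∂(μ.conv (heat E s)) =
      ∫ x, f x * Real.log (f x) ∂μ - heatEnt μ s f := by
  have hM := abs_le_of_pos_mem he h1 h2
  have hp := measurable_post (μ := μ) (s := s) hf
  have hfl : Measurable fun x => f x * Real.log (f x) := hf.mul hf.log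
  rw [heatEnt, ← integral_post hs hfl (abs_mul_log_le he h1 h2), ← integral_sub]
  · rfl
  · exact integrable_of_abs_le (measurable_post hfl)
      (abs_post_le hs hfl (abs_mul_log_le he h1 h2))
  · exact integrable_of_abs_le (hp.mul hp.log)
      (abs_mul_log_le (f := post μ s f) he (le_post hs hf hM h1) (post_le hs hf hM h2))

lemma entropy_loss_nonneg {a b : ℝ} (ha : 0 < a) (hb : 0 < b) :
    0 ≤ a * Real.log a - a * Real.log b - a + b := by
  have := Real.log_le_sub_one_of_pos (div_pos hb ha)
  rw [Real.log_div hb.ne' ha.ne'] at this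
  have h3 := mul_le_mul_of_nonneg_left this ha.le
  have h4 : a * (b / a - 1) = b - a := by field_simp
  linarith

lemma integral_mul_log_sub_heatEnt_nonneg (hs : 0 < s) (hχ : 0 < χ) (hv : TiltVariance μ s χ)
    (hf : Measurable f) (he : 0 < e) (h1 : ∀ x, e ≤ f x) (h2 : ∀ x, f x ≤ M) :
    0 ≤ ∫ x, f x * Real.log (f x) ∂μ - heatEnt μ s f := by
  rw [← integral_condEnt hs hf he h1 h2]
  refine integral_nonneg fun y => ?_
  have a := post_mul_norm_drift_sq_le hs hχ hv hf he h1 h2 y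
  have b : 0 ≤ post μ s f y * ‖drift μ s f y‖ ^ 2 :=
    mul_nonneg (he.trans_le (le_post hs hf (abs_le_of_pos_mem he h1 h2) h1 y)).le (sq_nonneg _)
  exact nonneg_of_mul_nonneg_right (b.trans a) (by positivity)

/-- Growth of the conditional entropy along the heat flow. -/
lemma exists_heatEnt_growth (he : 0 < e) (heM : e ≤ M) {κ : ℝ} (hκ : 0 ≤ κ) :
    ∃ C : ℝ, 0 ≤ C ∧ ∀ {f : E → ℝ}, Measurable f → (∀ x, e ≤ f x) → (∀ x, f x ≤ M) →
      ∀ s χ δ : ℝ, 0 < s → 0 < χ → χ / s ^ 2 ≤ κ → TiltVariance μ s χ → 0 < δ → δ ≤ 1 →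
      ∫ x, f x * Real.log (f x) ∂μ - heatEnt μ (s + δ) f ≤
        (1 + δ * (χ / s ^ 2)) * (∫ x, f x * Real.log (f x) ∂μ - heatEnt μ s f) +
          C * (√δ) ^ 3 := by
  have hM0 : 0 < M := he.trans_le heM
  obtain ⟨R, hR⟩ : ∃ R, R = M * max |Real.log e| |Real.log M| := ⟨_, rfl⟩
  have hR0 : 0 ≤ R := hR ▸ mul_nonneg hM0.le ((abs_nonneg _).trans (le_max_left _ _))
  obtain ⟨C, hC0, hC⟩ := exists_integral_entropy_loss_le (E := E) he heM
    (K := M / e * κ / 2) (W := √(4 * κ * R / e)) (by positivity) (Real.sqrt_nonneg _)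
  refine ⟨C, hC0, ?_⟩
  intro f hf h1 h2 s χ δ hs hχ hχκ hv hδ hδ1
  have hM := abs_le_of_pos_mem he h1 h2
  have hp := measurable_post (μ := μ) (s := s) hf
  have hp1 := le_post (μ := μ) hs hf hM h1
  have hp2 := post_le (μ := μ) hs hf hM h2
  have hstep := heatEnt_sub_le (μ := μ) hs hδ hf he h1 h2
  have hpt : ∀ y, ∫ z, (post μ s f y * Real.log (post μ s f y) -
        post μ s f y * Real.log (post μ s f (y + z)) - post μ s f y + post μ s f (y + z))
        ∂heat E δ ≤ δ * (χ / s ^ 2) * condEnt μ s f y + C * (√δ) ^ 3 := by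
    intro y
    have hst := post_mul_norm_drift_sq_le hs hχ hv hf he h1 h2 y
    have hce := (abs_le.1 (abs_condEnt_le (μ := μ) hs hf he h1 h2 y)).2
    rw [← hR] at hce
    have hw : ‖drift μ s f y‖ ≤ √(4 * κ * R / e) := by
      refine Real.le_sqrt_of_sq_le ?_
      rw [le_div_iff₀ he]
      have b1 : ‖drift μ s f y‖ ^ 2 * e ≤ post μ s f y * ‖drift μ s f y‖ ^ 2 := by
        rw [mul_comm]
        exact mul_le_mul_of_nonneg_right (hp1 y) (sq_nonneg _)
      have b2 : 2 * (χ / s ^ 2) * condEnt μ s f y ≤ 2 * (χ / s ^ 2) * (2 * R) :=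
        mul_le_mul_of_nonneg_left hce (by positivity)
      have b3 : 2 * (χ / s ^ 2) * (2 * R) ≤ 2 * κ * (2 * R) := by gcongr
      linarith
    refine (hC hp hp1 hp2 y (drift μ s f y) hw (fun v => ?_) δ hδ.le hδ1).trans ?_
    · refine (abs_log_post_sub_le hs hχ.le hv hf he h1 h2 y v).trans ?_
      gcongr
    · have := mul_le_mul_of_nonneg_right hst (by positivity : 0 ≤ δ / 2)
      linarith
  have hi : Integrable (condEnt μ s f) (μ.conv (heat E s)) :=
    integrable_of_abs_le (measurable_condEnt hf) (abs_condEnt_le hs hf he h1 h2)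
  have hmono := integral_mono_of_nonneg (μ := μ.conv (heat E s))
    (Filter.Eventually.of_forall fun y => integral_nonneg fun z =>
      entropy_loss_nonneg (he.trans_le (hp1 y)) (he.trans_le (hp1 (y + z))))
    ((hi.const_mul (δ * (χ / s ^ 2))).add (integrable_const (C * (√δ) ^ 3)))
    (Filter.Eventually.of_forall hpt)
  simp only [Pi.add_apply] at hmono
  rw [integral_add (hi.const_mul _) (integrable_const _), integral_const_mul,
    integral_condEnt hs hf he h1 h2] at hmono
  simp only [integral_const, probReal_univ, one_smul] at hmono
  have := hstep.trans hmono
  linarith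

/-- Conditional entropy after a short heat flow. -/
lemma exists_heatEnt_initial (hf : Measurable f) (he : 0 < e) (h1 : ∀ x, e ≤ f x)
    (h2 : ∀ x, f x ≤ M) {w : E → E} (hwm : Measurable w) {K W : ℝ} (hK : 0 ≤ K) (hW : 0 ≤ W)
    (hw : ∀ y, ‖w y‖ ≤ W)
    (hlog : ∀ y v, |Real.log (f (y + v)) - Real.log (f y) - ⟪v, w y⟫| ≤ K * ‖v‖ ^ 2) :
    ∃ C : ℝ, 0 ≤ C ∧ ∀ δ : ℝ, 0 < δ → δ ≤ 1 →
      ∫ x, f x * Real.log (f x) ∂μ - heatEnt μ δ f ≤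
        (δ / 2) * ∫ x, f x * ‖w x‖ ^ 2 ∂μ + C * (√δ) ^ 3 := by
  have heM : e ≤ M := (h1 0).trans (h2 0)
  have hM := abs_le_of_pos_mem he h1 h2
  obtain ⟨C, hC0, hC⟩ := exists_integral_entropy_loss_le (E := E) he heM hK hW
  refine ⟨C, hC0, fun δ hδ hδ1 => ?_⟩
  have hi : Integrable (fun x => f x * ‖w x‖ ^ 2) μ := by
    refine integrable_of_abs_le (hf.mul (hwm.norm.pow_const 2)) (C := M * W ^ 2) fun x => ?_
    rw [abs_mul, abs_of_nonneg (sq_nonneg ‖w x‖)]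
    exact mul_le_mul (hM x) (pow_le_pow_left₀ (norm_nonneg _) (hw x) 2) (sq_nonneg _)
      ((abs_nonneg _).trans (hM x))
  have hmono := integral_mono_of_nonneg (μ := μ)
    (Filter.Eventually.of_forall fun y => integral_nonneg fun z =>
      entropy_loss_nonneg (he.trans_le (h1 y)) (he.trans_le (h1 (y + z))))
    ((hi.mul_const (δ / 2)).add (integrable_const (C * (√δ) ^ 3)))
    (Filter.Eventually.of_forall fun y => hC hf h1 h2 y (w y) (hw y) (hlog y) δ hδ.le hδ1)
  simp only [Pi.add_apply] at hmono
  rw [integral_add (hi.mul_const _) (integrable_const _), integral_mul_const] at hmono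
  simp only [integral_const, probReal_univ, one_smul] at hmono
  have := (integral_mul_log_sub_heatEnt_le (μ := μ) hδ hf he h1 h2).trans hmono
  linarith

end EntropicStability

/-- A discrete Gronwall inequality with an error of order `δ ^ (3 / 2)` per step. -/
lemma div_le_div_of_step {G A κ : ℝ → ℝ} {C a s S d : ℝ} (hsS : s < S) (hC : 0 ≤ C) (ha : 0 < a)
    (hd : 0 < d) (hA : ∀ r, s ≤ r → r ≤ S → a ≤ A r) (hG : ∀ r, s ≤ r → r ≤ S → 0 ≤ G r)
    (hGs : ∀ r δ, s ≤ r → r + δ ≤ S → 0 < δ → δ ≤ d →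
      G (r + δ) ≤ (1 + δ * κ r) * G r + C * (√δ) ^ 3)
    (hAs : ∀ r δ, s ≤ r → r + δ ≤ S → 0 < δ → δ ≤ d → (1 + δ * κ r) * A r ≤ A (r + δ)) :
    G S / A S ≤ G s / A s := by
  have key : ∀ n : ℕ, 0 < n → (S - s) / n ≤ d →
      G S / A S ≤ G s / A s + (S - s) * C / a * √((S - s) / n) := by
    intro n hn hnd
    have hn0 : (0 : ℝ) < n := by exact_mod_cast hn
    obtain ⟨δ, hδ⟩ : ∃ δ, δ = (S - s) / n := ⟨_, rfl⟩
    have hδ0 : 0 < δ := by rw [hδ]; exact div_pos (by linarith) hn0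
    have hnδ : n * δ = S - s := by rw [hδ]; field_simp
    have ind : ∀ k : ℕ, k ≤ n →
        G (s + k * δ) / A (s + k * δ) ≤ G s / A s + k * (C * (√δ) ^ 3 / a) := by
      intro k
      induction k with
      | zero => intro _; simp
      | succ k ih =>
        intro hk
        have hk' : ((k : ℝ) + 1) * δ ≤ S - s := by
          rw [← hnδ]
          exact mul_le_mul_of_nonneg_right (by exact_mod_cast hk) hδ0.le
        have hk0 : (0 : ℝ) ≤ k * δ := by positivity
        have hk1 : s ≤ s + k * δ := by linarith
        have hk2 : s + k * δ + δ ≤ S := by linarith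
        have e : s + ((k + 1 : ℕ) : ℝ) * δ = s + k * δ + δ := by push_cast; ring
        have h1 := hGs _ δ hk1 hk2 hδ0 (hδ ▸ hnd)
        have h2 := hAs _ δ hk1 hk2 hδ0 (hδ ▸ hnd)
        have h3 := hA _ hk1 (by linarith)
        have h4 := hA (s + k * δ + δ) (by linarith) hk2
        have h5 := hG _ hk1 (by linarith)
        have ih' := ih (by omega)
        rw [e]
        generalize s + k * δ = r at *
        have h6 : G (r + δ) / A (r + δ) ≤ G r / A r + C * (√δ) ^ 3 / a := by
          have h7 : (1 + δ * κ r) * G r / A (r + δ) ≤ G r / A r := by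
            rw [div_le_div_iff₀ (ha.trans_le h4) (ha.trans_le h3)]
            have := mul_le_mul_of_nonneg_left h2 h5
            linarith
          have h8 : C * (√δ) ^ 3 / A (r + δ) ≤ C * (√δ) ^ 3 / a :=
            div_le_div_of_nonneg_left (by positivity) ha h4
          have h9 : G (r + δ) / A (r + δ) ≤
              ((1 + δ * κ r) * G r + C * (√δ) ^ 3) / A (r + δ) :=
            div_le_div_of_nonneg_right h1 (ha.trans_le h4).le
          rw [add_div] at h9
          linarith
        push_cast
        linarith
    have := ind n le_rfl
    have e1 : s + n * δ = S := by linarith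
    rw [e1] at this
    refine this.trans (le_of_eq ?_)
    have hsq : (√δ) ^ 3 = δ * √δ := by
      rw [pow_succ, Real.sq_sqrt hδ0.le]
    rw [hsq, ← hδ, ← hnδ]
    ring
  have hlim : Filter.Tendsto (fun n : ℕ => (S - s) / (n : ℝ)) Filter.atTop (nhds 0) :=
    tendsto_const_div_atTop_nhds_zero_nat _
  have hlim2 : Filter.Tendsto (fun n : ℕ => G s / A s + (S - s) * C / a * √((S - s) / (n : ℝ)))
      Filter.atTop (nhds (G s / A s + (S - s) * C / a * √0)) :=
    ((hlim.sqrt).const_mul _).const_add _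
  rw [Real.sqrt_zero, mul_zero, add_zero] at hlim2
  refine ge_of_tendsto hlim2 ?_
  filter_upwards [hlim.eventually (gt_mem_nhds hd), Filter.eventually_gt_atTop 0] with n h1 h2
  exact key n h2 h1.le

section HeatEntropy

open ProbabilityTheory
open scoped RealInnerProductSpace

variable {E : Type*} [NormedAddCommGroup E] [InnerProductSpace ℝ E] [FiniteDimensional ℝ E]
  [MeasurableSpace E] [BorelSpace E] {μ : Measure E} [IsProbabilityMeasure μ] {f : E → ℝ}
  {e M : ℝ}

lemma tendsto_tiltInt {q : E → ℝ} (hq : Measurable q) (hM : ∀ x, |q x| ≤ M) (x z : E) :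
    Filter.Tendsto (fun n : ℕ => tiltInt μ n q (x + √(n : ℝ) • z)) Filter.atTop
      (nhds (∫ x, q x ∂μ)) := by
  have hM0 : 0 ≤ M := (abs_nonneg _).trans (hM 0)
  refine tendsto_integral_filter_of_dominated_convergence
    (fun _ => M * Real.exp (‖x‖ ^ 2 + ‖z‖ ^ 2))
    (Filter.Eventually.of_forall fun n =>
      (hq.mul (measurable_heatKernel_left _ _)).aestronglyMeasurable) ?_ (integrable_const _)
    (Filter.Eventually.of_forall fun x' => ?_)
  · filter_upwards [Filter.eventually_ge_atTop 1] with n hn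
    have hn1 : (1 : ℝ) ≤ n := by exact_mod_cast hn
    have hn0 : (0 : ℝ) < n := by linarith
    refine Filter.Eventually.of_forall fun x' => ?_
    rw [Real.norm_eq_abs, abs_mul, abs_of_pos (heatKernel_pos _ _ _)]
    refine mul_le_mul (hM x') ((heatKernel_le hn0 _ _).trans (Real.exp_le_exp.2 ?_))
      (heatKernel_pos _ _ _).le hM0
    rw [div_le_iff₀ (by positivity)]
    have h1 : ‖x + √(n : ℝ) • z‖ ^ 2 ≤ (‖x‖ + √(n : ℝ) * ‖z‖) ^ 2 := by
      refine pow_le_pow_left₀ (norm_nonneg _) ((norm_add_le _ _).trans (le_of_eq ?_)) 2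
      rw [norm_smul, Real.norm_of_nonneg (Real.sqrt_nonneg _)]
    have h2 := Real.sq_sqrt hn0.le
    have h3 := sq_nonneg (‖x‖ - √(n : ℝ) * ‖z‖)
    have h4 := mul_le_mul_of_nonneg_right hn1 (sq_nonneg ‖x‖)
    have h5 : (√(n : ℝ) * ‖z‖) ^ 2 = n * ‖z‖ ^ 2 := by rw [mul_pow, h2]
    nlinarith
  · have h0 : Filter.Tendsto (fun n : ℕ => ((n : ℝ))⁻¹) Filter.atTop (nhds 0) :=
      tendsto_inv_atTop_nhds_zero_nat
    have h1 : Filter.Tendsto (fun n : ℕ => q x' * Real.exp (⟪x, x'⟫ * (n : ℝ)⁻¹ +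
        √((n : ℝ)⁻¹) * ⟪z, x'⟫ - ‖x'‖ ^ 2 / 2 * (n : ℝ)⁻¹)) Filter.atTop
        (nhds (q x' * Real.exp (⟪x, x'⟫ * 0 + √0 * ⟪z, x'⟫ - ‖x'‖ ^ 2 / 2 * 0))) :=
      (((h0.const_mul _).add (h0.sqrt.mul_const _)).sub (h0.const_mul _)).rexp.const_mul _
    have e0 : q x' * Real.exp (⟪x, x'⟫ * 0 + √0 * ⟪z, x'⟫ - ‖x'‖ ^ 2 / 2 * 0) = q x' := by simp
    rw [e0] at h1
    refine h1.congr' ?_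
    filter_upwards [Filter.eventually_ge_atTop 1] with n hn
    have hn0 : (0 : ℝ) < n := by exact_mod_cast hn
    rw [heatKernel, inner_add_left, real_inner_smul_left]
    congr 2
    have e1 : √((n : ℝ)⁻¹) = √(n : ℝ) / n := by
      rw [Real.sqrt_inv, eq_div_iff hn0.ne', inv_mul_eq_div, Real.div_sqrt]
    rw [e1]
    field_simp

/-- As the heat flow time goes to infinity, no information on the initial point is left. -/
lemma tendsto_heatEnt (hf : Measurable f) (he : 0 < e) (h1 : ∀ x, e ≤ f x) (h2 : ∀ x, f x ≤ M) :
    Filter.Tendsto (fun n : ℕ => heatEnt μ n f) Filter.atTop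
      (nhds ((∫ x, f x ∂μ) * Real.log (∫ x, f x ∂μ))) := by
  have hM := abs_le_of_pos_mem he h1 h2
  have hpm : ∀ n : ℕ, Measurable fun y => post μ n f y * Real.log (post μ n f y) := fun n =>
    (measurable_post hf).mul (measurable_post hf).log
  have hpb : ∀ n : ℕ, 0 < n → ∀ y, |post μ n f y * Real.log (post μ n f y)| ≤
      M * max |Real.log e| |Real.log M| := fun n hn y =>
    have hn0 : (0 : ℝ) < n := by exact_mod_cast hn
    abs_mul_log_le he (le_post hn0 hf hM h1) (post_le hn0 hf hM h2) y
  have hmm : ∀ n : ℕ, Measurable fun p : E × E =>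
      post μ n f (p.1 + √(n : ℝ) • p.2) * Real.log (post μ n f (p.1 + √(n : ℝ) • p.2)) :=
    fun n => (hpm n).comp (by fun_prop : Measurable fun p : E × E => p.1 + √(n : ℝ) • p.2)
  have heq : ∀ n : ℕ, 0 < n → heatEnt μ n f = ∫ p : E × E,
      post μ n f (p.1 + √(n : ℝ) • p.2) * Real.log (post μ n f (p.1 + √(n : ℝ) • p.2))
        ∂(μ.prod (stdGaussian E)) := by
    intro n hn
    rw [heatEnt, integral_conv (integrable_of_abs_le (hpm n) (hpb n hn)),
      integral_prod _ (integrable_of_abs_le (hmm n) fun p => hpb n hn _)]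
    refine integral_congr_ae (Filter.Eventually.of_forall fun x => ?_)
    exact integral_heat (n : ℝ) _
      ((hpm n).comp (measurable_const_add x)).stronglyMeasurable
  have hlim : Filter.Tendsto (fun n : ℕ => ∫ p : E × E,
      post μ n f (p.1 + √(n : ℝ) • p.2) * Real.log (post μ n f (p.1 + √(n : ℝ) • p.2))
        ∂(μ.prod (stdGaussian E))) Filter.atTop
      (nhds (∫ _ : E × E, (∫ x, f x ∂μ) * Real.log (∫ x, f x ∂μ) ∂(μ.prod (stdGaussian E)))) := by
    refine tendsto_integral_filter_of_dominated_convergence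
      (fun _ => M * max |Real.log e| |Real.log M|)
      (Filter.Eventually.of_forall fun n => (hmm n).aestronglyMeasurable) ?_ (integrable_const _)
      (Filter.Eventually.of_forall fun p => ?_)
    · filter_upwards [Filter.eventually_gt_atTop 0] with n hn
      exact Filter.Eventually.of_forall fun p => hpb n hn _
    · have h3 := tendsto_tiltInt (μ := μ) hf hM p.1 p.2
      have h4 := tendsto_tiltInt (μ := μ) (q := fun _ => 1) (M := 1) measurable_const
        (by simp) p.1 p.2
      have h5 : Filter.Tendsto (fun n : ℕ => post μ n f (p.1 + √(n : ℝ) • p.2)) Filter.atTop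
          (nhds (∫ x, f x ∂μ)) := by
        have := h3.div h4 (by simp)
        simpa using! this
      have hfi : e ≤ ∫ x, f x ∂μ := by
        have := integral_mono (μ := μ) (integrable_const e) (integrable_of_abs_le hf hM) h1
        simpa using this
      exact h5.mul (h5.log (he.trans_le hfi).ne')
  rw [integral_const, probReal_univ, one_smul] at hlim
  refine hlim.congr' ?_
  filter_upwards [Filter.eventually_gt_atTop 0] with n hn
  exact (heq n hn).symm

/-- Entropy bound from a bound on the variances of the Gaussian tilts of `μ`. -/
theorem entropy_le_of_tiltVariance {T χ K W : ℝ} (hT : 0 < T) (hχ : 0 < χ)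
    (hv1 : ∀ s, 0 < s → s ≤ 1 / (2 * T) → TiltVariance μ s (1 / (1 / s - T)))
    (hv2 : ∀ s, 0 < s → TiltVariance μ s χ)
    (hf : Measurable f) (he : 0 < e) (h1 : ∀ x, e ≤ f x) (h2 : ∀ x, f x ≤ M) {w : E → E}
    (hwm : Measurable w) (hK : 0 ≤ K) (hW : 0 ≤ W) (hw : ∀ y, ‖w y‖ ≤ W)
    (hlog : ∀ y v, |Real.log (f (y + v)) - Real.log (f y) - ⟪v, w y⟫| ≤ K * ‖v‖ ^ 2) :
    ∫ x, f x * Real.log (f x) ∂μ - (∫ x, f x ∂μ) * Real.log (∫ x, f x ∂μ) ≤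
      1 / (4 * T) * Real.exp (1 + 4 * T * χ) * ∫ x, f x * ‖w x‖ ^ 2 ∂μ := by
  obtain ⟨s₂, hs₂⟩ : ∃ s₂, s₂ = 1 / (2 * T) := ⟨_, rfl⟩
  have hs₂0 : 0 < s₂ := by rw [hs₂]; positivity
  have hTs₂ : T * s₂ = 1 / 2 := by rw [hs₂]; field_simp
  have heM : e ≤ M := (h1 0).trans (h2 0)
  obtain ⟨G, hG⟩ : ∃ G : ℝ → ℝ, G = fun s => ∫ x, f x * Real.log (f x) ∂μ - heatEnt μ s f :=
    ⟨_, rfl⟩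
  have hGapp : ∀ s, G s = ∫ x, f x * Real.log (f x) ∂μ - heatEnt μ s f := fun s => by rw [hG]
  have hG0 : ∀ s, 0 < s → 0 ≤ G s := fun s hs => by
    rw [hGapp]
    exact integral_mul_log_sub_heatEnt_nonneg hs hχ (hv2 s hs) hf he h1 h2
  have hI : 0 ≤ ∫ x, f x * ‖w x‖ ^ 2 ∂μ :=
    integral_nonneg fun x => mul_nonneg (he.le.trans (h1 x)) (sq_nonneg _)
  obtain ⟨C₀, hC₀, hinit⟩ := exists_heatEnt_initial (μ := μ) hf he h1 h2 hwm hK hW hw hlog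
  -- small times
  have hsmall : ∀ s, 0 < s → s < s₂ → s ≤ 1 →
      G s₂ ≤ s₂ * Real.exp 1 * (1 / 2 * ∫ x, f x * ‖w x‖ ^ 2 ∂μ + C₀ * √s) := by
    intro s hs hss₂ hs1
    have hκ : (0 : ℝ) ≤ 1 / s + 2 * T := by positivity
    obtain ⟨C, hC, hgrow⟩ := exists_heatEnt_growth (μ := μ) he heM hκ
    have hb : ∀ r, s ≤ r → r ≤ s₂ → 0 < 1 / (1 / r - T) ∧
        1 / (1 / r - T) / r ^ 2 ≤ 1 / r + 2 * T := by
      intro r hsr hr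
      have hr0 : 0 < r := hs.trans_le hsr
      have hTr : T * r ≤ 1 / 2 := by rw [← hTs₂]; exact mul_le_mul_of_nonneg_left hr hT.le
      have e1 : 1 / r - T = (1 - T * r) / r := by field_simp
      have hp : 0 < 1 - T * r := by linarith
      refine ⟨by rw [e1]; positivity, ?_⟩
      have e2 : 1 / (1 / r - T) / r ^ 2 = 1 / (r * (1 - T * r)) := by
        rw [e1]; field_simp
      have e3 : 1 / r + 2 * T = (1 + 2 * (T * r)) / r := by field_simp
      rw [e2, e3, div_le_div_iff₀ (by positivity) hr0]
      have : 0 < T * r := by positivity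
      have : 0 ≤ r * (T * r * (1 - 2 * (T * r))) := by
        have : 0 ≤ 1 - 2 * (T * r) := by linarith
        positivity
      nlinarith
    have hstep := div_le_div_of_step (G := G) (A := fun r => r * Real.exp (2 * T * r))
      (κ := fun r => 1 / r + 2 * T) (a := s) (d := 1) hss₂ hC hs one_pos
      (fun r hr _ => by
        have hr0 : 0 < r := hs.trans_le hr
        have : 1 ≤ Real.exp (2 * T * r) := Real.one_le_exp (by positivity)
        nlinarith)
      (fun r hr _ => hG0 r (hs.trans_le hr))
      (fun r δ hr hrδ hδ hδ1 => by
        have hr0 : 0 < r := hs.trans_le hr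
        obtain ⟨hb1, hb2⟩ := hb r hr (by linarith)
        have hb3 : 1 / r + 2 * T ≤ 1 / s + 2 * T := by
          have := one_div_le_one_div_of_le hs hr
          linarith
        have := hgrow hf h1 h2 r _ δ hr0 hb1 (hb2.trans hb3)
          (hv1 r hr0 (by rw [← hs₂]; linarith)) hδ hδ1
        rw [← hGapp, ← hGapp] at this
        refine this.trans (add_le_add_left (mul_le_mul_of_nonneg_right ?_ (hG0 r hr0)) _)
        have := mul_le_mul_of_nonneg_left hb2 hδ.le
        linarith)
      (fun r δ hr hrδ hδ hδ1 => by
        have hr0 : 0 < r := hs.trans_le hr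
        have e1 : (r + δ) * Real.exp (2 * T * (r + δ)) =
            r * Real.exp (2 * T * r) * ((1 + δ / r) * Real.exp (2 * T * δ)) := by
          rw [mul_add, Real.exp_add]; field_simp
        rw [e1, mul_comm]
        refine mul_le_mul_of_nonneg_left ?_ (by positivity)
        have h3 := Real.add_one_le_exp (2 * T * δ)
        have h4 : 0 ≤ δ / r := by positivity
        have h5 := mul_le_mul_of_nonneg_left h3 (by linarith : 0 ≤ 1 + δ / r)
        have h6 : 0 ≤ δ / r * (2 * T * δ) := by positivity
        have e2 : δ * (1 / r + 2 * T) = δ / r + 2 * T * δ := by ring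
        rw [e2]
        linarith)
    have e1 : 2 * T * s₂ = 1 := by linarith
    simp only [e1] at hstep
    have h3 := hinit s hs hs1
    rw [← hGapp] at h3
    have h4 : G s / (s * Real.exp (2 * T * s)) ≤ 1 / 2 * ∫ x, f x * ‖w x‖ ^ 2 ∂μ + C₀ * √s := by
      have h5 : 1 ≤ Real.exp (2 * T * s) := Real.one_le_exp (by positivity)
      have h6 : G s / (s * Real.exp (2 * T * s)) ≤ G s / s :=
        div_le_div_of_nonneg_left (hG0 s hs) hs (by nlinarith)
      refine h6.trans ?_
      rw [div_le_iff₀ hs]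
      refine h3.trans (le_of_eq ?_)
      have hsq : (√s) ^ 3 = s * √s := by rw [pow_succ, Real.sq_sqrt hs.le]
      rw [hsq]; ring
    have h5 := hstep.trans h4
    rwa [div_le_iff₀ (by positivity), mul_comm] at h5
  have hG₂ : G s₂ ≤ s₂ * Real.exp 1 * (1 / 2 * ∫ x, f x * ‖w x‖ ^ 2 ∂μ) := by
    have hl : Filter.Tendsto (fun s : ℝ =>
        s₂ * Real.exp 1 * (1 / 2 * ∫ x, f x * ‖w x‖ ^ 2 ∂μ + C₀ * √s)) (nhdsWithin 0 (Set.Ioi 0))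
        (nhds (s₂ * Real.exp 1 * (1 / 2 * ∫ x, f x * ‖w x‖ ^ 2 ∂μ + C₀ * √0))) := by
      refine (Continuous.tendsto ?_ 0).mono_left nhdsWithin_le_nhds
      fun_prop
    rw [Real.sqrt_zero, mul_zero, add_zero] at hl
    refine ge_of_tendsto hl ?_
    filter_upwards [Ioo_mem_nhdsGT hs₂0, Ioo_mem_nhdsGT (zero_lt_one (α := ℝ))] with s h3 h4
    exact hsmall s h3.1 h3.2 h4.2.le
  -- large times
  have hlarge : ∀ S, s₂ < S → G S ≤ Real.exp (4 * T * χ) * G s₂ := by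
    intro S hS
    have hκ : (0 : ℝ) ≤ χ / s₂ ^ 2 := by positivity
    obtain ⟨C, hC, hgrow⟩ := exists_heatEnt_growth (μ := μ) he heM hκ
    have hmono : ∀ r, s₂ ≤ r → Real.exp (-(2 * χ / s₂)) ≤ Real.exp (-(2 * χ / r)) := by
      intro r hr
      exact Real.exp_le_exp.2
        (neg_le_neg (div_le_div_of_nonneg_left (by positivity) hs₂0 hr))
    have hstep := div_le_div_of_step (G := G) (A := fun r => Real.exp (-(2 * χ / r)))
      (κ := fun r => χ / r ^ 2) (a := Real.exp (-(2 * χ / s₂))) (d := min 1 s₂) hS hC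
      (Real.exp_pos _) (lt_min one_pos hs₂0)
      (fun r hr _ => hmono r hr)
      (fun r hr _ => hG0 r (hs₂0.trans_le hr))
      (fun r δ hr hrδ hδ hδ1 => by
        have hr0 : 0 < r := hs₂0.trans_le hr
        have := hgrow hf h1 h2 r χ δ hr0 hχ
          (div_le_div_of_nonneg_left hχ.le (by positivity) (pow_le_pow_left₀ hs₂0.le hr 2))
          (hv2 r hr0) hδ (hδ1.trans (min_le_left _ _))
        rwa [← hGapp, ← hGapp] at this)
      (fun r δ hr hrδ hδ hδ1 => by
        have hr0 : 0 < r := hs₂0.trans_le hr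
        have hδr : δ ≤ r := (hδ1.trans (min_le_right _ _)).trans hr
        have e1 : -(2 * χ / (r + δ)) = 2 * χ * δ / (r * (r + δ)) + -(2 * χ / r) := by
          field_simp; ring
        rw [e1, Real.exp_add]
        refine mul_le_mul_of_nonneg_right ?_ (Real.exp_pos _).le
        have h3 := Real.add_one_le_exp (2 * χ * δ / (r * (r + δ)))
        have h4 : δ * (χ / r ^ 2) ≤ 2 * χ * δ / (r * (r + δ)) := by
          rw [mul_div_assoc', div_le_div_iff₀ (by positivity) (by positivity)]
          have : 0 ≤ δ * χ * r * (r - δ) := by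
            have : 0 ≤ r - δ := by linarith
            positivity
          nlinarith
        linarith)
    have h3 : G S ≤ G S / Real.exp (-(2 * χ / S)) := by
      rw [le_div_iff₀ (Real.exp_pos _)]
      refine mul_le_of_le_one_right (hG0 S (hs₂0.trans hS)) (Real.exp_le_one_iff.2 ?_)
      have : 0 < S := hs₂0.trans hS
      have : 0 < 2 * χ / S := by positivity
      linarith
    refine h3.trans (hstep.trans (le_of_eq ?_))
    have e1 : 4 * T * χ = 2 * χ / s₂ := by rw [hs₂]; field_simp; ring
    rw [Real.exp_neg, div_inv_eq_mul, mul_comm, e1]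
  have hfin : ∫ x, f x * Real.log (f x) ∂μ - (∫ x, f x ∂μ) * Real.log (∫ x, f x ∂μ) ≤
      Real.exp (4 * T * χ) * G s₂ := by
    refine le_of_tendsto ((tendsto_heatEnt (μ := μ) hf he h1 h2).const_sub _) ?_
    filter_upwards [(tendsto_natCast_atTop_atTop (R := ℝ)).eventually_gt_atTop s₂] with n hn
    rw [← hGapp]
    exact hlarge n hn
  refine hfin.trans ((mul_le_mul_of_nonneg_left hG₂ (Real.exp_pos _).le).trans (le_of_eq ?_))
  rw [Real.exp_add, hs₂]
  field_simp
  ring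

end HeatEntropy

lemma integral_sq_le_of_exp_mul_exp_le {Ω : Type*} [MeasurableSpace Ω] {ν : Measure Ω}
    [IsFiniteMeasure ν] [NeZero ν] {Y : Ω → ℝ} {V : ℝ} (hY : Measurable Y)
    (hi : ∀ ε : ℝ, Integrable (fun x => Real.exp (ε * Y x)) ν) (h0 : ∫ x, Y x ∂ν = 0)
    (H : ∀ ε : ℝ, 0 < ε → (∫ x, Real.exp (ε * Y x) ∂ν) * ∫ x, Real.exp (-ε * Y x) ∂ν ≤
      Real.exp (ε ^ 2 * V) * ν.real Set.univ ^ 2) :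
    ∫ x, Y x ^ 2 ∂ν ≤ V * ν.real Set.univ := by
  obtain ⟨m, hm⟩ : ∃ m, m = ν.real Set.univ := ⟨_, rfl⟩
  have hm0 : 0 < m := by rw [hm]; exact measureReal_univ_pos
  have hexp : ∀ a : ℝ, 0 ≤ a → ∀ x, Real.exp (a * |Y x|) ≤
      Real.exp (a * Y x) + Real.exp (-a * Y x) := by
    intro a ha x
    rcases abs_cases (Y x) with h | h <;> rw [h.1]
    · have := (Real.exp_pos (-a * Y x)).le
      linarith
    · have := (Real.exp_pos (a * Y x)).le
      rw [mul_neg, neg_mul]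
      linarith
  have h3 : ∀ x, |Y x| ^ 3 ≤ 6 * Real.exp |Y x| := fun x => by
    have := Real.pow_div_factorial_le_exp _ (abs_nonneg (Y x)) 3
    norm_num [Nat.factorial] at this
    linarith
  have h2 : ∀ x, Y x ^ 2 ≤ 2 * Real.exp |Y x| := fun x => by
    have := Real.pow_div_factorial_le_exp _ (abs_nonneg (Y x)) 2
    norm_num [Nat.factorial] at this
    linarith
  have h1 : ∀ x, |Y x| ≤ Real.exp |Y x| := fun x => by
    have := Real.add_one_le_exp |Y x|
    linarith
  have hE : ∀ a : ℝ, 0 ≤ a → Integrable (fun x => Real.exp (a * |Y x|)) ν := fun a ha =>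
    ((hi a).add (hi (-a))).mono' (by fun_prop) (Filter.Eventually.of_forall fun x => by
      rw [Real.norm_of_nonneg (Real.exp_pos _).le]
      exact hexp a ha x)
  have hE1 : Integrable (fun x => Real.exp |Y x|) ν := by simpa using hE 1 zero_le_one
  have hY1 : Integrable Y ν := hE1.mono' hY.aestronglyMeasurable
    (Filter.Eventually.of_forall fun x => h1 x)
  have hY2 : Integrable (fun x => Y x ^ 2) ν := (hE1.const_mul 2).mono' (by fun_prop)
    (Filter.Eventually.of_forall fun x => by
      rw [Real.norm_of_nonneg (sq_nonneg _)]; exact h2 x)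
  have hY3 : Integrable (fun x => |Y x| ^ 3 * Real.exp |Y x|) ν :=
    ((hE 2 zero_le_two).const_mul 6).mono' (by fun_prop) (Filter.Eventually.of_forall fun x => by
      rw [Real.norm_of_nonneg (by positivity), two_mul, Real.exp_add, ← mul_assoc]
      exact mul_le_mul_of_nonneg_right (h3 x) (Real.exp_pos _).le)
  obtain ⟨v, hv⟩ : ∃ v, v = ∫ x, Y x ^ 2 ∂ν := ⟨_, rfl⟩
  obtain ⟨k, hk⟩ : ∃ k, k = ∫ x, |Y x| ^ 3 * Real.exp |Y x| ∂ν := ⟨_, rfl⟩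
  have hv0 : 0 ≤ v := by rw [hv]; exact integral_nonneg fun x => sq_nonneg _
  have hk0 : 0 ≤ k := by rw [hk]; exact integral_nonneg fun x => by positivity
  have hlow : ∀ ε : ℝ, |ε| ≤ 1 → m + ε ^ 2 * v / 2 - |ε| ^ 3 * k ≤
      ∫ x, Real.exp (ε * Y x) ∂ν := by
    intro ε hε
    have e1 : ∫ x, (1 + ε * Y x + ε ^ 2 / 2 * Y x ^ 2 - |ε| ^ 3 * (|Y x| ^ 3 * Real.exp |Y x|)) ∂ν =
        m + ε ^ 2 * v / 2 - |ε| ^ 3 * k := by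
      rw [integral_sub (f := fun x => 1 + ε * Y x + ε ^ 2 / 2 * Y x ^ 2) ((((integrable_const _).add (hY1.const_mul _))).add (hY2.const_mul _))
        (hY3.const_mul _),
        integral_add (f := fun x => 1 + ε * Y x) ((integrable_const _).add (hY1.const_mul _))
          (hY2.const_mul _),
        integral_add (f := fun _ => 1) (integrable_const _) (hY1.const_mul _),
        integral_const_mul, integral_const_mul, integral_const_mul, h0, ← hv, ← hk, hm]
      simp
      ring
    rw [← e1]
    refine integral_mono (((((integrable_const _).add (hY1.const_mul _))).add
      (hY2.const_mul _)).sub (hY3.const_mul _)) (hi ε) fun x => ?_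
    have h := Complex.norm_exp_sub_sum_le_norm_mul_exp ((ε * Y x : ℝ) : ℂ) 3
    have e : Complex.exp ((ε * Y x : ℝ) : ℂ) -
        ∑ m ∈ Finset.range 3, ((ε * Y x : ℝ) : ℂ) ^ m / (m.factorial : ℂ) =
        ((Real.exp (ε * Y x) - (1 + ε * Y x + (ε * Y x) ^ 2 / 2) : ℝ) : ℂ) := by
      simp [Finset.sum_range_succ]
    rw [e, Complex.norm_real, Complex.norm_real, Real.norm_eq_abs, Real.norm_eq_abs, abs_mul] at h
    have h4 : Real.exp (|ε| * |Y x|) ≤ Real.exp |Y x| :=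
      Real.exp_le_exp.2 (mul_le_of_le_one_left (abs_nonneg _) hε)
    have h5 := mul_le_mul_of_nonneg_left h4 (by positivity : 0 ≤ (|ε| * |Y x|) ^ 3)
    have h6 := (abs_le.1 h).1
    have h7 : (|ε| * |Y x|) ^ 3 * Real.exp |Y x| = |ε| ^ 3 * (|Y x| ^ 3 * Real.exp |Y x|) := by ring
    have h8 : (ε * Y x) ^ 2 = ε ^ 2 * Y x ^ 2 := by ring
    dsimp only
    linarith
  have hfin : ∀ᶠ ε in nhdsWithin (0 : ℝ) (Set.Ioi 0),
      v ≤ V * m + (ε ^ 2 * V ^ 2 * m + 2 * k * ε) := by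
    have l1 : ∀ᶠ ε in nhdsWithin (0 : ℝ) (Set.Ioi 0), ε ^ 3 * k ≤ m := by
      have : Filter.Tendsto (fun ε : ℝ => ε ^ 3 * k) (nhdsWithin 0 (Set.Ioi 0))
          (nhds (0 ^ 3 * k)) := (Continuous.tendsto (by fun_prop) 0).mono_left nhdsWithin_le_nhds
      exact this.eventually (ge_mem_nhds (by simpa using hm0))
    have l2 : ∀ᶠ ε in nhdsWithin (0 : ℝ) (Set.Ioi 0), |ε ^ 2 * V| ≤ 1 := by
      have : Filter.Tendsto (fun ε : ℝ => |ε ^ 2 * V|) (nhdsWithin 0 (Set.Ioi 0))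
          (nhds |0 ^ 2 * V|) := (Continuous.tendsto (by fun_prop) 0).mono_left nhdsWithin_le_nhds
      exact this.eventually (ge_mem_nhds (by simp))
    filter_upwards [l1, l2, Ioo_mem_nhdsGT (zero_lt_one (α := ℝ))] with ε l1 l2 ⟨hε, hε1⟩
    have a1 := hlow ε (by rw [abs_of_pos hε]; exact hε1.le)
    have a2 := hlow (-ε) (by rw [abs_neg, abs_of_pos hε]; exact hε1.le)
    rw [abs_neg, neg_sq] at a2
    rw [abs_of_pos hε] at a1 a2
    have b0 : 0 ≤ m + ε ^ 2 * v / 2 - ε ^ 3 * k := by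
      have : 0 ≤ ε ^ 2 * v / 2 := by positivity
      linarith
    have b1 := mul_le_mul a1 a2 b0 (b0.trans a1)
    have b2 := b1.trans (H ε hε)
    rw [← hm] at b2
    have b3 : Real.exp (ε ^ 2 * V) ≤ 1 + ε ^ 2 * V + (ε ^ 2 * V) ^ 2 := by
      have := (abs_le.1 (Real.abs_exp_sub_one_sub_id_le l2)).2
      linarith
    have b4 := b2.trans (mul_le_mul_of_nonneg_right b3 (sq_nonneg m))
    have b5 : ε ^ 2 * m * v ≤ ε ^ 2 * m * (V * m + (ε ^ 2 * V ^ 2 * m + 2 * k * ε)) := by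
      nlinarith [sq_nonneg (ε ^ 2 * v / 2 - ε ^ 3 * k)]
    exact le_of_mul_le_mul_left b5 (by positivity)
  have hl : Filter.Tendsto (fun ε : ℝ => V * m + (ε ^ 2 * V ^ 2 * m + 2 * k * ε))
      (nhdsWithin 0 (Set.Ioi 0)) (nhds (V * m + (0 ^ 2 * V ^ 2 * m + 2 * k * 0))) :=
    (Continuous.tendsto (by fun_prop) 0).mono_left nhdsWithin_le_nhds
  rw [← hv, ← hm]
  have := ge_of_tendsto hl hfin
  simpa using this

lemma slice_midpoint {n : ℕ} (s : ℝ) (x y : Fin n → ℝ) (i : Fin (n + 1)) :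
    slice s (fun j => (x j + y j) / 2) i = (slice s x i + slice s y i) / 2 := by
  refine Fin.cases ?_ (fun j => ?_) i
  · simp only [slice_zero]
    rw [← Finset.sum_div, Finset.sum_add_distrib]
    ring
  · simp only [slice_succ]

/-- Exponential moments of linear statistics under a uniformly log-concave slice measure. -/
lemma lintegral_slice_exp_mul_le {n : ℕ} {W : Fin (n + 1) → ℝ → ℝ} {κ : ℝ} (hκ : 0 < κ)
    (hW : ∀ i, Measurable (W i))
    (hc : ∀ i x y, κ * (x - y) ^ 2 / 4 ≤ W i x + W i y - 2 * W i ((x + y) / 2))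
    (s ε c : ℝ) (v : Fin (n + 1) → ℝ) :
    (∫⁻ y : Fin n → ℝ, ENNReal.ofReal (Real.exp (ε * (∑ i, v i * slice s y i - c)) *
        Real.exp (-∑ i, W i (slice s y i)))) *
      (∫⁻ y : Fin n → ℝ, ENNReal.ofReal (Real.exp (-ε * (∑ i, v i * slice s y i - c)) *
        Real.exp (-∑ i, W i (slice s y i)))) ≤
      ENNReal.ofReal (Real.exp (ε ^ 2 * ((∑ i, v i ^ 2) / κ))) *
        (∫⁻ y : Fin n → ℝ, ENNReal.ofReal (Real.exp (-∑ i, W i (slice s y i)))) ^ 2 := by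
  have hsl : ∀ i, Measurable fun y : Fin n → ℝ => slice s y i := fun i =>
    ((continuous_apply i).comp (continuous_slice s)).measurable
  have hX : Measurable fun y : Fin n → ℝ => ∑ i, v i * slice s y i :=
    Finset.measurable_sum _ fun i _ => (hsl i).const_mul _
  have hS : Measurable fun y : Fin n → ℝ => ∑ i, W i (slice s y i) :=
    Finset.measurable_sum _ fun i _ => (hW i).comp (hsl i)
  have hS' : Measurable fun y : Fin n → ℝ =>
      ENNReal.ofReal (Real.exp (-∑ i, W i (slice s y i))) := hS.neg.exp.ennreal_ofReal
  have hpl := prekopa_leindler_pi n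
    (f := fun y => ENNReal.ofReal (Real.exp (ε * (∑ i, v i * slice s y i - c)) *
        Real.exp (-∑ i, W i (slice s y i))))
    (g := fun y => ENNReal.ofReal (Real.exp (-ε * (∑ i, v i * slice s y i - c)) *
        Real.exp (-∑ i, W i (slice s y i))))
    (h := fun y => ENNReal.ofReal (Real.exp (ε ^ 2 * ((∑ i, v i ^ 2) / κ) / 2)) *
      ENNReal.ofReal (Real.exp (-∑ i, W i (slice s y i))))
    (((hX.sub_const c).const_mul ε).exp.mul hS.neg.exp).ennreal_ofReal
    (((hX.sub_const c).const_mul (-ε)).exp.mul hS.neg.exp).ennreal_ofReal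
    (hS'.const_mul _) (fun x y => by
      rw [← ENNReal.ofReal_mul (by positivity), ← ENNReal.ofReal_mul (by positivity),
        ← ENNReal.ofReal_pow (by positivity), ← Real.exp_add, ← Real.exp_add, ← Real.exp_add,
        ← Real.exp_add, sq, ← Real.exp_add]
      refine ENNReal.ofReal_le_ofReal (Real.exp_le_exp.2 ?_)
      have key : ∀ i, ε * (v i * slice s x i) - ε * (v i * slice s y i) ≤ ε ^ 2 * (v i ^ 2 / κ) +
          W i (slice s x i) + W i (slice s y i) -
            2 * W i (slice s (fun j => (x j + y j) / 2) i) := fun i => by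
        rw [slice_midpoint]
        have h1 := hc i (slice s x i) (slice s y i)
        have h2 : 0 ≤ (2 * ε * v i - κ * (slice s x i - slice s y i)) ^ 2 / (4 * κ) := by
          positivity
        have h3 : (2 * ε * v i - κ * (slice s x i - slice s y i)) ^ 2 / (4 * κ) =
            ε ^ 2 * (v i ^ 2 / κ) - ε * v i * (slice s x i - slice s y i) +
              κ * (slice s x i - slice s y i) ^ 2 / 4 := by
          field_simp; ring
        linarith
      have hsum := Finset.sum_le_sum fun i (_ : i ∈ Finset.univ) => key i
      simp only [Finset.sum_add_distrib, Finset.sum_sub_distrib, ← Finset.mul_sum,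
        ← Finset.sum_div] at hsum
      linarith)
  rw [lintegral_const_mul _ hS', mul_pow, ← ENNReal.ofReal_pow (by positivity),
    ← Real.exp_nat_mul] at hpl
  convert hpl using 4
  push_cast
  ring

/-- Spectral bound for linear statistics of a uniformly log-concave slice measure. -/
theorem exists_lintegral_slice_sq_le_of_convex {n : ℕ} {W : Fin (n + 1) → ℝ → ℝ} {κ : ℝ}
    (hκ : 0 < κ) (hW : ∀ i, Measurable (W i))
    (hc : ∀ i x y, κ * (x - y) ^ 2 / 4 ≤ W i x + W i y - 2 * W i ((x + y) / 2))
    (s : ℝ) (v : Fin (n + 1) → ℝ) :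
    ∃ c, ∫⁻ y : Fin n → ℝ, ENNReal.ofReal ((∑ i, v i * slice s y i - c) ^ 2 *
        Real.exp (-∑ i, W i (slice s y i))) ≤
      ENNReal.ofReal ((∑ i, v i ^ 2) / κ) *
        ∫⁻ y : Fin n → ℝ, ENNReal.ofReal (Real.exp (-∑ i, W i (slice s y i))) := by
  have hsl : ∀ i, Measurable fun y : Fin n → ℝ => slice s y i := fun i =>
    ((continuous_apply i).comp (continuous_slice s)).measurable
  have hX : Measurable fun y : Fin n → ℝ => ∑ i, v i * slice s y i :=
    Finset.measurable_sum _ fun i _ => (hsl i).const_mul _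
  have hS : Measurable fun y : Fin n → ℝ => ∑ i, W i (slice s y i) :=
    Finset.measurable_sum _ fun i _ => (hW i).comp (hsl i)
  obtain ⟨X, hXd⟩ : ∃ X : (Fin n → ℝ) → ℝ, X = fun y => ∑ i, v i * slice s y i := ⟨_, rfl⟩
  obtain ⟨w, hw⟩ : ∃ w : (Fin n → ℝ) → ℝ, w = fun y => Real.exp (-∑ i, W i (slice s y i)) :=
    ⟨_, rfl⟩
  have hwm : Measurable w := hw ▸ hS.neg.exp
  have hw0 : ∀ y, 0 < w y := fun y => by rw [hw]; exact Real.exp_pos _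
  have hXm : Measurable X := hXd ▸ hX
  obtain ⟨V, hV⟩ : ∃ V, V = (∑ i, v i ^ 2) / κ := ⟨_, rfl⟩
  have hpl : ∀ ε c : ℝ, (∫⁻ y, ENNReal.ofReal (Real.exp (ε * (X y - c)) * w y)) *
      (∫⁻ y, ENNReal.ofReal (Real.exp (-ε * (X y - c)) * w y)) ≤
      ENNReal.ofReal (Real.exp (ε ^ 2 * V)) * (∫⁻ y, ENNReal.ofReal (w y)) ^ 2 := fun ε c => by
    rw [hXd, hw, hV]
    exact lintegral_slice_exp_mul_le hκ hW hc s ε c v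
  suffices h : ∃ c, ∫⁻ y, ENNReal.ofReal ((X y - c) ^ 2 * w y) ≤
      ENNReal.ofReal V * ∫⁻ y, ENNReal.ofReal (w y) by
    rw [hXd, hw, hV] at h
    exact h
  have hV0 : 0 ≤ V := by rw [hV]; positivity
  by_cases hfin : ∫⁻ y, ENNReal.ofReal (w y) = ∞
  · rcases hV0.eq_or_lt with h | h
    · refine ⟨0, le_of_eq_of_le ?_ zero_le⟩
      have hv : ∑ i, v i ^ 2 = 0 := by
        have := hV.symm.trans h.symm
        rwa [_root_.div_eq_zero_iff, or_iff_left hκ.ne'] at this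
      have hv' := (Finset.sum_eq_zero_iff_of_nonneg fun i _ => sq_nonneg (v i)).1 hv
      have hX0 : ∀ y, X y = 0 := fun y => by
        rw [hXd]
        refine Finset.sum_eq_zero fun i _ => ?_
        rw [pow_eq_zero_iff two_ne_zero |>.1 (hv' i (Finset.mem_univ i)), zero_mul]
      simp [hX0]
    · refine ⟨0, le_of_le_of_eq le_top ?_⟩
      rw [hfin, ENNReal.mul_top (by simpa using h)]
  obtain ⟨ν, hν⟩ : ∃ ν : Measure (Fin n → ℝ),
    ν = volume.withDensity fun y => ENNReal.ofReal (w y) := ⟨_, rfl⟩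
  have hlint : ∀ g : (Fin n → ℝ) → ℝ, Measurable g → (∀ y, 0 ≤ g y) →
      ∫⁻ y, ENNReal.ofReal (g y) ∂ν = ∫⁻ y, ENNReal.ofReal (g y * w y) := by
    intro g hg hg0
    rw [hν, lintegral_withDensity_eq_lintegral_mul _ hwm.ennreal_ofReal hg.ennreal_ofReal]
    refine lintegral_congr fun y => ?_
    rw [Pi.mul_apply, ← ENNReal.ofReal_mul (hw0 y).le, mul_comm]
  have huniv : ν Set.univ = ∫⁻ y, ENNReal.ofReal (w y) := by
    rw [hν, withDensity_apply _ MeasurableSet.univ, Measure.restrict_univ]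
  have : IsFiniteMeasure ν := ⟨by rw [huniv]; exact lt_top_iff_ne_top.2 hfin⟩
  have : NeZero ν := ⟨fun h => by
    have h1 : ν Set.univ = 0 := by rw [h]; simp
    rw [huniv, lintegral_eq_zero_iff hwm.ennreal_ofReal] at h1
    have h2 : ∀ᵐ y : Fin n → ℝ, False := by
      filter_upwards [h1] with y hy
      have := hw0 y
      simp only [Pi.zero_apply, ENNReal.ofReal_eq_zero] at hy
      linarith
    rw [Filter.eventually_false_iff_eq_bot, ae_eq_bot] at h2
    exact NeZero.ne _ h2⟩
  have hi : ∀ ε c : ℝ, Integrable (fun y => Real.exp (ε * (X y - c))) ν := by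
    intro ε c
    refine ⟨by fun_prop, ?_⟩
    rw [hasFiniteIntegral_iff_ofReal (Filter.Eventually.of_forall fun y => (Real.exp_pos _).le),
      hlint _ (by fun_prop) fun y => (Real.exp_pos _).le]
    have h1 : ∫⁻ y, ENNReal.ofReal (Real.exp (-ε * (X y - c)) * w y) ≠ 0 := by
      rw [← hlint (fun y => Real.exp (-ε * (X y - c))) (by fun_prop) fun y => (Real.exp_pos _).le]
      intro h
      rw [lintegral_eq_zero_iff (by fun_prop)] at h
      have h2 : ∀ᵐ y ∂ν, False := by
        filter_upwards [h] with y hy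
        have := Real.exp_pos (-ε * (X y - c))
        simp only [Pi.zero_apply, ENNReal.ofReal_eq_zero] at hy
        linarith
      rw [Filter.eventually_false_iff_eq_bot, ae_eq_bot] at h2
      exact NeZero.ne _ h2
    have h3 : (∫⁻ y, ENNReal.ofReal (Real.exp (ε * (X y - c)) * w y)) *
      (∫⁻ y, ENNReal.ofReal (Real.exp (-ε * (X y - c)) * w y)) < ∞ :=
      (hpl ε c).trans_lt (ENNReal.mul_lt_top ENNReal.ofReal_lt_top
        (ENNReal.pow_lt_top (lt_top_iff_ne_top.2 hfin)))
    exact ENNReal.lt_top_of_mul_ne_top_left h3.ne h1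
  have hX1 : Integrable X ν := by
    refine ((hi 1 0).add (hi (-1) 0)).mono' hXm.aestronglyMeasurable
      (Filter.Eventually.of_forall fun y => ?_)
    simp only [Pi.add_apply, one_mul, sub_zero, neg_mul]
    rw [Real.norm_eq_abs, abs_le]
    have h1 := Real.add_one_le_exp (X y)
    have h2 := Real.add_one_le_exp (-X y)
    have h3 := Real.exp_pos (X y)
    have h4 := Real.exp_pos (-X y)
    constructor <;> linarith
  obtain ⟨m, hm⟩ : ∃ m, m = ν.real Set.univ := ⟨_, rfl⟩
  have hm0 : 0 < m := by rw [hm]; exact measureReal_univ_pos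
  obtain ⟨c, hc⟩ : ∃ c, c = (∫ y, X y ∂ν) / m := ⟨_, rfl⟩
  have hmain := integral_sq_le_of_exp_mul_exp_le (ν := ν) (Y := fun y => X y - c) (V := V)
    (by fun_prop) (fun ε => hi ε c) (by
      rw [integral_sub hX1 (integrable_const c), integral_const, ← hm, hc, smul_eq_mul]
      field_simp
      ring) (fun ε hε => by
      rw [integral_eq_lintegral_of_nonneg_ae (Filter.Eventually.of_forall fun y =>
        (Real.exp_pos _).le) (by fun_prop), integral_eq_lintegral_of_nonneg_ae
        (Filter.Eventually.of_forall fun y => (Real.exp_pos _).le) (by fun_prop),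
        hlint _ (by fun_prop) fun y => (Real.exp_pos _).le,
        hlint _ (by fun_prop) fun y => (Real.exp_pos _).le, ← ENNReal.toReal_mul,
        Measure.real, huniv, ← ENNReal.toReal_pow,
        ← ENNReal.toReal_ofReal (Real.exp_pos (ε ^ 2 * V)).le, ← ENNReal.toReal_mul]
      exact ENNReal.toReal_mono (ENNReal.mul_ne_top ENNReal.ofReal_ne_top
        (ENNReal.pow_ne_top hfin)) (hpl ε c))
  refine ⟨c, ?_⟩
  have hXi : Integrable (fun y => (X y - c) ^ 2) ν := by
    refine (((hi 1 c).add (hi (-1) c)).const_mul 2).mono' (by fun_prop)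
      (Filter.Eventually.of_forall fun y => ?_)
    simp only [Pi.add_apply, one_mul, neg_mul]
    rw [Real.norm_of_nonneg (sq_nonneg _)]
    have h1 := Real.pow_div_factorial_le_exp _ (abs_nonneg (X y - c)) 2
    norm_num [Nat.factorial] at h1
    have h3 := Real.exp_pos (X y - c)
    have h4 := Real.exp_pos (-(X y - c))
    rcases abs_cases (X y - c) with h | h <;> rw [h.1] at h1 <;> linarith
  rw [← hlint _ (by fun_prop) fun y => sq_nonneg _,
    ← ofReal_integral_eq_lintegral_ofReal hXi (Filter.Eventually.of_forall fun y => sq_nonneg _),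
    ← huniv, ← ofReal_measureReal (measure_ne_top ν _), ← ENNReal.ofReal_mul hV0]
  exact ENNReal.ofReal_le_ofReal hmain

lemma canonEns_eq_zero_or_isProbabilityMeasure (ψ : ℝ → ℝ) (N : ℕ) (a : Fin N → ℝ) (m : ℝ) :
    canonEns ψ N a m = 0 ∨ IsProbabilityMeasure (canonEns ψ N a m) := by
  unfold canonEns
  dsimp only
  generalize ((μH[(N : ℝ) - 1]).restrict
    {x : EuclideanSpace ℝ (Fin N) | ∑ i, x i = (N : ℝ) * m}).withDensity
      (fun x => ENNReal.ofReal (Real.exp (-(∑ i, (ψ (x i) + a i * x i))))) = ν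
  by_cases h0 : ν Set.univ = 0
  · left
    rw [Measure.measure_univ_eq_zero.1 h0, smul_zero]
  · by_cases h1 : ν Set.univ = ∞
    · left
      rw [h1, ENNReal.inv_top, zero_smul]
    · right
      exact ⟨by rw [Measure.smul_apply, smul_eq_mul, ENNReal.inv_mul_cancel h0 h1]⟩

lemma ae_canonEns_sum_eq (ψ : ℝ → ℝ) (N : ℕ) (a : Fin N → ℝ) (m : ℝ) :
    ∀ᵐ x ∂canonEns ψ N a m, ∑ i, x i = (N : ℝ) * m := by
  unfold canonEns
  dsimp only
  refine Measure.ae_smul_measure ?_ _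
  refine (withDensity_absolutelyContinuous _ _).ae_le ?_
  refine ae_restrict_mem ?_
  exact (isClosed_eq (by fun_prop) continuous_const).measurableSet

/-- The parametrization of the hyperplane `∑ xᵢ = S` by all coordinates but the first. -/
def hyp {n : ℕ} (S : ℝ) (y : Fin n → ℝ) : EuclideanSpace ℝ (Fin (n + 1)) :=
  WithLp.toLp 2 (slice S y)

lemma hyp_apply {n : ℕ} (S : ℝ) (y : Fin n → ℝ) (i : Fin (n + 1)) : hyp S y i = slice S y i := rfl

lemma continuous_hyp {n : ℕ} (S : ℝ) : Continuous fun y : Fin n → ℝ => hyp S y :=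
  (PiLp.continuous_toLp 2 _).comp (continuous_slice S)

lemma injective_hyp {n : ℕ} (S : ℝ) : Function.Injective fun y : Fin n → ℝ => hyp S y := by
  intro y z h
  ext i
  have := congrArg (fun x : EuclideanSpace ℝ (Fin (n + 1)) => x i.succ) h
  simpa only [hyp_apply, slice_succ] using this

lemma range_hyp {n : ℕ} (S : ℝ) :
    Set.range (fun y : Fin n → ℝ => hyp S y) = {x | ∑ i, x i = S} := by
  ext x
  constructor
  · rintro ⟨y, rfl⟩
    exact sum_slice S y
  · intro hx
    refine ⟨fun i => x i.succ, ?_⟩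
    ext i
    refine Fin.cases ?_ (fun j => ?_) i
    · have hx' : ∑ i, x i = S := hx
      rw [Fin.sum_univ_succ] at hx'
      simp only [hyp_apply, slice_zero]
      linarith
    · simp only [hyp_apply, slice_succ]

lemma measurableEmbedding_hyp {n : ℕ} (S : ℝ) :
    MeasurableEmbedding fun y : Fin n → ℝ => hyp S y :=
  (continuous_hyp S).measurableEmbedding (injective_hyp S)

lemma hyp_add {n : ℕ} (S : ℝ) (y z : Fin n → ℝ) : hyp S (y + z) = hyp 0 y + hyp S z := by
  ext i
  refine Fin.cases ?_ (fun j => ?_) i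
  · simp only [hyp_apply, slice_zero, PiLp.add_apply, Pi.add_apply, Finset.sum_add_distrib]
    ring
  · simp only [hyp_apply, slice_succ, PiLp.add_apply, Pi.add_apply]

lemma exists_lipschitzWith_hyp {n : ℕ} (S : ℝ) :
    ∃ K, LipschitzWith K fun y : Fin n → ℝ => hyp S y := by
  let l : (Fin n → ℝ) →ₗ[ℝ] EuclideanSpace ℝ (Fin (n + 1)) :=
    { toFun := fun y => hyp 0 y
      map_add' := hyp_add 0
      map_smul' := fun r y => by
        ext i
        refine Fin.cases ?_ (fun j => ?_) i
        · simp [hyp_apply, slice_zero, Finset.mul_sum]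
        · simp [hyp_apply, slice_succ] }
  refine ⟨‖LinearMap.toContinuousLinearMap l‖₊, ?_⟩
  have h := (LinearMap.toContinuousLinearMap l).lipschitz
  refine LipschitzWith.of_dist_le_mul fun y z => ?_
  have e : ∀ y, hyp S y = l y + hyp S 0 := fun y => by
    rw [← add_zero y, hyp_add, add_zero]; rfl
  rw [e y, e z, dist_add_right]
  exact h.dist_le_mul y z

/-- In the slice coordinates, the Hausdorff measure of the hyperplane is a multiple of the
Lebesgue measure. -/
lemma exists_hausdorff_restrict_eq {n : ℕ} (S : ℝ) : ∃ c : NNReal,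
    (μH[(n : ℝ)] : Measure (EuclideanSpace ℝ (Fin (n + 1)))).restrict {x | ∑ i, x i = S} =
      c • (volume : Measure (Fin n → ℝ)).map (fun y => hyp S y) := by
  have hem := measurableEmbedding_hyp (n := n) S
  obtain ⟨ν, hν⟩ : ∃ ν : Measure (Fin n → ℝ), ν = Measure.comap (fun y => hyp S y) μH[(n : ℝ)] :=
    ⟨_, rfl⟩
  have happ : ∀ s, ν s = μH[(n : ℝ)] ((fun y => hyp S y) '' s) := fun s => by
    rw [hν, hem.comap_apply]
  have hinv : ν.IsAddLeftInvariant := by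
    refine ⟨fun z => ?_⟩
    ext s hs
    rw [Measure.map_apply (measurable_const_add z) hs, happ, happ]
    have : (fun y => hyp S y) '' s =
        (fun x => hyp 0 z + x) '' ((fun y => hyp S y) '' ((fun x => z + x) ⁻¹' s)) := by
      ext x
      constructor
      · rintro ⟨y, hy, rfl⟩
        refine ⟨hyp S (y - z), ⟨y - z, by simpa using hy, rfl⟩, ?_⟩
        dsimp only
        rw [← hyp_add, add_sub_cancel]
      · rintro ⟨_, ⟨y, hy, rfl⟩, rfl⟩
        exact ⟨z + y, hy, hyp_add S z y⟩
    rw [this, (isometry_add_left (hyp 0 z)).hausdorffMeasure_image (Or.inl (by positivity))]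
  have hcpt : IsFiniteMeasureOnCompacts ν := by
    refine ⟨fun K hK => ?_⟩
    obtain ⟨L, hL⟩ := exists_lipschitzWith_hyp (n := n) S
    rw [happ]
    refine (hL.hausdorffMeasure_image_le (by positivity) K).trans_lt ?_
    have := hausdorffMeasure_pi_real (ι := Fin n)
    rw [Fintype.card_fin] at this
    rw [this]
    exact ENNReal.mul_lt_top (by simp) hK.measure_lt_top
  obtain ⟨c, hc⟩ : ∃ c : NNReal, ν = c • volume :=
    ⟨_, Measure.isAddLeftInvariant_eq_smul ν volume⟩
  refine ⟨c, ?_⟩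
  rw [← range_hyp, ← hem.map_comap, ← hν, hc, Measure.map_smul]

lemma exists_lintegral_canonEns {ψ : ℝ → ℝ} (hψ : Measurable ψ) (n : ℕ) (a : Fin (n + 1) → ℝ)
    (m : ℝ) : ∃ (S : ℝ) (k : ℝ≥0∞), ∀ g : EuclideanSpace ℝ (Fin (n + 1)) → ℝ≥0∞, Measurable g →
      ∫⁻ x, g x ∂canonEns ψ (n + 1) a m = k * ∫⁻ y : Fin n → ℝ, g (hyp S y) *
        ENNReal.ofReal (Real.exp (-∑ i, (ψ (slice S y i) + a i * slice S y i))) := by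
  obtain ⟨S, hS⟩ : ∃ S : ℝ, S = ((n + 1 : ℕ) : ℝ) * m := ⟨_, rfl⟩
  obtain ⟨c, hc⟩ := exists_hausdorff_restrict_eq (n := n) S
  have hn : ((n + 1 : ℕ) : ℝ) - 1 = n := by push_cast; ring
  unfold canonEns
  dsimp only
  rw [hn, ← hS, hc]
  generalize ((c • (volume : Measure (Fin n → ℝ)).map (fun y => hyp S y)).withDensity
      (fun x => ENNReal.ofReal (Real.exp (-(∑ i, (ψ (x i) + a i * x i)))))) Set.univ = Z
  have hp : Measurable fun x : EuclideanSpace ℝ (Fin (n + 1)) =>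
      ENNReal.ofReal (Real.exp (-(∑ i, (ψ (x i) + a i * x i)))) := by fun_prop
  refine ⟨S, Z⁻¹ * c, fun g hg => ?_⟩
  rw [lintegral_smul_measure, lintegral_withDensity_eq_lintegral_mul _ hp hg,
    lintegral_smul_measure, lintegral_map (hp.mul hg) (continuous_hyp S).measurable, smul_eq_mul,
    ENNReal.smul_def, smul_eq_mul, mul_assoc]
  congr 2
  refine lintegral_congr fun y => ?_
  rw [Pi.mul_apply, mul_comm]
  rfl

lemma isLSI_zero (N : ℕ) (ρ : ℝ) : IsLSI N 0 ρ := by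
  intro f _ _ _ _ _
  simp [entFor]

lemma isLSI_canonEns_zero (ψ : ℝ → ℝ) (a : Fin 0 → ℝ) (m ρ : ℝ) :
    IsLSI 0 (canonEns ψ 0 a m) ρ := by
  rcases canonEns_eq_zero_or_isProbabilityMeasure ψ 0 a m with h | h
  · rw [h]; exact isLSI_zero 0 ρ
  · intro f _ _ _ _ _
    have hf : ∀ x, f x = f 0 := fun x => congrArg f (Subsingleton.elim x 0)
    simp [entFor, fisherX, hf]

section Tilt

open scoped RealInnerProductSpace

/-- A variance bound in slice coordinates for all quadratically tilted potentials gives a bound on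
the variances of the Gaussian tilts of the canonical ensemble. -/
lemma tiltVariance_canonEns {ψ : ℝ → ℝ} (hψ : Measurable ψ) {n : ℕ} {a : Fin (n + 1) → ℝ} {m : ℝ}
    [IsProbabilityMeasure (canonEns ψ (n + 1) a m)] {s χ : ℝ} (hs : 0 < s) (hχ : 0 ≤ χ)
    (H : ∀ (S : ℝ) (b v : Fin (n + 1) → ℝ), ∃ c : ℝ,
      ∫⁻ y : Fin n → ℝ, ENNReal.ofReal ((∑ i, v i * slice S y i - c) ^ 2 * Real.exp
        (-∑ i, (ψ (slice S y i) + b i * slice S y i + slice S y i ^ 2 / (2 * s)))) ≤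
      ENNReal.ofReal (χ * ∑ i, v i ^ 2) * ∫⁻ y : Fin n → ℝ, ENNReal.ofReal (Real.exp
        (-∑ i, (ψ (slice S y i) + b i * slice S y i + slice S y i ^ 2 / (2 * s))))) :
    TiltVariance (canonEns ψ (n + 1) a m) s χ := by
  intro h w
  obtain ⟨S, k, hk⟩ := exists_lintegral_canonEns hψ n a m
  obtain ⟨c, hc⟩ := H S (fun i => a i - h i / s) w
  have hw : ∑ i, w i ^ 2 = ‖w‖ ^ 2 := by rw [EuclideanSpace.real_norm_sq_eq]
  have hker : ∀ y : Fin n → ℝ, heatKernel s (hyp S y) h *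
      Real.exp (-∑ i, (ψ (slice S y i) + a i * slice S y i)) = Real.exp
        (-∑ i, (ψ (slice S y i) + (a i - h i / s) * slice S y i + slice S y i ^ 2 / (2 * s))) := by
    intro y
    rw [heatKernel, ← Real.exp_add]
    congr 1
    have e1 : ⟪h, hyp S y⟫ = ∑ i, h i * slice S y i := by
      simp [PiLp.inner_apply, hyp_apply, mul_comm]
    have e2 : ‖hyp S y‖ ^ 2 = ∑ i, slice S y i ^ 2 := by
      rw [EuclideanSpace.real_norm_sq_eq]; rfl
    rw [e1, e2, Finset.sum_div, Finset.sum_div, ← Finset.sum_sub_distrib,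
      ← Finset.sum_neg_distrib, ← Finset.sum_neg_distrib, ← Finset.sum_add_distrib]
    refine Finset.sum_congr rfl fun i _ => ?_
    ring
  have hkm := measurable_heatKernel_left s h
  have hin : ∀ y : Fin n → ℝ, ⟪w, hyp S y⟫ = ∑ i, w i * slice S y i := fun y => by
    simp [PiLp.inner_apply, hyp_apply, mul_comm]
  have h1 : ∫⁻ x, ENNReal.ofReal ((⟪w, x⟫ - c) ^ 2 * heatKernel s x h)
      ∂canonEns ψ (n + 1) a m = k * ∫⁻ y : Fin n → ℝ, ENNReal.ofReal
        ((∑ i, w i * slice S y i - c) ^ 2 * Real.exp (-∑ i, (ψ (slice S y i) +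
          (a i - h i / s) * slice S y i + slice S y i ^ 2 / (2 * s)))) := by
    rw [hk _ (by fun_prop)]
    congr 1
    refine lintegral_congr fun y => ?_
    rw [← ENNReal.ofReal_mul (mul_nonneg (sq_nonneg _) (heatKernel_pos _ _ _).le), mul_assoc,
      hker, hin]
  have h2 : ∫⁻ x, ENNReal.ofReal (heatKernel s x h) ∂canonEns ψ (n + 1) a m =
      k * ∫⁻ y : Fin n → ℝ, ENNReal.ofReal (Real.exp (-∑ i, (ψ (slice S y i) +
          (a i - h i / s) * slice S y i + slice S y i ^ 2 / (2 * s)))) := by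
    rw [hk _ (by fun_prop)]
    congr 1
    refine lintegral_congr fun y => ?_
    rw [← ENNReal.ofReal_mul (heatKernel_pos _ _ _).le, hker]
  refine ⟨c, ?_⟩
  have hi := integrable_heatKernel (μ := canonEns ψ (n + 1) a m) hs h
  have h0 : 0 ≤ χ * ‖w‖ ^ 2 := by positivity
  rw [integral_eq_lintegral_of_nonneg_ae (Filter.Eventually.of_forall fun x =>
      mul_nonneg (sq_nonneg _) (heatKernel_pos _ _ _).le) (by fun_prop),
    integral_eq_lintegral_of_nonneg_ae (Filter.Eventually.of_forall fun x =>
      (heatKernel_pos _ _ _).le) hkm.aestronglyMeasurable, ← ENNReal.toReal_ofReal h0,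
    ← ENNReal.toReal_mul]
  have hfin := hi.lintegral_lt_top
  refine ENNReal.toReal_mono (ENNReal.mul_ne_top ENNReal.ofReal_ne_top hfin.ne) ?_
  rw [h1, h2, ← mul_assoc, mul_comm (ENNReal.ofReal _), mul_assoc]
  refine mul_le_mul_right ?_ _
  rw [← hw]
  exact hc

end Tilt

lemma two_mul_midpoint_le {g : ℝ → ℝ} (hg : ContDiff ℝ 2 g) (h : ∀ x, 0 ≤ deriv (deriv g) x)
    (x y : ℝ) : 2 * g ((x + y) / 2) ≤ g x + g y := by
  have hc : ConvexOn ℝ Set.univ g :=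
    convexOn_univ_of_deriv2_nonneg (hg.differentiable (by norm_num))
      ((hg.iterate_deriv' 1 1).differentiable (by norm_num)) fun x => by simpa using h x
  obtain ⟨-, hc⟩ := hc
  have := @hc x trivial y trivial (1 / 2) (1 / 2) (by norm_num) (by norm_num) (by norm_num)
  simp only [smul_eq_mul] at this
  rw [show 1 / 2 * x + 1 / 2 * y = (x + y) / 2 by ring] at this
  linarith

section Potential

variable {ψ ψc δψ : ℝ → ℝ} {lam0 B : ℝ}

lemma convexPert_tilt (hlam0 : 0 < lam0) (hB : 0 ≤ B)
    (hψc : ContDiff ℝ 2 ψc) (hδψ : ContDiff ℝ 2 δψ)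
    (hconv : ∀ x, lam0 ≤ deriv (deriv ψc) x)
    (hb0 : ∀ x, |δψ x| ≤ B) (hb1 : ∀ x, |deriv δψ x| ≤ B) (b : ℝ) {s : ℝ} (hs : 0 < s) :
    ConvexPert lam0 B (fun x => ψc x + b * x + x ^ 2 / (2 * s)) δψ := by
  have hd : Differentiable ℝ ψc := hψc.differentiable (by norm_num)
  have hd1 : ContDiff ℝ 1 (deriv ψc) := hψc.iterate_deriv' 1 1
  have hder : deriv (fun x => ψc x + b * x + x ^ 2 / (2 * s)) = fun x => deriv ψc x + b + x / s := by
    ext x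
    have h1 := (((hd x).hasDerivAt.add ((hasDerivAt_id x).const_mul b)).add
      (((hasDerivAt_id x).pow 2).div_const (2 * s)))
    refine (h1.deriv).trans ?_
    simp
    field_simp
  refine ⟨hlam0, by fun_prop, ?_, fun x y hxy => ?_, hB, hδψ.differentiable (by norm_num), hb0, hb1⟩
  · rw [hder]
    have := hd1.continuous
    fun_prop
  · rw [hder]
    have h1 := mul_sub_le_image_sub_of_le_deriv (hd1.differentiable (by norm_num)) hconv hxy
    have h2 : x / s ≤ y / s := div_le_div_of_nonneg_right hxy hs.le
    dsimp only
    linarith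

lemma midpoint_convexity (hlam0 : 0 < lam0) (hψc : ContDiff ℝ 2 ψc) (hδψ : ContDiff ℝ 2 δψ)
    (hconv : ∀ x, lam0 ≤ deriv (deriv ψc) x) (hb2 : ∀ x, |deriv (deriv δψ) x| ≤ B) (x y : ℝ) :
    -(B * (x - y) ^ 2 / 4) ≤ (ψc x + δψ x) + (ψc y + δψ y) -
      2 * (ψc ((x + y) / 2) + δψ ((x + y) / 2)) := by
  have h1 := two_mul_midpoint_le hψc (fun x => hlam0.le.trans (hconv x)) x y
  have hd : Differentiable ℝ δψ := hδψ.differentiable (by norm_num)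
  have hd1 : ContDiff ℝ 1 (deriv δψ) := hδψ.iterate_deriv' 1 1
  have hder : deriv (fun x => δψ x + B / 2 * x ^ 2) = fun x => deriv δψ x + B * x := by
    ext x
    have h1 := ((hd x).hasDerivAt.add (((hasDerivAt_id x).pow 2).const_mul (B / 2)))
    refine (h1.deriv).trans ?_
    simp
    ring
  have h2 := two_mul_midpoint_le (g := fun x => δψ x + B / 2 * x ^ 2) (by fun_prop) (fun x => by
    rw [hder]
    have h1 := ((hd1.differentiable (by norm_num) x).hasDerivAt.add
      ((hasDerivAt_id x).const_mul B))
    refine le_of_le_of_eq ?_ h1.deriv.symm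
    have := (abs_le.1 (hb2 x)).1
    linarith) x y
  linarith

end Potential

/-- Variance bounds for all Gaussian tilts of all canonical ensembles. -/
theorem exists_tiltVariance_canonEns {ψ ψc δψ : ℝ → ℝ} {lam0 B : ℝ}
    (hlam0 : 0 < lam0) (hB : 0 ≤ B)
    (hsplit : ∀ x, ψ x = ψc x + δψ x)
    (hψc : ContDiff ℝ 2 ψc) (hδψ : ContDiff ℝ 2 δψ)
    (hconv : ∀ x, lam0 ≤ deriv (deriv ψc) x)
    (hb0 : ∀ x, |δψ x| ≤ B) (hb1 : ∀ x, |deriv δψ x| ≤ B)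
    (hb2 : ∀ x, |deriv (deriv δψ) x| ≤ B) :
    ∃ χ, 0 < χ ∧ ∀ (n : ℕ) (a : Fin (n + 1) → ℝ) (m : ℝ),
      IsProbabilityMeasure (canonEns ψ (n + 1) a m) →
      (∀ s, 0 < s → s ≤ 1 / (2 * (B + 1)) →
        TiltVariance (canonEns ψ (n + 1) a m) s (1 / (1 / s - (B + 1)))) ∧
      ∀ s, 0 < s → TiltVariance (canonEns ψ (n + 1) a m) s χ := by
  obtain ⟨χ, hχ, hvar⟩ := exists_lintegral_slice_sq_le lam0 B
  have hψ : Measurable ψ := by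
    rw [funext hsplit]
    exact (hψc.continuous.add hδψ.continuous).measurable
  refine ⟨χ, hχ, fun n a m hP => ⟨fun s hs hsB => ?_, fun s hs => ?_⟩⟩
  · have hs1 : B + 1 < 1 / s := by
      rw [lt_div_iff₀ hs]
      rw [le_div_iff₀ (by positivity)] at hsB
      linarith
    refine tiltVariance_canonEns hψ hs (by
      have : 0 < 1 / s - (B + 1) := by linarith
      positivity) fun S b v => ?_
    have := exists_lintegral_slice_sq_le_of_convex
      (W := fun i x => ψ x + b i * x + x ^ 2 / (2 * s)) (κ := 1 / s - (B + 1)) (by linarith)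
      (fun i => by fun_prop) (fun i x y => by
        have h1 := midpoint_convexity hlam0 hψc hδψ hconv hb2 x y
        rw [← hsplit, ← hsplit, ← hsplit] at h1
        have h2 : x ^ 2 / (2 * s) + y ^ 2 / (2 * s) - 2 * (((x + y) / 2) ^ 2 / (2 * s)) =
          1 / s * (x - y) ^ 2 / 4 := by field_simp; ring
        have h3 := sq_nonneg (x - y)
        linarith) S v
    rwa [one_div_mul_eq_div]
  · refine tiltVariance_canonEns hψ hs hχ.le fun S b v => ?_
    have := hvar (F := fun i x => ψc x + b i * x + x ^ 2 / (2 * s)) (D := fun _ => δψ)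
      (fun i => convexPert_tilt hlam0 hB hψc hδψ hconv hb0 hb1 (b i) hs) S v
    have e : ∀ i x, ψ x + b i * x + x ^ 2 / (2 * s) =
        ψc x + b i * x + x ^ 2 / (2 * s) + δψ x := fun i x => by rw [hsplit]; ring
    simpa only [e] using this

section Approximation

open scoped RealInnerProductSpace

variable {E : Type*} [NormedAddCommGroup E] [InnerProductSpace ℝ E] [FiniteDimensional ℝ E]

lemma exists_taylor_bound {F : E → ℝ} (hF : ContDiff ℝ 2 F)
    (hc : HasCompactSupport (fderiv ℝ F)) :
    ∃ K, 0 ≤ K ∧ ∀ y u, |F (y + u) - F y - ⟪u, gradient F y⟫| ≤ K * ‖u‖ ^ 2 := by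
  have hF1 : ContDiff ℝ 1 (fderiv ℝ F) := hF.fderiv_right (by norm_num)
  obtain ⟨K, hK⟩ := hF1.lipschitzWith_of_hasCompactSupport hc (by norm_num)
  refine ⟨K, K.2, fun y u => ?_⟩
  have hd : Differentiable ℝ F := hF.differentiable (by norm_num)
  have h := (convex_segment y (y + u)).norm_image_sub_le_of_norm_hasFDerivWithin_le' (f := F)
    (f' := fderiv ℝ F) (φ := fderiv ℝ F y) (C := K * ‖u‖)
    (fun x _ => (hd x).hasFDerivAt.hasFDerivWithinAt) (fun x hx => by
      rw [← dist_eq_norm]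
      refine (hK.dist_le_mul x y).trans (mul_le_mul_of_nonneg_left ?_ K.2)
      rw [segment_eq_image'] at hx
      obtain ⟨t, ⟨ht0, ht1⟩, rfl⟩ := hx
      rw [add_sub_cancel_left, dist_comm, dist_self_add_right, norm_smul, Real.norm_of_nonneg ht0]
      exact mul_le_of_le_one_left (norm_nonneg _) ht1) (left_mem_segment ℝ y (y + u)) (right_mem_segment ℝ y (y + u))
  rw [add_sub_cancel_left] at h
  have e : ⟪u, gradient F y⟫ = fderiv ℝ F y u := by
    rw [real_inner_comm, gradient, InnerProductSpace.toDual_symm_apply]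
  rw [e, ← Real.norm_eq_abs, sq, ← mul_assoc]
  exact h

variable [MeasurableSpace E] [BorelSpace E] {μ : Measure E} [IsProbabilityMeasure μ]
  {P : E →L[ℝ] E} {p : E} {T χ : ℝ}

lemma entropy_add_le_of_hasCompactSupport (hP : ∀ x, ‖P x‖ ≤ ‖x‖)
    (hPs : ∀ u v, ⟪P u, v⟫ = ⟪u, P v⟫) (hp : ∀ᵐ x ∂μ, P x + p = x) (hT : 0 < T) (hχ : 0 < χ)
    (hv1 : ∀ s, 0 < s → s ≤ 1 / (2 * T) → TiltVariance μ s (1 / (1 / s - T)))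
    (hv2 : ∀ s, 0 < s → TiltVariance μ s χ) {g : E → ℝ} (hg : ContDiff ℝ 2 g)
    (hgc : HasCompactSupport g) (hg0 : ∀ x, 0 ≤ g x) {e : ℝ} (he : 0 < e) :
    entFor μ (fun x => g x + e) ≤ 1 / (4 * T) * Real.exp (1 + 4 * T * χ) *
      ∫ x, ‖P (gradient g x)‖ ^ 2 / (g x + e) ∂μ := by
  obtain ⟨F, hFd⟩ : ∃ F : E → ℝ, F = fun x => Real.log (g x + e) := ⟨_, rfl⟩
  have hpos : ∀ x, 0 < g x + e := fun x => add_pos_of_nonneg_of_pos (hg0 x) he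
  have hF : ContDiff ℝ 2 F := by
    rw [hFd]
    exact (hg.add contDiff_const).log fun x => (hpos x).ne'
  have hgd : Differentiable ℝ g := hg.differentiable (by norm_num)
  have hder : ∀ x, fderiv ℝ F x = (g x + e)⁻¹ • fderiv ℝ g x := fun x => by
    rw [hFd]
    exact (((hgd x).hasFDerivAt.add_const e).log (hpos x).ne').fderiv
  have hgrad : ∀ x, gradient F x = (g x + e)⁻¹ • gradient g x := fun x => by
    rw [gradient, hder, map_smulₛₗ]; rfl
  have hFc : HasCompactSupport (fderiv ℝ F) := by
    have h1 : HasCompactSupport (fderiv ℝ g) := hgc.fderiv ℝ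
    refine h1.mono fun x hx => ?_
    rw [Function.mem_support] at hx ⊢
    intro h
    exact hx (by rw [hder, h, smul_zero])
  obtain ⟨K, hK, htay⟩ := exists_taylor_bound hF hFc
  have hF1 : Continuous (fderiv ℝ F) := hF.continuous_fderiv (by norm_num)
  obtain ⟨W, hW⟩ := hF1.bounded_above_of_compact_support hFc
  have hnorm : ∀ x, ‖gradient F x‖ ≤ W := fun x => by
    rw [gradient, LinearIsometryEquiv.norm_map]; exact hW x
  have hW0 : 0 ≤ W := (norm_nonneg _).trans (hnorm 0)
  obtain ⟨M, hM⟩ := hg.continuous.bounded_above_of_compact_support hgc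
  have hgc' : Continuous g := hg.continuous
  have hgradc : Continuous (gradient F) :=
    (InnerProductSpace.toDual ℝ E).symm.continuous.comp hF1
  have hmain := entropy_le_of_tiltVariance (μ := μ) (f := fun x => g (P x + p) + e)
    (w := fun x => P (gradient F (P x + p))) (e := e) (M := M + e) (K := K) (W := W) hT hχ hv1 hv2
    (by fun_prop) he (fun x => by have := hg0 (P x + p); linarith)
    (fun x => by
      have := (le_abs_self _).trans (hM (P x + p))
      linarith)
    (by fun_prop) hK hW0 (fun y => (hP _).trans (hnorm _))
    (fun y v => by
      have h1 := htay (P y + p) (P v)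
      rw [hPs] at h1
      have h2 : P (y + v) + p = P y + p + P v := by rw [map_add]; abel
      rw [h2]
      simp only [hFd] at h1 ⊢
      exact h1.trans (mul_le_mul_of_nonneg_left
        (pow_le_pow_left₀ (norm_nonneg _) (hP v) 2) hK))
  have e1 : ∫ x, (g (P x + p) + e) ∂μ = ∫ x, (g x + e) ∂μ :=
    integral_congr_ae (hp.mono fun x hx => by dsimp only; rw [hx])
  have e2 : ∫ x, (g (P x + p) + e) * Real.log (g (P x + p) + e) ∂μ =
      ∫ x, (g x + e) * Real.log (g x + e) ∂μ :=
    integral_congr_ae (hp.mono fun x hx => by dsimp only; rw [hx])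
  have e3 : ∫ x, (g (P x + p) + e) * ‖P (gradient F (P x + p))‖ ^ 2 ∂μ =
      ∫ x, ‖P (gradient g x)‖ ^ 2 / (g x + e) ∂μ :=
    integral_congr_ae (hp.mono fun x hx => by
      dsimp only
      rw [hx, hgrad, map_smul, norm_smul, Real.norm_of_nonneg (inv_pos.2 (hpos x)).le]
      have := (hpos x).ne'
      field_simp)
  rw [e1, e2, e3] at hmain
  exact hmain

lemma abs_mul_log_le_of_le_add_one {u t : ℝ} (hu : 0 ≤ u) (ht : 0 ≤ t) (hut : u ≤ t + 1) :
    |u * Real.log u| ≤ 3 + 2 * |t * Real.log t| + 2 * t := by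
  have hlog2 : Real.log 2 ≤ 1 := by have := Real.log_two_lt_d9; linarith
  rcases le_or_gt u 1 with h | h
  · rcases hu.eq_or_lt with h0 | h0
    · rw [← h0, zero_mul, abs_zero]; positivity
    · have h1 := Real.one_sub_inv_le_log_of_pos h0
      have h2 := Real.log_nonpos hu h
      have h3 := mul_le_mul_of_nonneg_left h1 hu
      rw [mul_sub, mul_inv_cancel₀ h0.ne'] at h3
      rw [abs_of_nonpos (mul_nonpos_of_nonneg_of_nonpos hu h2)]
      have := abs_nonneg (t * Real.log t)
      linarith
  · have h0 := Real.log_pos h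
    rw [abs_of_pos (by positivity)]
    rcases le_or_gt t 1 with h1 | h1
    · have h2 : Real.log u ≤ Real.log 2 := Real.log_le_log (by linarith) (by linarith)
      have h3 : u * Real.log u ≤ 2 * 1 := mul_le_mul (by linarith) (by linarith) h0.le (by norm_num)
      have := abs_nonneg (t * Real.log t)
      linarith
    · have h2 : Real.log u ≤ Real.log (2 * t) := Real.log_le_log (by linarith) (by linarith)
      rw [Real.log_mul two_ne_zero (by linarith)] at h2
      have h3 : u * Real.log u ≤ (2 * t) * (1 + Real.log t) :=
        mul_le_mul (by linarith) (by linarith) h0.le (by linarith)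
      have := le_abs_self (t * Real.log t)
      linarith

/-- The logarithmic Sobolev inequality from a bound on the variances of Gaussian tilts. -/
theorem entropy_le_of_tiltVariance_of_contDiff (hP : ∀ x, ‖P x‖ ≤ ‖x‖)
    (hPs : ∀ u v, ⟪P u, v⟫ = ⟪u, P v⟫) (hp : ∀ᵐ x ∂μ, P x + p = x) (hT : 0 < T) (hχ : 0 < χ)
    (hv1 : ∀ s, 0 < s → s ≤ 1 / (2 * T) → TiltVariance μ s (1 / (1 / s - T)))
    (hv2 : ∀ s, 0 < s → TiltVariance μ s χ) {f : E → ℝ} (hf : ContDiff ℝ (⊤ : ℕ∞) f)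
    (hf0 : ∀ x, 0 ≤ f x) (hfi : Integrable f μ)
    (hfl : Integrable (fun x => f x * Real.log (f x)) μ)
    (hfish : Integrable (fun x => ‖P (gradient f x)‖ ^ 2 / f x) μ) :
    entFor μ f ≤ 1 / (4 * T) * Real.exp (1 + 4 * T * χ) *
      ∫ x, ‖P (gradient f x)‖ ^ 2 / f x ∂μ := by
  let b : ContDiffBump (0 : E) := ⟨1, 2, one_pos, one_lt_two⟩
  have hb : ContDiff ℝ (⊤ : ℕ∞) b := b.contDiff
  have hbd : Differentiable ℝ b := hb.differentiable (by simp)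
  have hfd : Differentiable ℝ f := hf.differentiable (by simp)
  have hb1c : Continuous (fderiv ℝ b) := hb.continuous_fderiv (by simp)
  obtain ⟨C, hC⟩ := hb1c.bounded_above_of_compact_support (b.hasCompactSupport.fderiv ℝ)
  have hC0 : 0 ≤ C := (norm_nonneg _).trans (hC 0)
  obtain ⟨r, hr⟩ : ∃ r : ℕ → ℝ, r = fun k : ℕ => 1 / ((k : ℝ) + 1) := ⟨_, rfl⟩
  have hr0 : ∀ k, 0 < r k := fun k => by rw [hr]; positivity
  have hr1 : ∀ k, r k ≤ 1 := fun k => by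
    rw [hr]; dsimp only
    rw [div_le_one (by positivity)]
    have : (0 : ℝ) ≤ k := by positivity
    linarith
  have hrl : Filter.Tendsto r Filter.atTop (nhds 0) := by
    rw [hr]; exact tendsto_one_div_add_atTop_nhds_zero_nat
  obtain ⟨η, hη⟩ : ∃ η : ℕ → E → ℝ, η = fun k x => b (r k • x) := ⟨_, rfl⟩
  have hη0 : ∀ k x, 0 ≤ η k x := fun k x => by rw [hη]; exact b.nonneg
  have hη1 : ∀ k x, η k x ≤ 1 := fun k x => by rw [hη]; exact b.le_one
  have hηs : ∀ k, ContDiff ℝ (⊤ : ℕ∞) (η k) := fun k => by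
    rw [hη]; exact hb.comp (contDiff_const_smul (r k))
  have hηd : ∀ k x, HasFDerivAt (η k) (r k • fderiv ℝ b (r k • x)) x := fun k x => by
    rw [hη]
    have := (hbd (r k • x)).hasFDerivAt.comp x ((hasFDerivAt_id x).const_smul (r k))
    convert! this using 1
    ext v
    simp
  obtain ⟨g, hg⟩ : ∃ g : ℕ → E → ℝ, g = fun k x => η k x ^ 2 * f x := ⟨_, rfl⟩
  have hgapp : ∀ k x, g k x = η k x ^ 2 * f x := fun k x => by rw [hg]
  have hgs : ∀ k, ContDiff ℝ (⊤ : ℕ∞) (g k) := fun k => by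
    rw [hg]; exact ((hηs k).pow 2).mul hf
  have hg0 : ∀ k x, 0 ≤ g k x := fun k x => by
    rw [hgapp]; exact mul_nonneg (sq_nonneg _) (hf0 x)
  have hη2 : ∀ k x, η k x ^ 2 ≤ 1 := fun k x => pow_le_one₀ (hη0 k x) (hη1 k x)
  have hgf : ∀ k x, g k x ≤ f x := fun k x => by
    rw [hgapp]; exact mul_le_of_le_one_left (hf0 x) (hη2 k x)
  have hgc : ∀ k, HasCompactSupport (g k) := fun k => by
    have h1 : HasCompactSupport (η k) := by
      rw [hη]
      exact b.hasCompactSupport.comp_smul (hr0 k).ne'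
    refine h1.mono fun x hx => ?_
    rw [Function.mem_support] at hx ⊢
    intro h
    exact hx (by rw [hgapp, h]; ring)
  obtain ⟨d, hd⟩ : ∃ d : ℕ → E → E, d = fun k x => gradient b (r k • x) := ⟨_, rfl⟩
  have hdC : ∀ k x, ‖d k x‖ ≤ C := fun k x => by
    rw [hd]; dsimp only
    rw [gradient, LinearIsometryEquiv.norm_map]; exact hC _
  have hgrad : ∀ k x, gradient (g k) x =
      (η k x ^ 2) • gradient f x + (2 * η k x * f x * r k) • d k x := fun k x => by
    have h1 : HasFDerivAt (g k) ((η k x ^ 2) • fderiv ℝ f x +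
        f x • ((2 * η k x) • (r k • fderiv ℝ b (r k • x)))) x := by
      rw [hg]
      have := ((hηd k x).pow 2).mul (hfd x).hasFDerivAt
      convert! this using 2
      ext v
      simp
    rw [gradient, h1.fderiv, hd, map_add]
    simp only [map_smul, gradient, smul_smul]
    congr 2
    ring
  have hlim1 : ∀ x, Filter.Tendsto (fun k => η k x) Filter.atTop (nhds 1) := fun x => by
    have h1 : Filter.Tendsto (fun k => b (r k • x)) Filter.atTop (nhds (b ((0 : ℝ) • x))) :=
      (hb.continuous.tendsto _).comp (hrl.smul_const x)
    rw [zero_smul, b.one_of_mem_closedBall (by simp [b])] at h1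
    rw [hη]; exact h1
  have hlimg : ∀ x, Filter.Tendsto (fun k => g k x + r k) Filter.atTop (nhds (f x)) := fun x => by
    have := (((hlim1 x).pow 2).mul_const (f x)).add hrl
    simp only [one_pow, one_mul, add_zero] at this
    simpa only [hgapp] using this
  have hlimgrad : ∀ x, Filter.Tendsto (fun k => gradient (g k) x) Filter.atTop
      (nhds (gradient f x)) := fun x => by
    have h1 : Filter.Tendsto (fun k => (2 * η k x * f x * r k) • d k x) Filter.atTop (nhds 0) := by
      refine squeeze_zero_norm (a := fun k => 2 * f x * C * r k) (fun k => ?_) ?_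
      · have h2 : 0 ≤ 2 * η k x * f x * r k :=
          mul_nonneg (mul_nonneg (mul_nonneg zero_le_two (hη0 k x)) (hf0 x)) (hr0 k).le
        rw [norm_smul, Real.norm_of_nonneg h2]
        have h3 : 2 * η k x * f x * r k ≤ 2 * f x * r k := by
          have := mul_le_mul_of_nonneg_right (hη1 k x)
            (mul_nonneg (mul_nonneg zero_le_two (hf0 x)) (hr0 k).le)
          linarith
        exact (mul_le_mul h3 (hdC k x) (norm_nonneg _)
          (mul_nonneg (mul_nonneg zero_le_two (hf0 x)) (hr0 k).le)).trans (le_of_eq (by ring))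
      · simpa using hrl.const_mul (2 * f x * C)
    have := (((hlim1 x).pow 2).smul_const (gradient f x)).add h1
    simp only [one_pow, one_smul, add_zero] at this
    simpa only [hgrad] using this
  have hzero : ∀ x, f x = 0 → gradient f x = 0 := fun x hx => by
    have : IsLocalMin f x := Filter.Eventually.of_forall fun y => by rw [hx]; exact hf0 y
    rw [gradient, this.fderiv_eq_zero, map_zero]
  have hmain : ∀ k, entFor μ (fun x => g k x + r k) ≤ 1 / (4 * T) * Real.exp (1 + 4 * T * χ) *
      ∫ x, ‖P (gradient (g k) x)‖ ^ 2 / (g k x + r k) ∂μ := fun k =>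
    entropy_add_le_of_hasCompactSupport hP hPs hp hT hχ hv1 hv2
      (contDiff_infty.1 (hgs k) 2) (hgc k) (hg0 k) (hr0 k)
  have hgm : ∀ k, Measurable (g k) := fun k => (hgs k).continuous.measurable
  have hggm : ∀ k, Measurable (gradient (g k)) := fun k =>
    ((InnerProductSpace.toDual ℝ E).symm.continuous.comp
      ((hgs k).continuous_fderiv (by simp))).measurable
  have L1 : Filter.Tendsto (fun k => ∫ x, (g k x + r k) ∂μ) Filter.atTop (nhds (∫ x, f x ∂μ)) := by
    refine tendsto_integral_of_dominated_convergence (fun x => f x + 1)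
      (fun k => ((hgm k).add_const _).aestronglyMeasurable) (hfi.add (integrable_const 1))
      (fun k => Filter.Eventually.of_forall fun x => ?_)
      (Filter.Eventually.of_forall fun x => hlimg x)
    rw [Real.norm_of_nonneg (add_nonneg (hg0 k x) (hr0 k).le)]
    exact add_le_add (hgf k x) (hr1 k)
  have L2 : Filter.Tendsto (fun k => ∫ x, (g k x + r k) * Real.log (g k x + r k) ∂μ) Filter.atTop
      (nhds (∫ x, f x * Real.log (f x) ∂μ)) := by
    refine tendsto_integral_of_dominated_convergence
      (fun x => 3 + 2 * |f x * Real.log (f x)| + 2 * f x)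
      (fun k => (((hgm k).add_const _).mul ((hgm k).add_const _).log).aestronglyMeasurable)
      (((integrable_const 3).add (hfl.abs.const_mul 2)).add (hfi.const_mul 2))
      (fun k => Filter.Eventually.of_forall fun x => ?_)
      (Filter.Eventually.of_forall fun x =>
        (Real.continuous_mul_log.tendsto (f x)).comp (hlimg x))
    exact abs_mul_log_le_of_le_add_one (add_nonneg (hg0 k x) (hr0 k).le) (hf0 x)
      (add_le_add (hgf k x) (hr1 k))
  have L3 : Filter.Tendsto (fun k => ∫ x, ‖P (gradient (g k) x)‖ ^ 2 / (g k x + r k) ∂μ)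
      Filter.atTop (nhds (∫ x, ‖P (gradient f x)‖ ^ 2 / f x ∂μ)) := by
    refine tendsto_integral_of_dominated_convergence
      (fun x => 2 * (‖P (gradient f x)‖ ^ 2 / f x) + 8 * C ^ 2 * f x)
      (fun k => ((((P.continuous.measurable.comp (hggm k)).norm.pow_const 2).div
        ((hgm k).add_const _))).aestronglyMeasurable)
      ((hfish.const_mul 2).add (hfi.const_mul _))
      (fun k => Filter.Eventually.of_forall fun x => ?_)
      (Filter.Eventually.of_forall fun x => ?_)
    · have hgr : 0 < g k x + r k := add_pos_of_nonneg_of_pos (hg0 k x) (hr0 k)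
      rw [Real.norm_of_nonneg (by positivity), div_le_iff₀ hgr]
      rcases (hf0 x).eq_or_lt with h | h
      · rw [hgrad, hzero x h.symm, ← h]
        simp
      · have h1 : ‖P (gradient (g k) x)‖ ≤
            η k x * (η k x * ‖P (gradient f x)‖ + 2 * f x * C) := by
          rw [hgrad, map_add, map_smul, map_smul]
          refine (norm_add_le _ _).trans ?_
          rw [norm_smul, norm_smul, Real.norm_of_nonneg (sq_nonneg _), Real.norm_of_nonneg
            (mul_nonneg (mul_nonneg (mul_nonneg zero_le_two (hη0 k x)) (hf0 x)) (hr0 k).le)]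
          have h2 : 0 ≤ 2 * η k x * f x :=
            mul_nonneg (mul_nonneg zero_le_two (hη0 k x)) (hf0 x)
          have h3 : r k * ‖P (d k x)‖ ≤ 1 * C :=
            mul_le_mul (hr1 k) ((hP _).trans (hdC k x)) (norm_nonneg _) zero_le_one
          have h4 := mul_le_mul_of_nonneg_left h3 h2
          linarith
        have h2 : ‖P (gradient (g k) x)‖ ^ 2 ≤
            η k x ^ 2 * (2 * ‖P (gradient f x)‖ ^ 2 + 8 * C ^ 2 * f x ^ 2) := by
          refine (pow_le_pow_left₀ (norm_nonneg _) h1 2).trans ?_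
          rw [mul_pow]
          refine mul_le_mul_of_nonneg_left ?_ (sq_nonneg _)
          have h3 : (η k x * ‖P (gradient f x)‖) ^ 2 ≤ ‖P (gradient f x)‖ ^ 2 :=
            pow_le_pow_left₀ (mul_nonneg (hη0 k x) (norm_nonneg _))
              (mul_le_of_le_one_left (norm_nonneg _) (hη1 k x)) 2
          have h4 := sq_nonneg (η k x * ‖P (gradient f x)‖ - 2 * f x * C)
          nlinarith
        refine h2.trans ?_
        have h3 : η k x ^ 2 * (2 * ‖P (gradient f x)‖ ^ 2 + 8 * C ^ 2 * f x ^ 2) =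
            (2 * (‖P (gradient f x)‖ ^ 2 / f x) + 8 * C ^ 2 * f x) * g k x := by
          rw [hgapp]; field_simp
        rw [h3]
        refine mul_le_mul_of_nonneg_left (by have := hr0 k; linarith) ?_
        have := hf0 x
        positivity
    · rcases (hf0 x).eq_or_lt with h | h
      · simp [hgrad, hzero x h.symm, ← h]
      · exact (((P.continuous.tendsto _).comp (hlimgrad x)).norm.pow 2).div (hlimg x) h.ne'
  refine le_of_tendsto_of_tendsto' (b := Filter.atTop) ?_ (L3.const_mul _) hmain
  exact L2.sub ((Real.continuous_mul_log.tendsto _).comp L1)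

end Approximation

section MeanZeroProjection

open scoped RealInnerProductSpace

lemma exists_meanZeroProj (N : ℕ) : ∃ P : EuclideanSpace ℝ (Fin N) →L[ℝ] EuclideanSpace ℝ (Fin N),
    ∀ u i, P u i = u i - (∑ j, u j) / N := by
  let Q : EuclideanSpace ℝ (Fin N) →ₗ[ℝ] EuclideanSpace ℝ (Fin N) :=
    { toFun := fun u => WithLp.toLp 2 fun i => u i - (∑ j, u j) / N
      map_add' := fun u v => by
        ext i
        simp only [PiLp.add_apply, Finset.sum_add_distrib]
        ring
      map_smul' := fun c u => by
        ext i
        simp only [PiLp.smul_apply, smul_eq_mul, ← Finset.mul_sum, RingHom.id_apply]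
        ring }
  exact ⟨LinearMap.toContinuousLinearMap Q, fun u i => rfl⟩

variable {n : ℕ} {P : EuclideanSpace ℝ (Fin (n + 1)) →L[ℝ] EuclideanSpace ℝ (Fin (n + 1))}

lemma inner_meanZeroProj (hP : ∀ u i, P u i = u i - (∑ j, u j) / (n + 1 : ℕ))
    (u v : EuclideanSpace ℝ (Fin (n + 1))) :
    ⟪P u, v⟫ = ∑ i, u i * v i - (∑ i, u i) * (∑ i, v i) / (n + 1 : ℕ) := by
  simp only [PiLp.inner_apply, RCLike.inner_apply, conj_trivial, hP, mul_sub,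
    Finset.sum_sub_distrib, ← Finset.sum_mul]
  congr 1
  · exact Finset.sum_congr rfl fun i _ => mul_comm _ _
  · ring

lemma norm_meanZeroProj_le (hP : ∀ u i, P u i = u i - (∑ j, u j) / (n + 1 : ℕ))
    (u : EuclideanSpace ℝ (Fin (n + 1))) : ‖P u‖ ≤ ‖u‖ := by
  have hPP : P (P u) = P u := by
    have h : ∑ j, P u j = 0 := by
      simp only [hP, Finset.sum_sub_distrib, Finset.sum_const, Finset.card_univ, Fintype.card_fin,
        nsmul_eq_mul]
      have : ((n + 1 : ℕ) : ℝ) ≠ 0 := by positivity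
      field_simp
      ring
    ext i
    rw [hP (P u), h, zero_div, sub_zero]
  have h1 : ⟪P u, P u⟫ = ⟪P u, u⟫ := by
    have h2 : ⟪P (P u), u⟫ = ⟪P u, P u⟫ := by
      rw [inner_meanZeroProj hP, real_inner_comm, inner_meanZeroProj hP]
      simp only [mul_comm]
    rw [← h2, hPP]
  have h2 := real_inner_le_norm (P u) u
  rw [← h1, real_inner_self_eq_norm_sq, sq] at h2
  rcases (norm_nonneg (P u)).eq_or_lt with h | h
  · rw [← h]; exact norm_nonneg _
  · exact le_of_mul_le_mul_left h2 h

lemma fisherX_eq_norm_meanZeroProj (hP : ∀ u i, P u i = u i - (∑ j, u j) / (n + 1 : ℕ))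
    (f : EuclideanSpace ℝ (Fin (n + 1)) → ℝ) :
    fisherX (n + 1) f = fun x => ‖P (gradient f x)‖ ^ 2 / f x := by
  funext x
  rw [fisherX]
  split_ifs with h
  · rw [h, _root_.div_zero]
  · rw [EuclideanSpace.real_norm_sq_eq]
    simp only [hP]

end MeanZeroProjection

/-- If `ψ` is a bounded perturbation of a strictly convex potential and
`L > 0`, then there is `ρ > 0`, depending only on `ψ` and `L`, such that for every `N`, `m`
and every `a ∈ ℝ^N` with `max |aᵢ| ≤ L`, the canonical ensemble `μ_{N,a,m}` satisfies
`LSI(ρ)`. -/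
theorem statement0
    (ψ ψc δψ : ℝ → ℝ) (lam0 B L : ℝ)
    (hlam0 : 0 < lam0) (hB : 0 ≤ B) (hL : 0 < L)
    (hsplit : ∀ x, ψ x = ψc x + δψ x)
    (hψc : ContDiff ℝ 2 ψc) (hδψ : ContDiff ℝ 2 δψ)
    (hconv : ∀ x, lam0 ≤ deriv (deriv ψc) x)
    (hb0 : ∀ x, |δψ x| ≤ B) (hb1 : ∀ x, |deriv δψ x| ≤ B)
    (hb2 : ∀ x, |deriv (deriv δψ) x| ≤ B) :
    ∃ ρ : ℝ, 0 < ρ ∧ ∀ (N : ℕ) (m : ℝ) (a : Fin N → ℝ),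
      (∀ i, |a i| ≤ L) → IsLSI N (canonEns ψ N a m) ρ := by
  obtain ⟨χ, hχ, hv⟩ := exists_tiltVariance_canonEns hlam0 hB hsplit hψc hδψ hconv hb0 hb1 hb2
  have hT : 0 < B + 1 := by linarith
  refine ⟨(1 / (4 * (B + 1)) * Real.exp (1 + 4 * (B + 1) * χ))⁻¹, by positivity,
    fun N m a _ => ?_⟩
  cases N with
  | zero => exact isLSI_canonEns_zero ψ a m _
  | succ n =>
    rcases canonEns_eq_zero_or_isProbabilityMeasure ψ (n + 1) a m with h0 | hprob
    · rw [h0]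
      exact isLSI_zero _ _
    obtain ⟨P, hP⟩ := exists_meanZeroProj (n + 1)
    intro f hf hf0 hfi hfl hfish
    rw [fisherX_eq_norm_meanZeroProj hP] at hfish ⊢
    rw [one_div, inv_inv]
    refine entropy_le_of_tiltVariance_of_contDiff (p := WithLp.toLp 2 fun _ => m)
      (norm_meanZeroProj_le hP) (fun u v => ?_) ?_ hT hχ (hv n a m hprob).1 (hv n a m hprob).2
      hf hf0 hfi hfl hfish
    · rw [inner_meanZeroProj hP, real_inner_comm, inner_meanZeroProj hP]
      simp only [mul_comm]
    · filter_upwards [ae_canonEns_sum_eq ψ (n + 1) a m] with x hx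
      ext i
      have : ((n + 1 : ℕ) : ℝ) ≠ 0 := by positivity
      rw [PiLp.add_apply, hP, hx, mul_div_cancel_left₀ _ this, sub_add_cancel]
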